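/- For every δ > 0, the m_t-mass of the sublevel set {(x,y,z) : U(x) ≤ min U + δ} tends to 1 as t → ∞; equivalently, ∫_{{U(x) > min U + δ}} m_t(x,y,z) dx dy dz → 0 as t → ∞. -/

import Mathlib

noncomputable section

open Real MeasureTheory Filter

/-- The state space ℝⁿ × ℝⁿ × ℝᵐ. -/
abbrev St (n m : ℕ) := (Fin n → ℝ) × (Fin n → ℝ) × (Fin m → ℝ)

/-- `i`-th component of the gradient of a function on ℝᵏ. -/
def gradp {k : ℕ} (U : (Fin k → ℝ) → ℝ) (x : Fin k → ℝ) (i : Fin k) : ℝ :=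
  fderiv ℝ U x (Pi.single i 1)

/-- Partial derivative in the `i`-th x-coordinate. -/
def pX {n m : ℕ} (f : St n m → ℝ) (i : Fin n) (p : St n m) : ℝ :=
  fderiv ℝ f p (Pi.single i 1, 0, 0)

/-- Partial derivative in the `i`-th y-coordinate. -/
def pY {n m : ℕ} (f : St n m → ℝ) (i : Fin n) (p : St n m) : ℝ :=
  fderiv ℝ f p (0, Pi.single i 1, 0)

/-- Partial derivative in the `j`-th z-coordinate. -/
def pZ {n m : ℕ} (f : St n m → ℝ) (j : Fin m) (p : St n m) : ℝ :=
  fderiv ℝ f p (0, 0, Pi.single j 1)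

/-- Squared Euclidean norm of a vector. -/
def sqnorm {k : ℕ} (v : Fin k → ℝ) : ℝ := ∑ i, (v i) ^ 2

/-- Squared Euclidean norm of the full gradient. -/
def gradSq {n m : ℕ} (f : St n m → ℝ) (p : St n m) : ℝ :=
  (∑ i, (pX f i p) ^ 2) + (∑ i, (pY f i p) ^ 2) + (∑ j, (pZ f j p) ^ 2)

/-- The Hamiltonian W(x,y,z) = U(x) + |y|²/2 + |z|²/2. -/
def Wfun {n m : ℕ} (U : (Fin n → ℝ) → ℝ) (p : St n m) : ℝ :=
  U p.1 + sqnorm p.2.1 / 2 + sqnorm p.2.2 / 2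

/-- Normalizing constant Z_T. -/
def Zpart (n m : ℕ) (U : (Fin n → ℝ) → ℝ) (T : ℝ) : ℝ :=
  ∫ p : St n m, Real.exp (-(Wfun U p) / T)

/-- Density of the instantaneous equilibrium μ_T w.r.t. Lebesgue. -/
def muDen (n m : ℕ) (U : (Fin n → ℝ) → ℝ) (T : ℝ) (p : St n m) : ℝ :=
  Real.exp (-(Wfun U p) / T) / Zpart n m U T

/-- The Gibbs measure μ_T ∝ exp(−W/T). -/
def muT (n m : ℕ) (U : (Fin n → ℝ) → ℝ) (T : ℝ) : Measure (St n m) :=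
  volume.withDensity fun p => ENNReal.ofReal (muDen n m U T p)

/-- Generator of the generalised Langevin dynamics at temperature T. -/
def genL {n m : ℕ} (U : (Fin n → ℝ) → ℝ) (A : Matrix (Fin m) (Fin m) ℝ)
    (lam : Matrix (Fin m) (Fin n) ℝ) (T : ℝ) (f : St n m → ℝ) (p : St n m) : ℝ :=
  (∑ i, p.2.1 i * pX f i p)
    - (∑ i, gradp U p.1 i * pY f i p)
    + (∑ i, (lam.transpose.mulVec p.2.2) i * pY f i p)
    - (∑ j, (lam.mulVec p.2.1) j * pZ f j p)
    - T⁻¹ * (∑ j, (A.transpose.mulVec p.2.2) j * pZ f j p)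
    + (∑ i, ∑ j, A i j * pZ (fun q => pZ f j q) i p)

/-- Formal L²(μ_T)-adjoint of the generator. -/
def genLstar {n m : ℕ} (U : (Fin n → ℝ) → ℝ) (A : Matrix (Fin m) (Fin m) ℝ)
    (lam : Matrix (Fin m) (Fin n) ℝ) (T : ℝ) (h : St n m → ℝ) (p : St n m) : ℝ :=
  -(∑ i, p.2.1 i * pX h i p)
    + (∑ i, gradp U p.1 i * pY h i p)
    - (∑ i, (lam.transpose.mulVec p.2.2) i * pY h i p)
    + (∑ j, (lam.mulVec p.2.1) j * pZ h j p)
    - T⁻¹ * (∑ j, (A.mulVec p.2.2) j * pZ h j p)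
    + (∑ i, ∑ j, A i j * pZ (fun q => pZ h j q) i p)

/-- Formal Lebesgue adjoint L_T^⊤ (Fokker–Planck operator). -/
def genLadj {n m : ℕ} (U : (Fin n → ℝ) → ℝ) (A : Matrix (Fin m) (Fin m) ℝ)
    (lam : Matrix (Fin m) (Fin n) ℝ) (T : ℝ) (g : St n m → ℝ) (p : St n m) : ℝ :=
  -(∑ i, p.2.1 i * pX g i p)
    + (∑ i, (gradp U p.1 i - (lam.transpose.mulVec p.2.2) i) * pY g i p)
    + (∑ j, ((lam.mulVec p.2.1) j + T⁻¹ * (A.transpose.mulVec p.2.2) j) * pZ g j p)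
    + T⁻¹ * A.trace * g p
    + (∑ i, ∑ j, A i j * pZ (fun q => pZ g j q) i p)

/-- Operator norm of a matrix (Euclidean → Euclidean). -/
def opNorm {a b : ℕ} (M : Matrix (Fin a) (Fin b) ℝ) : ℝ :=
  sSup {c : ℝ | ∃ v : Fin b → ℝ, sqnorm v ≤ 1 ∧ c = Real.sqrt (sqnorm (M.mulVec v))}

/-- The Lyapunov function R(x,y,z,T). -/
def Rfun {n m : ℕ} (U : (Fin n → ℝ) → ℝ) (lamInv : Matrix (Fin n) (Fin m) ℝ)
    (δ T : ℝ) (p : St n m) : ℝ :=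
  Wfun U p + δ * T * ((∑ i, p.2.1 i * (lamInv.mulVec p.2.2) i) + (∑ i, p.1 i * p.2.1 i) / 2)

/-- Full gradient indexed by x-, y-, z-coordinates. -/
def fullGrad {n m : ℕ} (f : St n m → ℝ) (p : St n m) : (Fin n ⊕ (Fin n ⊕ Fin m)) → ℝ :=
  Sum.elim (fun i => pX f i p) (Sum.elim (fun i => pY f i p) (fun j => pZ f j p))

/-- Gateaux derivative dΦ(h).g of a map on functions. -/
def gateaux {n m : ℕ} (Φ : (St n m → ℝ) → St n m → ℝ) (h g : St n m → ℝ) (p : St n m) : ℝ :=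
  deriv (fun s : ℝ => Φ (fun q => h q + s * g q) p) 0

/-- Γ_{L_T*,Φ}(h) := ½ (L_T*(Φ(h)) − dΦ(h).(L_T* h)). -/
def GammaPhi {n m : ℕ} (U : (Fin n → ℝ) → ℝ) (A : Matrix (Fin m) (Fin m) ℝ)
    (lam : Matrix (Fin m) (Fin n) ℝ) (T : ℝ)
    (Φ : (St n m → ℝ) → St n m → ℝ) (h : St n m → ℝ) (p : St n m) : ℝ :=
  (genLstar U A lam T (Φ h) p - gateaux Φ h (genLstar U A lam T h) p) / 2

/-- Φ₁(h) = |2∇ₓh + 8S₀(∇_y h + λ⁻¹∇_z h)|²/h. -/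
def Phi1 {n m : ℕ} (lamInv : Matrix (Fin n) (Fin m) ℝ) (S0 : ℝ)
    (g : St n m → ℝ) (p : St n m) : ℝ :=
  (∑ i, (2 * pX g i p + 8 * S0 * (pY g i p + (lamInv.mulVec fun j => pZ g j p) i)) ^ 2) / g p

/-- Φ₂(h) = |∇_y h + S₁λ⁻¹∇_z h|²/h. -/
def Phi2 {n m : ℕ} (lamInv : Matrix (Fin n) (Fin m) ℝ) (S1 : ℝ)
    (g : St n m → ℝ) (p : St n m) : ℝ :=
  (∑ i, (pY g i p + S1 * (lamInv.mulVec fun j => pZ g j p) i) ^ 2) / g p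

/-- β(s) = 1 + β₀ + β₁ s + β₂ s². -/
def betaP (β0 β1 β2 s : ℝ) : ℝ := 1 + β0 + β1 * s + β2 * s ^ 2

/-- Ψ_T(h) = Φ₁(h) + Φ₂(h) + β·h ln h. -/
def PsiT {n m : ℕ} (lamInv : Matrix (Fin n) (Fin m) ℝ) (S0 S1 βc : ℝ)
    (g : St n m → ℝ) (p : St n m) : ℝ :=
  Phi1 lamInv S0 g p + Phi2 lamInv S1 g p + βc * (g p * Real.log (g p))

/-- λ̂² = max(|λ|², |λᵀ|², |λ⁻¹|², |λ⁻¹||λᵀ|). -/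
def lamhatSq {n m : ℕ} (lam : Matrix (Fin m) (Fin n) ℝ)
    (lamInv : Matrix (Fin n) (Fin m) ℝ) : ℝ :=
  max (max (opNorm lam ^ 2) (opNorm lam.transpose ^ 2))
    (max (opNorm lamInv ^ 2) (opNorm lamInv * opNorm lam.transpose))

section Development
open scoped ContDiff
open Finset (mul_sum sum_nonneg sum_le_sum sum_congr sum_add_distrib sum_mul single_le_sum mem_univ
  sum_const sum_sub_distrib card_univ abs_sum_le_sum_abs sum_comm)
open Set (Icc Ioi Iic Ici Ioo Ioc Iio Ico mem_Ici mem_Iic mem_Icc)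
open ContinuousLinearMap (fst snd proj compL opNorm_le_bound)

local notation "∇" => fderiv ℝ
local notation "C∞" => ContDiff ℝ ∞

set_option linter.unusedSectionVars false
set_option maxSynthPendingDepth 3

lemma mul_le_left {a b c : ℝ} (h : b ≤ c) (ha : 0 ≤ a := by positivity) : a * b ≤ a * c :=
  mul_le_mul_of_nonneg_left h ha

lemma mul_le_right {a b c : ℝ} (h : b ≤ c) (ha : 0 ≤ a := by positivity) : b * a ≤ c * a :=
  mul_le_mul_of_nonneg_right h ha

section Bounded
variable {E F G : Type} [NormedAddCommGroup E] [NormedSpace ℝ E]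
  [NormedAddCommGroup F] [NormedSpace ℝ F] [NormedAddCommGroup G] [NormedSpace ℝ G]

/-- Smooth maps whose derivatives up to order `j` are bounded by `K`. -/
def BD (j : ℕ) (K : ℝ) (u : E → F) : Prop :=
  C∞ u ∧ ∀ i ≤ j, ∀ p, ‖iteratedFDeriv ℝ i u p‖ ≤ K

lemma contDiff_fderiv_top {u : E → F} (hu : C∞ u) :
    C∞ (∇ u) :=
  (contDiff_infty_iff_fderiv.1 hu).2

lemma BD.nonneg {j : ℕ} {K : ℝ} {u : E → F} (h : BD j K u) : 0 ≤ K :=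
  (norm_nonneg _).trans (h.2 0 (Nat.zero_le _) 0)

lemma BD.norm_le {j : ℕ} {K : ℝ} {u : E → F} (h : BD j K u) (p : E) : ‖u p‖ ≤ K := by
  simpa using h.2 0 (Nat.zero_le _) p

lemma BD.mono {i j : ℕ} {K L : ℝ} {u : E → F} (h : BD j K u) (hij : i ≤ j) (hKL : K ≤ L) :
    BD i L u :=
  ⟨h.1, fun k hk p => (h.2 k (hk.trans hij) p).trans hKL⟩

lemma BD.fderiv {j : ℕ} {K : ℝ} {u : E → F} (h : BD (j + 1) K u) : BD j K (∇ u) :=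
  ⟨contDiff_fderiv_top h.1, fun i hi p => by
    rw [norm_iteratedFDeriv_fderiv]; exact h.2 (i + 1) (by omega) p⟩

lemma BD.norm_fderiv_le {j : ℕ} {K : ℝ} {u : E → F} (h : BD (j + 1) K u) (p : E) :
    ‖∇ u p‖ ≤ K := h.fderiv.norm_le p

lemma BD.norm_fderiv_fderiv_le {j : ℕ} {K : ℝ} {u : E → F} (h : BD (j + 2) K u) (p : E) :
    ‖∇ (∇ u) p‖ ≤ K :=
  (BD.fderiv (j := j) (BD.fderiv (j := j + 1) h)).norm_le p

lemma BD.succ {j : ℕ} {K : ℝ} {u : E → F} (hu : C∞ u)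
    (h0 : ∀ p, ‖u p‖ ≤ K) (h : BD j K (∇ u)) : BD (j + 1) K u := by
  refine ⟨hu, fun i hi p => ?_⟩
  rcases i with _ | i
  · simp_all
  · rw [← norm_iteratedFDeriv_fderiv]; exact h.2 i (by omega) p

lemma BD.zero {K : ℝ} {u : E → F} (hu : C∞ u) (h0 : ∀ p, ‖u p‖ ≤ K) :
    BD 0 K u := by
  refine ⟨hu, fun i hi p => ?_⟩
  obtain rfl : i = 0 := by omega
  simp_all

lemma BD.add {j : ℕ} {K L : ℝ} {u w : E → F} (hu : BD j K u) (hw : BD j L w) :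
    BD j (K + L) (fun p => u p + w p) := by
  refine ⟨hu.1.add hw.1, fun i hi p => ?_⟩
  have := iteratedFDeriv_add_apply (𝕜 := ℝ) (i := i) (x := p)
    (hu.1.contDiffAt.of_le (by exact_mod_cast le_top)) (hw.1.contDiffAt.of_le (by exact_mod_cast le_top))
  change ‖iteratedFDeriv ℝ i (u + w) p‖ ≤ _
  rw [this]
  exact (norm_add_le _ _).trans (add_le_add (hu.2 i hi p) (hw.2 i hi p))

lemma BD.smul {j : ℕ} {K : ℝ} {u : E → F} (hu : BD j K u) (c : ℝ) :
    BD j (|c| * K) (fun p => c • u p) := by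
  refine ⟨hu.1.const_smul c, fun i hi p => ?_⟩
  have := iteratedFDeriv_const_smul_apply (𝕜 := ℝ) (i := i) (x := p) (a := c)
    (hu.1.contDiffAt.of_le (by exact_mod_cast le_top))
  change ‖iteratedFDeriv ℝ i (c • u) p‖ ≤ _
  rw [this, norm_smul, norm_eq_abs]
  exact mul_le_left (hu.2 i hi p)

lemma BD.sum {ι : Type} {j : ℕ} {K : ι → ℝ} {u : ι → E → F} (s : Finset ι)
    (hu : ∀ i ∈ s, BD j (K i) (u i)) : BD j (∑ i ∈ s, K i) (fun p => ∑ i ∈ s, u i p) := by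
  classical
  induction s using Finset.induction_on with
  | empty =>
    refine ⟨by simpa using contDiff_const, fun i hi p => ?_⟩
    simp
  | insert a s ha ih =>
    simp only [Finset.sum_insert ha]
    exact (hu a (by simp)).add (ih fun i hi => hu i (by simp [hi]))

lemma BD.translate {j : ℕ} {K : ℝ} {u : E → F} (hu : BD j K u) (a : E) :
    BD j K (fun p => u (p + a)) :=
  ⟨hu.1.comp (contDiff_id.add contDiff_const), fun i hi p => by
    rw [iteratedFDeriv_comp_add_right]; exact hu.2 i hi _⟩

lemma BD.clm_left {j : ℕ} {K : ℝ} {u : E → F} (hu : BD j K u) (L : F →L[ℝ] G) :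
    BD j (‖L‖ * K) (fun p => L (u p)) := by
  refine ⟨L.contDiff.comp hu.1, fun i hi p => ?_⟩
  have := L.norm_iteratedFDeriv_comp_left (f := u) (x := p) (n := i)
    (hu.1.contDiffAt.of_le (by exact_mod_cast le_top)) le_rfl
  exact this.trans (mul_le_left (hu.2 i hi p))

lemma BD.bilin {H : Type} [NormedAddCommGroup H] [NormedSpace ℝ H] {j : ℕ} {K L : ℝ}
    {u : E → F} {w : E → G} (B : F →L[ℝ] G →L[ℝ] H) (hB : ‖B‖ ≤ 1)
    (hu : BD j K u) (hw : BD j L w) : BD j (2 ^ j * (K * L)) (fun p => B (u p) (w p)) := by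
  refine ⟨B.isBoundedBilinearMap.contDiff.comp (hu.1.prodMk hw.1), fun i hi p => ?_⟩
  have hK := hu.nonneg
  have hL := hw.nonneg
  refine (B.norm_iteratedFDeriv_le_of_bilinear_of_le_one hu.1 hw.1 p
    (by exact_mod_cast le_top) hB).trans ?_
  calc _ ≤ ∑ l ∈ Finset.range (i + 1), (i.choose l : ℝ) * (K * L) := by
        refine sum_le_sum fun l hl => ?_
        rw [Finset.mem_range] at hl
        rw [mul_assoc]
        refine mul_le_left ?_ (by simp)
        exact mul_le_mul (hu.2 l (by omega) p) (hw.2 (i - l) (by omega) p) (norm_nonneg _) hK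
    _ = 2 ^ i * (K * L) := by
        rw [← sum_mul]
        congr 1
        exact_mod_cast Nat.sum_range_choose i
    _ ≤ _ := by
        refine mul_le_right ?_ (mul_nonneg hK hL)
        exact pow_le_pow_right₀ (by norm_num) hi

lemma BD.mul {j : ℕ} {K L : ℝ} {u w : E → ℝ} (hu : BD j K u) (hw : BD j L w) :
    BD j (2 ^ j * (K * L)) (fun p => u p * w p) := by
  simpa using BD.bilin (ContinuousLinearMap.mul ℝ ℝ) (by simp) hu hw

lemma BD.const {j : ℕ} (c : F) : BD j ‖c‖ (fun _ : E => c) := by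
  refine ⟨contDiff_const, fun i hi p => ?_⟩
  rcases i with _ | i
  · simp
  · rw [iteratedFDeriv_const_of_ne (by omega)]; simp

/-- The map `p ↦ p + h • b p`. -/
def drift (b : E → E) (h : ℝ) (p : E) : E := p + h • b p

lemma drift_hasFDerivAt {b : E → E} (hb : C∞ b) (h : ℝ) (p : E) :
    HasFDerivAt (drift b h) (ContinuousLinearMap.id ℝ E + h • ∇ b p) p :=
  (hasFDerivAt_id p).add (((hb.differentiable (by simp)) p).hasFDerivAt.const_smul h)

lemma drift_contDiff {b : E → E} (hb : C∞ b) (h : ℝ) :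
    C∞ (drift b h) :=
  contDiff_id.add (hb.const_smul h)

theorem BD.comp_drift {b : E → E} {Cb : ℝ} (hb : C∞ b) (j : ℕ)
    (hDb : BD j Cb (∇ b)) :
    ∃ C : ℝ, 0 ≤ C ∧ ∀ h : ℝ, 0 ≤ h → h ≤ 1 → ∀ {F : Type} [NormedAddCommGroup F]
      [NormedSpace ℝ F] (u : E → F) (K : ℝ), BD j K u →
        BD j ((1 + C * h) * K) (fun p => u (drift b h p)) := by
  induction j with
  | zero =>
    refine ⟨0, le_rfl, fun h h0 h1 F _ _ u K hu => ?_⟩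
    refine BD.zero (hu.1.comp (drift_contDiff hb h)) fun p => ?_
    simpa using hu.norm_le _
  | succ j ih =>
    obtain ⟨C, hC, hcomp⟩ := ih (hDb.mono (by omega) le_rfl)
    have hCb := hDb.nonneg
    refine ⟨C + 2 ^ j * ((1 + C) * Cb), by positivity, fun h h0 h1 F _ _ u K hu => ?_⟩
    have hK := hu.nonneg
    refine BD.succ (hu.1.comp (drift_contDiff hb h)) (fun p => ?_) ?_
    · refine (hu.norm_le _).trans ?_
      have : 0 ≤ (C + 2 ^ j * ((1 + C) * Cb)) * h * K := by positivity
      linarith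
    · have h1' := hcomp h h0 h1 (∇ u) K hu.fderiv
      have h2 := BD.bilin (compL ℝ E E F)
        (ContinuousLinearMap.norm_compL_le ℝ E E F) h1' (hDb.mono (Nat.le_succ j) le_rfl)
      have h3 := h1'.add (h2.smul h)
      have hfun : ∇ (fun p => u (drift b h p)) = fun p =>
          ∇ u (drift b h p) + h • (compL ℝ E E F
            (∇ u (drift b h p))) (∇ b p) := by
        funext p
        have := ((hu.1.differentiable (by simp)) (drift b h p)).hasFDerivAt.comp p
          (drift_hasFDerivAt hb h p)
        rw [show (fun p => u (drift b h p)) = u ∘ drift b h from rfl, this.fderiv]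
        simp
      rw [hfun]
      refine h3.mono le_rfl ?_
      rw [abs_of_nonneg h0]
      have e1 : (1 + C * h) * K * Cb ≤ (1 + C) * K * Cb := by
        have : C * h ≤ C := by nlinarith
        gcongr
      have e2 : h * (2 ^ j * ((1 + C * h) * K * Cb)) ≤ h * (2 ^ j * ((1 + C) * K * Cb)) := by
        gcongr
      linarith

/-- Symmetric average of `F` over the points `q ± s • v l`. -/
def symAvg {ι : Type} [Fintype ι] (v : ι → E) (s : ℝ) (f : E → F) (q : E) : F :=
  (2 * (Fintype.card ι : ℝ))⁻¹ • ∑ l, (f (q + s • v l) + f (q - s • v l))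

lemma BD.symAvg {ι : Type} [Fintype ι] [Nonempty ι] (v : ι → E) (s : ℝ) {j : ℕ} {K : ℝ}
    {u : E → F} (hu : BD j K u) : BD j K (symAvg v s u) := by
  have h1 := (BD.sum (Finset.univ : Finset ι) (fun l _ =>
    (hu.translate (s • v l)).add (hu.translate (-(s • v l))))).smul
      ((2 * (Fintype.card ι : ℝ))⁻¹)
  convert h1 using 1
  · simp
    field_simp
    norm_num
  · funext p
    simp [_root_.symAvg, sub_eq_add_neg]

end Bounded

section Scheme
variable {E F : Type} [NormedAddCommGroup E] [NormedSpace ℝ E]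
  [NormedAddCommGroup F] [NormedSpace ℝ F]

lemma ContDiff.diff_top {u : E → F} (hu : C∞ u) : Differentiable ℝ u :=
  hu.differentiable (by simp)

lemma norm_sub_le_of_fderiv_bound {u : E → F} {K : ℝ} (hu : Differentiable ℝ u)
    (hK : ∀ p, ‖∇ u p‖ ≤ K) (p w : E) : ‖u (p + w) - u p‖ ≤ K * ‖w‖ := by
  have := Convex.norm_image_sub_le_of_norm_fderiv_le (𝕜 := ℝ) (f := u) (C := K) (s := Set.univ)
    (x := p) (y := p + w) (fun x _ => hu x) (fun x _ => hK x) convex_univ trivial trivial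
  simp_all

lemma taylor_one {u : E → F} {K : ℝ} (hu : Differentiable ℝ u)
    (hu2 : Differentiable ℝ (∇ u)) (hK : ∀ p, ‖∇ (∇ u) p‖ ≤ K) (p w : E) :
    ‖u (p + w) - u p - ∇ u p w‖ ≤ K * ‖w‖ ^ 2 := by
  have hK0 : 0 ≤ K := (norm_nonneg _).trans (hK p)
  have h := Convex.norm_image_sub_le_of_norm_hasFDerivWithin_le (𝕜 := ℝ)
    (f := fun x => u x - ∇ u p x)
    (f' := fun x => ∇ u x - ∇ u p) (C := K * ‖w‖)
    (s := Metric.closedBall p ‖w‖) (x := p) (y := p + w)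
    (fun x _ => ((hu x).hasFDerivAt.sub (∇ u p).hasFDerivAt).hasFDerivWithinAt)
    (fun x hx => by
      have := norm_sub_le_of_fderiv_bound hu2 hK p (x - p)
      rw [add_sub_cancel] at this
      refine this.trans (mul_le_left ?_ hK0)
      rwa [← dist_eq_norm])
    (convex_closedBall _ _) (by simp) (by simp)
  simp only [map_add] at h
  calc _ = ‖u (p + w) - (∇ u p p + ∇ u p w) - (u p - ∇ u p p)‖ := by
        abel
    _ ≤ _ := h
    _ = _ := by simp; ring

lemma taylor_two {u : E → ℝ} {K : ℝ} (hu : C∞ u)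
    (hK : ∀ p, ‖∇ (∇ (∇ u)) p‖ ≤ K) (p w : E) :
    |u (p + w) - u p - ∇ u p w - (1 / 2) * ∇ (∇ u) p w w| ≤ K * ‖w‖ ^ 3 := by
  have hK0 : 0 ≤ K := (norm_nonneg _).trans (hK p)
  have h1 := contDiff_fderiv_top hu
  have h2 := contDiff_fderiv_top h1
  set B := ∇ (∇ u) p with hB
  have hsymm : ∀ a c, B a c = B c a := fun a c => by
    have : IsSymmSndFDerivAt ℝ u p :=
      (hu.contDiffAt (x := p)).isSymmSndFDerivAt
        (by rw [minSmoothness_of_isRCLikeNormedField]; exact WithTop.coe_le_coe.2 (le_top : (2 : ℕ∞) ≤ ⊤))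
    exact this a c
  have hd : ∀ x : E, HasFDerivAt
      (fun x => u x - ∇ u p x - (1 / 2 : ℝ) * B (x - p) (x - p))
      (∇ u x - ∇ u p - B (x - p)) x := by
    intro x
    have hb : HasFDerivAt (fun x : E => B (x - p)) B x := by
      have := B.hasFDerivAt.comp x ((hasFDerivAt_id x).sub_const p)
      rwa [ContinuousLinearMap.comp_id] at this
    have hb2 := (hb.clm_apply ((hasFDerivAt_id x).sub_const p)).const_mul (1 / 2 : ℝ)
    refine (((hu.diff_top x).hasFDerivAt.sub (∇ u p).hasFDerivAt).sub hb2).congr_fderiv ?_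
    ext v
    have := hsymm v (x - p)
    simp only [map_sub, sub_apply] at this
    simp
    linarith
  have h := Convex.norm_image_sub_le_of_norm_hasFDerivWithin_le (𝕜 := ℝ)
    (C := K * ‖w‖ ^ 2) (s := Metric.closedBall p ‖w‖) (x := p) (y := p + w)
    (fun x _ => (hd x).hasFDerivWithinAt)
    (fun x hx => by
      have := taylor_one h1.diff_top h2.diff_top hK p (x - p)
      rw [add_sub_cancel] at this
      refine this.trans (mul_le_left ?_ hK0)
      gcongr
      rwa [← dist_eq_norm])
    (convex_closedBall _ _) (by simp) (by simp)
  simp only [map_add, add_sub_cancel_left, sub_self, map_zero,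
    mul_zero, sub_zero] at h
  calc _ = |u (p + w) - (∇ u p p + ∇ u p w) - 1 / 2 * B w w
            - (u p - ∇ u p p)| := by
        ring
    _ ≤ _ := h
    _ = _ := by ring

variable {ι : Type} [Fintype ι] [Nonempty ι]

lemma symAvg_mono (v : ι → E) (s : ℝ) {f g : E → ℝ} {q : E}
    (h : ∀ l, f (q + s • v l) ≤ g (q + s • v l) ∧ f (q - s • v l) ≤ g (q - s • v l)) :
    symAvg v s f q ≤ symAvg v s g q := by
  unfold symAvg
  refine mul_le_left (sum_le_sum fun l _ => ?_) (by simp)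
  grind

lemma symAvg_const (v : ι → E) (s : ℝ) (c : F) (q : E) : symAvg v s (fun _ => c) q = c := by
  unfold symAvg
  simp only [sum_const, card_univ, ← two_smul ℝ c, ← Nat.cast_smul_eq_nsmul ℝ,
    smul_smul]
  rw [show (2 * (Fintype.card ι : ℝ))⁻¹ * (Fintype.card ι * 2) = 1 by field_simp, one_smul]

lemma symAvg_add (v : ι → E) (s : ℝ) (f g : E → F) (q : E) :
    symAvg v s (fun x => f x + g x) q = symAvg v s f q + symAvg v s g q := by
  unfold symAvg
  rw [← smul_add, ← sum_add_distrib]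
  grind

lemma symAvg_mul (v : ι → E) (s c : ℝ) (f : E → ℝ) (q : E) :
    symAvg v s (fun x => c * f x) q = c * symAvg v s f q := by
  unfold symAvg
  simp only [← mul_add, ← mul_sum, smul_eq_mul]
  ring

lemma symAvg_sum {κ : Type} (v : ι → E) (s : ℝ) (t : Finset κ) (f : κ → E → ℝ) (q : E) :
    symAvg v s (fun x => ∑ k ∈ t, f k x) q = ∑ k ∈ t, symAvg v s (f k) q := by
  unfold symAvg
  simp only [smul_eq_mul, ← mul_sum]
  rw [sum_comm]
  simp only [sum_add_distrib]

/-- Variance identity for the symmetric average. -/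
lemma symAvg_variance (v : ι → E) (s c e : ℝ) (f : E → ℝ) (q : E) :
    symAvg v s (fun x => (f x - c) ^ 2) q - (symAvg v s f q - c) ^ 2
      = symAvg v s (fun x => (f x - e) ^ 2) q - (symAvg v s f q - e) ^ 2 := by
  have key : ∀ c : ℝ, symAvg v s (fun x => (f x - c) ^ 2) q
      = symAvg v s (fun x => f x ^ 2) q - 2 * c * symAvg v s f q + c ^ 2 := by
    intro c
    have : (fun x => (f x - c) ^ 2) = fun x => f x ^ 2 + ((-2 * c) * f x + c ^ 2) := by
      grind
    rw [this, symAvg_add, symAvg_add, symAvg_mul, symAvg_const]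
    ring
  grind

lemma sq_symAvg_le (v : ι → E) (s : ℝ) (f : E → ℝ) (q : E) :
    (symAvg v s f q) ^ 2 ≤ symAvg v s (fun x => f x ^ 2) q := by
  have h := symAvg_variance v s 0 (symAvg v s f q) f q
  have h2 : 0 ≤ symAvg v s (fun x => (f x - symAvg v s f q) ^ 2) q := by
    rw [← symAvg_const (F := ℝ) v s 0 q]
    exact symAvg_mono v s fun l => ⟨sq_nonneg _, sq_nonneg _⟩
  grind

/-- One step of the symmetric random walk scheme. -/
def stepP (v : ι → E) (b : E → E) (h : ℝ) (f : E → F) (p : E) : F :=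
  symAvg v (√(2 * Fintype.card ι * h)) f (drift b h p)

/-- Second order operator `f ↦ Df(b) + ∑ D²f(v_l, v_l)`. -/
def genB (v : ι → E) (b : E → E) (f : E → ℝ) (p : E) : ℝ :=
  ∇ f p (b p) + ∑ l, ∇ (∇ f) p (v l) (v l)

theorem stepP_error (v : ι → E) (b : E → E) {Cv Cb : ℝ} (hv : ∀ l, ‖v l‖ ≤ Cv)
    (hb : ∀ p, ‖b p‖ ≤ Cb * (1 + ‖p‖)) :
    ∃ C, 0 ≤ C ∧ ∀ h, 0 ≤ h → h ≤ 1 → ∀ (f : E → ℝ) (K : ℝ), BD 3 K f → ∀ p,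
      |stepP v b h f p - f p - h * genB v b f p| ≤ C * K * (h * √h) * (1 + ‖p‖) ^ 2 := by
  have hCv : 0 ≤ Cv := (norm_nonneg _).trans (hv (Classical.arbitrary ι))
  have hCb : 0 ≤ Cb := by
    have := (norm_nonneg _).trans (hb 0); simp_all
  set d : ℝ := (Fintype.card ι : ℝ) with hd
  have hd0 : 0 < d := by positivity
  refine ⟨(2 * d * √(2 * d)) * Cv ^ 3 + Cb ^ 2 + d * (Cb * Cv ^ 2), by positivity, ?_⟩
  intro h h0 h1 f K hf p
  have hK := hf.nonneg
  set s := √(2 * d * h) with hs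
  have hs0 : 0 ≤ s := by positivity
  have hs2 : s ^ 2 = 2 * d * h := sq_sqrt (by positivity)
  have hs3 : s ^ 3 = (2 * d * √(2 * d)) * (h * √h) := by
    rw [pow_succ, hs2, hs, sqrt_mul (by grind)]; ring
  set q := drift b h p with hq
  set D2 := ∇ (∇ f) with hD2
  have hT2 := taylor_two hf.1 (K := K)
    (fun p => BD.norm_le (j := 0) (hf.fderiv.fderiv.fderiv) p)
  have hT1 := taylor_one hf.1.diff_top (contDiff_fderiv_top hf.1).diff_top (K := K)
    (fun p => BD.norm_le (j := 1) (hf.fderiv.fderiv) p) p (h • b p)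
  have hT0 := norm_sub_le_of_fderiv_bound
    (contDiff_fderiv_top (contDiff_fderiv_top hf.1)).diff_top (K := K)
    (fun p => BD.norm_le (j := 0) (hf.fderiv.fderiv.fderiv) p) p (h • b p)
  -- noise part
  have hA : |symAvg v s f q - (f q + h * ∑ l, D2 q (v l) (v l))| ≤ K * s ^ 3 * Cv ^ 3 := by
    have e : symAvg v s f q - (f q + h * ∑ l, D2 q (v l) (v l))
        = (2 * d)⁻¹ * ∑ l, ((f (q + s • v l) - f q - ∇ f q (s • v l)
            - (1 / 2) * D2 q (s • v l) (s • v l))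
          + (f (q + -(s • v l)) - f q - ∇ f q (-(s • v l))
            - (1 / 2) * D2 q (-(s • v l)) (-(s • v l)))) := by
      have : ∀ l, ((f (q + s • v l) - f q - ∇ f q (s • v l)
            - (1 / 2) * D2 q (s • v l) (s • v l))
          + (f (q + -(s • v l)) - f q - ∇ f q (-(s • v l))
            - (1 / 2) * D2 q (-(s • v l)) (-(s • v l))))
          = (f (q + s • v l) + f (q - s • v l)) - 2 * f q - s ^ 2 * D2 q (v l) (v l) := by
        intro l
        simp [sub_eq_add_neg]
        ring
      simp only [this, sum_sub_distrib, ← mul_sum, sum_const,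
        card_univ, nsmul_eq_mul, ← hd, hs2]
      unfold symAvg
      rw [smul_eq_mul, ← hd]
      field_simp
      ring
    rw [e, abs_mul, abs_of_pos (by positivity : (0:ℝ) < (2 * d)⁻¹)]
    have : |∑ l, ((f (q + s • v l) - f q - ∇ f q (s • v l)
            - (1 / 2) * D2 q (s • v l) (s • v l))
          + (f (q + -(s • v l)) - f q - ∇ f q (-(s • v l))
            - (1 / 2) * D2 q (-(s • v l)) (-(s • v l))))| ≤ ∑ _l : ι, 2 * (K * (s * Cv) ^ 3) := by
      refine (abs_sum_le_sum_abs _ _).trans (sum_le_sum fun l _ => ?_)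
      have hn : ‖s • v l‖ ≤ s * Cv := by
        rw [norm_smul, norm_eq_abs, abs_of_nonneg hs0]
        exact mul_le_left (hv l) hs0
      have k1 := (hT2 q (s • v l)).trans
        (mul_le_left (pow_le_pow_left₀ (norm_nonneg _) hn 3) hK)
      have k2 := (hT2 q (-(s • v l))).trans
        (mul_le_left (pow_le_pow_left₀ (norm_nonneg (-(s • v l)))
          ((norm_neg _).trans_le hn) 3) hK)
      refine (abs_add_le _ _).trans ?_
      linarith
    refine (mul_le_left this).trans (le_of_eq ?_)
    simp only [sum_const, card_univ, nsmul_eq_mul, ← hd]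
    field_simp
  have hnb : ‖h • b p‖ ≤ h * (Cb * (1 + ‖p‖)) := by
    rw [norm_smul, norm_eq_abs, abs_of_nonneg h0]
    exact mul_le_left (hb p) h0
  have hBq : |f q - f p - h * ∇ f p (b p)| ≤ K * (h * (Cb * (1 + ‖p‖))) ^ 2 := by
    rw [map_smul, smul_eq_mul] at hT1
    exact hT1.trans (mul_le_left (pow_le_pow_left₀ (norm_nonneg _) hnb 2) hK)
  have hC : |∑ l, D2 q (v l) (v l) - ∑ l, D2 p (v l) (v l)|
      ≤ d * (K * (h * (Cb * (1 + ‖p‖))) * Cv ^ 2) := by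
    rw [← sum_sub_distrib]
    have : |∑ l, (D2 q (v l) (v l) - D2 p (v l) (v l))|
        ≤ ∑ _l : ι, K * (h * (Cb * (1 + ‖p‖))) * Cv ^ 2 := by
      refine (abs_sum_le_sum_abs _ _).trans (sum_le_sum fun l _ => ?_)
      have : D2 q (v l) (v l) - D2 p (v l) (v l) = (D2 q - D2 p) (v l) (v l) := by simp
      calc _ ≤ ‖(D2 q - D2 p)‖ * ‖v l‖ * ‖v l‖ := (D2 q - D2 p).le_opNorm₂ _ _
        _ ≤ (K * (h * (Cb * (1 + ‖p‖)))) * Cv * Cv := by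
          have : ‖D2 q - D2 p‖ ≤ K * (h * (Cb * (1 + ‖p‖))) :=
            hT0.trans (mul_le_left hnb hK)
          gcongr <;> exact hv l
        _ = _ := by ring
    refine this.trans (le_of_eq ?_)
    simp [hd]
  have hsum : stepP v b h f p - f p - h * genB v b f p
      = (symAvg v s f q - (f q + h * ∑ l, D2 q (v l) (v l)))
        + (f q - f p - h * ∇ f p (b p))
        + h * (∑ l, D2 q (v l) (v l) - ∑ l, D2 p (v l) (v l)) := by
    have : stepP v b h f p = symAvg v s f q := rfl
    rw [this, genB]
    ring
  rw [hsum]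
  refine (abs_add_le _ _).trans ((add_le_add ((abs_add_le _ _).trans (add_le_add hA hBq)) (le_of_eq
    (abs_mul _ _))).trans ?_)
  rw [abs_of_nonneg h0]
  have hC' := mul_le_left hC h0
  set N := 1 + ‖p‖ with hN
  have hN1 : 1 ≤ N := by linarith [norm_nonneg p]
  have hh : h ^ 2 ≤ h * √h := by
    rw [pow_two]; exact mul_le_left (le_sqrt_of_sq_le (by nlinarith)) h0
  have hN2 : N ≤ N ^ 2 := by nlinarith
  have hN3 : 1 ≤ N ^ 2 := by nlinarith
  have t1 : K * s ^ 3 * Cv ^ 3 ≤ K * ((2 * d * √(2 * d)) * (h * √h)) * Cv ^ 3 * N ^ 2 := by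
    rw [hs3]; exact le_mul_of_one_le_right (by positivity) hN3
  have t2 : K * (h * (Cb * N)) ^ 2 ≤ K * (Cb ^ 2 * (h * √h) * N ^ 2) := by
    have : (h * (Cb * N)) ^ 2 = Cb ^ 2 * h ^ 2 * N ^ 2 := by ring
    rw [this]; gcongr
  have t3 : h * (d * (K * (h * (Cb * N)) * Cv ^ 2)) ≤ d * K * Cb * Cv ^ 2 * (h * √h) * N ^ 2 := by
    have : h * (d * (K * (h * (Cb * N)) * Cv ^ 2)) = d * K * Cb * Cv ^ 2 * h ^ 2 * N := by ring
    rw [this]; gcongr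
  linarith

end Scheme

section Theta
variable {E : Type} [NormedAddCommGroup E] [NormedSpace ℝ E]
variable {ι : Type} [Fintype ι] [Nonempty ι]

/-- Sum of squared directional derivatives. -/
def dirQ {κ : Type} [Fintype κ] (w : κ → E) (g : E → ℝ) (p : E) : ℝ :=
  ∑ k, ∇ g p (w k) ^ 2

lemma dirQ_nonneg {κ : Type} [Fintype κ] (w : κ → E) (g : E → ℝ) (p : E) : 0 ≤ dirQ w g p :=
  sum_nonneg fun _ _ => sq_nonneg _

lemma hasFDerivAt_stepP (v : ι → E) {b : E → E} (hb : C∞ b) (h : ℝ) {g : E → ℝ}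
    (hg : Differentiable ℝ g) (p x : E) :
    ∇ (stepP v b h g) p x
      = symAvg v (√(2 * Fintype.card ι * h))
        (fun y => ∇ g y (x + h • ∇ b p x)) (drift b h p) := by
  have hd := drift_hasFDerivAt hb h p
  set s := √(2 * Fintype.card ι * h) with hs
  have h1 : ∀ a : E, HasFDerivAt (fun p => g (drift b h p + a))
      ((∇ g (drift b h p + a)).comp
        (ContinuousLinearMap.id ℝ E + h • ∇ b p)) p := fun a =>
    HasFDerivAt.comp p (hg _).hasFDerivAt (hd.add_const a)
  have h2 : HasFDerivAt (stepP v b h g)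
      ((2 * (Fintype.card ι : ℝ))⁻¹ • ∑ l, (((∇ g (drift b h p + s • v l)).comp
        (ContinuousLinearMap.id ℝ E + h • ∇ b p)) +
        ((∇ g (drift b h p + -(s • v l))).comp
        (ContinuousLinearMap.id ℝ E + h • ∇ b p)))) p := by
    have := (HasFDerivAt.fun_sum (u := (Finset.univ : Finset ι)) fun l _ =>
      (h1 (s • v l)).add (h1 (-(s • v l)))).const_smul ((2 * (Fintype.card ι : ℝ))⁻¹)
    refine this.congr_of_eventuallyEq (.of_forall fun y => ?_)
    simp [stepP, symAvg, sub_eq_add_neg, hs]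
  rw [h2.fderiv]
  simp [symAvg, sub_eq_add_neg]

set_option maxHeartbeats 2000000 in
theorem theta_step {κ : Type} [Fintype κ] (v : ι → E) (w : κ → E) (b : E → E)
    {Cv Cw Cb β η : ℝ} (hβ : 0 ≤ β) (hb : C∞ b) (hv : ∀ l, ‖v l‖ ≤ Cv)
    (hw : ∀ k, ‖w k‖ ≤ Cw) (hCw : 0 ≤ Cw) (hDb : ∀ p, ‖∇ b p‖ ≤ Cb)
    (hstr : ∀ (p : E) (ξ : E →L[ℝ] ℝ), 2 * ∑ k, ξ (w k) * ξ (∇ b p (w k))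
      - 2 * β * ∑ l, ξ (v l) ^ 2 ≤ -η * ∑ k, ξ (w k) ^ 2) :
    ∃ C, 0 ≤ C ∧ ∀ h, 0 ≤ h → h ≤ 1 → ∀ (g : E → ℝ) (K : ℝ), BD 2 K g → ∀ (c : ℝ) (p : E),
      dirQ w (stepP v b h g) p + β * (stepP v b h g p - c) ^ 2
        ≤ stepP v b h (fun x => (dirQ w g x + β * (g x - c) ^ 2) - h * η * dirQ w g x) p
          + C * K ^ 2 * (h * √h) := by
  have hCv : 0 ≤ Cv := (norm_nonneg _).trans (hv (Classical.arbitrary ι))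
  have hCb : 0 ≤ Cb := (norm_nonneg _).trans (hDb 0)
  set d : ℝ := (Fintype.card ι : ℝ) with hd
  have hd0 : 0 < d := by positivity
  set B := 2 * d * √(2 * d) with hB
  have hB0 : 0 ≤ B := by positivity
  refine ⟨Fintype.card κ * (Cb * Cw) ^ 2 + β * (B * (2 * Cv ^ 3) + (2 * d) ^ 2 * Cv ^ 4)
    + 2 * β * (d * (√(2 * d) * (2 * Cv ^ 3))), by positivity, ?_⟩
  intro h h0 h1 g K hg c p
  have hK := hg.nonneg
  set s := √(2 * d * h) with hs
  have hs0 : 0 ≤ s := by positivity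
  have hs2 : s ^ 2 = 2 * d * h := sq_sqrt (by positivity)
  have hs3 : s ^ 3 = B * (h * √h) := by
    rw [pow_succ, hs2, hs, sqrt_mul (by grind), hB]; ring
  have hss : s = √(2 * d) * √h := by grind
  have hh : h ^ 2 ≤ h * √h := by
    rw [pow_two]; exact mul_le_left (le_sqrt_of_sq_le (by nlinarith)) h0
  set q := drift b h p with hq
  have hP : ∀ f : E → ℝ, stepP v b h f p = symAvg v s f q := fun f => rfl
  have hgd := hg.1.diff_top
  have hD1 : ∀ p, ‖∇ g p‖ ≤ K := fun p => BD.norm_fderiv_le (j := 1) hg p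
  have hD2 : ∀ p, ‖∇ (∇ g) p‖ ≤ K := fun p => BD.norm_fderiv_fderiv_le (j := 0) hg p
  have hL := norm_sub_le_of_fderiv_bound (contDiff_fderiv_top hg.1).diff_top hD2
  have hT := taylor_one hgd (contDiff_fderiv_top hg.1).diff_top hD2
  have hsv : ∀ l, ‖s • v l‖ ≤ s * Cv := fun l => by
    rw [norm_smul, norm_eq_abs, abs_of_nonneg hs0]
    exact mul_le_left (hv l) hs0
  -- the derivative part
  have hder : dirQ w (stepP v b h g) p ≤ symAvg v s (fun y => dirQ w g y
      + (2 * h) * ∑ k, ∇ g y (w k) * ∇ g y (∇ b p (w k))) q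
      + h ^ 2 * (Fintype.card κ * (K * (Cb * Cw)) ^ 2) := by
    have e1 : dirQ w (stepP v b h g) p ≤ symAvg v s (fun y => ∑ k,
        (∇ g y (w k + h • ∇ b p (w k))) ^ 2) q := by
      rw [symAvg_sum]
      refine sum_le_sum fun k _ => ?_
      rw [hasFDerivAt_stepP v hb h hgd p (w k)]
      exact sq_symAvg_le _ _ _ _
    refine e1.trans ?_
    rw [← symAvg_const v s (h ^ 2 * (Fintype.card κ * (K * (Cb * Cw)) ^ 2)) q, ← symAvg_add]
    have key : ∀ y, ∑ k, ∇ g y (w k + h • ∇ b p (w k)) ^ 2 ≤ dirQ w g y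
      + (2 * h) * ∑ k, ∇ g y (w k) * ∇ g y (∇ b p (w k)) +
      h ^ 2 * (Fintype.card κ * (K * (Cb * Cw)) ^ 2) := by
      intro y
      have : (Fintype.card κ : ℝ) * (K * (Cb * Cw)) ^ 2 = ∑ _k : κ, (K * (Cb * Cw)) ^ 2 := by simp
      rw [this, dirQ, mul_sum, mul_sum, ← sum_add_distrib,
        ← sum_add_distrib]
      refine sum_le_sum fun k _ => ?_
      have hb' : |∇ g y (∇ b p (w k))| ≤ K * (Cb * Cw) := by
        refine ((∇ g y).le_opNorm (∇ b p (w k))).trans ?_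
        refine mul_le_mul (hD1 y) ?_ (norm_nonneg _) hK
        refine ((∇ b p).le_opNorm (w k)).trans ?_
        exact mul_le_mul (hDb p) (hw k) (norm_nonneg _) hCb
      have := sq_le_sq' (neg_le_of_abs_le hb') (le_of_abs_le hb')
      simp only [map_add, map_smul, smul_eq_mul]
      nlinarith [mul_le_left this]
    exact symAvg_mono v s fun l => ⟨key _, key _⟩
  -- the variance part
  have hvar : (symAvg v s g q - c) ^ 2 ≤ symAvg v s (fun y => (g y - c) ^ 2) q
      - 2 * h * ∑ l, ∇ g q (v l) ^ 2 + 2 * K ^ 2 * Cv ^ 3 * s ^ 3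
      + K ^ 2 * Cv ^ 4 * s ^ 4 := by
    have hv1 := symAvg_variance v s c (g q) g q
    have hlow : 2 * h * ∑ l, ∇ g q (v l) ^ 2 - 2 * K ^ 2 * Cv ^ 3 * s ^ 3
        ≤ symAvg v s (fun y => (g y - g q) ^ 2) q := by
      have e : 2 * h * ∑ l, ∇ g q (v l) ^ 2 - 2 * K ^ 2 * Cv ^ 3 * s ^ 3
          = (2 * d)⁻¹ * ∑ l, (2 * (s ^ 2 * ∇ g q (v l) ^ 2
            - 2 * K ^ 2 * Cv ^ 3 * s ^ 3)) := by
        simp only [← mul_sum, sum_sub_distrib, sum_const, card_univ,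
          nsmul_eq_mul, ← hd, hs2]
        grind
      rw [e]
      unfold symAvg
      refine mul_le_left (sum_le_sum fun l _ => ?_)
      have aux : ∀ a : E, ‖a‖ ≤ s * Cv → |∇ g q a| ≤ K * (s * Cv) →
          (∇ g q a) ^ 2 - 2 * K ^ 2 * Cv ^ 3 * s ^ 3 ≤ (g (q + a) - g q) ^ 2 := by
        intro a ha hda
        have t := hT q a
        have t' : |g (q + a) - g q - ∇ g q a| ≤ K * (s * Cv) ^ 2 :=
          t.trans (mul_le_left (pow_le_pow_left₀ (norm_nonneg _) ha 2) hK)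
        set x := g (q + a) - g q
        set z := ∇ g q a
        have : |z * (x - z)| ≤ (K * (s * Cv)) * (K * (s * Cv) ^ 2) := by
          rw [abs_mul]; exact mul_le_mul hda t' (abs_nonneg _) (by positivity)
        have := neg_le_of_abs_le this
        nlinarith [sq_nonneg (x - z)]
      have hda : ∀ a : E, ‖a‖ ≤ s * Cv → |∇ g q a| ≤ K * (s * Cv) := fun a ha =>
        (ContinuousLinearMap.le_opNorm _ _).trans (mul_le_mul (hD1 q) ha (norm_nonneg _) hK)
      have a1 := aux _ (hsv l) (hda _ (hsv l))
      have hn : ‖-(s • v l)‖ ≤ s * Cv := (norm_neg _).trans_le (hsv l)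
      have a2 := aux _ hn (hda _ hn)
      rw [← sub_eq_add_neg] at a2
      simp only [map_neg, map_smul, smul_eq_mul] at a1 a2
      linarith
    have hup : (symAvg v s g q - g q) ^ 2 ≤ K ^ 2 * Cv ^ 4 * s ^ 4 := by
      have : |symAvg v s g q - g q| ≤ K * (s * Cv) ^ 2 := by
        have e : symAvg v s g q - g q = (2 * d)⁻¹ * ∑ l,
            ((g (q + s • v l) - g q - ∇ g q (s • v l))
            + (g (q + -(s • v l)) - g q - ∇ g q (-(s • v l)))) := by
          have : ∀ l, ((g (q + s • v l) - g q - ∇ g q (s • v l))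
            + (g (q + -(s • v l)) - g q - ∇ g q (-(s • v l))))
            = (g (q + s • v l) + g (q - s • v l)) - 2 * g q := by
            intro l; simp [sub_eq_add_neg]; ring
          simp only [this, sum_sub_distrib, sum_const, card_univ,
            nsmul_eq_mul, ← hd]
          unfold symAvg
          rw [smul_eq_mul, ← hd]
          field_simp
        rw [e, abs_mul, abs_of_pos (by positivity : (0:ℝ) < (2 * d)⁻¹)]
        have : |∑ l, ((g (q + s • v l) - g q - ∇ g q (s • v l))
            + (g (q + -(s • v l)) - g q - ∇ g q (-(s • v l))))|
            ≤ ∑ _l : ι, 2 * (K * (s * Cv) ^ 2) := by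
          refine (abs_sum_le_sum_abs _ _).trans (sum_le_sum fun l _ => ?_)
          have k1 := (hT q (s • v l)).trans
            (mul_le_left (pow_le_pow_left₀ (norm_nonneg _) (hsv l) 2) hK)
          have k2 := (hT q (-(s • v l))).trans
            (mul_le_left (pow_le_pow_left₀ (norm_nonneg (-(s • v l)))
              ((norm_neg _).trans_le (hsv l)) 2) hK)
          rw [norm_eq_abs] at k1 k2
          refine (abs_add_le _ _).trans ?_
          linarith
        refine (mul_le_left this).trans (le_of_eq ?_)
        simp only [sum_const, card_univ, nsmul_eq_mul, ← hd]
        field_simp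
      have h2 := sq_le_sq' (neg_le_of_abs_le this) (le_of_abs_le this)
      linarith
    linarith
  -- the structural inequality
  have hmid : symAvg v s (fun y => (2 * h) * ∑ k, ∇ g y (w k) *
      ∇ g y (∇ b p (w k))) q
      ≤ symAvg v s (fun y => (-(h * η)) * dirQ w g y) q
        + 2 * β * h * ∑ l, ∇ g q (v l) ^ 2
        + 2 * β * h * (d * (2 * K ^ 2 * Cv ^ 3 * s)) := by
    rw [add_assoc, ← symAvg_const v s (2 * β * h * ∑ l, ∇ g q (v l) ^ 2
        + 2 * β * h * (d * (2 * K ^ 2 * Cv ^ 3 * s))) q, ← symAvg_add]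
    have key : ∀ a : E, ‖a‖ ≤ s * Cv → (2 * h) * ∑ k, ∇ g (q + a) (w k) *
      ∇ g (q + a) (∇ b p (w k)) ≤ (-(h * η)) * dirQ w g (q + a) +
        (2 * β * h * ∑ l, ∇ g q (v l) ^ 2
        + 2 * β * h * (d * (2 * K ^ 2 * Cv ^ 3 * s))) := by
      intro a ha
      have h2 := mul_le_left (hstr p (∇ g (q + a))) h0
      have h3 : ∑ l, ∇ g (q + a) (v l) ^ 2 ≤ ∑ l, ∇ g q (v l) ^ 2
          + d * (2 * K ^ 2 * Cv ^ 3 * s) := by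
        have : d * (2 * K ^ 2 * Cv ^ 3 * s) = ∑ _l : ι, (2 * K ^ 2 * Cv ^ 3 * s) := by simp [hd]
        rw [this, ← sum_add_distrib]
        refine sum_le_sum fun l _ => ?_
        have n1 : ∀ y, |∇ g y (v l)| ≤ K * Cv := fun y =>
          (ContinuousLinearMap.le_opNorm _ _).trans (mul_le_mul (hD1 y) (hv l) (norm_nonneg _) hK)
        have n2 : |∇ g (q + a) (v l) - ∇ g q (v l)| ≤ K * (s * Cv) * Cv := by
          have : ∇ g (q + a) (v l) - ∇ g q (v l)
            = (∇ g (q + a) - ∇ g q) (v l) := by simp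
          refine ((∇ g (q + a) - ∇ g q).le_opNorm (v l)).trans ?_
          refine mul_le_mul ((hL q a).trans ?_) (hv l) (norm_nonneg _) (by positivity)
          gcongr
        have n3 : |(∇ g (q + a) (v l) - ∇ g q (v l)) *
            (∇ g (q + a) (v l) + ∇ g q (v l))|
            ≤ (K * (s * Cv) * Cv) * (K * Cv + K * Cv) := by
          rw [abs_mul]
          exact mul_le_mul n2 ((abs_add_le _ _).trans (add_le_add (n1 _) (n1 _))) (abs_nonneg _)
            (by positivity)
        have := le_of_abs_le n3
        nlinarith
      have h4 := mul_le_left h3 (by positivity : 0 ≤ 2 * β * h)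
      unfold dirQ
      nlinarith
    refine symAvg_mono v s fun l => ⟨key _ (hsv l), ?_⟩
    have := key (-(s • v l)) ((norm_neg _).trans_le (hsv l))
    rwa [← sub_eq_add_neg] at this
  have hfin : symAvg v s (fun x => (dirQ w g x + β * (g x - c) ^ 2) - h * η * dirQ w g x) q
      = symAvg v s (dirQ w g) q + β * symAvg v s (fun y => (g y - c) ^ 2) q
        + symAvg v s (fun y => (-(h * η)) * dirQ w g y) q := by
    rw [← symAvg_mul, ← symAvg_add, ← symAvg_add]
    congr 1
    funext x; ring
  rw [hP, hP, hfin]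
  rw [symAvg_add] at hder
  have f1 : h ^ 2 * (Fintype.card κ * (K * (Cb * Cw)) ^ 2)
      ≤ (h * √h) * (Fintype.card κ * (K * (Cb * Cw)) ^ 2) := by gcongr
  have f2 : β * (2 * K ^ 2 * Cv ^ 3 * s ^ 3 + K ^ 2 * Cv ^ 4 * s ^ 4)
      ≤ β * (B * (2 * Cv ^ 3) + (2 * d) ^ 2 * Cv ^ 4) * K ^ 2 * (h * √h) := by
    have : s ^ 4 = (2 * d) ^ 2 * h ^ 2 := by
      grind
    rw [this, hs3]
    have : K ^ 2 * Cv ^ 4 * ((2 * d) ^ 2 * h ^ 2) ≤ K ^ 2 * Cv ^ 4 * ((2 * d) ^ 2 * (h * √h)) := by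
      gcongr
    nlinarith
  have f3 : 2 * β * h * (d * (2 * K ^ 2 * Cv ^ 3 * s))
      = 2 * β * (d * (√(2 * d) * (2 * Cv ^ 3))) * K ^ 2 * (h * √h) := by
    grind
  nlinarith

end Theta

section Structural
open Matrix

lemma sqnorm_nonneg {k : ℕ} (v : Fin k → ℝ) : 0 ≤ sqnorm v :=
  sum_nonneg fun _ _ => sq_nonneg _

lemma sqnorm_eq_dot {k : ℕ} (v : Fin k → ℝ) : sqnorm v = v ⬝ᵥ v := by
  simp [sqnorm, dotProduct, sq]

lemma sqnorm_mulVec_le {a b : ℕ} (M : Matrix (Fin a) (Fin b) ℝ) (v : Fin b → ℝ) :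
    sqnorm (M *ᵥ v) ≤ (∑ i, ∑ j, M i j ^ 2) * sqnorm v := by
  rw [sum_mul]
  refine sum_le_sum fun i _ => ?_
  simp only [mulVec, dotProduct]
  exact Finset.sum_mul_sq_le_sq_mul_sq _ _ _

lemma dot_le {k : ℕ} (u v : Fin k → ℝ) {ε : ℝ} (hε : 0 < ε) :
    u ⬝ᵥ v ≤ ε * sqnorm u + (4 * ε)⁻¹ * sqnorm v := by
  unfold sqnorm dotProduct
  rw [mul_sum, mul_sum, ← sum_add_distrib]
  refine sum_le_sum fun i _ => ?_
  have : 0 ≤ ε * (u i - (2 * ε)⁻¹ * v i) ^ 2 := by positivity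
  have e : ε * (u i - (2 * ε)⁻¹ * v i) ^ 2 = ε * u i ^ 2 + (4 * ε)⁻¹ * v i ^ 2 - u i * v i := by
    grind
  linarith

lemma sqnorm_add_le {k : ℕ} (u v : Fin k → ℝ) :
    sqnorm (u + v) ≤ 2 * sqnorm u + 2 * sqnorm v := by
  unfold sqnorm
  rw [mul_sum, mul_sum, ← sum_add_distrib]
  refine sum_le_sum fun i _ => ?_
  simp only [Pi.add_apply]
  nlinarith [sq_nonneg (u i - v i)]

lemma sqnorm_smul {k : ℕ} (c : ℝ) (u : Fin k → ℝ) : sqnorm (c • u) = c ^ 2 * sqnorm u := by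
  simp [sqnorm, mul_pow, mul_sum]

variable {n m : ℕ}

/-- Components of a covector on the state space. -/
lemma clm_apply_eq (ξ : St n m →L[ℝ] ℝ) (p : St n m) :
    ξ p = (fun i => ξ (Pi.single i 1, 0, 0)) ⬝ᵥ p.1
      + (fun i => ξ (0, Pi.single i 1, 0)) ⬝ᵥ p.2.1
      + (fun j => ξ (0, 0, Pi.single j 1)) ⬝ᵥ p.2.2 := by
  have h : p = (∑ i, p.1 i • ((Pi.single i 1, 0, 0) : St n m))
      + (∑ i, p.2.1 i • ((0, Pi.single i 1, 0) : St n m))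
      + (∑ j, p.2.2 j • ((0, 0, Pi.single j 1) : St n m)) := by
    refine Prod.ext ?_ (Prod.ext ?_ ?_)
    · simp [Prod.fst_sum, Prod.snd_sum]
      ext i; simp [Finset.sum_apply, Pi.single_apply]
    · simp [Prod.fst_sum, Prod.snd_sum]
      ext i; simp [Finset.sum_apply, Pi.single_apply]
    · simp [Prod.fst_sum, Prod.snd_sum]
      ext i; simp [Finset.sum_apply, Pi.single_apply]
  conv_lhs => rw [h]
  simp only [map_add, map_sum, map_smul, dotProduct, smul_eq_mul, mul_comm]

/-- Linear part of the Langevin drift. -/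
def driftLin (A : Matrix (Fin m) (Fin m) ℝ) (lam : Matrix (Fin m) (Fin n) ℝ) (τ : ℝ) :
    St n m →L[ℝ] St n m :=
  LinearMap.toContinuousLinearMap
    { toFun := fun p => (p.2.1, lamᵀ *ᵥ p.2.2, -(lam *ᵥ p.2.1) - τ • (Aᵀ *ᵥ p.2.2))
      map_add' := fun p q => by
        refine Prod.ext rfl (Prod.ext ?_ ?_)
        · simp [mulVec_add]
        · simp [mulVec_add]; abel
      map_smul' := fun c p => by
        refine Prod.ext rfl (Prod.ext ?_ ?_)
        · simp [mulVec_smul]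
        · simp [mulVec_smul, smul_sub, smul_comm c] }

lemma driftLin_apply (A : Matrix (Fin m) (Fin m) ℝ) (lam : Matrix (Fin m) (Fin n) ℝ) (τ : ℝ)
    (p : St n m) : driftLin A lam τ p
      = (p.2.1, lamᵀ *ᵥ p.2.2, -(lam *ᵥ p.2.1) - τ • (Aᵀ *ᵥ p.2.2)) := rfl

/-- Langevin drift with force field `-G` and inverse temperature `τ`. -/
def bDrift (G : (Fin n → ℝ) → Fin n → ℝ) (A : Matrix (Fin m) (Fin m) ℝ)
    (lam : Matrix (Fin m) (Fin n) ℝ) (τ : ℝ) (p : St n m) : St n m :=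
  driftLin A lam τ p - (0, G p.1, 0)

/-- The inclusion of the velocity component. -/
def inclY : (Fin n → ℝ) →L[ℝ] St n m :=
  (ContinuousLinearMap.inr ℝ (Fin n → ℝ) ((Fin n → ℝ) × (Fin m → ℝ))).comp
    (ContinuousLinearMap.inl ℝ (Fin n → ℝ) (Fin m → ℝ))

lemma inclY_apply (v : Fin n → ℝ) : (inclY v : St n m) = (0, v, 0) := rfl

lemma bDrift_contDiff {G : (Fin n → ℝ) → Fin n → ℝ} (hG : C∞ G)
    (A : Matrix (Fin m) (Fin m) ℝ) (lam : Matrix (Fin m) (Fin n) ℝ) (τ : ℝ) :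
    C∞ (bDrift G A lam τ) := by
  have : bDrift G A lam τ = fun p => driftLin A lam τ p - inclY (G p.1) := rfl
  exact (driftLin A lam τ).contDiff.sub (inclY.contDiff.comp (hG.comp contDiff_fst))

lemma bDrift_fderiv {G : (Fin n → ℝ) → Fin n → ℝ} (hG : Differentiable ℝ G)
    (A : Matrix (Fin m) (Fin m) ℝ) (lam : Matrix (Fin m) (Fin n) ℝ) (τ : ℝ) (p : St n m) :
    ∇ (bDrift G A lam τ) p = driftLin A lam τ
      - inclY.comp ((∇ G p.1).comp (fst ℝ _ _)) := by
  refine HasFDerivAt.fderiv ?_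
  have h1 := (hG p.1).hasFDerivAt.comp p (hasFDerivAt_fst (𝕜 := ℝ) (p := p))
  exact (driftLin A lam τ).hasFDerivAt.sub (inclY.hasFDerivAt.comp p h1)

/-- Hypocoercive directions. -/
def wDir (lamInv : Matrix (Fin n) (Fin m) ℝ) (S : ℝ) : Fin n ⊕ Fin n ⊕ Fin m → St n m :=
  Sum.elim (fun i => (Pi.single i 1, -Pi.single i 1, 0))
    (Sum.elim (fun i => (0, Pi.single i 1, -(S • lamInv i))) fun j => (0, 0, Pi.single j 1))

set_option maxHeartbeats 1000000 in
/-- The structural quadratic-form inequality on components. -/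
lemma quad_ineq (A : Matrix (Fin m) (Fin m) ℝ) (lam : Matrix (Fin m) (Fin n) ℝ)
    (lamInv : Matrix (Fin n) (Fin m) ℝ) (hl : lamInv * lam = 1) {D : ℝ} (hD : 0 ≤ D) :
    ∃ S B : ℝ, 0 ≤ S ∧ 0 ≤ B ∧ ∀ (H : Matrix (Fin n) (Fin n) ℝ), (∀ i j, |H i j| ≤ D) →
      ∀ (τ : ℝ) (a b : Fin n → ℝ) (c : Fin m → ℝ),
      2 * ((a - b) ⬝ᵥ (-(H *ᵥ b) - (a - lamᵀ *ᵥ c))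
        + (b - S • (lamInv *ᵥ c)) ⬝ᵥ ((a - lamᵀ *ᵥ c)
            - S • (lamInv *ᵥ (lam *ᵥ b - τ • (A *ᵥ c))))
        + c ⬝ᵥ (lam *ᵥ b - τ • (A *ᵥ c)))
      ≤ B * (1 + τ ^ 2) * sqnorm c
        - (sqnorm (a - b) + sqnorm (b - S • (lamInv *ᵥ c)) + sqnorm c) := by
  set D' : ℝ := n * n * D ^ 2 with hD'
  have hD'0 : 0 ≤ D' := by positivity
  set S : ℝ := D' + 3 with hS
  set Fl := ∑ i, ∑ j, lamᵀ i j ^ 2 with hFl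
  set Fg := ∑ i, ∑ j, lamInv i j ^ 2 with hFg
  set FA := ∑ i, ∑ j, A i j ^ 2 with hFA
  set Fgl := ∑ i, ∑ j, (lam * lamInv) i j ^ 2 with hFgl
  set FgA := ∑ i, ∑ j, (lamInv * A) i j ^ 2 with hFgA
  have n1 : 0 ≤ Fl := sum_nonneg fun _ _ => sum_nonneg fun _ _ => sq_nonneg _
  have n2 : 0 ≤ Fg := sum_nonneg fun _ _ => sum_nonneg fun _ _ => sq_nonneg _
  have n3 : 0 ≤ FA := sum_nonneg fun _ _ => sum_nonneg fun _ _ => sq_nonneg _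
  have n4 : 0 ≤ Fgl := sum_nonneg fun _ _ => sum_nonneg fun _ _ => sq_nonneg _
  have n5 : 0 ≤ FgA := sum_nonneg fun _ _ => sum_nonneg fun _ _ => sq_nonneg _
  refine ⟨S, 2 * (2 * Fl + 4 * S ^ 2 * Fg + 4 * S ^ 2 * D' * Fg + 2 * (S - S ^ 2) ^ 2 * Fg
    + 2 * S ^ 2 * FgA + 1 + 2 * S ^ 2 * Fgl + 2 * FA) + 1, by grind, by positivity, ?_⟩
  intro H hH τ a b c
  set P := a - b with hP
  set Q := b - S • (lamInv *ᵥ c) with hQ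
  have hb : b = Q + S • (lamInv *ᵥ c) := by ring
  have ha : a = P + Q + S • (lamInv *ᵥ c) := by ring
  have hglb : ∀ v : Fin n → ℝ, lamInv *ᵥ (lam *ᵥ v) = v := fun v => by
    rw [mulVec_mulVec, hl, one_mulVec]
  have hHn : ∑ i, ∑ j, H i j ^ 2 ≤ D' := by
    calc ∑ i, ∑ j, H i j ^ 2 ≤ ∑ _i : Fin n, ∑ _j : Fin n, D ^ 2 :=
          sum_le_sum fun i _ => sum_le_sum fun j _ => by
            rw [← sq_abs]; exact pow_le_pow_left₀ (abs_nonneg _) (hH i j) 2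
      _ = D' := by simp [hD']; ring
  have hHv : ∀ v : Fin n → ℝ, sqnorm (H *ᵥ v) ≤ D' * sqnorm v := fun v =>
    (sqnorm_mulVec_le H v).trans (mul_le_right hHn (sqnorm_nonneg v))
  set m1 := lamᵀ *ᵥ c + (-S) • (lamInv *ᵥ c + H *ᵥ (lamInv *ᵥ c)) with hm1
  set m2 := (S - S ^ 2) • (lamInv *ᵥ c) + (S * τ) • ((lamInv * A) *ᵥ c) with hm2
  set m3 := S • ((lam * lamInv) *ᵥ c) + (-τ) • (A *ᵥ c) with hm3
  have key : P ⬝ᵥ (-(H *ᵥ b) - (a - lamᵀ *ᵥ c))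
        + Q ⬝ᵥ ((a - lamᵀ *ᵥ c) - S • (lamInv *ᵥ (lam *ᵥ b - τ • (A *ᵥ c))))
        + c ⬝ᵥ (lam *ᵥ b - τ • (A *ᵥ c))
      = -sqnorm P - P ⬝ᵥ (H *ᵥ Q) + P ⬝ᵥ m1 - (S - 1) * sqnorm Q + Q ⬝ᵥ m2 + c ⬝ᵥ m3 := by
    have e1 : c ⬝ᵥ (lam *ᵥ b) = Q ⬝ᵥ (lamᵀ *ᵥ c) + S * (c ⬝ᵥ ((lam * lamInv) *ᵥ c)) := by
      rw [hb, mulVec_add, mulVec_smul, mulVec_mulVec, dotProduct_add, dotProduct_smul, smul_eq_mul,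
        dotProduct_mulVec, ← mulVec_transpose, dotProduct_comm]
    have e2 : lamInv *ᵥ (lam *ᵥ b - τ • (A *ᵥ c)) = b - τ • ((lamInv * A) *ᵥ c) := by
      rw [mulVec_sub, hglb, mulVec_smul, mulVec_mulVec]
    have e3 : Q ⬝ᵥ P = P ⬝ᵥ Q := dotProduct_comm _ _
    rw [e2, dotProduct_sub c, e1, sqnorm_eq_dot, sqnorm_eq_dot, hm1, hm2, hm3]
    have e4 : H *ᵥ b = H *ᵥ Q + S • (H *ᵥ (lamInv *ᵥ c)) := by
      conv_lhs => rw [hb]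
      rw [mulVec_add, mulVec_smul]
    rw [e4]
    have ha' := ha
    have hb' := hb
    rw [ha', hb']
    simp only [dotProduct_add, dotProduct_sub, dotProduct_smul, dotProduct_neg, smul_eq_mul, e3,
      smul_sub, smul_add]
    ring
  rw [key]
  have k1 : -(P ⬝ᵥ (H *ᵥ Q)) ≤ 1 / 4 * sqnorm P + D' * sqnorm Q := by
    have := dot_le P (-(H *ᵥ Q)) (ε := 1 / 4) (by norm_num)
    have h2 : sqnorm (-(H *ᵥ Q)) = sqnorm (H *ᵥ Q) := by simp [sqnorm]
    rw [dotProduct_neg, h2] at this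
    have := hHv Q
    linarith
  have k2 : P ⬝ᵥ m1 ≤ 1 / 4 * sqnorm P + sqnorm m1 := by
    have := dot_le P m1 (ε := 1 / 4) (by norm_num)
    linarith
  have k3 : Q ⬝ᵥ m2 ≤ 1 / 2 * sqnorm Q + sqnorm m2 := by
    have := dot_le Q m2 (ε := 1 / 2) (by norm_num)
    have := sqnorm_nonneg m2
    linarith
  have k4 : c ⬝ᵥ m3 ≤ sqnorm c + sqnorm m3 := by
    have := dot_le c m3 (ε := 1) (by norm_num)
    have := sqnorm_nonneg m3
    linarith
  have gc : sqnorm (lamInv *ᵥ c) ≤ Fg * sqnorm c := sqnorm_mulVec_le _ _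
  have j1 : sqnorm m1 ≤ (2 * Fl + 4 * S ^ 2 * Fg + 4 * S ^ 2 * D' * Fg) * sqnorm c := by
    have i1 := sqnorm_add_le (lamᵀ *ᵥ c) ((-S) • (lamInv *ᵥ c + H *ᵥ (lamInv *ᵥ c)))
    have i2 := sqnorm_add_le (lamInv *ᵥ c) (H *ᵥ (lamInv *ᵥ c))
    have i3 := hHv (lamInv *ᵥ c)
    have i4 : sqnorm (lamᵀ *ᵥ c) ≤ Fl * sqnorm c := sqnorm_mulVec_le _ _
    rw [sqnorm_smul] at i1
    have i5 := mul_le_left gc hD'0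
    have i6 := mul_le_left i2 (sq_nonneg S)
    have i7 := mul_le_left (i3.trans i5) (sq_nonneg S)
    have i8 := mul_le_left gc (sq_nonneg S)
    linarith
  have j2 : sqnorm m2 ≤ (2 * (S - S ^ 2) ^ 2 * Fg + 2 * S ^ 2 * FgA * τ ^ 2) * sqnorm c := by
    have i1 := sqnorm_add_le ((S - S ^ 2) • (lamInv *ᵥ c)) ((S * τ) • ((lamInv * A) *ᵥ c))
    rw [sqnorm_smul, sqnorm_smul] at i1
    have i2 := mul_le_left gc (sq_nonneg (S - S ^ 2))
    have i3 := mul_le_left (sqnorm_mulVec_le (lamInv * A) c) (sq_nonneg (S * τ))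
    linarith
  have j3 : sqnorm m3 ≤ (2 * S ^ 2 * Fgl + 2 * FA * τ ^ 2) * sqnorm c := by
    have i1 := sqnorm_add_le (S • ((lam * lamInv) *ᵥ c)) ((-τ) • (A *ᵥ c))
    rw [sqnorm_smul, sqnorm_smul] at i1
    have i2 := mul_le_left (sqnorm_mulVec_le (lam * lamInv) c) (sq_nonneg S)
    have i3 := mul_le_left (sqnorm_mulVec_le A c) (sq_nonneg τ)
    linarith
  have hc := sqnorm_nonneg c
  have hQ0 := sqnorm_nonneg Q
  set X := 2 * Fl + 4 * S ^ 2 * Fg + 4 * S ^ 2 * D' * Fg with hX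
  set Y := 2 * (S - S ^ 2) ^ 2 * Fg with hY
  set Z := 2 * S ^ 2 * FgA with hZ
  set V := 2 * S ^ 2 * Fgl with hV
  have r1 : 0 ≤ (X + Y + 1 + V) * τ ^ 2 * sqnorm c := by positivity
  have r2 : 0 ≤ (Z + 2 * FA) * sqnorm c := by positivity
  have r3 : 0 ≤ τ ^ 2 * sqnorm c := by positivity
  linarith

/-- `hstr` for the Langevin drift. -/
theorem structural (A : Matrix (Fin m) (Fin m) ℝ) (lam : Matrix (Fin m) (Fin n) ℝ)
    (lamInv : Matrix (Fin n) (Fin m) ℝ) (hl : lamInv * lam = 1) {D Ac : ℝ} (hD : 0 ≤ D)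
    (hAc : 0 < Ac) {ι : Type} [Fintype ι] (v : ι → St n m)
    (hv : ∀ ξ : St n m →L[ℝ] ℝ, Ac * sqnorm (fun j => ξ (0, 0, Pi.single j 1))
      ≤ ∑ l, ξ (v l) ^ 2) :
    ∃ S B : ℝ, 0 ≤ S ∧ 0 ≤ B ∧ ∀ (G : (Fin n → ℝ) → Fin n → ℝ), Differentiable ℝ G →
      (∀ x, ‖∇ G x‖ ≤ D) → ∀ (τ : ℝ) (p : St n m) (ξ : St n m →L[ℝ] ℝ),
      2 * ∑ k, ξ (wDir lamInv S k) * ξ (∇ (bDrift G A lam τ) p (wDir lamInv S k))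
      - 2 * (B * (1 + τ ^ 2)) * ∑ l, ξ (v l) ^ 2 ≤ -1 * ∑ k, ξ (wDir lamInv S k) ^ 2 := by
  obtain ⟨S, B, hS, hB, h⟩ := quad_ineq A lam lamInv hl hD
  refine ⟨S, B / (2 * Ac), hS, by positivity, ?_⟩
  intro G hG hGD τ p ξ
  set a : Fin n → ℝ := fun i => ξ (Pi.single i 1, 0, 0) with ha
  set b : Fin n → ℝ := fun i => ξ (0, Pi.single i 1, 0) with hb
  set c : Fin m → ℝ := fun j => ξ (0, 0, Pi.single j 1) with hc
  set H : Matrix (Fin n) (Fin n) ℝ := fun i k => ∇ G p.1 (Pi.single i 1) k with hH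
  have hHD : ∀ i j, |H i j| ≤ D := by
    intro i j
    refine (norm_le_pi_norm (∇ G p.1 (Pi.single i 1)) j).trans ?_
    refine ((∇ G p.1).le_opNorm _).trans ?_
    have : ‖(Pi.single i 1 : Fin n → ℝ)‖ = 1 := by
      rw [Pi.norm_single]; simp
    rw [this, mul_one]; exact hGD _
  have hξ := clm_apply_eq ξ
  have e1 : ∀ i, ξ (Pi.single i 1, -Pi.single i 1, 0) = (a - b) i := fun i => by
    rw [hξ]; simp [ha, hb]; ring
  have e2 : ∀ i, ξ (0, Pi.single i 1, -(S • lamInv i)) = (b - S • (lamInv *ᵥ c)) i := fun i => by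
    rw [hξ]; simp [hb, hc, mulVec, dotProduct_comm]; ring
  have hDb : ∀ q, ξ (∇ (bDrift G A lam τ) p q) =
      (-(H *ᵥ b)) ⬝ᵥ q.1 + (a - lamᵀ *ᵥ c) ⬝ᵥ q.2.1 + (lam *ᵥ b - τ • (A *ᵥ c)) ⬝ᵥ q.2.2 := by
    intro q
    rw [bDrift_fderiv hG, _root_.sub_apply, map_sub, hξ, hξ (((inclY.comp _ : St n m →L[ℝ] St n m)) q)]
    simp only [driftLin_apply, ContinuousLinearMap.comp_apply, inclY_apply,
      ContinuousLinearMap.coe_fst']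
    have hGq : b ⬝ᵥ (∇ G p.1 q.1) = (H *ᵥ b) ⬝ᵥ q.1 := by
      have : ∇ G p.1 q.1 = ∑ i, q.1 i • ∇ G p.1 (Pi.single i 1) := by
        conv_lhs => rw [show q.1 = ∑ i, q.1 i • (Pi.single i 1 : Fin n → ℝ) by
          ext i; simp [Finset.sum_apply, Pi.single_apply]]
        simp
      rw [this]
      simp only [dotProduct, mulVec, Finset.sum_apply, Pi.smul_apply, smul_eq_mul, hH,
        mul_sum, sum_mul]
      rw [sum_comm]
      refine sum_congr rfl fun i _ => sum_congr rfl fun k _ => ?_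
      ring
    have h1 : b ⬝ᵥ (lamᵀ *ᵥ q.2.2) = (lam *ᵥ b) ⬝ᵥ q.2.2 := by
      rw [dotProduct_mulVec, vecMul_transpose]
    have h2 : c ⬝ᵥ (lam *ᵥ q.2.1) = (lamᵀ *ᵥ c) ⬝ᵥ q.2.1 := by
      rw [dotProduct_mulVec, mulVec_transpose]
    have h3 : c ⬝ᵥ (Aᵀ *ᵥ q.2.2) = (A *ᵥ c) ⬝ᵥ q.2.2 := by
      rw [dotProduct_mulVec, vecMul_transpose]
    simp only [← ha, ← hb, ← hc, dotProduct_sub, dotProduct_neg, dotProduct_smul, smul_eq_mul,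
      dotProduct_zero, hGq, h1, h2, h3, neg_dotProduct, sub_dotProduct, smul_dotProduct]
    ring
  have hsum1 : ∑ k, ξ (wDir lamInv S k) * ξ (∇ (bDrift G A lam τ) p (wDir lamInv S k))
      = (a - b) ⬝ᵥ (-(H *ᵥ b) - (a - lamᵀ *ᵥ c))
        + (b - S • (lamInv *ᵥ c)) ⬝ᵥ ((a - lamᵀ *ᵥ c)
            - S • (lamInv *ᵥ (lam *ᵥ b - τ • (A *ᵥ c))))
        + c ⬝ᵥ (lam *ᵥ b - τ • (A *ᵥ c)) := by
    simp only [Fintype.sum_sum_type, wDir, Sum.elim_inl, Sum.elim_inr, hDb, e1, e2]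
    rw [← add_assoc]
    simp only [dotProduct_zero, dotProduct_neg, dotProduct_single, mul_one, zero_add,
      add_zero, dotProduct_smul, smul_eq_mul]
    congr 1
    congr 1
    refine sum_congr rfl fun i _ => ?_
    congr 1
    simp only [Pi.sub_apply, Pi.smul_apply, smul_eq_mul, mulVec, dotProduct, mul_comm]
    linarith
  have hsum2 : ∑ k, ξ (wDir lamInv S k) ^ 2
      = sqnorm (a - b) + sqnorm (b - S • (lamInv *ᵥ c)) + sqnorm c := by
    simp only [Fintype.sum_sum_type, wDir, Sum.elim_inl, Sum.elim_inr, e1, e2, sqnorm]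
    linarith
  have h1 := h H hHD τ a b c
  have h2 := mul_le_left (hv ξ) (by positivity : 0 ≤ B / Ac * (1 + τ ^ 2))
  have h3 : B / Ac * (1 + τ ^ 2) * (Ac * sqnorm c) = B * (1 + τ ^ 2) * sqnorm c := by
    field_simp
  have h4 : 2 * (B / (2 * Ac) * (1 + τ ^ 2)) = B / Ac * (1 + τ ^ 2) := by
    ring
  rw [h4]
  linarith

end Structural

section Diffusion
open Matrix
open scoped MatrixOrder

variable {n m : ℕ}

lemma exists_sqrt_symm (A : Matrix (Fin m) (Fin m) ℝ) {Ac : ℝ} (hAc : 0 < Ac)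
    (hApd : ∀ v : Fin m → ℝ, Ac * sqnorm v ≤ ∑ j, v j * A.mulVec v j) :
    ∃ B : Matrix (Fin m) (Fin m) ℝ, Bᵀ * B = (1 / 2 : ℝ) • (A + Aᵀ) := by
  have hM : ((1 / 2 : ℝ) • (A + Aᵀ)).PosSemidef := by
    refine Matrix.PosSemidef.of_dotProduct_mulVec_nonneg ?_ fun x => ?_
    · ext i j; simp; ring
    · have h1 := hApd x
      have h2 := mul_nonneg hAc.le (sqnorm_nonneg x)
      have h3 : x ⬝ᵥ (Aᵀ *ᵥ x) = x ⬝ᵥ (A *ᵥ x) := by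
        rw [dotProduct_mulVec, vecMul_transpose, dotProduct_comm]
      have h4 : ∑ j, x j * A.mulVec x j = x ⬝ᵥ (A *ᵥ x) := rfl
      simp only [star_trivial, smul_mulVec, add_mulVec, dotProduct_smul, dotProduct_add, h3,
        smul_eq_mul]
      linarith
  obtain ⟨B, hB⟩ := CStarAlgebra.nonneg_iff_eq_star_mul_self.1 (Matrix.nonneg_iff_posSemidef.2 hM)
  refine ⟨B, ?_⟩
  rw [hB, star_eq_conjTranspose, conjTranspose_eq_transpose_of_trivial]

/-- Noise directions: rows of `B` in the thermostat component. -/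
def vDir (B : Matrix (Fin m) (Fin m) ℝ) (l : Fin m) : St n m := (0, 0, B l)

lemma clm_vDir (B : Matrix (Fin m) (Fin m) ℝ) (l : Fin m) (ξ : St n m →L[ℝ] ℝ) :
    ξ (vDir B l) = (B *ᵥ (fun j => ξ (0, 0, Pi.single j 1))) l := by
  rw [clm_apply_eq]; simp [vDir, mulVec, dotProduct_comm]

lemma sum_vDir_bilin {A B : Matrix (Fin m) (Fin m) ℝ} (hB : Bᵀ * B = (1 / 2 : ℝ) • (A + Aᵀ))
    (Φ : St n m →L[ℝ] St n m →L[ℝ] ℝ) (hΦ : ∀ a c, Φ a c = Φ c a) :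
    ∑ l, Φ (vDir B l) (vDir B l)
      = ∑ i, ∑ j, A i j * Φ (0, 0, Pi.single i 1) (0, 0, Pi.single j 1) := by
  have h1 : ∀ l, Φ (vDir B l) (vDir B l)
      = ∑ i, ∑ j, B l i * B l j * Φ (0, 0, Pi.single i 1) (0, 0, Pi.single j 1) := by
    intro l
    have e1 : ∀ p : St n m, Φ p (vDir B l) = ∑ j, B l j * Φ p (0, 0, Pi.single j 1) := fun p => by
      rw [clm_vDir]; rfl
    have e2 : ∀ p : St n m, Φ (vDir B l) p = ∑ i, B l i * Φ (0, 0, Pi.single i 1) p := fun p => by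
      rw [hΦ, e1]
      exact sum_congr rfl fun j _ => by rw [hΦ]
    rw [e2]
    refine sum_congr rfl fun i _ => ?_
    rw [e1, mul_sum]
    exact sum_congr rfl fun j _ => by ring
  have h2 : ∀ i j, ∑ l, B l i * B l j = (1 / 2) * (A i j + A j i) := fun i j => by
    have := congrFun (congrFun hB i) j
    simpa [mul_apply] using this
  simp only [h1]
  rw [sum_comm]
  have h3 : ∀ i, ∑ l, ∑ j, B l i * B l j * Φ (0, 0, Pi.single i 1) (0, 0, Pi.single j 1)
      = ∑ j, (1 / 2) * (A i j + A j i) * Φ (0, 0, Pi.single i 1) (0, 0, Pi.single j 1) := by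
    intro i
    rw [sum_comm]
    refine sum_congr rfl fun j _ => ?_
    rw [← sum_mul, h2]
  simp only [h3]
  have h4 : ∑ i, ∑ j, A j i * Φ (0, 0, Pi.single i 1) (0, 0, Pi.single j 1)
      = ∑ i, ∑ j, A i j * Φ (0, 0, Pi.single i 1) (0, 0, Pi.single j 1) := by
    rw [sum_comm]
    exact sum_congr rfl fun i _ => sum_congr rfl fun j _ => by rw [hΦ]
  have h5 : ∀ i j, (1 / 2) * (A i j + A j i) * Φ (0, 0, Pi.single i 1) (0, 0, Pi.single j 1)
      = (1 / 2) * (A i j * Φ (0, 0, Pi.single i 1) (0, 0, Pi.single j 1))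
      + (1 / 2) * (A j i * Φ (0, 0, Pi.single i 1) (0, 0, Pi.single j 1)) := fun i j => by ring
  simp only [h5, sum_add_distrib, ← mul_sum, h4]
  ring

lemma sum_vDir_sq {A B : Matrix (Fin m) (Fin m) ℝ} (hB : Bᵀ * B = (1 / 2 : ℝ) • (A + Aᵀ))
    {Ac : ℝ} (hApd : ∀ v : Fin m → ℝ, Ac * sqnorm v ≤ ∑ j, v j * A.mulVec v j)
    (ξ : St n m →L[ℝ] ℝ) :
    Ac * sqnorm (fun j => ξ (0, 0, Pi.single j 1)) ≤ ∑ l, ξ (vDir B l) ^ 2 := by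
  have h := sum_vDir_bilin hB (ξ.smulRight ξ) (fun a c => by simp [mul_comm])
  simp only [ContinuousLinearMap.smulRight_apply, _root_.smul_apply, smul_eq_mul] at h
  simp only [sq]
  rw [h]
  refine (hApd _).trans (le_of_eq ?_)
  refine sum_congr rfl fun i _ => ?_
  rw [mulVec, dotProduct, mul_sum]
  exact sum_congr rfl fun j _ => by ring

lemma snd_symm {E : Type} [NormedAddCommGroup E] [NormedSpace ℝ E] {f : E → ℝ}
    (hf : C∞ f) (p a c : E) :
    ∇ (∇ f) p a c = ∇ (∇ f) p c a := by
  have : IsSymmSndFDerivAt ℝ f p := by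
    refine hf.contDiffAt.isSymmSndFDerivAt ?_
    rw [minSmoothness_of_isRCLikeNormedField]
    exact WithTop.coe_le_coe.2 (le_top : (2:ℕ∞) ≤ ⊤)
  exact this a c

lemma fderiv_dir {E : Type} [NormedAddCommGroup E] [NormedSpace ℝ E] {f : E → ℝ}
    (hf : C∞ f) (e p a : E) :
    ∇ (fun q => ∇ f q e) p a = ∇ (∇ f) p a e := by
  have h := ((contDiff_fderiv_top hf).diff_top p).hasFDerivAt.clm_apply (hasFDerivAt_const e p)
  rw [h.fderiv]; simp

variable (U : (Fin n → ℝ) → ℝ)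

lemma genLadj_eq {A B : Matrix (Fin m) (Fin m) ℝ} (hB : Bᵀ * B = (1 / 2 : ℝ) • (A + Aᵀ))
    (lam : Matrix (Fin m) (Fin n) ℝ) (τ : ℝ) {f : St n m → ℝ} (hf : C∞ f)
    (p : St n m) :
    genLadj U A lam τ f p = -(∇ f p (bDrift (gradp U) A lam τ⁻¹ p)) + τ⁻¹ * A.trace * f p
      + ∑ l, ∇ (∇ f) p (vDir B l) (vDir B l) := by
  rw [sum_vDir_bilin hB _ (snd_symm hf p), clm_apply_eq]
  unfold genLadj pX pY pZ
  simp only [fderiv_dir hf, bDrift, driftLin_apply, Prod.mk_sub_mk,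
    dotProduct, Pi.sub_apply, Pi.neg_apply, Pi.smul_apply, smul_eq_mul, mul_sub,
    sum_sub_distrib, mul_neg, Finset.sum_neg_distrib,
    sub_zero, sub_mul, add_mul, sum_add_distrib]
  simp only [mul_comm]
  ring

end Diffusion

section IBP
variable {n m : ℕ}

instance volume_isAddHaar_St : (volume : Measure (St n m)).IsAddHaarMeasure := by
  have h1 : (volume : Measure ((Fin n → ℝ) × (Fin m → ℝ))).IsAddHaarMeasure :=
    Measure.prod.instIsAddHaarMeasure (volume : Measure (Fin n → ℝ)) (volume : Measure (Fin m → ℝ))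
  exact Measure.prod.instIsAddHaarMeasure (volume : Measure (Fin n → ℝ))
    (volume : Measure ((Fin n → ℝ) × (Fin m → ℝ)))

lemma integral_fderiv_mul_compact {φ f : St n m → ℝ} (hφ : C∞ φ)
    (hc : HasCompactSupport φ) (hf : C∞ f) (w : St n m) :
    ∫ p, ∇ φ p w * f p = -∫ p, φ p * ∇ f p w := by
  have c1 : Continuous fun p => ∇ φ p w :=
    (contDiff_fderiv_top hφ).continuous.clm_apply continuous_const
  have c2 : Continuous fun p => ∇ f p w :=
    (contDiff_fderiv_top hf).continuous.clm_apply continuous_const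
  have hc1 : HasCompactSupport fun p => ∇ φ p w :=
    (hc.fderiv ℝ).comp_left (g := fun L : St n m →L[ℝ] ℝ => L w) (by simp)
  have := integral_mul_fderiv_eq_neg_fderiv_mul_of_integrable (μ := (volume : Measure (St n m)))
    (f := φ) (g := f) (v := w)
    ((c1.mul hf.continuous).integrable_of_hasCompactSupport hc1.mul_right)
    ((hφ.continuous.mul c2).integrable_of_hasCompactSupport hc.mul_right)
    ((hφ.continuous.mul hf.continuous).integrable_of_hasCompactSupport hc.mul_right)
    (fun x _ => hφ.diff_top x) (fun x _ => hf.diff_top x)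
  linarith

/-- Coordinate basis of the state space. -/
def cBas : Fin n ⊕ Fin n ⊕ Fin m → St n m :=
  Sum.elim (fun i => (Pi.single i 1, 0, 0))
    (Sum.elim (fun i => (0, Pi.single i 1, 0)) fun j => (0, 0, Pi.single j 1))

/-- Coordinates on the state space. -/
def cCoord : Fin n ⊕ Fin n ⊕ Fin m → St n m →L[ℝ] ℝ :=
  Sum.elim (fun i => (proj i).comp (fst ℝ _ _))
    (Sum.elim
      (fun i => (proj i).comp
        ((fst ℝ _ _).comp (snd ℝ _ _)))
      fun j => (proj j).comp
        ((snd ℝ _ _).comp (snd ℝ _ _)))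

lemma clm_eq_sum_coord (ξ : St n m →L[ℝ] ℝ) (p : St n m) :
    ξ p = ∑ k, ξ (cBas k) * cCoord k p := by
  rw [clm_apply_eq]
  simp only [Fintype.sum_sum_type, cBas, cCoord, Sum.elim_inl, Sum.elim_inr, dotProduct,
    ContinuousLinearMap.comp_apply, ContinuousLinearMap.proj_apply, ContinuousLinearMap.coe_fst',
    ContinuousLinearMap.coe_snd']
  linarith

lemma div_bDrift {G : (Fin n → ℝ) → Fin n → ℝ} (hG : Differentiable ℝ G)
    (A : Matrix (Fin m) (Fin m) ℝ) (lam : Matrix (Fin m) (Fin n) ℝ) (τ : ℝ) (p : St n m) :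
    ∑ k, cCoord k (∇ (bDrift G A lam τ) p (cBas k)) = -(τ * A.trace) := by
  simp [bDrift_fderiv hG, Fintype.sum_sum_type, cBas, cCoord, driftLin_apply, inclY_apply,
    Matrix.trace, mul_sum]

lemma ibp_genB {G : (Fin n → ℝ) → Fin n → ℝ} (hG : C∞ G)
    (A B : Matrix (Fin m) (Fin m) ℝ) (lam : Matrix (Fin m) (Fin n) ℝ) (τ : ℝ)
    {φ f : St n m → ℝ} (hφ : C∞ φ)
    (hc : HasCompactSupport φ) (hf : C∞ f) :
    ∫ p, genB (vDir B) (bDrift G A lam τ) φ p * f p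
      = ∫ p, φ p * (-(∇ f p (bDrift G A lam τ p)) + τ * A.trace * f p
        + ∑ l, ∇ (∇ f) p (vDir B l) (vDir B l)) := by
  set b := bDrift G A lam τ with hb
  have hbs : C∞ b := bDrift_contDiff hG A lam τ
  have dφ : ∀ w, C∞ fun p => ∇ φ p w := by fun_prop
  have df : ∀ w, C∞ fun p => ∇ f p w := by fun_prop
  have cφ : ∀ w, HasCompactSupport fun p => ∇ φ p w := fun w =>
    (hc.fderiv ℝ).comp_left (g := fun L : St n m →L[ℝ] ℝ => L w) (by simp)
  have bs : ∀ k, C∞ fun p => cCoord k (b p) := by fun_prop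
  have I1 : ∀ (g : St n m → ℝ) w, Continuous g → Integrable fun p => ∇ φ p w * g p :=
    fun g w hg => ((dφ w).continuous.mul hg).integrable_of_hasCompactSupport (cφ w).mul_right
  have I0 : ∀ (g : St n m → ℝ), Continuous g → Integrable fun p => φ p * g p :=
    fun g hg => (hφ.continuous.mul hg).integrable_of_hasCompactSupport hc.mul_right
  have ddφ : ∀ w p, ∇ (∇ φ) p w w = ∇ (fun q => ∇ φ q w) p w :=
    fun w p => (fderiv_dir hφ w p w).symm
  have ddf : ∀ w p, ∇ (∇ f) p w w = ∇ (fun q => ∇ f q w) p w :=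
    fun w p => (fderiv_dir hf w p w).symm
  have I2 : ∀ w, Integrable fun p => ∇ (∇ φ) p w w * f p := fun w => by
    simp only [ddφ]
    exact (((contDiff_fderiv_top (dφ w)).continuous.clm_apply continuous_const).mul
      hf.continuous).integrable_of_hasCompactSupport
      (((cφ w).fderiv ℝ).comp_left (g := fun L : St n m →L[ℝ] ℝ => L w) (by simp)).mul_right
  have cddf : ∀ w, Continuous fun p => ∇ (∇ f) p w w := fun w => by
    simp only [ddf]
    exact (contDiff_fderiv_top (df w)).continuous.clm_apply continuous_const
  -- first order part
  have first : ∀ k, ∫ p, ∇ φ p (cBas k) * (cCoord k (b p) * f p)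
      = -∫ p, (φ p * (f p * cCoord k (∇ b p (cBas k)))
        + φ p * (cCoord k (b p) * ∇ f p (cBas k))) := by
    intro k
    rw [integral_fderiv_mul_compact hφ hc ((bs k).mul hf)]
    congr 1
    refine integral_congr_ae (.of_forall fun p => ?_)
    have h1 : HasFDerivAt (fun p => cCoord k (b p)) ((cCoord k).comp (∇ b p)) p :=
      (cCoord k).hasFDerivAt.comp p (hbs.diff_top p).hasFDerivAt
    have h2 := h1.mul (hf.diff_top p).hasFDerivAt
    have h3 : ∇ (fun p => cCoord k (b p) * f p) p = _ := h2.fderiv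
    simp only [h3, add_apply, smul_apply, smul_eq_mul, ContinuousLinearMap.comp_apply]
    ring
  have second : ∀ w, ∫ p, ∇ (∇ φ) p w w * f p
      = ∫ p, φ p * ∇ (∇ f) p w w := by
    intro w
    simp only [ddφ, ddf]
    rw [integral_fderiv_mul_compact (dφ w) (cφ w) hf, integral_fderiv_mul_compact hφ hc (df w),
      neg_neg]
  have cdb : ∀ k, Continuous fun p => cCoord k (∇ b p (cBas k)) := fun k =>
    (cCoord k).continuous.comp ((contDiff_fderiv_top hbs).continuous.clm_apply continuous_const)
  have lhs : ∀ p, genB (vDir B) b φ p * f p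
      = ∑ k, ∇ φ p (cBas k) * (cCoord k (b p) * f p)
        + ∑ l, ∇ (∇ φ) p (vDir B l) (vDir B l) * f p := fun p => by
    unfold genB
    rw [add_mul, clm_eq_sum_coord (∇ φ p), sum_mul, sum_mul]
    simp only [mul_assoc]
  have rhs : ∀ p, φ p * (-(∇ f p (b p)) + τ * A.trace * f p
        + ∑ l, ∇ (∇ f) p (vDir B l) (vDir B l))
      = ∑ k, -(φ p * (f p * cCoord k (∇ b p (cBas k)))
        + φ p * (cCoord k (b p) * ∇ f p (cBas k)))
        + ∑ l, φ p * ∇ (∇ f) p (vDir B l) (vDir B l) := fun p => by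
    have h := div_bDrift (hG.diff_top) A lam τ p
    rw [clm_eq_sum_coord (∇ f p), Finset.sum_neg_distrib, sum_add_distrib,
      ← mul_sum, ← mul_sum, ← mul_sum, h, ← mul_sum]
    simp only [mul_comm (cCoord _ (b p))]
    ring
  simp only [lhs, rhs]
  have J : ∀ k, Integrable fun p => (φ p * (f p * cCoord k (∇ b p (cBas k)))
        + φ p * (cCoord k (b p) * ∇ f p (cBas k))) := fun k =>
    (I0 _ (hf.continuous.mul (cdb k))).add (I0 _ ((bs k).continuous.mul (df _).continuous))
  have J1 : ∀ k, Integrable fun p => ∇ φ p (cBas k) * (cCoord k (b p) * f p) :=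
    fun k => I1 _ _ ((bs k).continuous.mul hf.continuous)
  have J2 : ∀ l, Integrable fun p => ∇ (∇ φ) p (vDir B l) (vDir B l) * f p :=
    fun l => I2 _
  have J3 : ∀ l, Integrable fun p => φ p * ∇ (∇ f) p (vDir B l) (vDir B l) :=
    fun l => I0 _ (cddf _)
  have J' : ∀ k, Integrable fun p => -(φ p * (f p * cCoord k (∇ b p (cBas k)))
        + φ p * (cCoord k (b p) * ∇ f p (cBas k))) := fun k => (J k).neg
  rw [integral_add (integrable_finsetSum _ fun k _ => J1 k) (integrable_finsetSum _ fun l _ => J2 l),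
    integral_add (integrable_finsetSum _ fun k _ => J' k)
      (integrable_finsetSum _ fun l _ => J3 l),
    integral_finsetSum _ fun k _ => J1 k, integral_finsetSum _ fun l _ => J2 l,
    integral_finsetSum _ fun k _ => J' k, integral_finsetSum _ fun l _ => J3 l]
  simp only [first, second, integral_neg]

end IBP

section Interp

/-- Last point of `C` before `t`. -/
def lastPt (C : Set ℝ) (t : ℝ) : ℝ := sSup (C ∩ Iic t)

/-- First point of `C` strictly after `t` (or `t` itself at accumulation points). -/
def nextPt (C : Set ℝ) (t : ℝ) : ℝ := sInf (C ∩ Ioi t)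

/-- Slope of `f` across the gap of `C` at `t`, and `f'` outside of the gaps. -/
def gapSlope (C : Set ℝ) (f f' : ℝ → ℝ) (t : ℝ) : ℝ :=
  if t < nextPt C t then
    (f (nextPt C t) - f (lastPt C t)) / (nextPt C t - lastPt C t) else f' t

/-- Piecewise affine interpolation of `f` in the gaps of `C`. -/
def gapInterp (C : Set ℝ) (f : ℝ → ℝ) (t : ℝ) : ℝ :=
  f (lastPt C t) + (t - lastPt C t) *
    ((f (nextPt C t) - f (lastPt C t)) / (nextPt C t - lastPt C t))

variable {C : Set ℝ} {c d : ℝ}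

section basic
variable (hC : IsClosed C) (hc : Iic c ⊆ C) (hd : Ici d ⊆ C)
include hc in
lemma lastPt_nonempty (t : ℝ) : (C ∩ Iic t).Nonempty :=
  ⟨min c t, hc (min_le_left c t), min_le_right c t⟩

include hd in
lemma nextPt_nonempty (t : ℝ) : (C ∩ Ioi t).Nonempty :=
  ⟨max d (t + 1), hd (le_max_left d _), lt_of_lt_of_le (by linarith) (le_max_right d (t + 1))⟩

lemma bddAbove_inter_Iic (t : ℝ) : BddAbove (C ∩ Iic t) := ⟨t, fun _ h => h.2⟩
lemma bddBelow_inter_Ioi (t : ℝ) : BddBelow (C ∩ Ioi t) := ⟨t, fun _ h => le_of_lt h.2⟩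

include hc in
lemma lastPt_le (t : ℝ) : lastPt C t ≤ t := csSup_le (lastPt_nonempty hc t) fun _ h => h.2

include hC hc in
lemma lastPt_mem (t : ℝ) : lastPt C t ∈ C :=
  ((hC.inter isClosed_Iic).csSup_mem (lastPt_nonempty hc t) (bddAbove_inter_Iic t)).1

lemma le_lastPt {s t : ℝ} (hs : s ∈ C) (h : s ≤ t) : s ≤ lastPt C t :=
  le_csSup (bddAbove_inter_Iic t) ⟨hs, h⟩

include hd in
lemma le_nextPt (t : ℝ) : t ≤ nextPt C t :=
  le_csInf (nextPt_nonempty hd t) fun _ h => le_of_lt h.2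

include hC hd in
lemma nextPt_mem (t : ℝ) : nextPt C t ∈ C := by
  have h := csInf_mem_closure (nextPt_nonempty hd t) (bddBelow_inter_Ioi t)
  exact hC.closure_subset (closure_mono Set.inter_subset_left h)

lemma nextPt_le {s t : ℝ} (hs : s ∈ C) (h : t < s) : nextPt C t ≤ s :=
  csInf_le (bddBelow_inter_Ioi t) ⟨hs, h⟩

include hc in
lemma lastPt_mono : Monotone (lastPt C) := fun s t h =>
  csSup_le_csSup (bddAbove_inter_Iic t) (lastPt_nonempty hc s)
    (Set.inter_subset_inter_right _ (Set.Iic_subset_Iic.2 h))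

include hd in
lemma nextPt_mono : Monotone (nextPt C) := fun s t h =>
  csInf_le_csInf (bddBelow_inter_Ioi s) (nextPt_nonempty hd t)
    (Set.inter_subset_inter_right _ (Set.Ioi_subset_Ioi h))

include hc in
lemma lastPt_eq {t : ℝ} (ht : t ∈ C) : lastPt C t = t :=
  le_antisymm (lastPt_le hc t) (le_lastPt ht le_rfl)

/-- Between `t` and the next point the gap does not change. -/
lemma gap_const (hC : IsClosed C) (hc : Iic c ⊆ C) (hd : Ici d ⊆ C)
    {s t : ℝ} (h1 : lastPt C t ≤ s) (h2 : s < nextPt C t) :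
    lastPt C s = lastPt C t ∧ nextPt C s = nextPt C t := by
  have key : ∀ x ∈ C, x < nextPt C t → x ≤ lastPt C t := fun x hx hx2 => by
    by_contra h
    rcases le_or_gt x t with h3 | h3
    · exact h (le_lastPt hx h3)
    · exact absurd (nextPt_le hx h3) (not_le.2 hx2)
  refine ⟨le_antisymm (key _ (lastPt_mem hC hc s) ((lastPt_le hc s).trans_lt h2))
    (le_lastPt (lastPt_mem hC hc t) h1),
    le_antisymm (nextPt_le (nextPt_mem hC hd t) h2) ?_⟩
  by_contra h
  have h3 := key _ (nextPt_mem hC hd s) (not_le.1 h)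
  have h4 := le_nextPt hd s
  have h5 : s = lastPt C t := by linarith
  have h7 : nextPt C s = s := by linarith
  have h8 : sInf (C ∩ Ioi s) = s := h7
  have h9 : sInf (C ∩ Ioi s) < nextPt C t := by linarith
  obtain ⟨x, hx, hx2⟩ := exists_lt_of_csInf_lt (nextPt_nonempty hd s) h9
  grind

/-- The interpolation is a convex combination of the values at the gap's endpoints. -/
lemma gapInterp_convex (hC : IsClosed C) (hc : Iic c ⊆ C) (hd : Ici d ⊆ C)
    (f : ℝ → ℝ) (t : ℝ) : ∃ θ : ℝ, 0 ≤ θ ∧ θ ≤ 1 ∧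
      gapInterp C f t = (1 - θ) * f (lastPt C t) + θ * f (nextPt C t) ∧
      t = (1 - θ) * lastPt C t + θ * nextPt C t := by
  have h1 := lastPt_le hc t
  have h2 := le_nextPt hd t
  unfold gapInterp
  rcases eq_or_lt_of_le (h1.trans h2) with h | h
  · refine ⟨0, le_rfl, zero_le_one, ?_, ?_⟩
    · grind
    linarith
  · have hp : 0 < nextPt C t - lastPt C t := by linarith
    refine ⟨(t - lastPt C t) / (nextPt C t - lastPt C t), div_nonneg (by linarith) hp.le,
      (div_le_one hp).2 (by linarith), ?_, ?_⟩ <;> field_simp <;> ring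
end basic

lemma gapInterp_of_mem (hc : Iic c ⊆ C) (f : ℝ → ℝ) {t : ℝ} (ht : t ∈ C) :
    gapInterp C f t = f t := by
  unfold gapInterp; rw [lastPt_eq hc ht]; simp

lemma gapInterp_eventuallyEq (hC : IsClosed C) (hc : Iic c ⊆ C) (hd : Ici d ⊆ C)
    (f : ℝ → ℝ) {s t : ℝ} (h1 : lastPt C t ≤ s) (h2 : s < nextPt C t) :
    gapInterp C f s = f (lastPt C t) + (s - lastPt C t) *
    ((f (nextPt C t) - f (lastPt C t)) / (nextPt C t - lastPt C t)) := by
  unfold gapInterp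
  rw [(gap_const hC hc hd h1 h2).1, (gap_const hC hc hd h1 h2).2]

lemma gapInterp_hasDerivWithinAt (hC : IsClosed C) (hc : Iic c ⊆ C) (hd : Ici d ⊆ C)
    {f f' : ℝ → ℝ} {t : ℝ} (hf : t ∈ C → HasDerivWithinAt f (f' t) (Ioi t) t) :
    HasDerivWithinAt (gapInterp C f) (gapSlope C f f' t) (Ioi t) t := by
  have h2 := le_nextPt hd t
  rcases eq_or_lt_of_le h2 with h | h
  · have htC : t ∈ C := h ▸ nextPt_mem hC hd t
    have hf := hf htC
    unfold gapSlope
    rw [if_neg (by linarith)]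
    rw [hasDerivWithinAt_iff_isLittleO, Asymptotics.isLittleO_iff] at hf ⊢
    intro ε hε
    have hf := hf hε
    rw [eventually_nhdsWithin_iff, Metric.eventually_nhds_iff] at hf ⊢
    obtain ⟨δ, hδ, hf⟩ := hf
    have h9 : sInf (C ∩ Ioi t) < t + δ := by
      change nextPt C t < t + δ
      linarith
    obtain ⟨x, hx, hx2⟩ := exists_lt_of_csInf_lt (nextPt_nonempty hd t) h9
    have hx3 : t < x := hx.2
    refine ⟨x - t, by linarith, fun s hs hst => ?_⟩
    have hst : t < s := hst
    rw [dist_eq, abs_of_pos (by linarith)] at hs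
    obtain ⟨θ, hθ0, hθ1, e1, e2⟩ := gapInterp_convex hC hc hd f s
    have hl : t ≤ lastPt C s := le_lastPt htC hst.le
    have hr : nextPt C s ≤ x := nextPt_le hx.1 (by linarith)
    have hls := lastPt_le hc s
    have hsr := le_nextPt hd s
    have B : ∀ y, t ≤ y → y ≤ x → |f y - f t - (y - t) * f' t| ≤ ε * (y - t) := by
      intro y h1 h2
      rcases eq_or_lt_of_le h1 with rfl | h1
      · simp
      · have := hf (y := y) (by rw [dist_eq, abs_of_pos (by linarith)]; linarith) h1
        simpa [norm_eq_abs, abs_of_pos (sub_pos.2 h1)] using this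
    have B1 := B _ hl (by linarith)
    have B2 := B _ (by linarith) hr
    rw [gapInterp_of_mem hc f htC, norm_eq_abs, norm_eq_abs,
      abs_of_pos (sub_pos.2 hst), smul_eq_mul]
    have e3 : gapInterp C f s - f t - (s - t) * f' t
        = (1 - θ) * (f (lastPt C s) - f t - (lastPt C s - t) * f' t)
          + θ * (f (nextPt C s) - f t - (nextPt C s - t) * f' t) := by
      grind
    rw [e3]
    refine (abs_add_le _ _).trans ?_
    rw [abs_mul, abs_mul, abs_of_nonneg hθ0, abs_of_nonneg (sub_nonneg.2 hθ1)]
    have := mul_le_left B1 (sub_nonneg.2 hθ1)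
    have := mul_le_left B2 hθ0
    have e4 : ε * (s - t) = (1 - θ) * (ε * (lastPt C s - t)) + θ * (ε * (nextPt C s - t)) := by
      grind
    linarith
  · unfold gapSlope
    rw [if_pos h]
    have e : HasDerivAt (fun s => f (lastPt C t) + (s - lastPt C t) *
        ((f (nextPt C t) - f (lastPt C t)) / (nextPt C t - lastPt C t)))
        ((f (nextPt C t) - f (lastPt C t)) / (nextPt C t - lastPt C t)) t := by
      have := (((hasDerivAt_id t).sub_const (lastPt C t)).mul_const
        ((f (nextPt C t) - f (lastPt C t)) / (nextPt C t - lastPt C t))).const_add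
          (f (lastPt C t))
      grind
    refine e.hasDerivWithinAt.congr_of_eventuallyEq ?_ ?_
    · have : Ioo t (nextPt C t) ∈ nhdsWithin t (Ioi t) := Ioo_mem_nhdsGT h
      filter_upwards [this] with s hs
      exact gapInterp_eventuallyEq hC hc hd f ((lastPt_le hc t).trans hs.1.le) hs.2
    · rfl

lemma gapInterp_continuous (hC : IsClosed C) (hc : Iic c ⊆ C) (hd : Ici d ⊆ C)
    {f f' : ℝ → ℝ} (hfc : Continuous f) {t : ℝ}
    (hf : t ∈ C → HasDerivWithinAt f (f' t) (Ioi t) t) :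
    ContinuousAt (gapInterp C f) t := by
  refine continuousAt_iff_continuous_left'_right'.2
    ⟨?_, (gapInterp_hasDerivWithinAt hC hc hd hf).continuousWithinAt⟩
  have aff : ∀ x : ℝ, Continuous fun s => f (lastPt C x) + (s - lastPt C x) *
    ((f (nextPt C x) - f (lastPt C x)) / (nextPt C x - lastPt C x)) := by fun_prop
  by_cases ht : t ∈ C
  · rcases eq_or_lt_of_le (csSup_le (s := C ∩ Iio t)
      ⟨min c (t - 1), hc (mem_Iic.2 (min_le_left c (t - 1))), by
        simp⟩
      (fun x hx => le_of_lt hx.2)) with h | h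
    · rw [Metric.continuousWithinAt_iff]
      intro ε hε
      obtain ⟨δ, hδ, hfδ⟩ := Metric.continuousAt_iff.1 (hfc.continuousAt (x := t)) ε hε
      obtain ⟨x, hx, hx2⟩ := exists_lt_of_lt_csSup (s := C ∩ Iio t) (b := t - δ)
        ⟨min c (t - 1), hc (mem_Iic.2 (min_le_left c (t - 1))), by
          simp⟩ (by linarith)
      have hx3 : x < t := hx.2
      refine ⟨t - x, by linarith, fun {s} hs hst => ?_⟩
      have hs : s < t := hs
      rw [dist_eq, abs_of_neg (by linarith)] at hst
      obtain ⟨θ, hθ0, hθ1, e1, e2⟩ := gapInterp_convex hC hc hd f s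
      have hl : x ≤ lastPt C s := le_lastPt hx.1 (by linarith)
      have hr : nextPt C s ≤ t := nextPt_le ht hs
      have hls := lastPt_le hc s
      have hsr := le_nextPt hd s
      have B1 : |f (lastPt C s) - f t| < ε := by
        refine hfδ ?_
        rw [dist_eq, abs_lt]; grind
      have B2 : |f (nextPt C s) - f t| < ε := by
        refine hfδ ?_
        rw [dist_eq, abs_lt]; grind
      rw [gapInterp_of_mem hc f ht, dist_eq, e1]
      rw [abs_lt] at B1 B2 ⊢
      constructor
      · have p2 := mul_nonneg (sub_nonneg.2 hθ1) (sub_pos.2 B1.1).le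
        rcases eq_or_lt_of_le hθ0 with h0 | h0
        · grind
        · have := mul_pos h0 (sub_pos.2 B2.1)
          linarith
      · have p2 := mul_nonneg (sub_nonneg.2 hθ1) (sub_pos.2 B1.2).le
        rcases eq_or_lt_of_le hθ0 with h0 | h0
        · grind
        · have := mul_pos h0 (sub_pos.2 B2.2)
          linarith
    · obtain ⟨x, hx1, hx2⟩ := exists_between h
      have nx : ∀ y ∈ C, y < t → y < x := fun y hy hyt =>
        (le_csSup (s := C ∩ Iio t) ⟨t, fun z hz => le_of_lt hz.2⟩ ⟨hy, hyt⟩).trans_lt hx1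
      have hn : nextPt C x = t := by
        refine le_antisymm (nextPt_le ht hx2) ?_
        by_contra hcon
        have := nx _ (nextPt_mem hC hd x) (not_le.1 hcon)
        have := le_nextPt hd x
        linarith
      have e := ((aff x).tendsto t).mono_left (nhdsWithin_le_nhds (s := Iio t))
      have hv : f (lastPt C x) + (t - lastPt C x) *
          ((f (nextPt C x) - f (lastPt C x)) / (nextPt C x - lastPt C x)) = f t := by
        grind
      rw [hv] at e
      unfold ContinuousWithinAt
      rw [gapInterp_of_mem hc f ht]
      refine e.congr' ?_
      filter_upwards [Ioo_mem_nhdsLT hx2] with s hs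
      exact (gapInterp_eventuallyEq hC hc hd f ((lastPt_le hc x).trans hs.1.le)
        (by grind)).symm
  · have h1 : lastPt C t < t := lt_of_le_of_ne (lastPt_le hc t)
      fun h => ht (h ▸ lastPt_mem hC hc t)
    have h2 : t < nextPt C t := lt_of_le_of_ne (le_nextPt hd t)
      fun h => ht (h ▸ nextPt_mem hC hd t)
    refine ((aff t).continuousWithinAt).congr_of_eventuallyEq ?_ rfl
    filter_upwards [mem_nhdsWithin_of_mem_nhds (Ioo_mem_nhds h1 h2)] with s hs
    exact gapInterp_eventuallyEq hC hc hd f hs.1.le hs.2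

lemma integral_gapSlope (hC : IsClosed C) (hc : Iic c ⊆ C) (hd : Ici d ⊆ C)
    (hcd : c ≤ d) {f f' : ℝ → ℝ} (hfc : Continuous f)
    (hf : ∀ t, c ≤ t → t ∈ C → HasDerivWithinAt f (f' t) (Ioi t) t)
    (hi : IntervalIntegrable (gapSlope C f f') volume c d) :
    ∫ t in c..d, gapSlope C f f' t = f d - f c := by
  have h := intervalIntegral.integral_eq_sub_of_hasDeriv_right (f := gapInterp C f)
    (f' := gapSlope C f f') (a := c) (b := d)
    (fun t ht => by
      rw [Set.uIcc_of_le hcd] at ht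
      exact (gapInterp_continuous hC hc hd hfc (hf t ht.1)).continuousWithinAt)
    (fun t ht => by
      rw [min_eq_left hcd] at ht
      exact gapInterp_hasDerivWithinAt hC hc hd (hf t ht.1.le)) hi
  rw [h, gapInterp_of_mem hc f (hd (mem_Ici.2 le_rfl)),
    gapInterp_of_mem hc f (hc (mem_Iic.2 le_rfl))]

end Interp

section LimitBD
variable {E : Type} [NormedAddCommGroup E] [NormedSpace ℝ E]

lemma tendsto_fderiv_apply {F : Type} [NormedAddCommGroup F] [NormedSpace ℝ F]
    {f : ℕ → E → F} {g : E → F} {K : ℝ} (hf : ∀ k, BD 2 K (f k)) (hg : Differentiable ℝ g)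
    (hlim : ∀ p, Tendsto (fun k => f k p) atTop (nhds (g p))) (p w : E) :
    Tendsto (fun k => ∇ (f k) p w) atTop (nhds (∇ g p w)) := by
  rw [Metric.tendsto_atTop]
  intro ε hε
  have h1 : Tendsto (fun h : ℝ => h⁻¹ • (g (p + h • w) - g p)) (nhdsWithin 0 {0}ᶜ)
      (nhds (∇ g p w)) := ((hg p).hasFDerivAt.hasLineDerivAt w).tendsto_slope_zero
  have h2 : Tendsto (fun h : ℝ => K * |h| * ‖w‖ ^ 2) (nhdsWithin 0 {0}ᶜ) (nhds 0) := by
    have : Continuous fun h : ℝ => K * |h| * ‖w‖ ^ 2 := by fun_prop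
    have := (this.tendsto 0).mono_left (nhdsWithin_le_nhds (s := {0}ᶜ))
    grind
  obtain ⟨h, ⟨hh1, hh2⟩, hh0⟩ := (((Metric.tendsto_nhds.1 h1 (ε / 3) (by linarith)).and
    (h2.eventually (gt_mem_nhds (show (0 : ℝ) < ε / 3 by linarith)))).and
      self_mem_nhdsWithin).exists
  have h3 : Tendsto (fun k => h⁻¹ • (f k (p + h • w) - f k p)) atTop
      (nhds (h⁻¹ • (g (p + h • w) - g p))) := ((hlim _).sub (hlim _)).const_smul _
  obtain ⟨N, hN⟩ := Metric.tendsto_atTop.1 h3 (ε / 3) (by linarith)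
  refine ⟨N, fun k hk => ?_⟩
  have e1 : ‖f k (p + h • w) - f k p - ∇ (f k) p (h • w)‖ ≤ K * ‖h • w‖ ^ 2 :=
    taylor_one (hf k).1.diff_top
      (contDiff_fderiv_top (hf k).1).diff_top
      (fun q => (hf k).norm_fderiv_fderiv_le q) p (h • w)
  have e2 : ‖∇ (f k) p w - h⁻¹ • (f k (p + h • w) - f k p)‖ ≤ K * |h| * ‖w‖ ^ 2 := by
    have : ∇ (f k) p w - h⁻¹ • (f k (p + h • w) - f k p)
        = -(h⁻¹ • (f k (p + h • w) - f k p - ∇ (f k) p (h • w))) := by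
      rw [map_smul, smul_sub h⁻¹ _ (h • _), smul_smul, inv_mul_cancel₀ hh0, one_smul]; abel
    rw [this, norm_neg, norm_smul]
    refine (mul_le_left e1).trans (le_of_eq ?_)
    rw [norm_smul, norm_inv, norm_eq_abs]
    field_simp
  have e3 := hN k hk
  rw [dist_eq_norm] at e3 hh1 ⊢
  have : ∇ (f k) p w - ∇ g p w
      = (∇ (f k) p w - h⁻¹ • (f k (p + h • w) - f k p))
      + (h⁻¹ • (f k (p + h • w) - f k p) - h⁻¹ • (g (p + h • w) - g p))
      + (h⁻¹ • (g (p + h • w) - g p) - ∇ g p w) := by abel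
  rw [this]
  refine (norm_add_le _ _).trans_lt ?_
  have := norm_add_le (∇ (f k) p w - h⁻¹ • (f k (p + h • w) - f k p))
    (h⁻¹ • (f k (p + h • w) - f k p) - h⁻¹ • (g (p + h • w) - g p))
  linarith

lemma tendsto_clm_of_apply [FiniteDimensional ℝ E] {F : Type} [NormedAddCommGroup F]
    [NormedSpace ℝ F] {L : ℕ → E →L[ℝ] F} {M : E →L[ℝ] F}
    (h : ∀ w, Tendsto (fun k => L k w) atTop (nhds (M w))) :
    Tendsto L atTop (nhds M) := by
  let e := Module.finBasis ℝ E
  have key : ∀ ξ : E →L[ℝ] F, ξ = ∑ i, (LinearMap.toContinuousLinearMap (e.coord i)).smulRight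
      (ξ (e i)) := by
    intro ξ
    ext p
    conv_lhs => rw [← e.sum_repr p, map_sum]
    simp
  rw [key M]
  have : L = fun k => ∑ i, (LinearMap.toContinuousLinearMap (e.coord i)).smulRight (L k (e i)) :=
    funext fun k => key _
  rw [this]
  refine tendsto_finsetSum _ fun i _ => ?_
  exact ((ContinuousLinearMap.smulRightL ℝ E F
    (LinearMap.toContinuousLinearMap (e.coord i))).continuous.tendsto _).comp (h (e i))

/-- Pointwise limits lose at most one order of boundedness. -/
lemma BD.of_tendsto [FiniteDimensional ℝ E] (j : ℕ) : ∀ {F : Type} [NormedAddCommGroup F]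
    [NormedSpace ℝ F] {f : ℕ → E → F} {g : E → F} {K : ℝ}, (∀ k, BD (j + 1) K (f k)) →
    C∞ g → (∀ p, Tendsto (fun k => f k p) atTop (nhds (g p))) → BD j K g := by
  induction j with
  | zero =>
    intro F _ _ f g K hf hg hlim
    exact BD.zero hg fun p => le_of_tendsto (hlim p).norm
      (.of_forall fun k => (hf k).norm_le p)
  | succ j ih =>
    intro F _ _ f g K hf hg hlim
    refine BD.succ hg (fun p => le_of_tendsto (hlim p).norm
      (.of_forall fun k => (hf k).norm_le p)) ?_
    refine ih (fun k => (hf k).fderiv) (contDiff_fderiv_top hg) fun p => ?_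
    exact tendsto_clm_of_apply fun w => tendsto_fderiv_apply
      (fun k => (hf k).mono (by omega) le_rfl) hg.diff_top hlim p w

lemma exists_BD_of_compact {F : Type} [NormedAddCommGroup F] [NormedSpace ℝ F] {f : E → F}
    (hf : C∞ f) (hc : HasCompactSupport f) (j : ℕ) : ∃ K, BD j K f := by
  have h : ∀ i, ∃ K, ∀ p, ‖iteratedFDeriv ℝ i f p‖ ≤ K := fun i => by
    obtain ⟨K, hK⟩ := (hc.iteratedFDeriv (𝕜 := ℝ) i).exists_bound_of_continuous
      (hf.continuous_iteratedFDeriv (by exact_mod_cast le_top))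
    exact ⟨K, hK⟩
  choose K hK using h
  refine ⟨∑ i ∈ Finset.range (j + 1), |K i|, hf, fun i hi p => ?_⟩
  refine (hK i p).trans ((le_abs_self _).trans ?_)
  exact single_le_sum (f := fun i => |K i|) (fun _ _ => abs_nonneg _)
    (Finset.mem_range.2 (by omega))

lemma BD.genB {ι : Type} [Fintype ι] (v : ι → E) {b : E → E} {f : E → ℝ} {j : ℕ} {K Kb : ℝ}
    (hf : BD (j + 2) K f) (hb : BD j Kb b) :
    BD j ((2 ^ j * Kb + ∑ l, ‖v l‖ * ‖v l‖) * K) (genB v b f) := by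
  have h1 : BD j (2 ^ j * (K * Kb)) (fun p => ∇ f p (b p)) :=
    BD.bilin (ContinuousLinearMap.id ℝ (E →L[ℝ] ℝ)) ContinuousLinearMap.norm_id_le
      ((BD.fderiv (j := j + 1) hf).mono (by omega) le_rfl) hb
  have hK := hf.nonneg
  have h2 : ∀ l, BD j (‖v l‖ * ‖v l‖ * K)
      (fun p => ∇ (∇ f) p (v l) (v l)) := fun l => by
    have h3 := (BD.fderiv (j := j) (BD.fderiv (j := j + 1) hf))
    have h4 := (h3.clm_left (ContinuousLinearMap.apply ℝ (E →L[ℝ] ℝ) (v l))).clm_left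
      (ContinuousLinearMap.apply ℝ ℝ (v l))
    refine h4.mono le_rfl ?_
    rw [mul_assoc]
    have e1 : ‖ContinuousLinearMap.apply ℝ ℝ (v l)‖ ≤ ‖v l‖ :=
      opNorm_le_bound _ (norm_nonneg _) fun L => by
        rw [mul_comm]; exact L.le_opNorm (v l)
    have e2 : ‖ContinuousLinearMap.apply ℝ (E →L[ℝ] ℝ) (v l)‖ ≤ ‖v l‖ :=
      opNorm_le_bound _ (norm_nonneg _) fun L => by
        rw [mul_comm]; exact L.le_opNorm (v l)
    gcongr
  refine (h1.add (BD.sum Finset.univ fun l _ => h2 l)).mono le_rfl (le_of_eq ?_)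
  rw [← sum_mul]; ring

lemma abs_genB_le {ι : Type} [Fintype ι] (v : ι → E) (b : E → E) {f : E → ℝ} {K : ℝ}
    (hf : BD 2 K f) (p : E) :
    |genB v b f p| ≤ K * (‖b p‖ + ∑ l, ‖v l‖ * ‖v l‖) := by
  refine (abs_add_le _ _).trans ?_
  rw [mul_add, mul_sum]
  refine add_le_add ?_ ((abs_sum_le_sum_abs _ _).trans (sum_le_sum fun l _ => ?_))
  · refine ((∇ f p).le_opNorm (b p)).trans ?_
    exact mul_le_right (hf.norm_fderiv_le p)
  · refine ((∇ (∇ f) p (v l)).le_opNorm (v l)).trans ?_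
    refine (mul_le_right ((∇ (∇ f) p).le_opNorm (v l))).trans ?_
    rw [mul_assoc]
    exact mul_le_right (hf.norm_fderiv_fderiv_le p)
      (mul_nonneg (norm_nonneg _) (norm_nonneg _))

end LimitBD

section Scheffe

/-- Scheffé's lemma. -/
lemma tendsto_integral_abs_sub {α : Type} [MeasurableSpace α] {μ : Measure α} {ι : Type}
    {l : Filter ι} [l.IsCountablyGenerated] {f : ι → α → ℝ} {g : α → ℝ}
    (hf : ∀ᶠ i in l, Integrable (f i) μ) (hf0 : ∀ᶠ i in l, ∀ x, 0 ≤ f i x)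
    (hg : Integrable g μ) (hg0 : ∀ x, 0 ≤ g x)
    (hint : Tendsto (fun i => ∫ x, f i x ∂μ) l (nhds (∫ x, g x ∂μ)))
    (hlim : ∀ x, Tendsto (fun i => f i x) l (nhds (g x))) :
    Tendsto (fun i => ∫ x, |f i x - g x| ∂μ) l (nhds 0) := by
  have h1 : Tendsto (fun i => ∫ x, max (g x - f i x) 0 ∂μ) l (nhds (∫ x, (0 : ℝ) ∂μ)) := by
    refine tendsto_integral_filter_of_dominated_convergence g ?_ ?_ hg ?_
    · filter_upwards [hf] with i hi
      fun_prop
    · filter_upwards [hf0] with i hi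
      refine .of_forall fun x => ?_
      rw [norm_eq_abs, abs_of_nonneg (le_max_right _ _)]
      grind
    · refine .of_forall fun x => ?_
      have := ((tendsto_const_nhds (x := g x)).sub (hlim x)).max (tendsto_const_nhds (x := (0:ℝ)))
      grind
  have h2 := (h1.const_mul 2).add (hint.sub_const (∫ x, g x ∂μ))
  simp only [integral_zero, mul_zero, sub_self, add_zero] at h2
  refine h2.congr' ?_
  filter_upwards [hf] with i hi
  have hm : Integrable (fun x => max (g x - f i x) 0) μ := by fun_prop
  have hs : Integrable (fun x => f i x - g x) μ := hi.sub hg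
  rw [← integral_const_mul, ← integral_sub hi hg, ← integral_add (hm.const_mul 2) hs]
  refine integral_congr_ae (.of_forall fun x => ?_)
  grind

end Scheffe

section Flow
variable {n m : ℕ} {E : Type} [NormedAddCommGroup E] [NormedSpace ℝ E] {ι : Type} [Fintype ι]

/-- Zeroth plus first plus second order operator dual to `genB`. -/
def adjB (v : ι → E) (b : E → E) (κ : ℝ) (f : E → ℝ) (p : E) : ℝ :=
  -(∇ f p (b p)) + κ * f p + ∑ l, ∇ (∇ f) p (v l) (v l)

/-- The drift `b0 + t b1`. -/
def affDrift (b0 b1 : E → E) (t : ℝ) (p : E) : E := b0 p + t • b1 p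

/-- Smooth functions vanishing outside of the ball of radius `R`. -/
def TF (R : ℝ) (φ : E → ℝ) : Prop := C∞ φ ∧ ∀ p, R < ‖p‖ → φ p = 0

variable [MeasurableSpace E]

/-- Classical positive solutions of the Fokker–Planck equation with unit mass. -/
structure FPFlow (μ : Measure E) (v : ι → E) (b0 b1 : E → E) (κ : ℝ) (τ : ℝ → ℝ)
    (u : ℝ → E → ℝ) : Prop where
  b0_smooth : C∞ b0
  b1_smooth : C∞ b1
  τ_cont : Continuous τ
  smooth : ∀ t, C∞ (u t)
  pos : ∀ t p, 0 < u t p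
  mass : ∀ t, ∫ p, u t p ∂μ = 1
  cont : ∀ p, Continuous fun t => u t p
  deriv : ∀ t, 0 ≤ t → ∀ p,
    HasDerivWithinAt (fun s => u s p) (adjB v (affDrift b0 b1 (τ t)) (κ * τ t) (u t) p)
      (Ioi t) t
  ibp : ∀ (t : ℝ) (φ f : E → ℝ), C∞ φ → HasCompactSupport φ →
    C∞ f → ∫ p, genB v (affDrift b0 b1 t) φ p * f p ∂μ
      = ∫ p, φ p * adjB v (affDrift b0 b1 t) (κ * t) f p ∂μ

lemma affDrift_contDiff {b0 b1 : E → E} (h0 : C∞ b0)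
    (h1 : C∞ b1) (t : ℝ) : C∞ (affDrift b0 b1 t) :=
  h0.add (contDiff_const.smul h1)

lemma genB_contDiff {v : ι → E} {b : E → E} (hb : C∞ b) {f : E → ℝ}
    (hf : C∞ f) : C∞ (genB v b f) := by
  refine ((contDiff_fderiv_top hf).clm_apply hb).add (ContDiff.sum fun l _ => ?_)
  exact ((contDiff_fderiv_top (contDiff_fderiv_top hf)).clm_apply contDiff_const).clm_apply
    contDiff_const

lemma adjB_contDiff {v : ι → E} {b : E → E} (hb : C∞ b) (κ : ℝ) {f : E → ℝ}
    (hf : C∞ f) : C∞ (adjB v b κ f) := by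
  refine (((contDiff_fderiv_top hf).clm_apply hb).neg.add (contDiff_const.mul hf)).add
    (ContDiff.sum fun l _ => ?_)
  exact ((contDiff_fderiv_top (contDiff_fderiv_top hf)).clm_apply contDiff_const).clm_apply
    contDiff_const

lemma genB_affDrift (v : ι → E) (b0 b1 : E → E) (t : ℝ) (f : E → ℝ) (p : E) :
    genB v (affDrift b0 b1 t) f p = genB v b0 f p + t * ∇ f p (b1 p) := by
  unfold genB affDrift
  rw [map_add, map_smul, smul_eq_mul]; ring

/-- `genB` and `adjB` are local. -/
lemma genB_congr {v : ι → E} {b b' : E → E} {f g : E → ℝ} {p : E} (h : f =ᶠ[nhds p] g)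
    (hb : b p = b' p) : genB v b f p = genB v b' g p := by
  unfold genB
  rw [h.fderiv_eq, h.fderiv.fderiv_eq, hb]

lemma adjB_congr {v : ι → E} {b b' : E → E} {κ : ℝ} {f g : E → ℝ} {p : E} (h : f =ᶠ[nhds p] g)
    (hb : b p = b' p) : adjB v b κ f p = adjB v b' κ g p := by
  unfold adjB
  rw [h.fderiv_eq, h.fderiv.fderiv_eq, hb, h.eq_of_nhds]

lemma abs_adjB_le (v : ι → E) (b : E → E) (κ : ℝ) {f : E → ℝ} {K : ℝ} (hf : BD 2 K f) (p : E) :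
    |adjB v b κ f p| ≤ K * (‖b p‖ + |κ| + ∑ l, ‖v l‖ * ‖v l‖) := by
  have h1 := abs_genB_le v (fun p => -b p) hf p
  have h2 : adjB v b κ f p = genB v (fun p => -b p) f p + κ * f p := by
    unfold adjB genB; grind
  rw [h2]
  refine (abs_add_le _ _).trans ?_
  have h3 : |κ * f p| ≤ K * |κ| := by
    rw [abs_mul, mul_comm]
    exact mul_le_right (hf.norm_le p)
  rw [norm_neg] at h1
  linarith

lemma TF.eventually {R : ℝ} {φ : E → ℝ} (h : TF R φ) {p : E} (hp : R < ‖p‖) :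
    φ =ᶠ[nhds p] fun _ => 0 := by
  filter_upwards [(isOpen_lt continuous_const continuous_norm).mem_nhds hp] with q hq
  exact h.2 q hq

lemma genB_const (v : ι → E) (b : E → E) (c : ℝ) (p : E) : genB v b (fun _ => c) p = 0 := by
  unfold genB; simp

lemma TF.genB {R : ℝ} {φ : E → ℝ} (h : TF R φ) {v : ι → E} {b : E → E}
    (hb : C∞ b) : TF R (genB v b φ) :=
  ⟨genB_contDiff hb h.1, fun p hp => by
    rw [genB_congr (h.eventually hp) rfl, genB_const]⟩

variable [FiniteDimensional ℝ E] [BorelSpace E]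

lemma TF.compact {R : ℝ} {φ : E → ℝ} (h : TF R φ) : HasCompactSupport φ :=
  HasCompactSupport.intro (isCompact_closedBall (0 : E) R) fun x hx =>
    h.2 x (by simp_all)

variable {μ : Measure E} [IsFiniteMeasureOnCompacts μ] {v : ι → E} {b0 b1 : E → E} {κ : ℝ}
  {τ : ℝ → ℝ} {u : ℝ → E → ℝ}

namespace FPFlow

lemma integrable (H : FPFlow μ v b0 b1 κ τ u) (t : ℝ) : Integrable (u t) μ := by
  by_contra h
  have := H.mass t
  rw [integral_undef h] at this
  linarith

lemma tendsto_L1 (H : FPFlow μ v b0 b1 κ τ u) (t : ℝ) :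
    Tendsto (fun s => ∫ p, |u s p - u t p| ∂μ) (nhds t) (nhds 0) := by
  refine tendsto_integral_abs_sub (.of_forall H.integrable)
    (.of_forall fun s p => (H.pos s p).le) (H.integrable t) (fun p => (H.pos t p).le)
    ?_ fun p => (H.cont p).tendsto t
  simp only [H.mass]
  simp

/-- Integration of a compactly supported function against the flow. -/
def pair (μ : Measure E) (u : ℝ → E → ℝ) (φ : E → ℝ) (t : ℝ) : ℝ := ∫ p, φ p * u t p ∂μ

lemma integrable_bdd_mul {φ f : E → ℝ} (hφ : Continuous φ) {K : ℝ} (hK : ∀ p, |φ p| ≤ K)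
    (hf : Integrable f μ) : Integrable (fun p => φ p * f p) μ :=
  hf.bdd_mul hφ.aestronglyMeasurable (.of_forall hK)

lemma continuous_pair (H : FPFlow μ v b0 b1 κ τ u) {φ : E → ℝ} (hφ : Continuous φ) {K : ℝ}
    (hK : ∀ p, |φ p| ≤ K) : Continuous (pair μ u φ) := by
  rw [continuous_iff_continuousAt]
  intro t
  have h1 := (H.tendsto_L1 t).const_mul K
  rw [mul_zero] at h1
  unfold ContinuousAt
  rw [tendsto_iff_dist_tendsto_zero]
  refine squeeze_zero (fun _ => dist_nonneg) (fun s => ?_) h1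
  have i1 := integrable_bdd_mul hφ hK (H.integrable s)
  have i2 := integrable_bdd_mul hφ hK (H.integrable t)
  unfold pair
  rw [dist_eq, ← integral_sub i1 i2, ← integral_const_mul]
  refine abs_integral_le_integral_abs.trans (integral_mono (i1.sub i2).abs
    (((H.integrable s).sub (H.integrable t)).abs.const_mul K) fun p => ?_)
  rw [← mul_sub, abs_mul]
  exact mul_le_right (hK p)

lemma abs_pair_le (H : FPFlow μ v b0 b1 κ τ u) {φ : E → ℝ} (hφ : Continuous φ) {K : ℝ}
    (hK : ∀ p, |φ p| ≤ K) (t : ℝ) : |pair μ u φ t| ≤ K := by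
  have i1 := integrable_bdd_mul hφ hK (H.integrable t)
  have : K = ∫ p, K * u t p ∂μ := by rw [integral_const_mul, H.mass, mul_one]
  rw [this]
  refine abs_integral_le_integral_abs.trans (integral_mono i1.abs
    ((H.integrable t).const_mul K) fun p => ?_)
  rw [abs_mul, abs_of_pos (H.pos t p)]
  exact mul_le_right (hK p) (H.pos t p).le

/-- Right-hand side of the weak formulation. -/
def rate (μ : Measure E) (v : ι → E) (b0 b1 : E → E) (τ : ℝ → ℝ) (u : ℝ → E → ℝ) (φ : E → ℝ)
    (t : ℝ) : ℝ := ∫ p, genB v (affDrift b0 b1 (τ t)) φ p * u t p ∂μ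

lemma exists_abs_le {f : E → ℝ} {R : ℝ} (hf : TF R f) : ∃ K, ∀ p, |f p| ≤ K := by
  obtain ⟨K, hK⟩ := hf.compact.exists_bound_of_continuous hf.1.continuous
  exact ⟨K, hK⟩

lemma continuous_rate (H : FPFlow μ v b0 b1 κ τ u) {R : ℝ} {φ : E → ℝ} (hφ : TF R φ) :
    Continuous (rate μ v b0 b1 τ u φ) := by
  have hd : TF R (fun p => ∇ φ p (b1 p)) :=
    ⟨(contDiff_fderiv_top hφ.1).clm_apply H.b1_smooth, fun p hp => by
      show ∇ φ p (b1 p) = 0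
      rw [(hφ.eventually hp).fderiv_eq]; simp⟩
  have hg : TF R (genB v b0 φ) := hφ.genB H.b0_smooth
  obtain ⟨K1, hK1⟩ := exists_abs_le hd
  obtain ⟨K0, hK0⟩ := exists_abs_le hg
  have : rate μ v b0 b1 τ u φ
      = fun t => pair μ u (genB v b0 φ) t + τ t * pair μ u (fun p => ∇ φ p (b1 p)) t := by
    funext t
    unfold rate pair
    rw [← integral_const_mul, ← integral_add (integrable_bdd_mul hg.1.continuous hK0 (H.integrable t))
      ((integrable_bdd_mul hd.1.continuous hK1 (H.integrable t)).const_mul _)]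
    refine integral_congr_ae (.of_forall fun p => ?_)
    simp only [genB_affDrift]; ring
  rw [this]
  exact (H.continuous_pair hg.1.continuous hK0).add
    (H.τ_cont.mul (H.continuous_pair hd.1.continuous hK1))

/-- Defect in the weak formulation. -/
def defect (μ : Measure E) (v : ι → E) (b0 b1 : E → E) (τ : ℝ → ℝ) (u : ℝ → E → ℝ) (φ : E → ℝ)
    (t : ℝ) : ℝ := pair μ u φ t - ∫ s in (0 : ℝ)..t, rate μ v b0 b1 τ u φ s

lemma continuous_defect (H : FPFlow μ v b0 b1 κ τ u) {R : ℝ} {φ : E → ℝ} (hφ : TF R φ) :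
    Continuous (defect μ v b0 b1 τ u φ) := by
  obtain ⟨K, hK⟩ := exists_abs_le hφ
  exact (H.continuous_pair hφ.1.continuous hK).sub
    (intervalIntegral.continuous_primitive
      (fun a b => (H.continuous_rate hφ).intervalIntegrable a b) 0)

/-- Times near which the weak formulation holds for all test functions in the ball. -/
def goodSet (μ : Measure E) (v : ι → E) (b0 b1 : E → E) (τ : ℝ → ℝ) (u : ℝ → E → ℝ) (R : ℝ) :
    Set ℝ :=
  {t | ∃ ε > 0, ∀ φ, TF R φ → ∀ s ∈ Ioo (t - ε) (t + ε), ∀ s' ∈ Ioo (t - ε) (t + ε),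
    0 ≤ s → 0 ≤ s' → defect μ v b0 b1 τ u φ s = defect μ v b0 b1 τ u φ s'}

lemma isOpen_goodSet (R : ℝ) : IsOpen (goodSet μ v b0 b1 τ u R) := by
  rw [Metric.isOpen_iff]
  rintro t ⟨ε, hε, h⟩
  refine ⟨ε / 2, by linarith, fun t' ht' => ⟨ε / 2, by linarith, fun φ hφ s hs s' hs' => ?_⟩⟩
  rw [Metric.mem_ball, dist_eq, abs_lt] at ht'
  grind

lemma nonneg_of_notMem_goodSet {R t : ℝ} (ht : t ∉ goodSet μ v b0 b1 τ u R) : 0 ≤ t := by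
  by_contra h
  exact ht ⟨-t, by linarith, fun φ _ s hs s' _ h0 => by
    grind⟩

/-- The weak formulation holds across intervals of good times. -/
lemma defect_eq_of_good (H : FPFlow μ v b0 b1 κ τ u) {R : ℝ} {φ : E → ℝ} (hφ : TF R φ) {a b : ℝ}
    (ha : 0 ≤ a) (hab : a ≤ b) (hg : Ioo a b ⊆ goodSet μ v b0 b1 τ u R) :
    defect μ v b0 b1 τ u φ a = defect μ v b0 b1 τ u φ b := by
  rcases eq_or_lt_of_le hab with rfl | hab
  · rfl
  have hd : ∀ t ∈ Ioo a b, HasDerivAt (defect μ v b0 b1 τ u φ) 0 t := by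
    intro t ht
    obtain ⟨ε, hε, h⟩ := hg ht
    refine (hasDerivAt_const t (defect μ v b0 b1 τ u φ t)).congr_of_eventuallyEq ?_
    filter_upwards [Ioo_mem_nhds (show t - ε < t by linarith) (show t < t + ε by linarith),
      Ioo_mem_nhds ht.1 ht.2] with s hs hs2
    grind
  obtain ⟨t, _, h⟩ := exists_hasDerivAt_eq_slope _ (fun _ => 0) hab
    (H.continuous_defect hφ).continuousOn hd
  grind

lemma pair_sub_eq (H : FPFlow μ v b0 b1 κ τ u) {R : ℝ} {φ : E → ℝ} (hφ : TF R φ) {a b : ℝ}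
    (h : defect μ v b0 b1 τ u φ a = defect μ v b0 b1 τ u φ b) :
    pair μ u φ b - pair μ u φ a = ∫ s in a..b, rate μ v b0 b1 τ u φ s := by
  have hi := fun a b => (H.continuous_rate hφ).intervalIntegrable (μ := volume) a b
  rw [← intervalIntegral.integral_interval_sub_left (hi 0 b) (hi 0 a)]
  unfold defect at h
  linarith

end FPFlow

lemma integrable_of_continuous_zero {f : E → ℝ} (hf : Continuous f) {R : ℝ}
    (h : ∀ p, R < ‖p‖ → f p = 0) : Integrable f μ :=
  hf.integrable_of_hasCompactSupport (HasCompactSupport.intro (isCompact_closedBall (0 : E) R)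
    fun x hx => h x (by simp_all))

namespace FPFlow


lemma exists_uniform_BD {χ : E → ℝ} {R : ℝ} (hχ : TF R χ)
    (hu : ∀ t, C∞ (u t)) (huc : ∀ p, Continuous fun t => u t p)
    {B : Set ℝ} (hB : IsClosed B) (hne : B.Nonempty) (j : ℕ) :
    ∃ t0 ∈ B, ∃ ε > 0, ∃ K, ∀ t ∈ B, |t - t0| < ε → BD j K (fun p => χ p * u t p) := by
  have : Nonempty B := hne.to_subtype
  let S : ℕ → Set B := fun k => {t | BD (j + 1) k (fun p => χ p * u t p)}
  have hS : ⋃ k, closure (S k) = Set.univ := by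
    rw [Set.eq_univ_iff_forall]
    intro t
    have hc : HasCompactSupport (fun p => χ p * u t p) := hχ.compact.mul_right
    obtain ⟨K, hK⟩ := exists_BD_of_compact (hχ.1.mul (hu t)) hc (j + 1)
    obtain ⟨k, hk⟩ := exists_nat_ge K
    exact Set.mem_iUnion.2 ⟨k, subset_closure (hK.mono le_rfl hk)⟩
  obtain ⟨k, t0, ht0⟩ := nonempty_interior_of_iUnion_of_closed (fun k => isClosed_closure) hS
  obtain ⟨ε, hε, hsub⟩ := Metric.isOpen_iff.1 isOpen_interior t0 ht0
  refine ⟨t0, t0.2, ε, hε, k, fun t ht htt => ?_⟩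
  have hm : (⟨t, ht⟩ : B) ∈ closure (S k) := interior_subset (hsub (by
    exact htt))
  obtain ⟨s, hs, hlim⟩ := mem_closure_iff_seq_limit.1 hm
  refine BD.of_tendsto j hs (hχ.1.mul (hu t)) fun p => ?_
  have h1 : Tendsto (fun i => ((s i : B) : ℝ)) atTop (nhds t) :=
    (continuous_subtype_val.tendsto _).comp hlim
  exact (((huc p).tendsto t).comp h1).const_mul (χ p)

lemma abs_rate_le (H : FPFlow μ v b0 b1 κ τ u) {φ : E → ℝ} {R : ℝ} (hφ : TF R φ) {t K : ℝ}
    (hK : ∀ p, |genB v (affDrift b0 b1 (τ t)) φ p| ≤ K) : |rate μ v b0 b1 τ u φ t| ≤ K :=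
  H.abs_pair_le (hφ.genB (affDrift_contDiff H.b0_smooth H.b1_smooth _)).1.continuous hK t

/-- Across an interval of good times whose endpoints are controlled, the flow moves at most
linearly. -/
lemma gap_estimate (H : FPFlow μ v b0 b1 κ τ u) {R R' : ℝ} {φ χ : E → ℝ} (hφ : TF R φ)
    (hχ : TF R' χ) (hχ1 : ∀ p, ‖p‖ < R + 1 → χ p = 1) (K M : ℝ) :
    ∃ C, 0 ≤ C ∧ ∀ a b, 0 ≤ a → a < b → b ≤ M → Ioo a b ⊆ goodSet μ v b0 b1 τ u R →
      BD 4 K (fun p => χ p * u a p) → BD 4 K (fun p => χ p * u b p) →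
      ∫ p, |φ p| * |u b p - u a p| ∂μ ≤ C * (b - a) := by
  obtain ⟨Kφ, hKφ⟩ := exists_BD_of_compact hφ.1 hφ.compact 4
  have hc0 : HasCompactSupport (fun p => χ p • b0 p) := hχ.compact.smul_right
  have hc1 : HasCompactSupport (fun p => χ p • b1 p) := hχ.compact.smul_right
  obtain ⟨K0, hK0⟩ := exists_BD_of_compact (hχ.1.smul H.b0_smooth) hc0 4
  obtain ⟨K1, hK1⟩ := exists_BD_of_compact (hχ.1.smul H.b1_smooth) hc1 4
  obtain ⟨T0, hT0⟩ := (isCompact_Icc (a := (0 : ℝ)) (b := M)).exists_bound_of_continuousOn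
    H.τ_cont.continuousOn
  set Sv : ℝ := ∑ l, ‖v l‖ * ‖v l‖ with hS
  set bh : ℝ → E → E := affDrift (fun p => χ p • b0 p) (fun p => χ p • b1 p) with hbh
  set Kb := K0 + T0 * K1 with hKb
  set Kψ := (2 : ℝ) ^ 4 * (Kφ * (2 ^ 4 * (Kφ * (K + K)))) with hKψ
  set C1 := (2 ^ 2 * Kb + Sv) * Kψ with hC1
  set C2 := C1 * (Kb + Sv) with hC2
  set C3 := K * (Kb + |κ| * T0 + Sv) with hC3
  have iφ : Integrable (fun p => φ p ^ 2) μ :=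
    integrable_of_continuous_zero (hφ.1.continuous.pow 2) fun p hp => by
      rw [hφ.2 p hp]; norm_num
  have iχ : Integrable (fun p => χ p ^ 2) μ :=
    integrable_of_continuous_zero (hχ.1.continuous.pow 2) fun p hp => by
      rw [hχ.2 p hp]; norm_num
  set I2 := ∫ p, φ p ^ 2 ∂μ with hI2
  set J2 := ∫ p, χ p ^ 2 ∂μ with hJ2
  have hχR : ∀ p, ‖p‖ ≤ R → χ p = 1 := by grind
  refine ⟨max 0 (J2 / 2 + (C3 ^ 2 * I2 + 2 * C2) / 2), le_max_left _ _,
    fun a b ha hab hbM hgood hBa hBb => ?_⟩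
  have hKa := hBa.nonneg
  have hT00 : 0 ≤ T0 := (norm_nonneg _).trans (hT0 a ⟨ha, by linarith⟩)
  have hK10 := hK1.nonneg
  have hK00 := hK0.nonneg
  set y := b - a with hy
  have hy0 : 0 < y := by positivity
  set D : E → ℝ := fun p => χ p * u b p + (-1 : ℝ) • (χ p * u a p) with hD
  have hDB : BD 4 (K + K) D := by
    have := hBb.add (hBa.smul (-1))
    grind
  have hDeq : ∀ p, ‖p‖ ≤ R → D p = u b p - u a p := fun p hp => by
    simp only [hD, hχR p hp, smul_eq_mul]; ring
  set ψ : E → ℝ := fun p => φ p * (φ p * D p) with hψ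
  have hψB : BD 4 Kψ ψ := hKφ.mul (hKφ.mul hDB)
  have hψT : TF R ψ := ⟨hψB.1, fun p hp => by simp [hψ, hφ.2 p hp]⟩
  have hDc : Continuous D := hDB.1.continuous
  -- cut-off drift
  have hbB : ∀ t ∈ Icc (0 : ℝ) M, BD 4 Kb (bh (τ t)) := fun t ht => by
    refine (hK0.add (hK1.smul (τ t))).mono le_rfl ?_
    have := mul_le_right (hT0 t ht) hK10
    rw [norm_eq_abs] at this
    linarith
  have hbeq : ∀ t p, ‖p‖ ≤ R → affDrift b0 b1 t p = bh t p := fun t p hp => by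
    simp only [hbh, affDrift, hχR p hp, one_smul]
  have hgen : ∀ (t : ℝ) (f : E → ℝ), TF R f →
      genB v (affDrift b0 b1 t) f = genB v (bh t) f := fun t f hf => by
    funext p
    rcases le_or_gt ‖p‖ R with hp | hp
    · exact genB_congr (EventuallyEq.refl _ _) (hbeq t p hp)
    · rw [genB_congr (hf.eventually hp) rfl, genB_const, genB_congr (hf.eventually hp) rfl,
        genB_const]
  have hrate2 : ∀ r ∈ Icc a b, ∀ s ∈ Icc a b,
      |rate μ v b0 b1 τ u (genB v (affDrift b0 b1 (τ r)) ψ) s| ≤ C2 := by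
    intro r hr s hs
    have hr' : r ∈ Icc (0 : ℝ) M := ⟨ha.trans hr.1, hr.2.trans hbM⟩
    have hs' : s ∈ Icc (0 : ℝ) M := ⟨ha.trans hs.1, hs.2.trans hbM⟩
    have hT : TF R (genB v (affDrift b0 b1 (τ r)) ψ) :=
      hψT.genB (affDrift_contDiff H.b0_smooth H.b1_smooth _)
    refine H.abs_rate_le hT fun p => ?_
    have hB2 : BD 2 C1 (genB v (affDrift b0 b1 (τ r)) ψ) := by
      rw [hgen _ _ hψT]
      exact BD.genB (j := 2) v hψB ((hbB r hr').mono (by norm_num) le_rfl)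
    rw [hgen _ _ hT]
    refine (abs_genB_le v _ hB2 p).trans (mul_le_left ?_ hB2.nonneg)
    have := (hbB s hs').norm_le p
    linarith
  have hC20 : 0 ≤ C2 :=
    (abs_nonneg _).trans (hrate2 a ⟨le_rfl, hab.le⟩ a ⟨le_rfl, hab.le⟩)
  have hadj : ∀ r ∈ Icc a b, ∀ p, ‖p‖ ≤ R →
      |adjB v (affDrift b0 b1 (τ r)) (κ * τ r) (u a) p| ≤ C3 := by
    intro r hr p hp
    have hr' : r ∈ Icc (0 : ℝ) M := ⟨ha.trans hr.1, hr.2.trans hbM⟩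
    have he : u a =ᶠ[nhds p] fun p => χ p * u a p := by
      filter_upwards [(isOpen_lt continuous_norm continuous_const).mem_nhds
        (show ‖p‖ < R + 1 by linarith)] with q hq
      rw [hχ1 q hq, one_mul]
    rw [adjB_congr he (hbeq _ p hp)]
    refine (abs_adjB_le v _ _ (hBa.mono (by norm_num) le_rfl) p).trans
      (mul_le_left ?_ hKa)
    have h1 := (hbB r hr').norm_le p
    have h2 : |κ * τ r| ≤ |κ| * T0 := by
      rw [abs_mul]; exact mul_le_left (hT0 r hr')
    linarith
  have iX : Integrable (fun p => φ p ^ 2 * D p ^ 2) μ :=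
    integrable_of_continuous_zero ((hφ.1.continuous.pow 2).mul (hDc.pow 2)) fun p hp => by
      rw [hφ.2 p hp]; norm_num
  have iW : Integrable (fun p => φ p ^ 2 * |D p|) μ :=
    integrable_of_continuous_zero ((hφ.1.continuous.pow 2).mul hDc.abs) fun p hp => by
      rw [hφ.2 p hp]; norm_num
  set X2 := ∫ p, φ p ^ 2 * D p ^ 2 ∂μ with hX2
  set Wd := ∫ p, φ p ^ 2 * |D p| ∂μ with hWd
  have hsub : ∀ r ∈ Icc a b, Ioo a r ⊆ goodSet μ v b0 b1 τ u R := fun r hr =>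
    (Set.Ioo_subset_Ioo_right hr.2).trans hgood
  have hrate : ∀ r ∈ Icc a b, |rate μ v b0 b1 τ u ψ r| ≤ C3 * Wd + C2 * y := by
    intro r hr
    have hT : TF R (genB v (affDrift b0 b1 (τ r)) ψ) :=
      hψT.genB (affDrift_contDiff H.b0_smooth H.b1_smooth _)
    have h1 := H.pair_sub_eq hT (H.defect_eq_of_good hT ha hr.1 (hsub r hr))
    have h2 : |∫ s in a..r, rate μ v b0 b1 τ u (genB v (affDrift b0 b1 (τ r)) ψ) s|
        ≤ C2 * |r - a| := by
      refine intervalIntegral.norm_integral_le_of_norm_le_const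
        (f := rate μ v b0 b1 τ u (genB v (affDrift b0 b1 (τ r)) ψ)) (C := C2) fun s hs => ?_
      · rw [Set.uIoc_of_le hr.1] at hs
        exact hrate2 r hr s ⟨hs.1.le, hs.2.trans hr.2⟩
    have h2' : C2 * |r - a| ≤ C2 * y := by
      rw [abs_of_nonneg (by linarith [hr.1])]
      exact mul_le_left (by linarith [hr.2]) hC20
    have h3 : |pair μ u (genB v (affDrift b0 b1 (τ r)) ψ) a| ≤ C3 * Wd := by
      unfold pair
      rw [H.ibp (τ r) ψ (u a) hψT.1 hψT.compact (H.smooth a), hWd, ← integral_const_mul, ← norm_eq_abs]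
      refine norm_integral_le_of_norm_le (iW.const_mul C3) (.of_forall fun p => ?_)
      rw [norm_eq_abs, abs_mul]
      rcases le_or_gt ‖p‖ R with hp | hp
      · have e1 : |ψ p| = φ p ^ 2 * |D p| := by
          rw [abs_mul, abs_mul, ← mul_assoc, abs_mul_abs_self, sq]
        rw [e1, mul_comm C3]
        exact mul_le_left (hadj r hr p hp)
      · rw [hψT.2 p hp, hφ.2 p hp]; norm_num
    have h4 : rate μ v b0 b1 τ u ψ r = pair μ u (genB v (affDrift b0 b1 (τ r)) ψ) r := rfl
    rw [h4, show pair μ u (genB v (affDrift b0 b1 (τ r)) ψ) r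
      = pair μ u (genB v (affDrift b0 b1 (τ r)) ψ) a
        + ∫ s in a..r, rate μ v b0 b1 τ u (genB v (affDrift b0 b1 (τ r)) ψ) s by linarith]
    refine (abs_add_le _ _).trans ?_
    linarith
  have hX : X2 ≤ (C3 * Wd + C2 * y) * y := by
    have h1 := H.pair_sub_eq hψT (H.defect_eq_of_good hψT ha hab.le hgood)
    have h2 : |∫ s in a..b, rate μ v b0 b1 τ u ψ s| ≤ (C3 * Wd + C2 * y) * |b - a| := by
      refine intervalIntegral.norm_integral_le_of_norm_le_const
        (f := rate μ v b0 b1 τ u ψ) (C := C3 * Wd + C2 * y) fun s hs => ?_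
      · rw [Set.uIoc_of_le hab.le] at hs
        exact hrate s ⟨hs.1.le, hs.2⟩
    rw [abs_of_pos (show 0 < b - a from hy0)] at h2
    obtain ⟨Kp, hKp⟩ := exists_abs_le hψT
    have i1 := integrable_bdd_mul hψT.1.continuous hKp (H.integrable b)
    have i2 := integrable_bdd_mul hψT.1.continuous hKp (H.integrable a)
    have h3 : X2 = pair μ u ψ b - pair μ u ψ a := by
      unfold pair
      rw [← integral_sub i1 i2, hX2]
      refine integral_congr_ae (.of_forall fun p => ?_)
      rcases le_or_gt ‖p‖ R with hp | hp
      · simp only [hψ]; rw [← mul_sub, ← hDeq p hp]; ring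
      · simp only [hψ]; rw [hφ.2 p hp]; ring
    rw [h3, h1]
    exact (le_abs_self _).trans h2
  have hW : C3 * y * Wd ≤ X2 / 2 + C3 ^ 2 * y ^ 2 / 2 * I2 := by
    rw [hWd, hX2, hI2, ← integral_const_mul, ← integral_const_mul, ← integral_div,
      ← integral_add (iX.div_const 2) (iφ.const_mul _)]
    refine integral_mono (iW.const_mul _) ((iX.div_const 2).add (iφ.const_mul _)) fun p => ?_
    have : 0 ≤ φ p ^ 2 * (|D p| - C3 * y) ^ 2 := by positivity
    rw [← sq_abs (D p)]
    linarith
  have hfin : ∫ p, |φ p| * |u b p - u a p| ∂μ ≤ y / 2 * J2 + X2 / (2 * y) := by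
    rw [hJ2, hX2, ← integral_const_mul, ← integral_div,
      ← integral_add (iχ.const_mul _) (iX.div_const _)]
    refine integral_mono ?_ ((iχ.const_mul _).add (iX.div_const _)) fun p => ?_
    · exact integrable_of_continuous_zero (hφ.1.continuous.abs.mul
        ((H.smooth b).continuous.sub (H.smooth a).continuous).abs) fun p hp => by
          rw [hφ.2 p hp]; simp
    · rcases le_or_gt ‖p‖ R with hp | hp
      · rw [← hDeq p hp, hχR p hp, ← abs_mul, ← mul_pow, ← sq_abs (φ p * D p)]
        have h0 : 0 ≤ (y - |φ p * D p|) ^ 2 / (2 * y) := by positivity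
        have e : (y - |φ p * D p|) ^ 2 / (2 * y)
            = y / 2 * 1 ^ 2 + |φ p * D p| ^ 2 / (2 * y) - |φ p * D p| := by
          field_simp; ring
        linarith
      · rw [hφ.2 p hp]
        have : 0 ≤ y / 2 * χ p ^ 2 := by positivity
        simpa using this
  refine (hfin.trans ?_).trans (mul_le_right (le_max_right _ _) hy0.le)
  have h5 : X2 / (2 * y) ≤ (C3 ^ 2 * I2 + 2 * C2) / 2 * y := by
    rw [div_le_iff₀ (by positivity)]
    linarith
  linarith

end FPFlow
namespace FPFlow

/-- Right derivative in time, extended to negative times by its value at `0`. -/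
def dtime (v : ι → E) (b0 b1 : E → E) (κ : ℝ) (τ : ℝ → ℝ) (u : ℝ → E → ℝ) (t : ℝ) (q : E) : ℝ :=
  adjB v (affDrift b0 b1 (τ (max t 0))) (κ * τ (max t 0)) (u (max t 0)) q

lemma measurable_uncurry (H : FPFlow μ v b0 b1 κ τ u) :
    Measurable (fun x : ℝ × E => u x.1 x.2) :=
  (stronglyMeasurable_uncurry_of_continuous_of_stronglyMeasurable (u := fun t q => u t q)
    (fun q => H.cont q) fun t => (H.smooth t).continuous.stronglyMeasurable).measurable

lemma measurable_dtime (H : FPFlow μ v b0 b1 κ τ u) :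
    Measurable (fun x : ℝ × E => dtime v b0 b1 κ τ u x.1 x.2) := by
  have hs : Tendsto (fun k : ℕ => 1 / ((k : ℝ) + 1)) atTop (nhds 0) :=
    tendsto_one_div_add_atTop_nhds_zero_nat
  refine measurable_of_tendsto_metrizable
    (f := fun (k : ℕ) (x : ℝ × E) =>
      (1 / ((k : ℝ) + 1))⁻¹ * (u (max x.1 0 + 1 / ((k : ℝ) + 1)) x.2 - u (max x.1 0) x.2))
    (fun k => ?_) (tendsto_pi_nhds.2 fun x => ?_)
  · have h1 : Measurable fun x : ℝ × E => max x.1 0 := by fun_prop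
    refine ((H.measurable_uncurry.comp ((h1.add_const (1 / ((k : ℝ) + 1))).prodMk
      measurable_snd)).sub (H.measurable_uncurry.comp (h1.prodMk measurable_snd))).const_mul _
  · have hd := H.deriv (max x.1 0) (le_max_right _ _) x.2
    rw [hasDerivWithinAt_iff_tendsto_slope' (by simp)] at hd
    have h2 : Tendsto (fun k : ℕ => max x.1 0 + 1 / ((k : ℝ) + 1)) atTop
        (nhdsWithin (max x.1 0) (Ioi (max x.1 0))) := by
      refine tendsto_nhdsWithin_iff.2 ⟨by simpa using hs.const_add (max x.1 0),
        .of_forall fun k => ?_⟩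
      have : 0 < 1 / ((k : ℝ) + 1) := by positivity
      grind
    refine (hd.comp h2).congr fun k => ?_
    simp only [Function.comp, slope, vsub_eq_sub, smul_eq_mul, add_sub_cancel_left]

/-- The bad times in `[c, d]`, completed by two half-lines. -/
def badPts (G : Set ℝ) (c d : ℝ) : Set ℝ := (Gᶜ ∩ Icc c d) ∪ Iic c ∪ Ici d

lemma defect_eq_of_uniform (H : FPFlow μ v b0 b1 κ τ u) {R R' : ℝ} {φ χ : E → ℝ} (hφ : TF R φ)
    (hχ : TF R' χ) (hχ1 : ∀ p, ‖p‖ < R + 1 → χ p = 1) {K c d : ℝ} (hc0 : 0 ≤ c) (hcd : c ≤ d)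
    (hcB : c ∉ goodSet μ v b0 b1 τ u R) (hdB : d ∉ goodSet μ v b0 b1 τ u R)
    (hK : ∀ t, t ∉ goodSet μ v b0 b1 τ u R → c ≤ t → t ≤ d → BD 4 K (fun p => χ p * u t p)) :
    defect μ v b0 b1 τ u φ c = defect μ v b0 b1 τ u φ d := by
  set G := goodSet μ v b0 b1 τ u R with hG
  set C := badPts G c d with hC
  have hCc : IsClosed C :=
    (((isOpen_goodSet R).isClosed_compl.inter isClosed_Icc).union isClosed_Iic).union isClosed_Ici
  have hc : Iic c ⊆ C := fun x hx => Or.inl (Or.inr hx)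
  have hd : Ici d ⊆ C := fun x hx => Or.inr hx
  have hcC : c ∈ C := by grind
  have hdC : d ∈ C := by grind
  have hmem : ∀ t ∈ C, c ≤ t → t ≤ d → t ∉ G := fun t ht h1 h2 => by
    rcases ht with (ht | ht) | ht
    · grind
    · grind
    grind
  have hgapgood : ∀ t, Ioo (lastPt C t) (nextPt C t) ⊆ G := fun t s hs => by
    by_contra hsG
    have hsC : s ∈ C := by
      by_cases h1 : s ≤ c
      · grind
      by_cases h2 : d ≤ s
      · grind
      exact Or.inl (Or.inl ⟨hsG, by linarith, by linarith⟩)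
    rcases le_or_gt s t with h | h
    · exact absurd (le_lastPt hsC h) (not_le.2 hs.1)
    · exact absurd (nextPt_le hsC h) (not_le.2 hs.2)
  obtain ⟨Cg, hCg0, hCg⟩ := H.gap_estimate hφ hχ hχ1 K d
  -- bound outside of gaps
  have hc0' : HasCompactSupport (fun p => χ p • b0 p) := hχ.compact.smul_right
  have hc1' : HasCompactSupport (fun p => χ p • b1 p) := hχ.compact.smul_right
  obtain ⟨K0, hK0⟩ := exists_BD_of_compact (hχ.1.smul H.b0_smooth) hc0' 0
  obtain ⟨K1, hK1⟩ := exists_BD_of_compact (hχ.1.smul H.b1_smooth) hc1' 0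
  obtain ⟨T0, hT0⟩ := (isCompact_Icc (a := (0 : ℝ)) (b := d)).exists_bound_of_continuousOn
    H.τ_cont.continuousOn
  set Sv : ℝ := ∑ l, ‖v l‖ * ‖v l‖ with hS
  set C3 := K * (K0 + T0 * K1 + |κ| * T0 + Sv) with hC3
  have hadj : ∀ t ∈ C, c ≤ t → t ≤ d → ∀ p, ‖p‖ ≤ R →
      |dtime v b0 b1 κ τ u t p| ≤ C3 := by
    intro t ht h1 h2 p hp
    have ht0 : max t 0 = t := max_eq_left (hc0.trans h1)
    have hr' : t ∈ Icc (0 : ℝ) d := ⟨hc0.trans h1, h2⟩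
    have hB := hK t (hmem t ht h1 h2) h1 h2
    have he : u t =ᶠ[nhds p] fun p => χ p * u t p := by
      filter_upwards [(isOpen_lt continuous_norm continuous_const).mem_nhds
        (show ‖p‖ < R + 1 by linarith)] with q hq
      rw [hχ1 q hq, one_mul]
    unfold dtime
    rw [ht0, adjB_congr he (b' := affDrift (fun p => χ p • b0 p) (fun p => χ p • b1 p) (τ t))
      (by simp only [affDrift, hχ1 p (by linarith), one_smul])]
    refine (abs_adjB_le v _ _ (hB.mono (by norm_num) le_rfl) p).trans
      (mul_le_left ?_ hB.nonneg)
    have h3 : ‖affDrift (fun p => χ p • b0 p) (fun p => χ p • b1 p) (τ t) p‖ ≤ K0 + T0 * K1 := by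
      refine (norm_add_le _ _).trans (add_le_add (hK0.norm_le p) ?_)
      rw [norm_smul]
      exact mul_le_mul (hT0 t hr') (hK1.norm_le p) (norm_nonneg _)
        ((norm_nonneg _).trans (hT0 t hr'))
    have h4 : |κ * τ t| ≤ |κ| * T0 := by
      rw [abs_mul]; exact mul_le_left (hT0 t hr')
    linarith
  -- the space-time integrand
  set σ : ℝ → E → ℝ := fun t q =>
    gapSlope C (fun s => u s q) (fun s => dtime v b0 b1 κ τ u s q) t with hσ
  have hmeas : Measurable (fun x : ℝ × E => φ x.2 * σ x.1 x.2) := by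
    have hl : Measurable (lastPt C) := (lastPt_mono hc).measurable
    have hn : Measurable (nextPt C) := (nextPt_mono hd).measurable
    refine (hφ.1.continuous.measurable.comp measurable_snd).mul ?_
    refine Measurable.ite (measurableSet_lt measurable_fst (hn.comp measurable_fst)) ?_
      H.measurable_dtime
    exact ((H.measurable_uncurry.comp ((hn.comp measurable_fst).prodMk measurable_snd)).sub
      (H.measurable_uncurry.comp ((hl.comp measurable_fst).prodMk measurable_snd))).div
      ((hn.comp measurable_fst).sub (hl.comp measurable_fst))
  have habs : Integrable (fun p => |φ p|) μ :=
    integrable_of_continuous_zero hφ.1.continuous.abs fun p hp => by rw [hφ.2 p hp]; simp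
  have hcases : ∀ t ∈ Ico c d, (t < nextPt C t ∧ c ≤ lastPt C t ∧ lastPt C t < nextPt C t ∧
      nextPt C t ≤ d) ∨ (¬ t < nextPt C t ∧ t ∈ C) := fun t ht => by
    have h1 := le_lastPt (C := C) hcC ht.1
    have h2 := nextPt_le (C := C) hdC ht.2
    by_cases h : t < nextPt C t
    · exact Or.inl ⟨h, h1, (lastPt_le hc t).trans_lt h, h2⟩
    · refine Or.inr ⟨h, ?_⟩
      have := nextPt_mem hCc hd t
      rwa [le_antisymm (not_lt.1 h) (le_nextPt hd t)] at this
  -- slices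
  have hslice : ∀ t ∈ Ico c d, Integrable (fun q => φ q * σ t q) μ ∧
      ∫ q, |φ q * σ t q| ∂μ ≤ max Cg (C3 * ∫ p, |φ p| ∂μ) ∧
      ∫ q, φ q * σ t q ∂μ = gapSlope C (fun s => ∫ r in (0 : ℝ)..s, rate μ v b0 b1 τ u φ r)
        (rate μ v b0 b1 τ u φ) t := by
    intro t ht
    rcases hcases t ht with ⟨h1, h2, h3, h4⟩ | ⟨h1, h2⟩
    · have hla : lastPt C t ∉ G := hmem _ (lastPt_mem hCc hc t) h2 (h3.le.trans h4)
      have hnb : nextPt C t ∉ G := hmem _ (nextPt_mem hCc hd t) (h2.trans h3.le) h4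
      have hy : 0 < nextPt C t - lastPt C t := by linarith
      have e : ∀ q, φ q * σ t q
          = φ q * (u (nextPt C t) q - u (lastPt C t) q) / (nextPt C t - lastPt C t) := fun q => by
        simp only [hσ, gapSlope, if_pos h1]; ring
      obtain ⟨Kp, hKp⟩ := exists_abs_le hφ
      have i1 := integrable_bdd_mul hφ.1.continuous hKp (H.integrable (nextPt C t))
      have i2 := integrable_bdd_mul hφ.1.continuous hKp (H.integrable (lastPt C t))
      have i3 : Integrable (fun q => φ q * (u (nextPt C t) q - u (lastPt C t) q)) μ := by
        refine (i1.sub i2).congr (.of_forall fun q => ?_)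
        change φ q * u (nextPt C t) q - φ q * u (lastPt C t) q = _
        ring
      refine ⟨?_, ?_, ?_⟩
      · simp only [e]; fun_prop
      · simp only [e]
        refine le_trans ?_ (le_max_left _ _)
        have h5 := hCg _ _ (hc0.trans h2) h3 h4 (hgapgood t)
          (hK _ hla h2 (h3.le.trans h4)) (hK _ hnb (h2.trans h3.le) h4)
        have h6 : ∀ q, |φ q * (u (nextPt C t) q - u (lastPt C t) q)
            / (nextPt C t - lastPt C t)| = |φ q| * |u (nextPt C t) q - u (lastPt C t) q|
            / (nextPt C t - lastPt C t) := fun q => by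
          rw [abs_div, abs_mul, abs_of_pos hy]
        simp only [h6]
        rw [integral_div, div_le_iff₀ hy]
        exact h5
      · simp only [e]
        rw [integral_div]
        have h7 := H.defect_eq_of_good hφ (hc0.trans h2) h3.le (hgapgood t)
        have h8 : ∫ q, φ q * (u (nextPt C t) q - u (lastPt C t) q) ∂μ
            = pair μ u φ (nextPt C t) - pair μ u φ (lastPt C t) := by
          unfold pair
          rw [← integral_sub i1 i2]
          ring
        simp only [gapSlope, if_pos h1]
        unfold defect at h7
        congr 1
        linarith
    · have ht0 : max t 0 = t := max_eq_left (hc0.trans ht.1)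
      have e : ∀ q, σ t q = dtime v b0 b1 κ τ u t q := fun q => by
        simp only [hσ, gapSlope, if_neg h1]
      have hbd := hadj t h2 ht.1 ht.2.le
      have hcont : Continuous (dtime v b0 b1 κ τ u t) :=
        (adjB_contDiff (affDrift_contDiff H.b0_smooth H.b1_smooth _) _ (H.smooth _)).continuous
      have i3 : Integrable (fun q => φ q * dtime v b0 b1 κ τ u t q) μ :=
        integrable_of_continuous_zero (hφ.1.continuous.mul hcont) fun p hp => by
          rw [hφ.2 p hp, zero_mul]
      refine ⟨?_, ?_, ?_⟩
      · simp only [e]; exact i3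
      · simp only [e]
        refine le_trans ?_ (le_max_right _ _)
        rw [← integral_const_mul]
        refine integral_mono i3.abs (habs.const_mul _) fun p => ?_
        rw [abs_mul, mul_comm C3]
        rcases le_or_gt ‖p‖ R with hp | hp
        · exact mul_le_left (hbd p hp)
        · rw [hφ.2 p hp]; simp
      · simp only [e, gapSlope, if_neg h1]
        unfold rate
        rw [H.ibp (τ t) φ (u t) hφ.1 hφ.compact (H.smooth t)]
        unfold dtime
        rw [ht0]
  have hae : ∀ᵐ t ∂(volume.restrict (Ioc c d)), t ∈ Ico c d := by
    have h1 : ∀ᵐ t ∂(volume.restrict (Ioc c d)), t ≠ d :=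
      ae_restrict_of_ae (by simp [ae_iff])
    filter_upwards [h1, ae_restrict_mem measurableSet_Ioc] with t h2 h3
    exact ⟨h3.1.le, lt_of_le_of_ne h3.2 h2⟩
  have hint : Integrable (Function.uncurry fun t q => φ q * σ t q)
      ((volume.restrict (Ioc c d)).prod μ) := by
    have hm : AEStronglyMeasurable (Function.uncurry fun t q => φ q * σ t q)
        ((volume.restrict (Ioc c d)).prod μ) := hmeas.aestronglyMeasurable
    refine (integrable_prod_iff hm).2 ⟨?_, ?_⟩
    · filter_upwards [hae] with t ht using (hslice t ht).1
    · refine Integrable.of_bound hm.norm.integral_prod_right'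
        (max Cg (C3 * ∫ p, |φ p| ∂μ)) ?_
      filter_upwards [hae] with t ht
      rw [norm_eq_abs, abs_of_nonneg (integral_nonneg fun q => norm_nonneg _)]
      exact (hslice t ht).2.1
  have hswap := integral_integral_swap hint
  -- time integrals
  have hL : ∫ q, (∫ t in Ioc c d, φ q * σ t q) ∂μ = ∫ q, φ q * (u d q - u c q) ∂μ := by
    refine integral_congr_ae ?_
    filter_upwards [hint.prod_left_ae] with q hq
    by_cases hφq : φ q = 0
    · simp [hφq]
    have hi : IntervalIntegrable (fun t => σ t q) volume c d := by
      rw [intervalIntegrable_iff_integrableOn_Ioc_of_le hcd]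
      have := hq.const_mul (φ q)⁻¹
      refine this.congr (.of_forall fun t => ?_)
      simp only [Function.uncurry]
      field_simp
    have h1 := integral_gapSlope hCc hc hd hcd (f := fun s => u s q)
      (f' := fun s => dtime v b0 b1 κ τ u s q) (H.cont q) (fun t ht _ => by
        have := H.deriv t (hc0.trans ht) q
        unfold dtime
        rwa [max_eq_left (hc0.trans ht)]) hi
    rw [integral_const_mul, ← intervalIntegral.integral_of_le hcd]
    exact congrArg _ h1
  have hR : ∫ t in Ioc c d, (∫ q, φ q * σ t q ∂μ)
      = (∫ r in (0 : ℝ)..d, rate μ v b0 b1 τ u φ r) - ∫ r in (0 : ℝ)..c, rate μ v b0 b1 τ u φ r := by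
    have hcr := H.continuous_rate hφ
    have h1 : (fun t => ∫ q, φ q * σ t q ∂μ) =ᵐ[volume.restrict (Ioc c d)]
        gapSlope C (fun s => ∫ r in (0 : ℝ)..s, rate μ v b0 b1 τ u φ r)
          (rate μ v b0 b1 τ u φ) := by
      filter_upwards [hae] with t ht using (hslice t ht).2.2
    have h2 : IntervalIntegrable (gapSlope C
        (fun s => ∫ r in (0 : ℝ)..s, rate μ v b0 b1 τ u φ r) (rate μ v b0 b1 τ u φ))
        volume c d := by
      rw [intervalIntegrable_iff_integrableOn_Ioc_of_le hcd]
      exact hint.integral_prod_left.congr h1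
    rw [integral_congr_ae h1, ← intervalIntegral.integral_of_le hcd]
    refine integral_gapSlope hCc hc hd hcd (intervalIntegral.continuous_primitive
      (fun a b => hcr.intervalIntegrable a b) 0) (fun t _ _ => ?_) h2
    exact (intervalIntegral.integral_hasDerivAt_right (hcr.intervalIntegrable _ _)
      (hcr.stronglyMeasurableAtFilter _ _) hcr.continuousAt).hasDerivWithinAt
  obtain ⟨Kp, hKp⟩ := exists_abs_le hφ
  have i1 := integrable_bdd_mul hφ.1.continuous hKp (H.integrable d)
  have i2 := integrable_bdd_mul hφ.1.continuous hKp (H.integrable c)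
  have hP : ∫ q, φ q * (u d q - u c q) ∂μ = pair μ u φ d - pair μ u φ c := by
    unfold pair
    rw [← integral_sub i1 i2]
    ring
  unfold defect
  linarith

/-- The weak formulation of the Fokker–Planck equation. -/
theorem weak_formulation (H : FPFlow μ v b0 b1 κ τ u) {R : ℝ} {φ : E → ℝ} (hφ : TF R φ)
    {a b : ℝ} (ha : 0 ≤ a) (hab : a ≤ b) :
    pair μ u φ b - pair μ u φ a = ∫ s in a..b, rate μ v b0 b1 τ u φ s := by
  have hgood : goodSet μ v b0 b1 τ u R = Set.univ := by
    by_contra hne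
    have hB : IsClosed (goodSet μ v b0 b1 τ u R)ᶜ := (isOpen_goodSet R).isClosed_compl
    have hBne : ((goodSet μ v b0 b1 τ u R)ᶜ).Nonempty := Set.nonempty_compl.2 hne
    set R0 := max R 0 with hR0
    have hR00 : 0 ≤ R0 := by positivity
    let χ0 : ContDiffBump (0 : E) := ⟨R0 + 1, R0 + 2, by linarith, by linarith⟩
    have hχ : TF (R0 + 2) (χ0 : E → ℝ) := ⟨χ0.contDiff, fun p hp => by
      refine χ0.zero_of_le_dist ?_
      rw [dist_zero_right]; linarith⟩
    have hχ1 : ∀ p : E, ‖p‖ < R + 1 → χ0 p = 1 := fun p hp => χ0.one_of_mem_closedBall (by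
      rw [mem_closedBall_zero_iff]
      grind)
    obtain ⟨t0, ht0, ε, hε, K, hK⟩ := exists_uniform_BD hχ H.smooth H.cont hB hBne 4
    refine ht0 ⟨ε, hε, fun f hf => ?_⟩
    have key : ∀ s ∈ Ioo (t0 - ε) (t0 + ε), 0 ≤ s →
        defect μ v b0 b1 τ u f s = defect μ v b0 b1 τ u f t0 := by
      intro s hs hs0
      have ht00 := nonneg_of_notMem_goodSet ht0
      rcases le_total t0 s with h | h
      · obtain ⟨l, hl, hmax⟩ := ((isCompact_Icc (a := t0) (b := s)).inter_left hB).exists_isGreatest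
          ⟨t0, ht0, le_rfl, h⟩
        have h1 : defect μ v b0 b1 τ u f t0 = defect μ v b0 b1 τ u f l :=
          H.defect_eq_of_uniform hf hχ hχ1 ht00 hl.2.1 ht0 hl.1 (K := K) fun t ht h1 h2 =>
            hK t ht (by grind)
        rw [h1]
        refine (H.defect_eq_of_good hf (ht00.trans hl.2.1) hl.2.2 fun r hr => ?_).symm
        by_contra hrG
        exact absurd (hmax ⟨hrG, hl.2.1.trans hr.1.le, hr.2.le⟩) (not_le.2 hr.1)
      · obtain ⟨l, hl, hmin⟩ := ((isCompact_Icc (a := s) (b := t0)).inter_left hB).exists_isLeast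
          ⟨t0, ht0, h, le_rfl⟩
        have h1 : defect μ v b0 b1 τ u f l = defect μ v b0 b1 τ u f t0 :=
          H.defect_eq_of_uniform hf hχ hχ1 (hs0.trans hl.2.1) hl.2.2 hl.1 ht0 (K := K)
            fun t ht h1 h2 => hK t ht (by grind)
        rw [← h1]
        refine H.defect_eq_of_good hf hs0 hl.2.1 fun r hr => ?_
        by_contra hrG
        exact absurd (hmin ⟨hrG, hr.1.le, hr.2.le.trans hl.2.2⟩) (not_le.2 hr.2)
    grind
  exact H.pair_sub_eq hφ (H.defect_eq_of_good hφ ha hab (by grind))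

end FPFlow
section FlowInstance
open Matrix

lemma gradp_contDiff {k : ℕ} {U : (Fin k → ℝ) → ℝ} (hU : C∞ U) :
    C∞ (gradp U) := by
  rw [contDiff_pi]
  intro i
  exact (contDiff_fderiv_top hU).clm_apply contDiff_const

lemma bDrift_eq_affDrift (G : (Fin n → ℝ) → Fin n → ℝ) (A : Matrix (Fin m) (Fin m) ℝ)
    (lam : Matrix (Fin m) (Fin n) ℝ) (τ : ℝ) :
    bDrift G A lam τ
      = affDrift (bDrift G A lam 0) (fun p => driftLin A lam 1 p - driftLin A lam 0 p) τ := by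
  funext p
  simp only [bDrift, affDrift, driftLin_apply]
  refine Prod.ext ?_ (Prod.ext ?_ ?_)
  · simp
  · simp
  · simp [sub_eq_add_neg]

theorem fpFlow_of {U : (Fin n → ℝ) → ℝ} (hU : C∞ U)
    {A B : Matrix (Fin m) (Fin m) ℝ} (hB : Bᵀ * B = (1 / 2 : ℝ) • (A + Aᵀ))
    (lam : Matrix (Fin m) (Fin n) ℝ) {T : ℝ → ℝ} (hTpos : ∀ t, 0 < T t) (hTc : Continuous T)
    {mFam : ℝ → St n m → ℝ} (hMsmooth : ∀ t, C∞ (mFam t))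
    (hMpos : ∀ t p, 0 < mFam t p) (hMprob : ∀ t, ∫ p : St n m, mFam t p = 1)
    (hFP : ∀ t : ℝ, 0 ≤ t → ∀ p : St n m,
      HasDerivAt (fun s => mFam s p) (genLadj U A lam (T t) (mFam t) p) t) :
    FPFlow volume (vDir B) (bDrift (gradp U) A lam 0)
      (fun p => driftLin A lam 1 p - driftLin A lam 0 p) A.trace (fun t => (T (max t 0))⁻¹)
      (fun t => mFam (max t 0)) where
  b0_smooth := bDrift_contDiff (gradp_contDiff hU) A lam 0
  b1_smooth := (driftLin A lam 1).contDiff.sub (driftLin A lam 0).contDiff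
  τ_cont := (hTc.comp (continuous_id.max continuous_const)).inv₀ fun t => (hTpos _).ne'
  smooth t := hMsmooth _
  pos t p := hMpos _ p
  mass t := hMprob _
  cont p := by
    rw [continuous_iff_continuousAt]
    intro t
    have h1 : ContinuousAt (fun s => mFam s p) (max t 0) :=
      (hFP _ (le_max_right _ _) p).continuousAt
    fun_prop
  deriv t ht p := by
    have h1 := (hFP t ht p).hasDerivWithinAt (s := Ioi t)
    rw [genLadj_eq U hB lam (T t) (hMsmooth t) p, bDrift_eq_affDrift] at h1
    simp only [max_eq_left ht]
    rw [mul_comm A.trace]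
    refine h1.congr (fun s hs => ?_) ?_
    · rw [max_eq_left (ht.trans (le_of_lt hs))]
    · rw [max_eq_left ht]
  ibp t φ f hφ hc hf := by
    rw [← bDrift_eq_affDrift, mul_comm A.trace]
    exact ibp_genB (gradp_contDiff hU) A B lam t hφ hc hf

end FlowInstance

lemma BD.comp_contraction {F G : Type} [NormedAddCommGroup F] [NormedSpace ℝ F]
    [NormedAddCommGroup G] [NormedSpace ℝ G] {j : ℕ} {K : ℝ}
    {f : F → G} (hf : BD j K f) (L : E →L[ℝ] F) (hL : ‖L‖ ≤ 1) :
    BD j K (fun p => f (L p)) := by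
  refine ⟨hf.1.comp L.contDiff, fun i hi p => ?_⟩
  have h := ContinuousLinearMap.iteratedFDeriv_comp_right L hf.1 p (i := i)
    (by exact_mod_cast le_top)
  change ‖iteratedFDeriv ℝ i (f ∘ L) p‖ ≤ K
  rw [h]
  refine (ContinuousMultilinearMap.norm_compContinuousLinearMap_le _ _).trans ?_
  calc _ ≤ ‖iteratedFDeriv ℝ i f (L p)‖ * 1 := by
        refine mul_le_left (Finset.prod_le_one (fun _ _ => norm_nonneg _)
          fun _ _ => hL)
    _ ≤ K := by rw [mul_one]; exact hf.2 i hi _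

variable (E) in
lemma exists_cutoff (j : ℕ) : ∃ (χ : ℕ → E → ℝ) (K : ℝ), (∀ k, BD j K (χ k)) ∧
    (∀ k : ℕ, TF (2 * (k + 1)) (χ k)) ∧ (∀ k p, 0 ≤ χ k p ∧ χ k p ≤ 1) ∧
    ∀ (k : ℕ) p, ‖p‖ < k + 1 → χ k p = 1 := by
  let ψ : ContDiffBump (0 : E) := ⟨1, 2, one_pos, one_lt_two⟩
  have hψ : C∞ (ψ : E → ℝ) := ψ.contDiff
  obtain ⟨K, hK⟩ := exists_BD_of_compact hψ ψ.hasCompactSupport j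
  let L : ℕ → E →L[ℝ] E := fun k => ((k : ℝ) + 1)⁻¹ • ContinuousLinearMap.id ℝ E
  have hLn : ∀ k p, ‖L k p‖ = ((k : ℝ) + 1)⁻¹ * ‖p‖ := fun k p => by
    change ‖((k : ℝ) + 1)⁻¹ • p‖ = _
    rw [norm_smul, norm_of_nonneg (by positivity)]
  have hBD : ∀ k, BD j K (fun p => ψ (L k p)) := fun k => by
    refine hK.comp_contraction (L k) (opNorm_le_bound _ zero_le_one fun p => ?_)
    rw [hLn]
    exact mul_le_right (inv_le_one_of_one_le₀ (by linarith))
  refine ⟨fun k p => ψ (L k p), K, hBD, fun k => ⟨(hBD k).1, fun p hp => ?_⟩,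
    fun k p => ⟨ψ.nonneg, ψ.le_one⟩, fun k p hp => ?_⟩
  · refine ψ.zero_of_le_dist ?_
    rw [dist_zero_right, hLn]
    have : (0:ℝ) < k + 1 := by grind
    rw [inv_mul_eq_div, le_div_iff₀ this]
    linarith
  · refine ψ.one_of_mem_closedBall ?_
    rw [mem_closedBall_zero_iff, hLn]
    have : (0:ℝ) < k + 1 := by grind
    rw [inv_mul_eq_div, div_le_iff₀ this]
    linarith

/-- Compactly supported approximation of a bounded function, locally stationary. -/
lemma BD.exists_approx {j : ℕ} {K : ℝ} {f : E → ℝ} (hf : BD j K f) :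
    ∃ (g : ℕ → E → ℝ) (K' : ℝ), (∀ k, BD j K' (g k)) ∧ (∀ k : ℕ, TF (2 * (k + 1)) (g k)) ∧
      (∀ k p, |g k p| ≤ |f p|) ∧
      ∀ p, ∀ᶠ k in atTop, g k =ᶠ[nhds p] f := by
  obtain ⟨χ, Kχ, h1, h2, h3, h4⟩ := exists_cutoff E j
  refine ⟨fun k p => χ k p * f p, _, fun k => (h1 k).mul hf, fun k => ⟨(h2 k).1.mul hf.1,
    fun p hp => by
      show χ k p * f p = 0
      rw [(h2 k).2 p hp, zero_mul]⟩, fun k p => ?_, fun p => ?_⟩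
  · rw [abs_mul, abs_of_nonneg (h3 k p).1]
    exact mul_le_of_le_one_left (abs_nonneg _) (h3 k p).2
  · obtain ⟨k0, hk0⟩ := exists_nat_gt ‖p‖
    filter_upwards [eventually_ge_atTop k0] with k hk
    have : ‖p‖ < k + 1 := hk0.trans_le (by
      have : (k0 : ℝ) ≤ k := by gcongr
      linarith)
    filter_upwards [(isOpen_lt continuous_norm continuous_const).mem_nhds this] with q hq
    grind

lemma abs_genB_le_linear {v : ι → E} {b : E → E} {Cb : ℝ} (hCb : 0 ≤ Cb)
    (hb : ∀ p, ‖b p‖ ≤ Cb * (1 + ‖p‖)) {K : ℝ} {f : E → ℝ} (hf : BD 2 K f) (p : E) :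
    |genB v b f p| ≤ K * (Cb + ∑ l, ‖v l‖ * ‖v l‖) * (1 + ‖p‖) := by
  refine (abs_genB_le v b hf p).trans ?_
  rw [mul_assoc]
  refine mul_le_left ?_ hf.nonneg
  have h1 : 0 ≤ ∑ l, ‖v l‖ * ‖v l‖ := by positivity
  nlinarith [hb p, mul_nonneg h1 (norm_nonneg p)]

/-- Invariance extends from compactly supported functions to bounded ones. -/
lemma integral_genB_eq_zero {μ : Measure E} {v : ι → E} {b : E → E}
    (hbs : C∞ b) {Cb : ℝ} (hCb : 0 ≤ Cb)
    (hb : ∀ p, ‖b p‖ ≤ Cb * (1 + ‖p‖)) {ρ : E → ℝ} (hρc : Continuous ρ)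
    (hρ : Integrable (fun p => (1 + ‖p‖) * ρ p) μ) (hρ0 : ∀ p, 0 ≤ ρ p)
    (h0 : ∀ (R : ℝ) (φ : E → ℝ), TF R φ → ∫ p, genB v b φ p * ρ p ∂μ = 0)
    {K : ℝ} {f : E → ℝ} (hf : BD 2 K f) : ∫ p, genB v b f p * ρ p ∂μ = 0 := by
  obtain ⟨g, K', h1, h2, -, h4⟩ := hf.exists_approx
  have hlim : Tendsto (fun k => ∫ p, genB v b (g k) p * ρ p ∂μ) atTop
      (nhds (∫ p, genB v b f p * ρ p ∂μ)) := by
    refine tendsto_integral_of_dominated_convergence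
      (fun p => K' * (Cb + ∑ l : ι, ‖v l‖ * ‖v l‖) * ((1 + ‖p‖) * ρ p)) (fun k => ?_)
      (hρ.const_mul _) (fun k => .of_forall fun p => ?_)
      (.of_forall fun p => ?_)
    · exact ((genB_contDiff hbs (h1 k).1).continuous.mul hρc).aestronglyMeasurable
    · rw [norm_mul, norm_eq_abs, norm_of_nonneg (hρ0 p), ← mul_assoc]
      exact mul_le_right (abs_genB_le_linear hCb hb (h1 k) p) (hρ0 p)
    · refine tendsto_const_nhds.congr' ?_
      filter_upwards [h4 p] with k hk
      rw [genB_congr hk rfl]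
  have : (fun k => ∫ p, genB v b (g k) p * ρ p ∂μ) = fun _ => 0 := by
    funext k; exact h0 _ _ (h2 k)
  simp_all

/-- The weak formulation for bounded test functions under a first moment bound. -/
theorem FPFlow.weak_formulation_BD (H : FPFlow μ v b0 b1 κ τ u) {Cb : ℝ} (hCb : 0 ≤ Cb)
    {a b : ℝ} (ha : 0 ≤ a) (hab : a ≤ b)
    (hb : ∀ s ∈ Icc a b, ∀ p, ‖affDrift b0 b1 (τ s) p‖ ≤ Cb * (1 + ‖p‖)) {M : ℝ}
    (hi : ∀ s ∈ Icc a b, Integrable (fun p => (1 + ‖p‖) * u s p) μ)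
    (hM : ∀ s ∈ Icc a b, ∫ p, (1 + ‖p‖) * u s p ∂μ ≤ M)
    {K : ℝ} {f : E → ℝ} (hf : BD 2 K f) :
    IntervalIntegrable (rate μ v b0 b1 τ u f) volume a b ∧
    pair μ u f b - pair μ u f a = ∫ s in a..b, rate μ v b0 b1 τ u f s := by
  obtain ⟨g, K', h1, h2, h3, h4⟩ := hf.exists_approx
  set C := K' * (Cb + ∑ l : ι, ‖v l‖ * ‖v l‖) with hC
  have hC0 : 0 ≤ C := mul_nonneg (h1 0).nonneg
    (add_nonneg hCb (sum_nonneg fun l _ => by positivity))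
  have hpair : ∀ t, Tendsto (fun k => pair μ u (g k) t) atTop (nhds (pair μ u f t)) := by
    intro t
    refine tendsto_integral_of_dominated_convergence (fun p => K * u t p) (fun k => ?_)
      ((H.integrable t).const_mul K) (fun k => .of_forall fun p => ?_)
      (.of_forall fun p => ?_)
    · exact ((h1 k).1.continuous.mul (H.smooth t).continuous).aestronglyMeasurable
    · rw [norm_mul, norm_of_nonneg (H.pos t p).le, norm_eq_abs]
      exact mul_le_right ((h3 k p).trans (hf.norm_le p)) (H.pos t p).le
    · refine tendsto_const_nhds.congr' ?_
      filter_upwards [h4 p] with k hk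
      rw [hk.eq_of_nhds]
  have hbd : ∀ s ∈ Icc a b, ∀ k p,
      ‖genB v (affDrift b0 b1 (τ s)) (g k) p * u s p‖ ≤ C * ((1 + ‖p‖) * u s p) := by
    intro s hs k p
    rw [norm_mul, norm_of_nonneg (H.pos s p).le, norm_eq_abs, ← mul_assoc]
    exact mul_le_right (abs_genB_le_linear hCb (hb s hs) (h1 k) p) (H.pos s p).le
  have hrate : ∀ s ∈ Icc a b, Tendsto (fun k => rate μ v b0 b1 τ u (g k) s) atTop
      (nhds (rate μ v b0 b1 τ u f s)) := by
    intro s hs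
    refine tendsto_integral_of_dominated_convergence (fun p => C * ((1 + ‖p‖) * u s p))
      (fun k => ?_) ((hi s hs).const_mul C) (fun k => .of_forall fun p => hbd s hs k p)
      (.of_forall fun p => ?_)
    · exact ((genB_contDiff (affDrift_contDiff H.b0_smooth H.b1_smooth _)
        (h1 k).1).continuous.mul (H.smooth s).continuous).aestronglyMeasurable
    · refine tendsto_const_nhds.congr' ?_
      filter_upwards [h4 p] with k hk
      rw [genB_congr hk rfl]
  have hrb : ∀ s ∈ Icc a b, ∀ k, ‖rate μ v b0 b1 τ u (g k) s‖ ≤ C * M := by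
    intro s hs k
    refine (norm_integral_le_of_norm_le ((hi s hs).const_mul C)
      (.of_forall (hbd s hs k))).trans ?_
    rw [integral_const_mul]
    exact mul_le_left (hM s hs) hC0
  have hsub : Set.uIoc a b ⊆ Icc a b := by
    grind
  constructor
  · have hm : AEStronglyMeasurable (rate μ v b0 b1 τ u f) (volume.restrict (Set.uIoc a b)) := by
      refine aestronglyMeasurable_of_tendsto_ae (u := atTop)
        (f := fun k => rate μ v b0 b1 τ u (g k))
        (fun k => (H.continuous_rate (h2 k)).aestronglyMeasurable) ?_
      filter_upwards [ae_restrict_mem measurableSet_uIoc] with s hs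
      grind
    refine (intervalIntegrable_const (c := C * M)).mono_fun hm ?_
    filter_upwards [ae_restrict_mem measurableSet_uIoc] with s hs
    exact (le_of_tendsto (hrate s (hsub hs)).norm
      (.of_forall (hrb s (hsub hs)))).trans (le_abs_self _)
  · refine tendsto_nhds_unique ((hpair b).sub (hpair a)) ?_
    have : (fun k => pair μ u (g k) b - pair μ u (g k) a)
        = fun k => ∫ s in a..b, rate μ v b0 b1 τ u (g k) s := by
      funext k; exact H.weak_formulation (h2 k) ha hab
    rw [this]
    refine intervalIntegral.tendsto_integral_filter_of_dominated_convergence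
      (fun _ => C * M) (.of_forall fun k =>
        (H.continuous_rate (h2 k)).aestronglyMeasurable) (.of_forall fun k =>
        .of_forall fun s hs => hrb s (hsub hs) k) intervalIntegrable_const
      (.of_forall fun s hs => hrate s (hsub hs))

lemma fderiv_comp_real {ψ : ℝ → ℝ} (hψ : C∞ ψ) {R : E → ℝ}
    (hR : C∞ R) (p h : E) :
    ∇ (fun q => ψ (R q)) p h = deriv ψ (R p) * ∇ R p h := by
  have h1 := (hψ.diff_top (R p)).hasDerivAt.comp_hasFDerivAt p (hR.diff_top p).hasFDerivAt
  have h2 : ∇ (fun q => ψ (R q)) p = deriv ψ (R p) • ∇ R p := h1.fderiv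
  simp_all

lemma contDiff_deriv_top {ψ : ℝ → ℝ} (hψ : C∞ ψ) :
    C∞ (deriv ψ) :=
  (contDiff_fderiv_top hψ).clm_apply contDiff_const

lemma genB_comp (v : ι → E) (b : E → E) {ψ : ℝ → ℝ} (hψ : C∞ ψ) {R : E → ℝ}
    (hR : C∞ R) (p : E) :
    genB v b (fun q => ψ (R q)) p
      = deriv ψ (R p) * genB v b R p + deriv (deriv ψ) (R p) * ∑ l, ∇ R p (v l) ^ 2 := by
  have hc : C∞ (fun q => ψ (R q)) := hψ.comp hR
  have hd := contDiff_deriv_top hψ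
  unfold genB
  rw [fderiv_comp_real hψ hR, mul_add, mul_sum, mul_sum, add_assoc,
    ← sum_add_distrib]
  congr 1
  refine sum_congr rfl fun l _ => ?_
  rw [← fderiv_dir hc, ← fderiv_dir hR]
  have h1 : (fun q => ∇ (fun q => ψ (R q)) q (v l))
      = fun q => deriv ψ (R q) * ∇ R q (v l) := by
    funext q; exact fderiv_comp_real hψ hR q (v l)
  have h2 : DifferentiableAt ℝ (fun q => ∇ R q (v l)) p :=
    ((contDiff_fderiv_top hR).clm_apply contDiff_const).diff_top p
  have h3 : DifferentiableAt ℝ (fun q => deriv ψ (R q)) p := (hd.comp hR).diff_top p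
  rw [h1, fderiv_fun_mul h3 h2]
  have h4 := fderiv_comp_real hd hR p (v l)
  change deriv ψ (R p) * ∇ (fun q => ∇ R q (v l)) p (v l)
    + ∇ R p (v l) * ∇ (fun q => deriv ψ (R q)) p (v l) = _
  grind

section Hamiltonian
open Matrix

lemma contDiff_sqnorm {k : ℕ} : C∞ (sqnorm : (Fin k → ℝ) → ℝ) := by
  exact ContDiff.sum fun i _ => (contDiff_apply ℝ ℝ i).pow 2

lemma fderiv_sqnorm {k : ℕ} (x h : Fin k → ℝ) : ∇ sqnorm x h = 2 * (x ⬝ᵥ h) := by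
  have h1 : HasFDerivAt (sqnorm : (Fin k → ℝ) → ℝ)
      (∑ i, (2 * x i) • (proj i : (Fin k → ℝ) →L[ℝ] ℝ)) x := by
    refine HasFDerivAt.fun_sum fun i _ => ?_
    have := (hasFDerivAt_apply (𝕜 := ℝ) i x).pow 2
    grind
  rw [h1.fderiv]
  simp [dotProduct, mul_sum, mul_assoc, ContinuousLinearMap.sum_apply]

lemma contDiff_Wfun {V : (Fin n → ℝ) → ℝ} (hV : C∞ V) :
    C∞ (Wfun V : St n m → ℝ) := by
  exact ((hV.comp contDiff_fst).add ((contDiff_sqnorm.comp contDiff_snd.fst).div_const 2)).add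
    ((contDiff_sqnorm.comp contDiff_snd.snd).div_const 2)

lemma fderiv_Wfun {V : (Fin n → ℝ) → ℝ} (hV : C∞ V) (p h : St n m) :
    ∇ (Wfun V) p h = gradp V p.1 ⬝ᵥ h.1 + p.2.1 ⬝ᵥ h.2.1 + p.2.2 ⬝ᵥ h.2.2 := by
  have h1 := (hV.diff_top p.1).hasFDerivAt.comp p (hasFDerivAt_fst (𝕜 := ℝ) (p := p))
  have h2 := (((contDiff_sqnorm (k := n)).diff_top p.2.1).hasFDerivAt.comp p
    ((hasFDerivAt_snd (𝕜 := ℝ) (p := p)).fst)).const_mul (2⁻¹ : ℝ)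
  have h3 := (((contDiff_sqnorm (k := m)).diff_top p.2.2).hasFDerivAt.comp p
    ((hasFDerivAt_snd (𝕜 := ℝ) (p := p)).snd)).const_mul (2⁻¹ : ℝ)
  have h4 := (h1.add h2).add h3
  have h5 := h4.congr_of_eventuallyEq (f₁ := (Wfun V : St n m → ℝ))
    (.of_forall fun q => by simp [Wfun, div_eq_inv_mul])
  rw [h5.fderiv]
  have h6 : ∇ V p.1 h.1 = gradp V p.1 ⬝ᵥ h.1 := by
    have e : h.1 = ∑ i, h.1 i • (Pi.single i (1 : ℝ) : Fin n → ℝ) := by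
      funext j; simp [Finset.sum_apply, Pi.single_apply]
    conv_lhs => rw [e]
    rw [map_sum]
    unfold dotProduct gradp
    refine sum_congr rfl fun i _ => ?_
    rw [map_smul, smul_eq_mul, mul_comm]
  rw [← h6]
  change ∇ V p.1 h.1 + 2⁻¹ * ∇ sqnorm p.2.1 h.2.1
    + 2⁻¹ * ∇ sqnorm p.2.2 h.2.2 = _
  rw [fderiv_sqnorm, fderiv_sqnorm]; ring

lemma sum_row_sq {A B : Matrix (Fin m) (Fin m) ℝ} (hB : Bᵀ * B = (1 / 2 : ℝ) • (A + Aᵀ)) :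
    ∑ l, B l ⬝ᵥ B l = A.trace := by
  have h : (Bᵀ * B).trace = A.trace := by
    rw [hB, Matrix.trace_smul, Matrix.trace_add, Matrix.trace_transpose, smul_eq_mul]; ring
  rw [← h, Matrix.trace_mul_comm]
  rfl

lemma sum_dot_row_sq {A B : Matrix (Fin m) (Fin m) ℝ} (hB : Bᵀ * B = (1 / 2 : ℝ) • (A + Aᵀ))
    (z : Fin m → ℝ) : ∑ l, (z ⬝ᵥ B l) ^ 2 = z ⬝ᵥ (Aᵀ *ᵥ z) := by
  have h1 : ∑ l, (z ⬝ᵥ B l) ^ 2 = (B *ᵥ z) ⬝ᵥ (B *ᵥ z) := by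
    refine sum_congr rfl fun l _ => ?_
    rw [sq]; congr 1 <;> exact dotProduct_comm _ _
  have h2 : z ⬝ᵥ (A *ᵥ z) = z ⬝ᵥ (Aᵀ *ᵥ z) := by
    rw [Matrix.dotProduct_mulVec, ← Matrix.mulVec_transpose, dotProduct_comm]
  rw [h1, Matrix.dotProduct_mulVec, Matrix.vecMul_mulVec, hB, Matrix.vecMul_smul,
    smul_dotProduct, Matrix.vecMul_add, add_dotProduct, ← Matrix.dotProduct_mulVec,
    ← Matrix.dotProduct_mulVec, h2, smul_eq_mul]
  ring

lemma genB_Wfun {V : (Fin n → ℝ) → ℝ} (hV : C∞ V)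
    {A B : Matrix (Fin m) (Fin m) ℝ} (hB : Bᵀ * B = (1 / 2 : ℝ) • (A + Aᵀ)) (b : St n m → St n m)
    (p : St n m) : genB (vDir B) b (Wfun V) p = ∇ (Wfun V) p (b p) + A.trace := by
  unfold genB
  rw [← sum_row_sq hB]
  congr 1
  refine sum_congr rfl fun l _ => ?_
  rw [← fderiv_dir (contDiff_Wfun hV)]
  have h1 : (fun q => ∇ (Wfun V : St n m → ℝ) q (vDir B l)) = fun q => q.2.2 ⬝ᵥ B l := by
    funext q; rw [fderiv_Wfun hV]; simp [vDir]
  have h2 : HasFDerivAt (fun q : St n m => q.2.2 ⬝ᵥ B l)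
      (∑ i, (B l i) • ((proj (R := ℝ) (φ := fun _ : Fin m => ℝ) i).comp
        ((snd ℝ _ _).comp
          (snd ℝ (Fin n → ℝ) ((Fin n → ℝ) × (Fin m → ℝ)))))) p := by
    refine HasFDerivAt.fun_sum fun i _ => ?_
    exact (((proj (R := ℝ) (φ := fun _ : Fin m => ℝ) i).comp
        ((snd ℝ _ _).comp
          (snd ℝ (Fin n → ℝ) ((Fin n → ℝ) × (Fin m → ℝ))))).hasFDerivAt).mul_const _
  rw [h1, h2.fderiv]
  simp [dotProduct, vDir]

lemma fderiv_Wfun_bDrift {V : (Fin n → ℝ) → ℝ} (hV : C∞ V)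
    (A : Matrix (Fin m) (Fin m) ℝ) (lam : Matrix (Fin m) (Fin n) ℝ) (τ : ℝ) (p : St n m) :
    ∇ (Wfun V) p (bDrift (gradp V) A lam τ p) = -(τ * (p.2.2 ⬝ᵥ (Aᵀ *ᵥ p.2.2))) := by
  rw [fderiv_Wfun hV]
  simp only [bDrift, driftLin_apply, Prod.fst_sub, Prod.snd_sub, sub_zero, dotProduct_sub,
    dotProduct_neg, dotProduct_smul, smul_eq_mul]
  have h1 : p.2.1 ⬝ᵥ (lamᵀ *ᵥ p.2.2) = p.2.2 ⬝ᵥ (lam *ᵥ p.2.1) := by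
    rw [Matrix.dotProduct_mulVec, Matrix.vecMul_transpose, dotProduct_comm]
  rw [h1, dotProduct_comm (gradp V p.1)]; ring

/-- Unnormalised Gibbs density. -/
def gibbs (V : (Fin n → ℝ) → ℝ) (τ : ℝ) (p : St n m) : ℝ := exp (-(τ * Wfun V p))

lemma gibbs_pos (V : (Fin n → ℝ) → ℝ) (τ : ℝ) (p : St n m) : 0 < gibbs V τ p := exp_pos _

lemma contDiff_gibbs {V : (Fin n → ℝ) → ℝ} (hV : C∞ V) (τ : ℝ) :
    C∞ (gibbs V τ : St n m → ℝ) :=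
  ((contDiff_const.mul (contDiff_Wfun hV)).neg).exp

lemma adjoint_gibbs {V : (Fin n → ℝ) → ℝ} (hV : C∞ V)
    {A B : Matrix (Fin m) (Fin m) ℝ} (hB : Bᵀ * B = (1 / 2 : ℝ) • (A + Aᵀ))
    (lam : Matrix (Fin m) (Fin n) ℝ) (τ : ℝ) (p : St n m) :
    -(∇ (gibbs V τ) p (bDrift (gradp V) A lam τ p)) + τ * A.trace * gibbs V τ p
      + ∑ l, ∇ (∇ (gibbs V τ)) p (vDir B l) (vDir B l) = 0 := by
  have hψ : C∞ (fun s : ℝ => exp (-(τ * s))) :=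
    by fun_prop
  have d1 : ∀ s, deriv (fun s : ℝ => exp (-(τ * s))) s = -τ * exp (-(τ * s)) := by
    intro s
    have : HasDerivAt (fun s : ℝ => exp (-(τ * s))) (exp (-(τ * s)) * -(τ * 1)) s :=
      (((hasDerivAt_id s).const_mul τ).neg).exp
    rw [this.deriv]; ring
  have d2 : ∀ s, deriv (deriv (fun s : ℝ => exp (-(τ * s)))) s
      = τ ^ 2 * exp (-(τ * s)) := by
    intro s
    rw [funext d1, deriv_const_mul _ (by fun_prop), d1]; ring
  have h := genB_comp (vDir B) (fun p => -bDrift (gradp V) A lam τ p) hψ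
    (contDiff_Wfun (m := m) hV) p
  rw [genB_Wfun hV hB, d1, d2, map_neg, fderiv_Wfun_bDrift hV] at h
  have h2 : ∑ l, ∇ (Wfun V : St n m → ℝ) p (vDir B l) ^ 2
      = p.2.2 ⬝ᵥ (Aᵀ *ᵥ p.2.2) := by
    rw [← sum_dot_row_sq hB]
    refine sum_congr rfl fun l _ => ?_
    rw [fderiv_Wfun hV]; simp [vDir]
  rw [h2] at h
  unfold genB at h
  rw [map_neg] at h
  change -(∇ (gibbs V τ) p (bDrift (gradp V) A lam τ p))
    + ∑ l, ∇ (∇ (gibbs V τ)) p (vDir B l) (vDir B l) = _ at h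
  have h3 : gibbs V τ p = exp (-(τ * Wfun V p)) := rfl
  rw [h3]
  linarith

lemma exists_bDrift_bound (A : Matrix (Fin m) (Fin m) ℝ) (lam : Matrix (Fin m) (Fin n) ℝ) (τ : ℝ) :
    ‖driftLin A lam τ‖ ≤ (‖driftLin A lam 0‖ + ‖driftLin A lam 1 - driftLin A lam 0‖) * (1 + |τ|) := by
  have h : driftLin A lam τ = driftLin A lam 0 + τ • (driftLin A lam 1 - driftLin A lam 0) := by
    ext p <;> simp [driftLin_apply, sub_eq_add_neg]
  rw [h]
  refine (norm_add_le _ _).trans ?_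
  rw [norm_smul, norm_eq_abs]
  nlinarith [norm_nonneg (driftLin A lam 1 - driftLin A lam 0), mul_nonneg (norm_nonneg (driftLin A lam 0)) (abs_nonneg τ)]

lemma norm_bDrift_le (A : Matrix (Fin m) (Fin m) ℝ) (lam : Matrix (Fin m) (Fin n) ℝ) (τ : ℝ)
    {G : (Fin n → ℝ) → Fin n → ℝ} {g : ℝ} (hg : ∀ x, ‖G x‖ ≤ g * (1 + ‖x‖)) (p : St n m) :
    ‖bDrift G A lam τ p‖ ≤ ((‖driftLin A lam 0‖ + ‖driftLin A lam 1 - driftLin A lam 0‖) *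
      (1 + |τ|) + g) * (1 + ‖p‖) := by
  have hg0 : 0 ≤ g := by
    have h0 := (norm_nonneg _).trans (hg 0)
    simp_all
  have h1 : ‖((0 : Fin n → ℝ), G p.1, (0 : Fin m → ℝ))‖ ≤ g * (1 + ‖p‖) := by
    rw [Prod.norm_mk, Prod.norm_mk, norm_zero, norm_zero, max_eq_left (norm_nonneg (G p.1)),
      max_eq_right (norm_nonneg (G p.1))]
    exact (hg _).trans (mul_le_left (by linarith [norm_fst_le p]) hg0)
  have h2 := ((driftLin A lam τ).le_opNorm p).trans
    (mul_le_right (exists_bDrift_bound A lam τ))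
  have h3 : 0 ≤ (‖driftLin A lam 0‖ + ‖driftLin A lam 1 - driftLin A lam 0‖) * (1 + |τ|) := by
    positivity
  refine (norm_sub_le _ _).trans ?_
  linarith

/-- Invariance of the Gibbs measure tested on bounded functions. -/
theorem integral_genB_gibbs {V : (Fin n → ℝ) → ℝ} (hV : C∞ V)
    {A B : Matrix (Fin m) (Fin m) ℝ} (hB : Bᵀ * B = (1 / 2 : ℝ) • (A + Aᵀ))
    (lam : Matrix (Fin m) (Fin n) ℝ) (τ : ℝ) {g : ℝ} (hg : ∀ x, ‖gradp V x‖ ≤ g * (1 + ‖x‖))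
    (hi : Integrable (fun p : St n m => (1 + ‖p‖) * gibbs V τ p)) {K : ℝ} {f : St n m → ℝ}
    (hf : BD 2 K f) :
    ∫ p, genB (vDir B) (bDrift (gradp V) A lam τ) f p * gibbs V τ p = 0 := by
  have hb := norm_bDrift_le A lam τ hg
  have hCb : 0 ≤ (‖driftLin A lam 0‖ + ‖driftLin A lam 1 - driftLin A lam 0‖) * (1 + |τ|) + g := by
    have h0 := (norm_nonneg _).trans (hb 0)
    simpa using h0
  refine integral_genB_eq_zero (bDrift_contDiff (gradp_contDiff hV) A lam τ) hCb hb
    (contDiff_gibbs hV τ).continuous hi (fun p => (gibbs_pos V τ p).le) (fun R φ hφ => ?_) hf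
  rw [ibp_genB (gradp_contDiff hV) A B lam τ hφ.1 hφ.compact (contDiff_gibbs hV τ)]
  simp only [adjoint_gibbs hV hB lam τ, mul_zero, integral_zero]

end Hamiltonian

section Truncation

/-- Fatou's lemma for real integrals. -/
lemma integrable_of_fatou {α : Type} [MeasurableSpace α] {μ : Measure α} {F : ℕ → α → ℝ}
    {f : α → ℝ} {M : ℝ} (hF : ∀ k, Integrable (F k) μ) (h0 : ∀ k x, 0 ≤ F k x)
    (hM : ∀ k, ∫ x, F k x ∂μ ≤ M) (hlim : ∀ x, Tendsto (fun k => F k x) atTop (nhds (f x))) :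
    Integrable f μ ∧ ∫ x, f x ∂μ ≤ M := by
  have hf0 : ∀ x, 0 ≤ f x := fun x => ge_of_tendsto (hlim x) (.of_forall fun k => h0 k x)
  have hmeas : AEStronglyMeasurable f μ :=
    aestronglyMeasurable_of_tendsto_ae atTop (fun k => (hF k).aestronglyMeasurable)
      (.of_forall hlim)
  have hM0 : 0 ≤ M := (integral_nonneg (h0 0)).trans (hM 0)
  have hle : ∫⁻ x, ENNReal.ofReal (f x) ∂μ ≤ ENNReal.ofReal M := by
    have h1 : ∀ x, ENNReal.ofReal (f x) = liminf (fun k => ENNReal.ofReal (F k x)) atTop :=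
      fun x => ((ENNReal.continuous_ofReal.tendsto _).comp (hlim x)).liminf_eq.symm
    simp_rw [h1]
    refine (lintegral_liminf_le' fun k => (hF k).aestronglyMeasurable.aemeasurable.ennreal_ofReal).trans ?_
    refine liminf_le_of_le (by isBoundedDefault) fun b hb => ?_
    obtain ⟨k, hk⟩ := hb.exists
    refine hk.trans ?_
    rw [← ofReal_integral_eq_lintegral_ofReal (hF k) (.of_forall (h0 k))]
    simp_all
  have hint : Integrable f μ := by
    refine ⟨hmeas, ?_⟩
    rw [hasFiniteIntegral_iff_ofReal (.of_forall hf0)]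
    exact hle.trans_lt ENNReal.ofReal_lt_top
  refine ⟨hint, ?_⟩
  rw [← ofReal_integral_eq_lintegral_ofReal hint (.of_forall hf0)] at hle
  simp_all

/-- Slope of the truncation at height `k`. -/
def truncSlope (k : ℝ) (r : ℝ) : ℝ := 1 - smoothTransition (r / k - 1)

/-- A smooth concave truncation of the identity. -/
def trunc (k : ℝ) (s : ℝ) : ℝ := ∫ r in (0:ℝ)..s, truncSlope k r

variable {k : ℝ}

lemma truncSlope_contDiff : C∞ (truncSlope k) :=
  contDiff_const.sub (smoothTransition.contDiff.comp
    ((contDiff_id.div_const k).sub contDiff_const))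

lemma truncSlope_nonneg (r : ℝ) : 0 ≤ truncSlope k r :=
  sub_nonneg.2 (smoothTransition.le_one _)

lemma truncSlope_le_one (r : ℝ) : truncSlope k r ≤ 1 := by
  unfold truncSlope; linarith [smoothTransition.nonneg (r / k - 1)]

lemma truncSlope_of_le (hk : 0 < k) {r : ℝ} (h : r ≤ k) : truncSlope k r = 1 := by
  unfold truncSlope
  rw [smoothTransition.zero_of_nonpos (by rw [sub_nonpos, div_le_one hk]; exact h), sub_zero]

lemma truncSlope_of_ge (hk : 0 < k) {r : ℝ} (h : 2 * k ≤ r) : truncSlope k r = 0 := by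
  unfold truncSlope
  rw [smoothTransition.one_of_one_le, sub_self]
  have : 2 ≤ r / k := by rw [le_div_iff₀ hk]; exact h
  linarith

lemma truncSlope_antitone (hk : 0 < k) : Antitone (truncSlope k) := fun a b hab => by
  unfold truncSlope
  have := smoothTransition.monotone (a := a / k - 1) (b := b / k - 1)
    (by gcongr)
  linarith

lemma trunc_hasDerivAt (s : ℝ) : HasDerivAt (trunc k) (truncSlope k s) s :=
  intervalIntegral.integral_hasDerivAt_right
    (truncSlope_contDiff.continuous.intervalIntegrable _ _)
    (truncSlope_contDiff.continuous.stronglyMeasurableAtFilter _ _)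
    truncSlope_contDiff.continuous.continuousAt

lemma deriv_trunc : deriv (trunc k) = truncSlope k := funext fun s => (trunc_hasDerivAt s).deriv

lemma trunc_contDiff : C∞ (trunc k) := by
  rw [contDiff_infty_iff_deriv]
  exact ⟨fun s => (trunc_hasDerivAt s).differentiableAt, by
    rw [deriv_trunc]; exact truncSlope_contDiff⟩

lemma deriv_truncSlope_nonpos (hk : 0 < k) (s : ℝ) : deriv (truncSlope k) s ≤ 0 :=
  (truncSlope_antitone hk).deriv_nonpos

lemma trunc_of_le (hk : 0 < k) {s : ℝ} (h0 : 0 ≤ s) (h : s ≤ k) : trunc k s = s := by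
  unfold trunc
  rw [intervalIntegral.integral_congr (g := fun _ => (1:ℝ))]
  · simp
  · intro r hr
    rw [Set.uIcc_of_le h0] at hr
    exact truncSlope_of_le hk (hr.2.trans h)

lemma trunc_of_ge (hk : 0 < k) {s : ℝ} (h : 2 * k ≤ s) : trunc k s = trunc k (2 * k) := by
  have h1 := intervalIntegral.integral_add_adjacent_intervals (a := 0) (b := 2 * k) (c := s)
    (truncSlope_contDiff (k := k).continuous.intervalIntegrable (μ := volume) _ _)
    (truncSlope_contDiff (k := k).continuous.intervalIntegrable _ _)
  have h2 : ∫ r in (2 * k)..s, truncSlope k r = 0 := by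
    rw [intervalIntegral.integral_congr (g := fun _ => (0:ℝ))]
    · simp
    · intro r hr
      rw [Set.uIcc_of_le h] at hr
      exact truncSlope_of_ge hk hr.1
  unfold trunc
  linarith

lemma trunc_le {s : ℝ} (h0 : 0 ≤ s) : trunc k s ≤ s := by
  have := intervalIntegral.integral_mono_on h0
    (truncSlope_contDiff (k := k).continuous.intervalIntegrable (μ := volume) 0 s)
    (continuous_const (y := (1:ℝ)).intervalIntegrable 0 s) fun r _ => truncSlope_le_one r
  simpa [trunc] using this

lemma slope_mul_le_trunc (hk : 0 < k) {s : ℝ} (h0 : 0 ≤ s) : truncSlope k s * s ≤ trunc k s := by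
  have := intervalIntegral.integral_mono_on h0
    (continuous_const (y := truncSlope k s).intervalIntegrable (μ := volume) 0 s)
    (truncSlope_contDiff (k := k).continuous.intervalIntegrable 0 s)
    fun r hr => truncSlope_antitone hk hr.2
  simpa [trunc, mul_comm] using this

lemma trunc_nonneg (hk : 0 < k) {s : ℝ} (h0 : 0 ≤ s) : 0 ≤ trunc k s :=
  (mul_nonneg (truncSlope_nonneg s) h0).trans (slope_mul_le_trunc hk h0)

end Truncation

/-- Propagation of a Lyapunov function along the flow. -/
theorem FPFlow.lyapunov (H : FPFlow μ v b0 b1 κ τ u) {R : E → ℝ} (hR : C∞ R)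
    {c0 : ℝ} (hc0 : 0 < c0) (hRc : ∀ p, c0 * ‖p‖ ^ 2 ≤ R p) {c C t : ℝ} (hc : 0 < c) (hC : 0 ≤ C)
    (hL : ∀ s ∈ Icc 0 t, ∀ p, genB v (affDrift b0 b1 (τ s)) R p ≤ C - c * R p)
    (hi0 : Integrable (fun p => R p * u 0 p) μ) :
    ∀ s ∈ Icc 0 t, Integrable (fun p => R p * u s p) μ ∧
      ∫ p, R p * u s p ∂μ ≤ ∫ p, R p * u 0 p ∂μ + C / c := by
  have hR0 : ∀ p, 0 ≤ R p := fun p => (by positivity : 0 ≤ c0 * ‖p‖ ^ 2).trans (hRc p)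
  set I0 := ∫ p, R p * u 0 p ∂μ with hI0
  have hkpos : ∀ k : ℕ, (0:ℝ) < k + 1 := by grind
  let ck : ℕ → ℝ := fun k => trunc (k + 1) (2 * (k + 1))
  let φ : ℕ → E → ℝ := fun k p => trunc (k + 1) (R p) - ck k
  have hψ : ∀ k : ℕ, C∞ (fun s => trunc (k + 1) s - ck k) := fun k =>
    trunc_contDiff.sub contDiff_const
  have hTF : ∀ k : ℕ, TF (sqrt (2 * (k + 1) / c0)) (φ k) := fun k =>
    ⟨(hψ k).comp hR, fun p hp => by
      have h1 : 2 * ((k:ℝ) + 1) / c0 < ‖p‖ ^ 2 := (sqrt_lt (by positivity)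
        (norm_nonneg p)).1 hp
      rw [div_lt_iff₀ hc0] at h1
      have h2 : 2 * ((k:ℝ) + 1) ≤ R p := by grind
      exact sub_eq_zero.2 (trunc_of_ge (hkpos k) h2)⟩
  have hgen : ∀ (k : ℕ) s, s ∈ Icc 0 t → ∀ p, genB v (affDrift b0 b1 (τ s)) (φ k) p
      ≤ C - c * (truncSlope (k + 1) (R p) * R p) := by
    intro k s hs p
    have h1 := genB_comp v (affDrift b0 b1 (τ s)) (hψ k) hR p
    have d1 : _root_.deriv (fun s => trunc ((k:ℝ) + 1) s - ck k) = truncSlope (k + 1) := by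
      funext r; exact ((trunc_hasDerivAt r).sub_const _).deriv
    rw [d1] at h1
    have h2 : _root_.deriv (truncSlope ((k:ℝ) + 1)) (R p) * ∑ l, ∇ R p (v l) ^ 2 ≤ 0 :=
      mul_nonpos_of_nonpos_of_nonneg (deriv_truncSlope_nonpos (hkpos k) _)
        (sum_nonneg fun l _ => sq_nonneg _)
    have h3 := mul_le_left (hL s hs p) (truncSlope_nonneg (k := k + 1) (R p))
    have h4 := mul_le_of_le_one_left hC (truncSlope_le_one (k := k + 1) (R p))
    nlinarith
  let mk : ℕ → ℝ → ℝ := fun k s => FPFlow.pair μ u (φ k) s + ck k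
  let gk : ℕ → E → ℝ := fun k p => truncSlope (k + 1) (R p) * R p
  have hgkc : ∀ k, Continuous (gk k) := fun k =>
    (truncSlope_contDiff.continuous.comp hR.continuous).mul hR.continuous
  have hgk0 : ∀ k p, 0 ≤ gk k p := fun k p => mul_nonneg (truncSlope_nonneg _) (hR0 p)
  have hgkb : ∀ (k : ℕ) p, |gk k p| ≤ 2 * (k + 1) := fun k p => by
    rw [abs_of_nonneg (hgk0 k p)]
    rcases le_total (2 * ((k:ℝ) + 1)) (R p) with h | h
    · change truncSlope _ _ * _ ≤ _
      rw [truncSlope_of_ge (hkpos k) h, zero_mul]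
      positivity
    · exact (mul_le_of_le_one_left (hR0 p) (truncSlope_le_one _)).trans h
  have hgki : ∀ k s, Integrable (fun p => gk k p * u s p) μ := fun k s =>
    FPFlow.integrable_bdd_mul (hgkc k) (hgkb k) (H.integrable s)
  have hφi : ∀ k s, Integrable (fun p => φ k p * u s p) μ := fun k s => by
    obtain ⟨K, hK⟩ := FPFlow.exists_abs_le (hTF k)
    exact FPFlow.integrable_bdd_mul (hTF k).1.continuous hK (H.integrable s)
  have hTi : ∀ (k : ℕ) s, Integrable (fun p => trunc (k + 1) (R p) * u s p) μ := fun k s => by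
    refine ((hφi k s).add ((H.integrable s).const_mul (ck k))).congr
      (.of_forall fun p => ?_)
    simp only [Pi.add_apply, φ]; ring
  have hmk : ∀ (k : ℕ) s, mk k s = ∫ p, trunc (k + 1) (R p) * u s p ∂μ := fun k s => by
    have h1 : ∫ p, (trunc (k + 1) (R p) * u s p - ck k * u s p) ∂μ
        = ∫ p, trunc (k + 1) (R p) * u s p ∂μ - ck k := by
      rw [integral_sub (hTi k s) ((H.integrable s).const_mul _), integral_const_mul, H.mass,
        mul_one]
    have h2 : FPFlow.pair μ u (φ k) s
        = ∫ p, (trunc (k + 1) (R p) * u s p - ck k * u s p) ∂μ := by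
      refine integral_congr_ae (.of_forall fun p => ?_)
      simp only [φ]; ring
    linarith
  have hrate : ∀ (k : ℕ) s, s ∈ Icc 0 t → FPFlow.rate μ v b0 b1 τ u (φ k) s
      ≤ C - c * FPFlow.pair μ u (gk k) s := by
    intro k s hs
    have hb := (hTF k).genB (v := v) (affDrift_contDiff H.b0_smooth H.b1_smooth (τ s))
    obtain ⟨K, hK⟩ := FPFlow.exists_abs_le hb
    have h1 : C - c * FPFlow.pair μ u (gk k) s
        = ∫ p, (C * u s p - c * (gk k p * u s p)) ∂μ := by
      rw [integral_sub ((H.integrable s).const_mul _) ((hgki k s).const_mul _),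
        integral_const_mul, integral_const_mul, H.mass, mul_one]; rfl
    rw [h1]
    refine integral_mono (FPFlow.integrable_bdd_mul hb.1.continuous hK (H.integrable s))
      (((H.integrable s).const_mul _).sub ((hgki k s).const_mul _)) fun p => ?_
    have := mul_le_right (hgen k s hs p) (H.pos s p).le
    linarith
  have hder : ∀ (k : ℕ) s, 0 < s → HasDerivAt (mk k) (FPFlow.rate μ v b0 b1 τ u (φ k) s) s := by
    intro k s hs
    have hcr := H.continuous_rate (hTF k)
    have h1 : HasDerivAt (fun s => ∫ r in (0:ℝ)..s, FPFlow.rate μ v b0 b1 τ u (φ k) r)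
        (FPFlow.rate μ v b0 b1 τ u (φ k) s) s :=
      intervalIntegral.integral_hasDerivAt_right (hcr.intervalIntegrable _ _)
        (hcr.stronglyMeasurableAtFilter _ _) hcr.continuousAt
    refine (h1.add_const (mk k 0)).congr_of_eventuallyEq ?_
    filter_upwards [lt_mem_nhds hs] with r hr
    have := H.weak_formulation (hTF k) le_rfl hr.le
    linarith
  have hmkc : ∀ k, Continuous (mk k) := fun k => by
    obtain ⟨K, hK⟩ := FPFlow.exists_abs_le (hTF k)
    exact (H.continuous_pair (hTF k).1.continuous hK).add continuous_const
  have hgpc : ∀ k, Continuous (FPFlow.pair μ u (gk k)) := fun k =>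
    H.continuous_pair (hgkc k) (hgkb k)
  have hgp0 : ∀ k s, 0 ≤ FPFlow.pair μ u (gk k) s := fun k s =>
    integral_nonneg fun p => mul_nonneg (hgk0 k p) (H.pos s p).le
  have hmk0 : ∀ k, mk k 0 ≤ I0 := fun k => by
    rw [hmk]
    exact integral_mono (hTi k 0) hi0 fun p =>
      mul_le_right (trunc_le (hR0 p)) (H.pos 0 p).le
  have hlimT : ∀ s p, Tendsto (fun k : ℕ => trunc (k + 1) (R p) * u s p) atTop
      (nhds (R p * u s p)) := fun s p => by
    refine tendsto_const_nhds.congr' ?_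
    obtain ⟨k0, hk0⟩ := exists_nat_gt (R p)
    filter_upwards [eventually_ge_atTop k0] with k hk
    have : (k0 : ℝ) ≤ k := by gcongr
    rw [trunc_of_le (hkpos k) (hR0 p) (by linarith)]
  -- crude growth
  have hcrude : ∀ s ∈ Icc 0 t, Integrable (fun p => R p * u s p) μ ∧
      ∫ p, R p * u s p ∂μ ≤ I0 + C * t := by
    intro s hs
    refine integrable_of_fatou (fun k => hTi k s) (fun k p => mul_nonneg
      (trunc_nonneg (hkpos k) (hR0 p)) (H.pos s p).le) (fun k => ?_) (hlimT s)
    rw [← hmk]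
    have h1 := H.weak_formulation (hTF k) le_rfl hs.1
    have h2 : ∫ r in (0:ℝ)..s, FPFlow.rate μ v b0 b1 τ u (φ k) r ≤ ∫ r in (0:ℝ)..s, C :=
      intervalIntegral.integral_mono_on hs.1
        ((H.continuous_rate (hTF k)).intervalIntegrable _ _) (by simp) fun r hr => by
          have h3 := hrate k r ⟨hr.1, hr.2.trans hs.2⟩
          have := mul_nonneg hc.le (hgp0 k r)
          linarith
    rw [intervalIntegral.integral_const, smul_eq_mul, sub_zero] at h2
    have h5 : s * C ≤ t * C := mul_le_right hs.2 hC
    linarith [hmk0 k]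
  intro s hs
  refine ⟨(hcrude s hs).1, ?_⟩
  -- the exponentially weighted estimate
  let e : ℕ → ℝ → ℝ := fun k r => mk k r - FPFlow.pair μ u (gk k) r
  have hec : ∀ k, Continuous (e k) := by fun_prop
  have hgron : ∀ k, exp (c * s) * (mk k s - C / c) ≤ (mk k 0 - C / c)
      + ∫ r in (0:ℝ)..s, c * exp (c * r) * e k r := by
    intro k
    have hEc : Continuous fun r => c * exp (c * r) * e k r :=
      by fun_prop
    let Fk : ℝ → ℝ := fun r => exp (c * r) * (mk k r - C / c)
      - ∫ q in (0:ℝ)..r, c * exp (c * q) * e k q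
    have hFd : ∀ r, 0 < r → HasDerivAt Fk (c * exp (c * r) * (mk k r - C / c)
        + exp (c * r) * FPFlow.rate μ v b0 b1 τ u (φ k) r
        - c * exp (c * r) * e k r) r := by
      intro r hr
      have h1 : HasDerivAt (fun r => exp (c * r)) (exp (c * r) * (c * 1)) r :=
        ((hasDerivAt_id r).const_mul c).exp
      have h2 := h1.mul ((hder k r hr).sub_const (C / c))
      have h3 : HasDerivAt (fun r => ∫ q in (0:ℝ)..r, c * exp (c * q) * e k q)
          (c * exp (c * r) * e k r) r :=
        intervalIntegral.integral_hasDerivAt_right (hEc.intervalIntegrable _ _)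
          (hEc.stronglyMeasurableAtFilter _ _) hEc.continuousAt
      refine (h2.sub h3).congr_deriv ?_
      ring
    have hFc : Continuous Fk := by
      fun_prop
    have hanti : AntitoneOn Fk (Icc 0 s) := by
      refine antitoneOn_of_deriv_nonpos (convex_Icc 0 s) hFc.continuousOn ?_ ?_
      · intro r hr
        rw [interior_Icc] at hr
        exact (hFd r hr.1).differentiableAt.differentiableWithinAt
      · intro r hr
        rw [interior_Icc] at hr
        rw [(hFd r hr.1).deriv]
        have h1 := hrate k r ⟨hr.1.le, hr.2.le.trans hs.2⟩
        have h2 := mul_le_left h1 (exp_pos (c * r)).le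
        have h3 : c * (C / c) = C := by field_simp
        have h4 : c * exp (c * r) * (C / c) = exp (c * r) * C := by
          grind
        linarith
    have := hanti (Set.left_mem_Icc.2 hs.1) (Set.right_mem_Icc.2 hs.1) hs.1
    simp only [Fk, mul_zero, exp_zero, one_mul, intervalIntegral.integral_same, sub_zero]
      at this
    linarith
  have he0 : ∀ r ∈ Icc 0 t, Tendsto (fun k => e k r) atTop (nhds 0) := by
    intro r hr
    have h1 : Tendsto (fun k => mk k r) atTop (nhds (∫ p, R p * u r p ∂μ)) := by
      simp_rw [hmk]
      refine tendsto_integral_of_dominated_convergence (fun p => R p * u r p)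
        (fun k => (hTi k r).aestronglyMeasurable) (hcrude r hr).1
        (fun k => .of_forall fun p => ?_) (.of_forall (hlimT r))
      rw [norm_of_nonneg (mul_nonneg (trunc_nonneg (hkpos k) (hR0 p)) (H.pos r p).le)]
      exact mul_le_right (trunc_le (hR0 p)) (H.pos r p).le
    have h2 : Tendsto (fun k => FPFlow.pair μ u (gk k) r) atTop
        (nhds (∫ p, R p * u r p ∂μ)) := by
      refine tendsto_integral_of_dominated_convergence (fun p => R p * u r p)
        (fun k => (hgki k r).aestronglyMeasurable) (hcrude r hr).1
        (fun k => .of_forall fun p => ?_) (.of_forall fun p => ?_)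
      · rw [norm_of_nonneg (mul_nonneg (hgk0 k p) (H.pos r p).le)]
        exact mul_le_right ((slope_mul_le_trunc (hkpos k) (hR0 p)).trans
          (trunc_le (hR0 p))) (H.pos r p).le
      · refine tendsto_const_nhds.congr' ?_
        obtain ⟨k0, hk0⟩ := exists_nat_gt (R p)
        filter_upwards [eventually_ge_atTop k0] with k hk
        have : (k0 : ℝ) ≤ k := by gcongr
        change _ = truncSlope (k + 1) (R p) * R p * u r p
        rw [truncSlope_of_le (hkpos k) (by linarith), one_mul]
    simpa using h1.sub h2
  have hebd : ∀ r ∈ Icc 0 t, ∀ k, |e k r| ≤ I0 + C * t := by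
    intro r hr k
    have h1 : mk k r ≤ I0 + C * t := by
      rw [hmk]
      exact (integral_mono (hTi k r) (hcrude r hr).1 fun p =>
        mul_le_right (trunc_le (hR0 p)) (H.pos r p).le).trans (hcrude r hr).2
    have h2 : FPFlow.pair μ u (gk k) r ≤ mk k r := by
      rw [hmk]
      exact integral_mono (hgki k r) (hTi k r) fun p =>
        mul_le_right (slope_mul_le_trunc (hkpos k) (hR0 p)) (H.pos r p).le
    rw [abs_of_nonneg (sub_nonneg.2 h2)]
    have := hgp0 k r
    linarith
  have hint0 : Tendsto (fun k => ∫ r in (0:ℝ)..s, c * exp (c * r) * e k r) atTop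
      (nhds 0) := by
    have := intervalIntegral.tendsto_integral_filter_of_dominated_convergence (μ := volume)
      (a := 0) (b := s) (l := atTop) (F := fun k r => c * exp (c * r) * e k r)
      (f := fun _ => 0)
      (fun r => c * exp (c * r) * (I0 + C * t)) (.of_forall fun k => by
        fun_prop)
      (.of_forall fun k => .of_forall fun r hr => by
        rw [Set.uIoc_of_le hs.1] at hr
        rw [norm_mul, norm_of_nonneg (by positivity), norm_eq_abs]
        exact mul_le_left (hebd r ⟨hr.1.le, hr.2.trans hs.2⟩ k))
      (Continuous.intervalIntegrable (by fun_prop) _ _)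
      (.of_forall fun r hr => by
        rw [Set.uIoc_of_le hs.1] at hr
        simpa using (he0 r ⟨hr.1.le, hr.2.trans hs.2⟩).const_mul (c * exp (c * r)))
    simpa using this
  have hfin : ∀ k, mk k s ≤ I0 + C / c + |∫ r in (0:ℝ)..s, c * exp (c * r) * e k r| := by
    intro k
    have h1 := hgron k
    have h2 : 1 ≤ exp (c * s) := one_le_exp (mul_nonneg hc.le hs.1)
    have h3 : 0 ≤ C / c := by positivity
    set J := ∫ r in (0:ℝ)..s, c * exp (c * r) * e k r
    have hI00 : 0 ≤ I0 := integral_nonneg fun p => mul_nonneg (hR0 p) (H.pos 0 p).le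
    by_contra hcon
    have h4 : 0 ≤ mk k s - C / c := by linarith [abs_nonneg J]
    nlinarith [le_abs_self J, hmk0 k]
  have hmklim : Tendsto (fun k => mk k s) atTop (nhds (∫ p, R p * u s p ∂μ)) := by
    simp_rw [hmk]
    refine tendsto_integral_of_dominated_convergence (fun p => R p * u s p)
      (fun k => (hTi k s).aestronglyMeasurable) (hcrude s hs).1
      (fun k => .of_forall fun p => ?_) (.of_forall (hlimT s))
    rw [norm_of_nonneg (mul_nonneg (trunc_nonneg (hkpos k) (hR0 p)) (H.pos s p).le)]
    exact mul_le_right (trunc_le (hR0 p)) (H.pos s p).le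
  have hbd := (hint0.abs).const_add (I0 + C / c)
  rw [abs_zero, add_zero] at hbd
  exact le_of_tendsto_of_tendsto' hmklim hbd hfin

section CrossTerm
open Matrix

/-- The hypocoercive cross term of the Lyapunov function. -/
def crossFun (lamInv : Matrix (Fin n) (Fin m) ℝ) (p : St n m) : ℝ :=
  p.2.1 ⬝ᵥ (lamInv *ᵥ p.2.2) + 1 / 2 * (p.1 ⬝ᵥ p.2.1)

lemma contDiff_crossFun (lamInv : Matrix (Fin n) (Fin m) ℝ) :
    C∞ (crossFun lamInv) := by
  unfold crossFun
  simp only [dotProduct, mulVec]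
  have hx : ∀ i, C∞ (fun p : St n m => p.1 i) := by fun_prop
  fun_prop

lemma fderiv_crossFun (lamInv : Matrix (Fin n) (Fin m) ℝ) (p h : St n m) :
    ∇ (crossFun lamInv) p h = h.2.1 ⬝ᵥ (lamInv *ᵥ p.2.2) + p.2.1 ⬝ᵥ (lamInv *ᵥ h.2.2)
      + 1 / 2 * (h.1 ⬝ᵥ p.2.1 + p.1 ⬝ᵥ h.2.1) := by
  have h1 := ((contDiff_crossFun lamInv).diff_top p).hasFDerivAt.hasLineDerivAt h
  set c := h.2.1 ⬝ᵥ (lamInv *ᵥ p.2.2) + p.2.1 ⬝ᵥ (lamInv *ᵥ h.2.2)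
      + 1 / 2 * (h.1 ⬝ᵥ p.2.1 + p.1 ⬝ᵥ h.2.1)
  have e : (fun t : ℝ => crossFun lamInv (p + t • h))
      = fun t => crossFun lamInv p + t * c + t ^ 2 * crossFun lamInv h := by
    funext t
    simp only [crossFun, c, Prod.fst_add, Prod.snd_add, Prod.smul_fst, Prod.smul_snd, mulVec_add,
      mulVec_smul, dotProduct_add, add_dotProduct, smul_dotProduct, dotProduct_smul, smul_eq_mul]
    ring
  have h2 : HasDerivAt (fun t : ℝ => crossFun lamInv (p + t • h)) c 0 := by
    rw [e]
    have := (((hasDerivAt_id (0:ℝ)).mul_const c).const_add (crossFun lamInv p)).add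
      (((hasDerivAt_id (0:ℝ)).pow 2).mul_const (crossFun lamInv h))
    exact HasDerivAt.congr_deriv this (by simp)
  exact h1.unique h2

lemma abs_crossFun_le (lamInv : Matrix (Fin n) (Fin m) ℝ) :
    ∃ C, 0 ≤ C ∧ ∀ p : St n m,
      |crossFun lamInv p| ≤ C * (sqnorm p.1 + sqnorm p.2.1 + sqnorm p.2.2) := by
  set L := ∑ i, ∑ j, lamInv i j ^ 2
  have hL : 0 ≤ L := by positivity
  refine ⟨1 + L, by grind, fun p => ?_⟩
  have a1 := dot_le p.2.1 (lamInv *ᵥ p.2.2) (ε := 1 / 4) (by norm_num)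
  have a2 := dot_le (-p.2.1) (lamInv *ᵥ p.2.2) (ε := 1 / 4) (by norm_num)
  have a3 := dot_le p.1 p.2.1 (ε := 1 / 2) (by norm_num)
  have a4 := dot_le (-p.1) p.2.1 (ε := 1 / 2) (by norm_num)
  have e : ∀ {k : ℕ} (w : Fin k → ℝ), sqnorm (-w) = sqnorm w := fun w => by simp [sqnorm]
  rw [e, neg_dotProduct] at a2 a4
  have b := sqnorm_mulVec_le lamInv p.2.2
  have x0 := sqnorm_nonneg p.1
  have y0 := sqnorm_nonneg p.2.1
  have z0 := sqnorm_nonneg p.2.2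
  have l1 := mul_nonneg hL x0
  have l2 := mul_nonneg hL y0
  unfold crossFun
  rw [abs_le]
  constructor <;> linarith

/-- Dissipation produced by the cross term. -/
lemma fderiv_crossFun_bDrift {G : (Fin n → ℝ) → Fin n → ℝ} {r1 r2 Ug : ℝ} (hr1 : 0 < r1)
    (hr2 : 0 < r2) (hUg : 0 < Ug)
    (hgrad1 : ∀ x, r1 * sqnorm x - Ug ≤ ∑ i, G x i * x i)
    (hgrad2 : ∀ x, sqnorm (G x) ≤ r2 * sqnorm x + Ug)
    (A : Matrix (Fin m) (Fin m) ℝ)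
    (lam : Matrix (Fin m) (Fin n) ℝ) (lamInv : Matrix (Fin n) (Fin m) ℝ)
    (hlamInv : lamInv * lam = 1) :
    ∃ C, 0 ≤ C ∧ ∀ τ p, ∇ (crossFun lamInv) p (bDrift G A lam τ p)
      ≤ C + C * (1 + τ ^ 2) * sqnorm p.2.2 - 1 / 4 * sqnorm p.2.1 - r1 / 4 * sqnorm p.1 := by
  have hM0 : ∀ {a b : ℕ} (M : Matrix (Fin a) (Fin b) ℝ), 0 ≤ ∑ i, ∑ j, M i j ^ 2 := fun M =>
    sum_nonneg fun _ _ => sum_nonneg fun _ _ => sq_nonneg _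
  set L1 := ∑ i, ∑ j, lamInv i j ^ 2 with hL1d
  set L2 := ∑ i, ∑ j, lamᵀ i j ^ 2 with hL2d
  set L3 := ∑ i, ∑ j, (lamInv * Aᵀ) i j ^ 2 with hL3d
  set ε := r1 / (8 * r2) with hε
  have hε0 : 0 < ε := by positivity
  set C0 := L2 + L1 + (4 * ε)⁻¹ * L1 + L3 + (4 * (r1 / 4))⁻¹ * L2
  have hC0 : 0 ≤ C0 := by positivity
  refine ⟨C0 + ε * Ug + Ug, by positivity, fun τ p => ?_⟩
  rw [fderiv_crossFun]
  simp only [bDrift, driftLin_apply, Prod.fst_sub, Prod.snd_sub, sub_zero]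
  set x := p.1
  set y := p.2.1
  set z := p.2.2
  have e1 : y ⬝ᵥ (lamInv *ᵥ (-(lam *ᵥ y) - τ • (Aᵀ *ᵥ z)))
      = - sqnorm y - (τ • y) ⬝ᵥ ((lamInv * Aᵀ) *ᵥ z) := by
    rw [mulVec_sub, mulVec_neg, mulVec_smul, mulVec_mulVec, mulVec_mulVec, hlamInv, one_mulVec,
      dotProduct_sub, dotProduct_neg, ← sqnorm_eq_dot, dotProduct_smul, smul_dotProduct]
  have e2 : y ⬝ᵥ y = sqnorm y := (sqnorm_eq_dot y).symm
  have e3 : x ⬝ᵥ G x = ∑ i, G x i * x i := by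
    rw [dotProduct_comm]; rfl
  rw [e1, e2, sub_dotProduct, dotProduct_sub, e3]
  have a1 := dot_le (lamᵀ *ᵥ z) (lamInv *ᵥ z) (ε := 1 / 2) (by norm_num)
  have a2 := dot_le (-(G x)) (lamInv *ᵥ z) hε0
  have a3 := dot_le y (-(τ • ((lamInv * Aᵀ) *ᵥ z))) (ε := 1 / 4) (by norm_num)
  have a4 := dot_le x (lamᵀ *ᵥ z) (ε := r1 / 4) (by positivity)
  have e : ∀ {k : ℕ} (w : Fin k → ℝ), sqnorm (-w) = sqnorm w := fun w => by simp [sqnorm]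
  rw [e, neg_dotProduct] at a2
  rw [e, sqnorm_smul, dotProduct_neg, dotProduct_smul, smul_eq_mul] at a3
  rw [smul_dotProduct, smul_eq_mul]
  have b1 := sqnorm_mulVec_le lamInv z
  have b2 := sqnorm_mulVec_le lamᵀ z
  have b3 := sqnorm_mulVec_le (lamInv * Aᵀ) z
  have z0 := sqnorm_nonneg z
  have g1 := hgrad1 x
  have g2 := mul_le_left (hgrad2 x) hε0.le
  have c1 : ε * (r2 * sqnorm x) = r1 / 8 * sqnorm x := by rw [hε]; field_simp
  have c2 := mul_le_left b1 (show 0 ≤ (4 * ε)⁻¹ by positivity)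
  have c3 := mul_le_left b3 (sq_nonneg τ)
  have c4 := mul_le_left b2 (show 0 ≤ (4 * (r1 / 4))⁻¹ by positivity)
  have d0 : (C0 + ε * Ug + Ug) * (1 + τ ^ 2) * sqnorm z ≥ C0 * sqnorm z + τ ^ 2 * (L3 * sqnorm z) := by
    have t1 : 0 ≤ (ε * Ug + Ug) * (1 + τ ^ 2) * sqnorm z := by positivity
    have t2 : 0 ≤ (C0 - L3) * τ ^ 2 * sqnorm z := by
      have : 0 ≤ C0 - L3 := by
        have : C0 - L3 = L2 + L1 + (4 * ε)⁻¹ * L1 + (4 * (r1 / 4))⁻¹ * L2 := by ring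
        rw [this]; positivity
      positivity
    linarith
  have d2 : 0 ≤ L3 * sqnorm z := by positivity
  have d3 : 0 ≤ (4 * (r1 / 4))⁻¹ * (L2 * sqnorm z) := by positivity
  have d4 : 0 ≤ L2 * sqnorm z := by positivity
  have d5 : 0 ≤ L1 * sqnorm z := by positivity
  linarith

lemma genB_crossFun (lamInv : Matrix (Fin n) (Fin m) ℝ) (B : Matrix (Fin m) (Fin m) ℝ)
    (b : St n m → St n m) (p : St n m) :
    genB (vDir B) b (crossFun lamInv) p = ∇ (crossFun lamInv) p (b p) := by
  unfold genB
  rw [add_eq_left]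
  refine Finset.sum_eq_zero fun l _ => ?_
  have hS := contDiff_crossFun (n := n) (m := m) lamInv
  have h1 : (fun q => ∇ (crossFun lamInv) q (vDir B l))
      = fun q : St n m => q.2.1 ⬝ᵥ (lamInv *ᵥ B l) := by
    funext q; rw [fderiv_crossFun]; simp [vDir]
  have h2 := (((contDiff_fderiv_top hS).diff_top p).hasFDerivAt.clm_apply
    (hasFDerivAt_const (vDir B l) p)).hasLineDerivAt (vDir B l)
  rw [show (fun y => (∇ (crossFun lamInv) y) (vDir B l)) = _ from h1] at h2
  unfold HasLineDerivAt at h2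
  have h3 : (fun t : ℝ => (p + t • vDir B l : St n m).2.1 ⬝ᵥ (lamInv *ᵥ B l))
      = fun _ => p.2.1 ⬝ᵥ (lamInv *ᵥ B l) := by
    simp [vDir]
  rw [h3] at h2
  have := h2.unique (hasDerivAt_const _ _)
  simpa using this

lemma genB_add_smul {E : Type} [NormedAddCommGroup E] [NormedSpace ℝ E] {ι : Type} [Fintype ι]
    (v : ι → E) (b : E → E) {f g : E → ℝ} (hf : C∞ f)
    (hg : C∞ g) (c d : ℝ) (p : E) :
    genB v b (fun q => f q - d + c * g q) p = genB v b f p + c * genB v b g p := by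
  have h1 : ∇ (fun q => f q - d + c * g q) = fun q => ∇ f q + c • ∇ g q := by
    funext q
    exact ((((hf.diff_top q).hasFDerivAt).sub_const d).add
      (((hg.diff_top q).hasFDerivAt).const_mul c)).fderiv
  have h2 : ∇ (∇ (fun q => f q - d + c * g q)) p
      = ∇ (∇ f) p + c • ∇ (∇ g) p := by
    rw [h1]
    exact ((((contDiff_fderiv_top hf).diff_top p).hasFDerivAt).add
      ((((contDiff_fderiv_top hg).diff_top p).hasFDerivAt).const_smul c)).fderiv
  unfold genB
  rw [h2, congrFun h1 p]
  simp only [_root_.add_apply, _root_.smul_apply, smul_eq_mul, sum_add_distrib,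
    ← mul_sum]
  ring

end CrossTerm

section MomentBound
open Matrix

/-- Squared Euclidean norm on the state space. -/
def sqSt (p : St n m) : ℝ := sqnorm p.1 + sqnorm p.2.1 + sqnorm p.2.2

lemma sqSt_nonneg (p : St n m) : 0 ≤ sqSt p :=
  add_nonneg (add_nonneg (sqnorm_nonneg _) (sqnorm_nonneg _)) (sqnorm_nonneg _)

lemma norm_sq_le_sqnorm {k : ℕ} (v : Fin k → ℝ) : ‖v‖ ^ 2 ≤ sqnorm v := by
  have h : ‖v‖ ≤ sqrt (sqnorm v) := by
    refine (pi_norm_le_iff_of_nonneg (sqrt_nonneg _)).2 fun i => ?_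
    rw [norm_eq_abs, ← sqrt_sq_eq_abs]
    exact sqrt_le_sqrt (single_le_sum (f := fun i => v i ^ 2)
      (fun i _ => sq_nonneg _) (mem_univ i))
  calc ‖v‖ ^ 2 ≤ sqrt (sqnorm v) ^ 2 := by gcongr
    _ = sqnorm v := sq_sqrt (sqnorm_nonneg v)

lemma sqnorm_le_norm_sq {k : ℕ} (v : Fin k → ℝ) : sqnorm v ≤ k * ‖v‖ ^ 2 := by
  calc ∑ i, v i ^ 2 ≤ ∑ _i : Fin k, ‖v‖ ^ 2 := sum_le_sum fun i _ => by
        rw [← sq_abs, ← norm_eq_abs]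
        have := norm_le_pi_norm v i
        gcongr
    _ = k * ‖v‖ ^ 2 := by simp

lemma norm_sq_le_sqSt (p : St n m) : ‖p‖ ^ 2 ≤ sqSt p := by
  have h : ‖p‖ ≤ sqrt (sqSt p) := by
    have x0 := sqnorm_nonneg p.1
    have y0 := sqnorm_nonneg p.2.1
    have z0 := sqnorm_nonneg p.2.2
    refine max_le ?_ (max_le ?_ ?_) <;>
    refine le_sqrt_of_sq_le ?_ <;> unfold sqSt
    · linarith [norm_sq_le_sqnorm p.1]
    · linarith [norm_sq_le_sqnorm p.2.1]
    · linarith [norm_sq_le_sqnorm p.2.2]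
  calc ‖p‖ ^ 2 ≤ sqrt (sqSt p) ^ 2 := by gcongr
    _ = sqSt p := sq_sqrt (sqSt_nonneg p)

lemma one_add_norm_sq_le (p : St n m) : (1 + ‖p‖) ^ 2 ≤ 2 * (1 + sqSt p) := by
  have := norm_sq_le_sqSt p
  nlinarith [sq_nonneg (1 - ‖p‖)]

lemma continuous_sqSt : Continuous (sqSt : St n m → ℝ) :=
  (((contDiff_sqnorm.comp contDiff_fst).add (contDiff_sqnorm.comp contDiff_snd.fst)).add
    (contDiff_sqnorm.comp contDiff_snd.snd)).continuous

lemma hadamard_bounds {abar : Fin n → ℝ} (habar : ∀ i, 0 < abar i) :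
    ∃ a0 a1, 0 < a0 ∧ 0 < a1 ∧ ∀ x : Fin n → ℝ, a0 * sqnorm x ≤ sqnorm (fun i => abar i * x i) ∧
      sqnorm (fun i => abar i * x i) ≤ a1 * sqnorm x := by
  have h1 : ∃ a0, 0 < a0 ∧ ∀ i, a0 ≤ abar i ^ 2 := by
    rcases isEmpty_or_nonempty (Fin n) with h | h
    · exact ⟨1, one_pos, fun i => h.elim i⟩
    · obtain ⟨i0, hi0⟩ := Finite.exists_min fun i => abar i ^ 2
      exact ⟨abar i0 ^ 2, pow_pos (habar i0) 2, hi0⟩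
  obtain ⟨a0, ha0, h0⟩ := h1
  refine ⟨a0, 1 + ∑ i, abar i ^ 2, ha0, by positivity, fun x => ⟨?_, ?_⟩⟩
  · unfold sqnorm
    rw [mul_sum]
    refine sum_le_sum fun i _ => ?_
    rw [mul_pow]; exact mul_le_right (h0 i)
  · unfold sqnorm
    rw [mul_sum]
    refine sum_le_sum fun i _ => ?_
    rw [mul_pow]
    refine mul_le_right ?_
    have := single_le_sum (f := fun i => abar i ^ 2) (fun i _ => sq_nonneg _)
      (mem_univ i)
    linarith

/-- The Lyapunov function: energy above its lower bound plus a small cross term. -/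
def lyapFun (U : (Fin n → ℝ) → ℝ) (Um : ℝ) (lamInv : Matrix (Fin n) (Fin m) ℝ) (d : ℝ)
    (p : St n m) : ℝ := Wfun U p - Um + d * crossFun lamInv p

lemma lyapFun_contDiff {U : (Fin n → ℝ) → ℝ} (hU : C∞ U) (Um : ℝ)
    (lamInv : Matrix (Fin n) (Fin m) ℝ) (d : ℝ) : C∞ (lyapFun U Um lamInv d) :=
  ((contDiff_Wfun hU).sub contDiff_const).add (contDiff_const.mul (contDiff_crossFun lamInv))

lemma lyapFun_bounds {U : (Fin n → ℝ) → ℝ} {abar : Fin n → ℝ} (habar : ∀ i, 0 < abar i)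
    {Um UM : ℝ} (hUlow : ∀ x, sqnorm (fun i => abar i * x i) + Um ≤ U x)
    (hUup : ∀ x, U x ≤ sqnorm (fun i => abar i * x i) + UM)
    (lamInv : Matrix (Fin n) (Fin m) ℝ) :
    ∃ c k C, 0 < c ∧ 0 < k ∧ 0 < C ∧ ∀ d, 0 ≤ d → d ≤ k → ∀ p : St n m,
      c * sqSt p ≤ lyapFun U Um lamInv d p ∧ lyapFun U Um lamInv d p ≤ C * (1 + sqSt p) := by
  obtain ⟨a0, a1, ha0, ha1, hab⟩ := hadamard_bounds habar
  obtain ⟨CS, hCS0, hCS⟩ := abs_crossFun_le (n := n) (m := m) lamInv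
  set c := min a0 (1 / 2) with hc
  have hc0 : 0 < c := by positivity
  refine ⟨c / 2, min 1 (c / (2 * (CS + 1))), a1 + 1 + |UM - Um| + CS, by grind,
    by positivity, by grind, fun d hd hdk p => ?_⟩
  have hd1 : d ≤ 1 := by grind
  have hd2 : d * CS ≤ c / 2 := by
    have h1 := hdk.trans (min_le_right _ _)
    rw [le_div_iff₀ (by grind)] at h1
    nlinarith
  have hS : |crossFun lamInv p| ≤ CS * sqSt p := hCS p
  have hdS : |d * crossFun lamInv p| ≤ d * CS * sqSt p := by
    rw [abs_mul, abs_of_nonneg hd, mul_assoc]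
    gcongr
  have hq := sqSt_nonneg p
  have x0 := sqnorm_nonneg p.1
  have y0 := sqnorm_nonneg p.2.1
  have z0 := sqnorm_nonneg p.2.2
  obtain ⟨b1, b2⟩ := hab p.1
  have u1 := hUlow p.1
  have u2 := hUup p.1
  have l1 : c * sqSt p ≤ Wfun U p - Um := by
    have t1 := mul_le_right (min_le_left a0 (1/2)) x0
    have t2 := mul_le_right (min_le_right a0 (1/2)) y0
    have t3 := mul_le_right (min_le_right a0 (1/2)) z0
    unfold Wfun sqSt
    linarith
  have l2 : Wfun U p - Um ≤ |UM - Um| + (a1 + 1) * sqSt p := by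
    have t1 := mul_nonneg ha1.le y0
    have t2 := mul_nonneg ha1.le z0
    unfold Wfun sqSt
    grind
  obtain ⟨s1, s2⟩ := abs_le.1 hdS
  have e1 := mul_le_right hd2 hq
  have e2 := mul_le_right (mul_le_right hd1 hCS0) hq
  have e3 := mul_nonneg (abs_nonneg (UM - Um)) hq
  unfold lyapFun
  grind

lemma genB_lyapFun_le {U : (Fin n → ℝ) → ℝ} (hU : C∞ U)
    {abar : Fin n → ℝ} (habar : ∀ i, 0 < abar i)
    {r1 r2 Ug : ℝ} (hr1 : 0 < r1) (hr2 : 0 < r2) (hUg : 0 < Ug) {Um UM : ℝ}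
    (hUlow : ∀ x, sqnorm (fun i => abar i * x i) + Um ≤ U x)
    (hUup : ∀ x, U x ≤ sqnorm (fun i => abar i * x i) + UM)
    (hgrad1 : ∀ x, r1 * sqnorm x - Ug ≤ ∑ i, gradp U x i * x i)
    (hgrad2 : ∀ x, sqnorm (gradp U x) ≤ r2 * sqnorm x + Ug)
    {A B : Matrix (Fin m) (Fin m) ℝ} (hB : Bᵀ * B = (1 / 2 : ℝ) • (A + Aᵀ)) {Ac : ℝ} (hAc : 0 < Ac)
    (hApd : ∀ v : Fin m → ℝ, Ac * sqnorm v ≤ ∑ j, v j * A.mulVec v j)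
    (lam : Matrix (Fin m) (Fin n) ℝ) (lamInv : Matrix (Fin n) (Fin m) ℝ)
    (hlamInv : lamInv * lam = 1) :
    ∃ c3 k C1 c5, 0 < c3 ∧ 0 < k ∧ 0 ≤ C1 ∧ 0 < c5 ∧ ∃ C4, 0 < C4 ∧ ∀ d, 0 < d → d ≤ k →
      (∀ p : St n m, c3 * sqSt p ≤ lyapFun U Um lamInv d p ∧
        lyapFun U Um lamInv d p ≤ C4 * (1 + sqSt p)) ∧
      ∀ τ, 0 < τ → d * (1 + τ ^ 2) ≤ k * τ → ∀ p,
        genB (vDir B) (bDrift (gradp U) A lam τ) (lyapFun U Um lamInv d) p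
          ≤ C1 - c5 * d * lyapFun U Um lamInv d p := by
  obtain ⟨c, k1, C, hc, hk1, hC, hbd⟩ := lyapFun_bounds (m := m) habar hUlow hUup lamInv
  obtain ⟨CS, hCS0, hCS⟩ := fderiv_crossFun_bDrift hr1 hr2 hUg hgrad1 hgrad2 A lam lamInv hlamInv
  set k := min (min k1 1) (Ac / (2 * (CS + 1))) with hk
  have hk0 : 0 < k := by positivity
  have hkk1 : k ≤ k1 := (min_le_left _ _).trans (min_le_left _ _)
  have hk11 : k ≤ 1 := (min_le_left _ _).trans (min_le_right _ _)
  have hkA : k * CS ≤ Ac / 2 := by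
    have h1 : k ≤ Ac / (2 * (CS + 1)) := min_le_right _ _
    rw [le_div_iff₀ (by positivity)] at h1
    nlinarith
  set c6 := min (min (1 / 4) (r1 / 4)) (Ac / 2) with hc6
  have hc60 : 0 < c6 := by positivity
  have q1 : c6 ≤ 1 / 4 := (min_le_left _ _).trans (min_le_left _ _)
  have q2 : c6 ≤ r1 / 4 := (min_le_left _ _).trans (min_le_right _ _)
  have q3 : c6 ≤ Ac / 2 := min_le_right _ _
  refine ⟨c, k, |A.trace| + CS + c6, c6 / C, hc, hk0, by positivity, by positivity, C, hC,
    fun d hd hdk => ⟨hbd d hd.le (hdk.trans hkk1), fun τ hτ hdτ p => ?_⟩⟩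
  have h1 : genB (vDir B) (bDrift (gradp U) A lam τ) (lyapFun U Um lamInv d) p
      = genB (vDir B) (bDrift (gradp U) A lam τ) (Wfun U) p
        + d * genB (vDir B) (bDrift (gradp U) A lam τ) (crossFun lamInv) p :=
    genB_add_smul _ _ (contDiff_Wfun hU) (contDiff_crossFun lamInv) d Um p
  rw [h1, genB_Wfun hU hB, fderiv_Wfun_bDrift hU, genB_crossFun]
  have h2 := mul_le_left (hCS τ p) hd.le
  have h3 : Ac * sqnorm p.2.2 ≤ p.2.2 ⬝ᵥ (Aᵀ *ᵥ p.2.2) := by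
    rw [mulVec_transpose, dotProduct_comm, ← dotProduct_mulVec]
    exact hApd p.2.2
  have h4 := mul_le_left h3 hτ.le
  have x0 := sqnorm_nonneg p.1
  have y0 := sqnorm_nonneg p.2.1
  have z0 := sqnorm_nonneg p.2.2
  have hdτ' : d ≤ τ := by
    have s1 : d * 1 ≤ d * (1 + τ ^ 2) := mul_le_left (by nlinarith) hd.le
    have s2 : k * τ ≤ 1 * τ := by gcongr
    linarith
  have h5 : d * (1 + τ ^ 2) * (CS * sqnorm p.2.2) ≤ τ * (Ac / 2 * sqnorm p.2.2) := by
    have s1 := mul_le_right hdτ (mul_nonneg hCS0 z0)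
    have s2 := mul_le_left (mul_le_right hkA z0) hτ.le
    linarith
  have h6 : d * (c6 * sqnorm p.2.2) ≤ τ * (Ac / 2 * sqnorm p.2.2) := by
    have s1 := mul_le_mul hdτ' (mul_le_right q3 z0) (by positivity) hτ.le
    exact s1
  have h7 := mul_le_left (mul_le_right q1 y0) hd.le
  have h8 := mul_le_left (mul_le_right q2 x0) hd.le
  have h9 := (hbd d hd.le (hdk.trans hkk1) p).2
  have h10 : c6 / C * d * lyapFun U Um lamInv d p ≤ d * c6 * (1 + sqSt p) := by
    have s1 := mul_le_left h9 (show 0 ≤ c6 / C * d by positivity)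
    have s2 : c6 / C * d * (C * (1 + sqSt p)) = d * c6 * (1 + sqSt p) := by field_simp
    linarith
  have h11 : d * c6 * (1 + sqSt p) = d * c6 + d * (c6 * sqnorm p.1) + d * (c6 * sqnorm p.2.1)
      + d * (c6 * sqnorm p.2.2) := by unfold sqSt; ring
  have h12 : d * c6 ≤ c6 := mul_le_of_le_one_left hc60.le (hdk.trans hk11)
  have h13 : d * CS ≤ CS := mul_le_of_le_one_left hCS0 (hdk.trans hk11)
  have := le_abs_self A.trace
  linarith

theorem moment_bound {U : (Fin n → ℝ) → ℝ} (hU : C∞ U)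
    {abar : Fin n → ℝ} (habar : ∀ i, 0 < abar i)
    {r1 r2 Ug : ℝ} (hr1 : 0 < r1) (hr2 : 0 < r2) (hUg : 0 < Ug) {Um UM : ℝ}
    (hUlow : ∀ x, sqnorm (fun i => abar i * x i) + Um ≤ U x)
    (hUup : ∀ x, U x ≤ sqnorm (fun i => abar i * x i) + UM)
    (hgrad1 : ∀ x, r1 * sqnorm x - Ug ≤ ∑ i, gradp U x i * x i)
    (hgrad2 : ∀ x, sqnorm (gradp U x) ≤ r2 * sqnorm x + Ug)
    {A B : Matrix (Fin m) (Fin m) ℝ} (hB : Bᵀ * B = (1 / 2 : ℝ) • (A + Aᵀ)) {Ac : ℝ} (hAc : 0 < Ac)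
    (hApd : ∀ v : Fin m → ℝ, Ac * sqnorm v ≤ ∑ j, v j * A.mulVec v j)
    (lam : Matrix (Fin m) (Fin n) ℝ) (lamInv : Matrix (Fin n) (Fin m) ℝ)
    (hlamInv : lamInv * lam = 1)
    {T : ℝ → ℝ} (hTpos : ∀ t, 0 < T t) (hTc : Continuous T)
    (hTlim : Tendsto T atTop (nhds 0)) (hTanti : ∃ t0, AntitoneOn T (Ici t0))
    {mFam : ℝ → St n m → ℝ} (hMsmooth : ∀ t, C∞ (mFam t))
    (hMpos : ∀ t p, 0 < mFam t p) (hMprob : ∀ t, ∫ p : St n m, mFam t p = 1)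
    (hFP : ∀ t : ℝ, 0 ≤ t → ∀ p : St n m,
      HasDerivAt (fun s => mFam s p) (genLadj U A lam (T t) (mFam t) p) t)
    (hmom : Integrable (fun q : St n m => (sqrt (sqnorm q.1) ^ 2 +
      sqrt (sqnorm q.2.1) ^ 2 + sqrt (sqnorm q.2.2) ^ 2) * mFam 0 q)) :
    ∃ C, 0 < C ∧ ∀ᶠ t in atTop, ∀ s ∈ Icc 0 t,
      Integrable (fun p => (1 + ‖p‖) ^ 2 * mFam s p) ∧
      ∫ p, (1 + ‖p‖) ^ 2 * mFam s p ≤ C * (1 + (T t)⁻¹) := by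
  obtain ⟨c3, k, C1, c5, hc3, hk, hC1, hc5, C4, hC4, hL⟩ := genB_lyapFun_le hU habar hr1 hr2 hUg
    hUlow hUup hgrad1 hgrad2 hB hAc hApd lam lamInv hlamInv
  have H := fpFlow_of hU hB lam hTpos hTc hMsmooth hMpos hMprob hFP
  have hsq0 : Integrable (fun q : St n m => sqSt q * mFam 0 q) := by
    refine hmom.congr (.of_forall fun q => ?_)
    simp only [sq_sqrt (sqnorm_nonneg _)]
    rfl
  have hint : ∀ t, Integrable (mFam t) := fun t => by
    by_contra hcon
    have := hMprob t
    rw [integral_undef hcon] at this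
    linarith
  set I0 := ∫ q : St n m, sqSt q * mFam 0 q
  have hI0 : 0 ≤ I0 := integral_nonneg fun q => mul_nonneg (sqSt_nonneg q) (hMpos 0 q).le
  -- a global upper bound on the temperature and a comparison with the terminal one
  obtain ⟨Tm, hTm0, hTm⟩ : ∃ Tm, 0 < Tm ∧ ∀ s, 0 ≤ s → T s ≤ Tm := by
    obtain ⟨t1, ht1⟩ := eventually_atTop.1 (hTlim.eventually (gt_mem_nhds one_pos))
    obtain ⟨M, hM⟩ := (isCompact_Icc (a := (0:ℝ)) (b := t1)).exists_bound_of_continuousOn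
      hTc.continuousOn
    refine ⟨max M 1, by simp, fun s hs => ?_⟩
    rcases le_total s t1 with h | h
    · exact ((le_abs_self _).trans (hM s ⟨hs, h⟩)).trans (le_max_left _ _)
    · exact (ht1 s h).le.trans (le_max_right _ _)
  have hTcomp : ∀ᶠ t in atTop, ∀ s ∈ Icc 0 t, T t ≤ T s := by
    obtain ⟨t0, ht0⟩ := hTanti
    obtain ⟨s0, hs0, hmin⟩ := (isCompact_Icc (a := (0:ℝ)) (b := max t0 0)).exists_isMinOn
      ⟨0, by simp⟩ hTc.continuousOn
    filter_upwards [hTlim.eventually (gt_mem_nhds (hTpos s0)), eventually_ge_atTop t0]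
      with t h1 h2 s hs
    rcases le_total s (max t0 0) with h | h
    · exact h1.le.trans (hmin ⟨hs.1, h⟩)
    · exact ht0 (mem_Ici.2 ((le_max_left _ _).trans h)) (mem_Ici.2 h2) hs.2
  set k' := k / (1 + Tm ^ 2) with hk'
  set D := (C4 * (1 + I0) + C1 / (c5 * k')) / c3
  refine ⟨2 * (1 + D), by positivity, ?_⟩
  filter_upwards [hTcomp, hTlim.eventually (gt_mem_nhds one_pos), eventually_ge_atTop 0]
    with t ht1 ht2 ht0 s hs
  have hTt := hTpos t
  set d := k' * T t with hd
  have hd0 : 0 < d := by positivity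
  have hdk : d ≤ k := by
    have : k' ≤ k := div_le_self hk.le (by nlinarith)
    calc d ≤ k' * 1 := by rw [hd]; gcongr
      _ ≤ k := by linarith
  obtain ⟨hb, hLd⟩ := hL d hd0 hdk
  have hR := lyapFun_contDiff hU Um lamInv d
  have hi0 : Integrable (fun p => lyapFun U Um lamInv d p * mFam 0 p) := by
    refine (((hint 0).const_mul C4).add (hsq0.const_mul C4)).mono'
      (hR.continuous.mul (hMsmooth 0).continuous).aestronglyMeasurable
      (.of_forall fun p => ?_)
    have h0 : 0 ≤ lyapFun U Um lamInv d p :=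
      (mul_nonneg hc3.le (sqSt_nonneg p)).trans (hb p).1
    rw [norm_of_nonneg (mul_nonneg h0 (hMpos 0 p).le)]
    have := mul_le_right (hb p).2 (hMpos 0 p).le
    simp only [Pi.add_apply]
    linarith
  have hi0' : ∫ p, lyapFun U Um lamInv d p * mFam 0 p ≤ C4 * (1 + I0) := by
    have h1 : ∫ p, (C4 * mFam 0 p + C4 * (sqSt p * mFam 0 p)) = C4 * (1 + I0) := by
      rw [integral_add ((hint 0).const_mul C4) (hsq0.const_mul C4), integral_const_mul,
        integral_const_mul, hMprob 0]; ring
    rw [← h1]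
    refine integral_mono hi0 (((hint 0).const_mul C4).add (hsq0.const_mul C4)) fun p => ?_
    have := mul_le_right (hb p).2 (hMpos 0 p).le
    linarith
  have key := H.lyapunov hR hc3 (fun p => (mul_le_left (norm_sq_le_sqSt p)
    hc3.le).trans (hb p).1) (c := c5 * d) (C := C1) (t := t) (by positivity) hC1
    (fun r hr p => by
      have hmax : max r 0 = r := max_eq_left hr.1
      rw [← bDrift_eq_affDrift]
      simp only [hmax]
      have hTr := hTpos r
      refine hLd (T r)⁻¹ (by positivity) ?_ p
      have e1 : d * (1 + (T r)⁻¹ ^ 2) = d * (1 + T r ^ 2) / T r ^ 2 := by field_simp; ring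
      rw [e1, div_le_iff₀ (by positivity)]
      have e2 : k * (T r)⁻¹ * T r ^ 2 = k * T r := by field_simp
      have e3 : d * (1 + T r ^ 2) ≤ d * (1 + Tm ^ 2) := by
        have := hTm r hr.1
        gcongr
      have e4 : d * (1 + Tm ^ 2) = k * T t := by rw [hd, hk']; field_simp
      have e5 := mul_le_left (ht1 r hr) hk.le
      linarith) (by simpa using hi0) s hs
  simp only [max_self, max_eq_left hs.1] at key
  obtain ⟨ki, kb⟩ := key
  have hsqi : Integrable (fun p : St n m => sqSt p * mFam s p) := by
    refine (ki.div_const c3).mono' (continuous_sqSt.mul (hMsmooth s).continuous).aestronglyMeasurable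
      (.of_forall fun p => ?_)
    rw [norm_of_nonneg (mul_nonneg (sqSt_nonneg p) (hMpos s p).le), le_div_iff₀ hc3]
    have := mul_le_right (hb p).1 (hMpos s p).le
    linarith
  have hsqb : ∫ p : St n m, sqSt p * mFam s p ≤ D * (1 + (T t)⁻¹) := by
    have h1 : c3 * ∫ p : St n m, sqSt p * mFam s p ≤ ∫ p, lyapFun U Um lamInv d p * mFam s p := by
      rw [← integral_const_mul]
      refine integral_mono (hsqi.const_mul c3) ki fun p => ?_
      have := mul_le_right (hb p).1 (hMpos s p).le
      linarith
    have h2 : C1 / (c5 * d) = C1 / (c5 * k') * (T t)⁻¹ := by ring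
    have h3 : D * (1 + (T t)⁻¹) * c3 = (C4 * (1 + I0) + C1 / (c5 * k')) * (1 + (T t)⁻¹) := by
      simp only [D]; field_simp
    have h4 : 0 ≤ C4 * (1 + I0) * (T t)⁻¹ := by positivity
    have h5 : 0 ≤ C1 / (c5 * k') := by positivity
    rw [← mul_le_mul_iff_of_pos_right hc3, h3]
    linarith
  have hmaj : Integrable (fun p : St n m => 2 * mFam s p + 2 * (sqSt p * mFam s p)) :=
    by fun_prop
  have hle : ∀ p : St n m, (1 + ‖p‖) ^ 2 * mFam s p ≤ 2 * mFam s p + 2 * (sqSt p * mFam s p) :=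
    fun p => by
      have := mul_le_right (one_add_norm_sq_le p) (hMpos s p).le
      linarith
  have hfi : Integrable (fun p : St n m => (1 + ‖p‖) ^ 2 * mFam s p) := by
    refine hmaj.mono' ((((continuous_const.add continuous_norm).pow 2).mul
      (hMsmooth s).continuous).aestronglyMeasurable) (.of_forall fun p => ?_)
    rw [norm_of_nonneg (mul_nonneg (sq_nonneg _) (hMpos s p).le)]
    exact hle p
  refine ⟨hfi, (integral_mono hfi hmaj hle).trans ?_⟩
  rw [integral_add ((hint s).const_mul 2) (hsqi.const_mul 2), integral_const_mul,
    integral_const_mul, hMprob s]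
  have : 0 < (T t)⁻¹ := by positivity
  linarith

end MomentBound

variable [Nonempty ι] {κ : Type} [Fintype κ] {b : E → E} {w : κ → E} {β η CP : ℝ} {ρ : E → ℝ}

/-- Data of a diffusion with constant coefficients in the noise, an invariant probability density
`ρ` satisfying a Poincaré inequality for the gradient along `w`, and the structural inequality
making `|Dg(w)|² + β (g - c)²` decay along the semigroup. -/
structure Frozen (μ : Measure E) (v : ι → E) (b : E → E) (w : κ → E) (β η CP : ℝ)
    (ρ : E → ℝ) : Prop where
  b_smooth : C∞ b
  b_bd : ∀ j, ∃ C, BD j C (∇ b)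
  b_lin : ∃ C, ∀ p, ‖b p‖ ≤ C * (1 + ‖p‖)
  β_nonneg : 0 ≤ β
  η_pos : 0 < η
  η_le : η ≤ 1
  CP_nonneg : 0 ≤ CP
  str : ∀ (p : E) (ξ : E →L[ℝ] ℝ), 2 * ∑ k, ξ (w k) * ξ (∇ b p (w k))
      - 2 * β * ∑ l, ξ (v l) ^ 2 ≤ -η * ∑ k, ξ (w k) ^ 2
  cont : Continuous ρ
  nonneg : ∀ p, 0 ≤ ρ p
  mass : ∫ p, ρ p ∂μ = 1
  moment : Integrable (fun p => (1 + ‖p‖) ^ 2 * ρ p) μ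
  inv : ∀ (K : ℝ) (f : E → ℝ), BD 2 K f → ∫ p, genB v b f p * ρ p ∂μ = 0
  poincare : ∀ (K : ℝ) (g : E → ℝ), BD 1 K g →
    ∫ p, (g p - ∫ q, g q * ρ q ∂μ) ^ 2 * ρ p ∂μ ≤ CP * ∫ p, dirQ w g p * ρ p ∂μ

lemma stepP_mono (v : ι → E) (b : E → E) (h : ℝ) {f g : E → ℝ} (hfg : ∀ p, f p ≤ g p) (p : E) :
    stepP v b h f p ≤ stepP v b h g p :=
  symAvg_mono v _ fun _ => ⟨hfg _, hfg _⟩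

lemma stepP_const (v : ι → E) (b : E → E) (h : ℝ) (c : ℝ) (p : E) :
    stepP v b h (fun _ => c) p = c := symAvg_const v _ c _

lemma BD.apply_dir {j : ℕ} {K : ℝ} {g : E → ℝ} (hg : BD (j + 1) K g) (a : E) :
    BD j (‖a‖ * K) (fun p => ∇ g p a) := by
  have h := hg.fderiv.clm_left (ContinuousLinearMap.apply ℝ ℝ a)
  have h2 : ‖ContinuousLinearMap.apply ℝ ℝ a‖ ≤ ‖a‖ :=
    opNorm_le_bound _ (norm_nonneg _) fun f => by
      rw [ContinuousLinearMap.apply_apply, mul_comm]; exact f.le_opNorm a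
  exact h.mono le_rfl (mul_le_right h2 hg.nonneg)

lemma BD.dirQ {j : ℕ} {K : ℝ} {g : E → ℝ} (hg : BD (j + 1) K g) (w : κ → E) :
    BD j ((∑ k, 2 ^ j * ‖w k‖ ^ 2) * K ^ 2) (_root_.dirQ w g) := by
  have h := BD.sum Finset.univ (fun k _ => (hg.apply_dir (w k)).mul (hg.apply_dir (w k)))
  have e : (fun p => ∑ k : κ, ∇ g p (w k) * ∇ g p (w k))
      = _root_.dirQ w g := by
    unfold _root_.dirQ; simp [sq]
  rw [e] at h
  refine h.mono le_rfl (le_of_eq ?_)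
  rw [sum_mul]
  grind

lemma BD.sub_const_sq {j : ℕ} {K : ℝ} {g : E → ℝ} (hg : BD j K g) {c : ℝ} (hc : |c| ≤ K) :
    BD j ((2 ^ j * 4) * K ^ 2) (fun p => (g p - c) ^ 2) := by
  have h0 : BD j (2 * K) (fun p => g p + -c) :=
    (hg.add (BD.const (-c))).mono le_rfl (by rw [norm_neg, norm_eq_abs]; linarith)
  have h := h0.mul h0
  grind

/-- The functional `|Dg(w)|² + β (g - c)²`. -/
def thetaF (w : κ → E) (β : ℝ) (g : E → ℝ) (c : ℝ) (p : E) : ℝ :=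
  dirQ w g p + β * (g p - c) ^ 2

lemma thetaF_nonneg (w : κ → E) {β : ℝ} (hβ : 0 ≤ β) (g : E → ℝ) (c : ℝ) (p : E) :
    0 ≤ thetaF w β g c p := add_nonneg (dirQ_nonneg w g p) (by positivity)

lemma BD.thetaF_sub {K : ℝ} {g : E → ℝ} (hg : BD 4 K g) (w : κ → E) {β η : ℝ} (hβ : 0 ≤ β)
    (hη : 0 ≤ η) (hη1 : η ≤ 1) {c : ℝ} (hc : |c| ≤ K) :
    BD 3 ((2 * (∑ k, 2 ^ 3 * ‖w k‖ ^ 2) + β * 32) * K ^ 2)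
      (fun p => thetaF w β g c p - η * _root_.dirQ w g p) := by
  have hd := BD.dirQ (j := 3) hg w
  have hs := (hg.mono (by norm_num : 3 ≤ 4) le_rfl).sub_const_sq hc
  have h := (hd.smul (1 - η)).add (hs.smul β)
  have e : (fun p => (1 - η) • _root_.dirQ w g p + β • (g p - c) ^ 2)
      = fun p => thetaF w β g c p - η * _root_.dirQ w g p := by
    funext p; unfold thetaF; ring
  rw [e] at h
  refine h.mono le_rfl ?_
  rw [abs_of_nonneg hβ, abs_of_nonneg (by linarith)]
  have : 0 ≤ (∑ k, 2 ^ 3 * ‖w k‖ ^ 2) * K ^ 2 := hd.nonneg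
  nlinarith

namespace Frozen

lemma integrable_ρ (H : Frozen μ v b w β η CP ρ) : Integrable ρ μ := by
  by_contra h
  have := H.mass
  rw [integral_undef h] at this
  linarith

lemma integrable_mul (H : Frozen μ v b w β η CP ρ) {f : E → ℝ} (hf : Continuous f) {K : ℝ}
    (hK : ∀ p, |f p| ≤ K) : Integrable (fun p => f p * ρ p) μ :=
  H.integrable_ρ.bdd_mul hf.aestronglyMeasurable (.of_forall hK)

/-- Mean against `ρ`. -/
def mean (μ : Measure E) (ρ : E → ℝ) (g : E → ℝ) : ℝ := ∫ p, g p * ρ p ∂μ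

/-- The modified energy `∫ (|Dg(w)|² + β (g - ∫gρ)²) ρ`. -/
def energy (μ : Measure E) (w : κ → E) (β : ℝ) (ρ : E → ℝ) (g : E → ℝ) : ℝ :=
  ∫ p, thetaF w β g (mean μ ρ g) p * ρ p ∂μ

lemma abs_mean_le (H : Frozen μ v b w β η CP ρ) {f : E → ℝ} {K : ℝ}
    (hK : ∀ p, |f p| ≤ K) : |mean μ ρ f| ≤ K := by
  have h := norm_integral_le_of_norm_le (μ := μ) (f := fun p => f p * ρ p)
    (H.integrable_ρ.const_mul K) (.of_forall fun p => by
      rw [norm_mul, norm_eq_abs, norm_eq_abs, abs_of_nonneg (H.nonneg p)]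
      exact mul_le_right (hK p) (H.nonneg p))
  rw [integral_const_mul, H.mass, mul_one] at h
  exact h

lemma energy_nonneg (H : Frozen μ v b w β η CP ρ) (g : E → ℝ) : 0 ≤ energy μ w β ρ g :=
  integral_nonneg fun p => mul_nonneg (thetaF_nonneg w H.β_nonneg g _ p) (H.nonneg p)

lemma integral_sq_sub (H : Frozen μ v b w β η CP ρ) {g : E → ℝ} (hg : Continuous g) {K : ℝ}
    (hK : ∀ p, |g p| ≤ K) (c : ℝ) :
    ∫ p, (g p - c) ^ 2 * ρ p ∂μ
      = (∫ p, (g p - mean μ ρ g) ^ 2 * ρ p ∂μ) + (mean μ ρ g - c) ^ 2 := by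
  have i1 := H.integrable_mul hg hK
  have i2 : Integrable (fun p => (g p) ^ 2 * ρ p) μ :=
    H.integrable_mul (K := K ^ 2) (hg.pow 2) fun p => by
      rw [abs_pow]; exact pow_le_pow_left₀ (abs_nonneg _) (hK p) 2
  have key : ∀ c : ℝ, ∫ p, (g p - c) ^ 2 * ρ p ∂μ
      = (∫ p, g p ^ 2 * ρ p ∂μ) - 2 * c * mean μ ρ g + c ^ 2 := by
    intro c
    have e : (fun p => (g p - c) ^ 2 * ρ p)
        = fun p => (g p ^ 2 * ρ p - (2 * c) * (g p * ρ p)) + c ^ 2 * ρ p := by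
      grind
    have i12 : Integrable (fun p => (g p) ^ 2 * ρ p - (2 * c) * (g p * ρ p)) μ :=
      by fun_prop
    rw [e, integral_add i12 (H.integrable_ρ.const_mul _),
      integral_sub i2 (i1.const_mul _), integral_const_mul, integral_const_mul, H.mass]
    unfold mean; ring
  grind

lemma integral_thetaF (H : Frozen μ v b w β η CP ρ) {g : E → ℝ} {K : ℝ} (hg : BD 1 K g) (c : ℝ) :
    ∫ p, thetaF w β g c p * ρ p ∂μ
      = (∫ p, dirQ w g p * ρ p ∂μ) + β * ∫ p, (g p - c) ^ 2 * ρ p ∂μ := by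
  have hd := BD.dirQ (j := 0) hg w
  have i1 : Integrable (fun p => dirQ w g p * ρ p) μ :=
    H.integrable_mul hd.1.continuous hd.norm_le
  have hc := hg.1.continuous
  have i2 : Integrable (fun p => (g p - c) ^ 2 * ρ p) μ :=
    H.integrable_mul (K := (K + |c|) ^ 2) ((hc.sub continuous_const).pow 2) fun p => by
      rw [abs_pow]
      refine pow_le_pow_left₀ (abs_nonneg _) ?_ 2
      have := hg.norm_le p
      rw [norm_eq_abs] at this
      grind
  rw [← integral_const_mul, ← integral_add i1 (i2.const_mul _)]
  refine integral_congr_ae (.of_forall fun p => ?_)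
  simp only [thetaF]; ring

/-- Change of the mean over one step. -/
lemma mean_stepP (H : Frozen μ v b w β η CP ρ) : ∃ C, 0 ≤ C ∧ ∀ h, 0 ≤ h → h ≤ 1 →
    ∀ (f : E → ℝ) (K : ℝ), BD 3 K f →
      |mean μ ρ (stepP v b h f) - mean μ ρ f| ≤ C * K * (h * √h) := by
  obtain ⟨Cb, hb⟩ := H.b_lin
  obtain ⟨C, hC, hs⟩ := stepP_error v b (Cv := ∑ l, ‖v l‖)
    (fun l => single_le_sum (f := fun l => ‖v l‖) (fun i _ => norm_nonneg _)
      (mem_univ l)) hb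
  set M := ∫ p, (1 + ‖p‖) ^ 2 * ρ p ∂μ with hM
  have hM0 : 0 ≤ M := integral_nonneg fun p => mul_nonneg (by positivity) (H.nonneg p)
  have hCb : 0 ≤ Cb := by
    have := (norm_nonneg _).trans (hb 0); simp_all
  refine ⟨C * M, by positivity, fun h h0 h1 f K hf => ?_⟩
  have hK := hf.nonneg
  have hfc := hf.1.continuous
  have hPc : Continuous (stepP v b h f) := by
    exact (BD.symAvg v _ hf).1.continuous.comp (drift_contDiff H.b_smooth h).continuous
  have hPb : ∀ p, |stepP v b h f p| ≤ K := fun p => (BD.symAvg v _ hf).norm_le _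
  have i1 := H.integrable_mul hPc hPb
  have i2 := H.integrable_mul hfc hf.norm_le
  have hf2 := hf.mono (by norm_num : 2 ≤ 3) le_rfl
  have i3 : Integrable (fun p => genB v b f p * ρ p) μ := by
    refine (H.moment.const_mul (K * (Cb + ∑ l, ‖v l‖ * ‖v l‖))).mono'
      (((genB_contDiff H.b_smooth hf.1).continuous.mul H.cont).aestronglyMeasurable)
      (.of_forall fun p => ?_)
    rw [norm_mul, norm_eq_abs, norm_eq_abs, abs_of_nonneg (H.nonneg p), ← mul_assoc]
    refine mul_le_right ?_ (H.nonneg p)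
    refine (abs_genB_le_linear hCb hb hf2 p).trans ?_
    have h3 : 0 ≤ K * (Cb + ∑ l, ‖v l‖ * ‖v l‖) :=
      by positivity
    exact mul_le_left (by nlinarith [norm_nonneg p]) h3
  have e : mean μ ρ (stepP v b h f) - mean μ ρ f
      = ∫ p, (stepP v b h f p - f p - h * genB v b f p) * ρ p ∂μ := by
    have e2 : (fun p => (stepP v b h f p - f p - h * genB v b f p) * ρ p)
        = fun p => (stepP v b h f p * ρ p - f p * ρ p) - h * (genB v b f p * ρ p) := by
      grind
    have i12 : Integrable (fun p => stepP v b h f p * ρ p - f p * ρ p) μ := i1.sub i2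
    rw [e2, integral_sub i12 (i3.const_mul _), integral_sub i1 i2, integral_const_mul,
      H.inv K f hf2]
    simp [mean]
  rw [e]
  have h4 := norm_integral_le_of_norm_le (μ := μ)
    (f := fun p => (stepP v b h f p - f p - h * genB v b f p) * ρ p)
    (H.moment.const_mul (C * K * (h * √h))) (.of_forall fun p => by
      rw [norm_mul, norm_eq_abs, norm_eq_abs, abs_of_nonneg (H.nonneg p), ← mul_assoc]
      exact mul_le_right (hs h h0 h1 f K hf p) (H.nonneg p))
  rw [integral_const_mul, norm_eq_abs] at h4
  linarith

/-- One step of the discretised semigroup. -/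
theorem one_step (H : Frozen μ v b w β η CP ρ) : ∃ C, 0 ≤ C ∧ ∀ h, 0 ≤ h → h ≤ 1 →
    ∀ (g : E → ℝ) (K : ℝ), BD 4 K g →
      BD 4 ((1 + C * h) * K) (stepP v b h g) ∧
      (∀ Θ, (∀ p, thetaF w β g 0 p ≤ Θ) →
        ∀ p, thetaF w β (stepP v b h g) 0 p ≤ Θ + C * K ^ 2 * (h * √h)) ∧
      |mean μ ρ (stepP v b h g) - mean μ ρ g| ≤ C * K * (h * √h) ∧
      energy μ w β ρ (stepP v b h g)
        ≤ (1 - h * (η / (1 + β * CP))) * energy μ w β ρ g + C * K ^ 2 * (h * √h) := by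
  obtain ⟨C1, hC1, hm⟩ := H.mean_stepP
  obtain ⟨D4, hD4⟩ := H.b_bd 4
  obtain ⟨C2, hC2, hcd⟩ := BD.comp_drift H.b_smooth 4 hD4
  obtain ⟨C3, hC3, hθ⟩ := theta_step v w b (Cv := ∑ l, ‖v l‖) (Cw := ∑ k, ‖w k‖) H.β_nonneg
    H.b_smooth (fun l => single_le_sum (f := fun l => ‖v l‖) (fun i _ => norm_nonneg _)
      (mem_univ l)) (fun l => single_le_sum (f := fun l => ‖w l‖)
      (fun i _ => norm_nonneg _) (mem_univ l)) (sum_nonneg fun i _ => norm_nonneg _)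
    hD4.norm_le H.str
  set F0 := 2 * (∑ k, 2 ^ 3 * ‖w k‖ ^ 2) + β * 32 with hF0
  have hβ := H.β_nonneg
  have hF0n : 0 ≤ F0 :=
    by positivity
  refine ⟨C1 + C2 + C3 + C1 * F0, by positivity, fun h h0 h1 g K hg => ?_⟩
  have hK := hg.nonneg
  have hhs : 0 ≤ h * √h := by positivity
  have hg' : BD 4 ((1 + C2 * h) * K) (stepP v b h g) :=
    hcd h h0 h1 _ K (BD.symAvg v (√(2 * Fintype.card ι * h)) hg)
  have hg2 := hg.mono (by norm_num : 2 ≤ 4) le_rfl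
  have hg1 := hg.mono (by norm_num : 1 ≤ 4) le_rfl
  have hg'1 := hg'.mono (by norm_num : 1 ≤ 4) le_rfl
  refine ⟨hg'.mono le_rfl ?_, fun Θ hΘ p => ?_, ?_, ?_⟩
  · refine mul_le_right ?_ hK
    have : C2 * h ≤ (C1 + C2 + C3 + C1 * F0) * h :=
      mul_le_right (by nlinarith) h0
    linarith
  · refine (hθ h h0 h1 g K hg2 0 p).trans ?_
    refine add_le_add ?_ ?_
    · rw [← stepP_const v b h Θ p]
      refine stepP_mono v b h (fun x => ?_) p
      have h2 := hΘ x
      have h3 : 0 ≤ h * η * dirQ w g x :=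
        mul_nonneg (mul_nonneg h0 H.η_pos.le) (dirQ_nonneg w g x)
      unfold thetaF at h2
      linarith
    · refine mul_le_right (mul_le_right ?_) hhs
      nlinarith
  · refine (hm h h0 h1 g K (hg.mono (by norm_num) le_rfl)).trans ?_
    refine mul_le_right (mul_le_right ?_ hK) hhs
    nlinarith
  · set c := mean μ ρ g with hc
    have hcK : |c| ≤ K := H.abs_mean_le hg.norm_le
    have hη0 := H.η_pos.le
    have hη1 : h * η ≤ 1 := by nlinarith [H.η_le]
    have hF := hg.thetaF_sub w hβ (mul_nonneg h0 hη0) hη1 hcK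
    set F : E → ℝ := fun p => thetaF w β g c p - h * η * dirQ w g p with hFd
    have hFm := hm h h0 h1 F _ hF
    have s1 : energy μ w β ρ (stepP v b h g)
        ≤ ∫ p, thetaF w β (stepP v b h g) c p * ρ p ∂μ := by
      unfold energy
      rw [H.integral_thetaF hg'1, H.integral_thetaF hg'1,
        H.integral_sq_sub hg'1.1.continuous hg'1.norm_le c]
      have : 0 ≤ β * (mean μ ρ (stepP v b h g) - c) ^ 2 := by positivity
      linarith
    have hd := BD.dirQ (j := 3) hg w
    have hPF := BD.symAvg v (√(2 * Fintype.card ι * h)) hF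
    have iP : Integrable (fun p => stepP v b h F p * ρ p) μ :=
      H.integrable_mul (hPF.1.continuous.comp (drift_contDiff H.b_smooth h).continuous)
        (fun p => hPF.norm_le _)
    have s2 : ∫ p, thetaF w β (stepP v b h g) c p * ρ p ∂μ
        ≤ mean μ ρ (stepP v b h F) + C3 * K ^ 2 * (h * √h) := by
      have e : mean μ ρ (stepP v b h F) + C3 * K ^ 2 * (h * √h)
          = ∫ p, (stepP v b h F p * ρ p + C3 * K ^ 2 * (h * √h) * ρ p) ∂μ := by
        rw [integral_add iP (H.integrable_ρ.const_mul _), integral_const_mul, H.mass, mul_one]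
        rfl
      rw [e]
      refine integral_mono_of_nonneg (.of_forall fun p =>
        mul_nonneg (thetaF_nonneg w hβ _ c p) (H.nonneg p))
        (iP.add (H.integrable_ρ.const_mul _)) (.of_forall fun p => ?_)
      have := mul_le_right (hθ h h0 h1 g K hg2 c p) (H.nonneg p)
      change thetaF w β (stepP v b h g) c p * ρ p ≤ (stepP v b h F p + _) * ρ p at this
      linarith
    have iθ : Integrable (fun p => dirQ w g p * ρ p) μ :=
      H.integrable_mul hd.1.continuous hd.norm_le
    have s3 : mean μ ρ F = energy μ w β ρ g - h * η * ∫ p, dirQ w g p * ρ p ∂μ := by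
      have hth := hg.thetaF_sub w hβ le_rfl zero_le_one hcK
      have it : Integrable (fun p => thetaF w β g c p * ρ p) μ := by
        refine H.integrable_mul (K := (F0) * K ^ 2) ?_ ?_
        · have := hth.1.continuous
          simpa using this
        · intro p
          have := hth.norm_le p
          simpa using this
      unfold mean energy
      rw [← integral_const_mul, ← integral_sub it (iθ.const_mul _)]
      refine integral_congr_ae (.of_forall fun p => ?_)
      linarith
    have s4 : energy μ w β ρ g ≤ (1 + β * CP) * ∫ p, dirQ w g p * ρ p ∂μ := by
      unfold energy
      rw [H.integral_thetaF hg1]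
      have := mul_le_left (H.poincare K g hg1) hβ
      unfold mean
      linarith
    have hpos : 0 < 1 + β * CP := by nlinarith [mul_nonneg hβ H.CP_nonneg]
    have s5 : energy μ w β ρ g / (1 + β * CP) ≤ ∫ p, dirQ w g p * ρ p ∂μ := by
      rw [div_le_iff₀ hpos]; linarith
    have s6 := mul_le_left s5 (mul_nonneg h0 hη0)
    have s7 := (abs_le.1 hFm).2
    have s8 : h * η * (energy μ w β ρ g / (1 + β * CP))
        = h * (η / (1 + β * CP)) * energy μ w β ρ g := by ring
    have s9 : C1 * (F0 * K ^ 2) * (h * √h) + C3 * K ^ 2 * (h * √h)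
        ≤ (C1 + C2 + C3 + C1 * F0) * K ^ 2 * (h * √h) := by
      have : 0 ≤ (C1 + C2) * (K ^ 2 * (h * √h)) := by positivity
      nlinarith
    linarith

end Frozen
variable {κc : ℝ}

namespace FPFlow

lemma uniform_L1 (H : FPFlow μ v b0 b1 κc τ u) (a c : ℝ) {ε : ℝ} (hε : 0 < ε) :
    ∃ δ > 0, ∀ r ∈ Icc a c, ∀ s ∈ Icc a c, |r - s| ≤ δ →
      ∫ p, |u r p - u s p| ∂μ ≤ ε := by
  set F : ℝ → (E →₁[μ] ℝ) := fun r => (H.integrable r).toL1 (u r) with hF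
  have hd : ∀ r s, dist (F r) (F s) = ∫ p, |u r p - u s p| ∂μ := by
    intro r s
    rw [dist_eq_norm, hF]
    rw [← Integrable.toL1_sub, L1.norm_of_fun_eq_integral_norm]
    rfl
  have hc : Continuous F := by
    rw [continuous_iff_continuousAt]
    intro t
    unfold ContinuousAt
    rw [tendsto_iff_dist_tendsto_zero]
    simp only [hd]
    exact H.tendsto_L1 t
  have h := (isCompact_Icc (a := a) (b := c)).uniformContinuousOn_of_continuous hc.continuousOn
  rw [Metric.uniformContinuousOn_iff_le] at h
  obtain ⟨δ, hδ, h⟩ := h ε hε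
  refine ⟨δ, hδ, fun r hr s hs hrs => ?_⟩
  rw [← hd]
  exact h r hr s hs (by rwa [dist_eq])

lemma uniform_weighted_L1 (H : FPFlow μ v b0 b1 κc τ u) {a c M : ℝ}
    (hi : ∀ s ∈ Icc a c, Integrable (fun p => (1 + ‖p‖) ^ 2 * u s p) μ)
    (hM : ∀ s ∈ Icc a c, ∫ p, (1 + ‖p‖) ^ 2 * u s p ∂μ ≤ M) {ε : ℝ} (hε : 0 < ε) :
    ∃ δ > 0, ∀ r ∈ Icc a c, ∀ s ∈ Icc a c, |r - s| ≤ δ →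
      ∫ p, (1 + ‖p‖) * |u r p - u s p| ∂μ ≤ ε := by
  set R := 4 * (|M| + 1) / ε with hR
  have hR0 : 0 < R := by positivity
  obtain ⟨δ, hδ, h⟩ := H.uniform_L1 a c (ε := ε / (2 * R)) (by positivity)
  refine ⟨δ, hδ, fun r hr s hs hrs => ?_⟩
  have i1 : Integrable (fun p => |u r p - u s p|) μ := ((H.integrable r).sub (H.integrable s)).abs
  have i2 : Integrable (fun p => (1 + ‖p‖) ^ 2 * u r p + (1 + ‖p‖) ^ 2 * u s p) μ :=
    by fun_prop
  have i3 : Integrable (fun p => R * |u r p - u s p| +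
      R⁻¹ * ((1 + ‖p‖) ^ 2 * u r p + (1 + ‖p‖) ^ 2 * u s p)) μ :=
    by fun_prop
  calc ∫ p, (1 + ‖p‖) * |u r p - u s p| ∂μ
      ≤ ∫ p, (R * |u r p - u s p| +
        R⁻¹ * ((1 + ‖p‖) ^ 2 * u r p + (1 + ‖p‖) ^ 2 * u s p)) ∂μ := by
        refine integral_mono_of_nonneg (.of_forall fun p => by positivity) i3
          (.of_forall fun p => ?_)
        have ha := abs_nonneg (u r p - u s p)
        have hpr := (H.pos r p).le
        have hps := (H.pos s p).le
        have hb : |u r p - u s p| ≤ u r p + u s p := by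
          rw [abs_le]; grind
        rcases le_total (1 + ‖p‖) R with hp | hp
        · have h1 : 0 ≤ R⁻¹ * ((1 + ‖p‖) ^ 2 * u r p + (1 + ‖p‖) ^ 2 * u s p) := by positivity
          nlinarith [mul_le_right hp ha]
        · have h1 : 1 + ‖p‖ ≤ R⁻¹ * (1 + ‖p‖) ^ 2 := by
            rw [inv_mul_eq_div, le_div_iff₀ hR0, sq]
            gcongr
          nlinarith [mul_nonneg hR0.le ha]
    _ = R * (∫ p, |u r p - u s p| ∂μ) + R⁻¹ * ((∫ p, (1 + ‖p‖) ^ 2 * u r p ∂μ) +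
          ∫ p, (1 + ‖p‖) ^ 2 * u s p ∂μ) := by
        rw [integral_add (i1.const_mul R) (i2.const_mul R⁻¹), integral_const_mul,
          integral_const_mul, integral_add (hi r hr) (hi s hs)]
    _ ≤ R * (ε / (2 * R)) + R⁻¹ * (2 * (|M| + 1)) := by
        refine add_le_add (mul_le_left (h r hr s hs hrs) hR0.le)
          (mul_le_left ?_ (inv_nonneg.2 hR0.le))
        have := hM r hr
        grind
    _ = ε := by grind

/-- Comparison of the weak formulation with one step of the discretised semigroup. -/
lemma pair_step (H : FPFlow μ v b0 b1 κc τ u) {b : E → E} (hbs : C∞ b)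
    (w : κ → E) {Cb κ0 M : ℝ} (hκ0 : 0 ≤ κ0)
    (hb : ∀ p, ‖b p‖ ≤ Cb * (1 + ‖p‖)) {Ce : ℝ} (hCe : 0 ≤ Ce)
    (herr : ∀ h, 0 ≤ h → h ≤ 1 → ∀ (f : E → ℝ) (K : ℝ), BD 3 K f → ∀ p,
      |stepP v b h f p - f p - h * genB v b f p| ≤ Ce * K * (h * √h) * (1 + ‖p‖) ^ 2)
    {a c : ℝ} (ha : 0 ≤ a)
    (hbt : ∀ s ∈ Icc a c, ∀ p, ‖affDrift b0 b1 (τ s) p‖ ≤ Cb * (1 + ‖p‖))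
    (hcl : ∀ s ∈ Icc a c, ∀ p (ξ : E →L[ℝ] ℝ), |ξ (affDrift b0 b1 (τ s) p - b p)|
      ≤ κ0 * (1 + ‖p‖) * √(∑ k, ξ (w k) ^ 2))
    (hi : ∀ s ∈ Icc a c, Integrable (fun p => (1 + ‖p‖) ^ 2 * u s p) μ)
    (hM : ∀ s ∈ Icc a c, ∫ p, (1 + ‖p‖) ^ 2 * u s p ∂μ ≤ M)
    {ϖ δ : ℝ} (hϖ : ∀ r ∈ Icc a c, ∀ s ∈ Icc a c, |r - s| ≤ δ →
      ∫ p, (1 + ‖p‖) * |u r p - u s p| ∂μ ≤ ϖ)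
    {h : ℝ} (h0 : 0 ≤ h) (h1 : h ≤ 1) (hδ : h ≤ δ) {r : ℝ} (hra : a ≤ r - h) (hrc : r ≤ c)
    {g : E → ℝ} {K Θ : ℝ} (hg : BD 3 K g) (hΘ : ∀ p, dirQ w g p ≤ Θ) :
    pair μ u g r ≤ pair μ u (stepP v b h g) (r - h)
      + h * (κ0 * √Θ * M + K * (Cb + ∑ l, ‖v l‖ * ‖v l‖) * ϖ) + Ce * K * M * (h * √h) := by
  have hK := hg.nonneg
  have hCb : 0 ≤ Cb := by
    have := (norm_nonneg _).trans (hb 0); simpa using this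
  set Cg := Cb + ∑ l, ‖v l‖ * ‖v l‖ with hCg
  have hCg0 : 0 ≤ Cg := by positivity
  set s := r - h with hs
  have hsr : s ≤ r := by linarith
  have hsI : s ∈ Icc a c := by grind
  have hsub : ∀ x ∈ Icc s r, x ∈ Icc a c := by grind
  have hg2 := hg.mono (by norm_num : 2 ≤ 3) le_rfl
  have hi1 : ∀ x ∈ Icc a c, Integrable (fun p => (1 + ‖p‖) * u x p) μ := fun x hx =>
    (hi x hx).mono' ((continuous_const.add continuous_norm).mul
      (H.smooth x).continuous).aestronglyMeasurable (.of_forall fun p => by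
        rw [norm_mul, norm_eq_abs, norm_eq_abs, abs_of_pos (H.pos x p),
          abs_of_nonneg (by positivity)]
        exact mul_le_right (by nlinarith [norm_nonneg p]) (H.pos x p).le)
  have hM1 : ∀ x ∈ Icc a c, ∫ p, (1 + ‖p‖) * u x p ∂μ ≤ M := fun x hx => by
    refine (integral_mono (hi1 x hx) (hi x hx) fun p => ?_).trans (hM x hx)
    exact mul_le_right (by nlinarith [norm_nonneg p]) (H.pos x p).le
  have igen : ∀ (b' : E → E), C∞ b' → (∀ p, ‖b' p‖ ≤ Cb * (1 + ‖p‖)) →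
      ∀ x ∈ Icc a c, Integrable (fun p => genB v b' g p * u x p) μ := by
    intro b' hb's hb' x hx
    refine ((hi1 x hx).const_mul (K * Cg)).mono' ((genB_contDiff hb's hg.1).continuous.mul
      (H.smooth x).continuous).aestronglyMeasurable (.of_forall fun p => ?_)
    rw [norm_mul, norm_eq_abs, norm_eq_abs, abs_of_pos (H.pos x p), ← mul_assoc]
    exact mul_le_right (abs_genB_le_linear hCb hb' hg2 p) (H.pos x p).le
  set X := (∫ p, genB v b g p * u s p ∂μ) + κ0 * √Θ * M + K * Cg * ϖ with hX
  have hrate : ∀ x ∈ Icc s r, rate μ v b0 b1 τ u g x ≤ X := by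
    intro x hx
    have hxI := hsub x hx
    have j1 := igen _ (affDrift_contDiff H.b0_smooth H.b1_smooth (τ x)) (hbt x hxI) x hxI
    have j2 := igen b hbs hb x hxI
    have j3 := igen b hbs hb s hsI
    have k1 : (∫ p, genB v (affDrift b0 b1 (τ x)) g p * u x p ∂μ)
        - ∫ p, genB v b g p * u x p ∂μ ≤ κ0 * √Θ * M := by
      rw [← integral_sub j1 j2]
      have : ∫ p, (genB v (affDrift b0 b1 (τ x)) g p * u x p - genB v b g p * u x p) ∂μ
          ≤ ∫ p, κ0 * √Θ * ((1 + ‖p‖) * u x p) ∂μ := by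
        refine integral_mono (j1.sub j2) ((hi1 x hxI).const_mul _) fun p => ?_
        have e : genB v (affDrift b0 b1 (τ x)) g p * u x p - genB v b g p * u x p
            = ∇ g p (affDrift b0 b1 (τ x) p - b p) * u x p := by
          unfold genB; rw [map_sub]; ring
        have h3 := (le_abs_self _).trans (hcl x hxI p (∇ g p))
        have h4 : √(∑ k, ∇ g p (w k) ^ 2) ≤ √Θ := sqrt_le_sqrt (hΘ p)
        have h5 := mul_le_left h4
          (mul_nonneg hκ0 (by positivity : 0 ≤ 1 + ‖p‖))
        have h6 := mul_le_right (h3.trans h5) (H.pos x p).le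
        linarith
      refine this.trans ?_
      rw [integral_const_mul]
      exact mul_le_left (hM1 x hxI)
    have k2 : (∫ p, genB v b g p * u x p ∂μ) - ∫ p, genB v b g p * u s p ∂μ
        ≤ K * Cg * ϖ := by
      rw [← integral_sub j2 j3]
      have hdi : Integrable (fun p => (1 + ‖p‖) * |u x p - u s p|) μ := by
        have := ((hi1 x hxI).sub (hi1 s hsI)).abs
        refine this.congr (.of_forall fun p => ?_)
        show |(1 + ‖p‖) * u x p - (1 + ‖p‖) * u s p| = _
        rw [← mul_sub, abs_mul, abs_of_nonneg (by positivity : 0 ≤ 1 + ‖p‖)]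
      have : ∫ p, (genB v b g p * u x p - genB v b g p * u s p) ∂μ
          ≤ ∫ p, K * Cg * ((1 + ‖p‖) * |u x p - u s p|) ∂μ := by
        refine integral_mono (j2.sub j3) (hdi.const_mul _) fun p => ?_
        rw [← mul_sub, ← mul_assoc]
        refine (le_abs_self _).trans ?_
        rw [abs_mul]
        exact mul_le_right (abs_genB_le_linear hCb hb hg2 p)
      refine this.trans ?_
      rw [integral_const_mul]
      refine mul_le_left (hϖ x hxI s hsI ?_) (mul_nonneg hK hCg0)
      grind
    show (∫ p, genB v (affDrift b0 b1 (τ x)) g p * u x p ∂μ) ≤ X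
    linarith
  obtain ⟨w1, w2⟩ := H.weak_formulation_BD hCb (ha.trans hra) hsr
    (fun x hx => hbt x (hsub x hx)) (fun x hx => hi1 x (hsub x hx))
    (fun x hx => hM1 x (hsub x hx)) hg2
  have w3 : ∫ x in s..r, rate μ v b0 b1 τ u g x ≤ ∫ _ in s..r, X :=
    intervalIntegral.integral_mono_on hsr w1 intervalIntegrable_const hrate
  rw [intervalIntegral.integral_const, smul_eq_mul, show r - s = h by linarith] at w3
  have hPb := BD.symAvg v (√(2 * Fintype.card ι * h)) hg
  have l1 : Integrable (fun p => stepP v b h g p * u s p) μ :=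
    integrable_bdd_mul (hPb.1.continuous.comp (drift_contDiff hbs h).continuous)
      (fun p => hPb.norm_le _) (H.integrable s)
  have l2 : Integrable (fun p => g p * u s p) μ :=
    integrable_bdd_mul hg.1.continuous (fun p => hg.norm_le _) (H.integrable s)
  have l3 := igen b hbs hb s hsI
  have m1 : pair μ u g s + h * (∫ p, genB v b g p * u s p ∂μ)
      - pair μ u (stepP v b h g) s ≤ Ce * K * M * (h * √h) := by
    have l4 : Integrable (fun p => g p * u s p + h * (genB v b g p * u s p)) μ :=
      by fun_prop
    unfold pair
    rw [← integral_const_mul, ← integral_add l2 (l3.const_mul h), ← integral_sub l4 l1]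
    have : ∫ p, (g p * u s p + h * (genB v b g p * u s p) - stepP v b h g p * u s p) ∂μ
        ≤ ∫ p, Ce * K * (h * √h) * ((1 + ‖p‖) ^ 2 * u s p) ∂μ := by
      refine integral_mono (l4.sub l1) ((hi s hsI).const_mul _) fun p => ?_
      have := mul_le_right (neg_le_of_abs_le (herr h h0 h1 g K hg p))
        (H.pos s p).le
      linarith
    refine this.trans ?_
    rw [integral_const_mul]
    have := mul_le_left (hM s hsI)
      (by positivity : 0 ≤ Ce * K * (h * √h))
    linarith
  linarith

end FPFlow
set_option maxHeartbeats 1000000 in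
open FPFlow in
/-- Propagation of a test function over one unit of time, by the frozen semigroup. -/
theorem Frozen.unit_step (H : Frozen μ v b w β η CP ρ) (HF : FPFlow μ v b0 b1 κc τ u)
    {Cb κ0 M a : ℝ} (ha : 0 ≤ a) (hκ0 : 0 ≤ κ0)
    (hbt : ∀ s ∈ Icc a (a + 1), ∀ p, ‖affDrift b0 b1 (τ s) p‖ ≤ Cb * (1 + ‖p‖))
    (hcl : ∀ s ∈ Icc a (a + 1), ∀ p (ξ : E →L[ℝ] ℝ), |ξ (affDrift b0 b1 (τ s) p - b p)|
      ≤ κ0 * (1 + ‖p‖) * √(∑ k, ξ (w k) ^ 2))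
    (hi : ∀ s ∈ Icc a (a + 1), Integrable (fun p => (1 + ‖p‖) ^ 2 * u s p) μ)
    (hM : ∀ s ∈ Icc a (a + 1), ∫ p, (1 + ‖p‖) ^ 2 * u s p ∂μ ≤ M)
    {g : E → ℝ} {K Θ ε : ℝ} (hg : BD 4 K g) (hg01 : ∀ p, 0 ≤ g p ∧ g p ≤ 1)
    (hΘ : ∀ p, thetaF w β g 0 p ≤ Θ) (hε : 0 < ε) :
    ∃ g' K', BD 4 K' g' ∧ (∀ p, 0 ≤ g' p ∧ g' p ≤ 1) ∧ (∀ p, thetaF w β g' 0 p ≤ Θ + ε) ∧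
      |mean μ ρ g' - mean μ ρ g| ≤ ε ∧
      energy μ w β ρ g' ≤ exp (-(η / (1 + β * CP))) * energy μ w β ρ g + ε ∧
      pair μ u g (a + 1) ≤ pair μ u g' a + κ0 * √(Θ + ε) * M + ε := by
  obtain ⟨C, hC, hone⟩ := H.one_step
  obtain ⟨Cb', hb'⟩ := H.b_lin
  obtain ⟨Ce, hCe, herr⟩ := stepP_error v b (Cv := ∑ l, ‖v l‖)
    (fun l => single_le_sum (f := fun l => ‖v l‖) (fun i _ => norm_nonneg _)
      (mem_univ l)) hb'
  have hK := hg.nonneg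
  have hM0 : 0 ≤ M := by
    refine le_trans ?_ (hM a ⟨le_rfl, by linarith⟩)
    exact integral_nonneg fun p => mul_nonneg (by positivity) (HF.pos a p).le
  set D := max Cb Cb' with hD
  have hbt' : ∀ s ∈ Icc a (a + 1), ∀ p, ‖affDrift b0 b1 (τ s) p‖ ≤ D * (1 + ‖p‖) :=
    fun s hs p => (hbt s hs p).trans
      (mul_le_right (le_max_left _ _))
  have hbD : ∀ p, ‖b p‖ ≤ D * (1 + ‖p‖) := fun p => (hb' p).trans
      (mul_le_right (le_max_right _ _))
  have hD0 : 0 ≤ D := by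
    have := (norm_nonneg _).trans (hbD 0); simpa using this
  set Cg := D + ∑ l, ‖v l‖ * ‖v l‖ with hCg
  have hCg0 : 0 ≤ Cg := by positivity
  set L := exp C * K with hL
  have hL0 : 0 ≤ L := by positivity
  set Ĉ := C * L ^ 2 + C * L + Ce * L * M with hĈ
  set ϖ := ε / (2 * (L * Cg + 1)) with hϖ
  have hϖ0 : 0 < ϖ := by positivity
  have hϖε : L * Cg * ϖ ≤ ε / 2 := by
    rw [hϖ, mul_div_assoc', div_le_iff₀ (by positivity)]
    linarith
  obtain ⟨δ, hδ, hmod⟩ := HF.uniform_weighted_L1 hi hM hϖ0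
  -- choice of the number of steps
  have hlim : Tendsto (fun N : ℕ => Ĉ * √(1 / ((N : ℝ) + 1))) atTop (nhds 0) := by
    have h1 := (tendsto_one_div_add_atTop_nhds_zero_nat (𝕜 := ℝ)).sqrt.const_mul Ĉ
    grind
  obtain ⟨N, hN1, hN2⟩ := ((hlim.eventually_le_const (by grind : (0:ℝ) < ε / 2)).and
    ((tendsto_one_div_add_atTop_nhds_zero_nat (𝕜 := ℝ)).eventually_le_const hδ)).exists
  set n : ℕ := N + 1 with hn
  set h : ℝ := 1 / ((N : ℝ) + 1) with hh
  have h0 : 0 < h := by positivity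
  have h1 : h ≤ 1 := by rw [hh, div_le_one (by grind)]; linarith
  have hnh : (n : ℝ) * h = 1 := by rw [hn, hh]; push_cast; field_simp
  set e := Ĉ * (h * √h) with he
  have he0 : 0 ≤ e := by positivity
  have hne : (n : ℝ) * e ≤ ε / 2 := by
    have : (n : ℝ) * e = (n * h) * (Ĉ * √h) := by linarith
    rw [this, hnh, one_mul]; exact hN1
  have hβ := H.β_nonneg
  have hpos : 1 ≤ 1 + β * CP := by linarith [mul_nonneg hβ H.CP_nonneg]
  set ρ' := η / (1 + β * CP) with hρ'
  have hρ0 : 0 ≤ ρ' := div_nonneg H.η_pos.le (by linarith)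
  have hρ1 : ρ' ≤ 1 := by
    rw [hρ', div_le_one (by linarith)]; linarith [H.η_le]
  have hq0 : 0 ≤ 1 - h * ρ' := by linarith [mul_le_one₀ h1 hρ0 hρ1]
  have hq1 : 1 - h * ρ' ≤ 1 := by linarith [mul_nonneg h0.le hρ0]
  have hKk : ∀ k : ℕ, k ≤ n → (1 + C * h) ^ k * K ≤ L := by
    intro k hk
    refine mul_le_right ?_ hK
    calc (1 + C * h) ^ k ≤ exp (C * h) ^ k :=
          pow_le_pow_left₀ (by positivity) (by linarith [add_one_le_exp (C * h)]) k
      _ = exp (k * (C * h)) := by rw [← exp_nat_mul]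
      _ ≤ exp C := by
        apply exp_le_exp.2
        have : (k : ℝ) * h ≤ n * h := mul_le_right (by gcongr) h0.le
        rw [hnh] at this
        have := mul_le_left this hC
        linarith
  set Z := h * (κ0 * √(Θ + ε) * M + L * Cg * ϖ) with hZ
  have key : ∀ k : ℕ, k ≤ n → ∃ f, BD 4 ((1 + C * h) ^ k * K) f ∧ (∀ p, 0 ≤ f p ∧ f p ≤ 1) ∧
      (∀ p, thetaF w β f 0 p ≤ Θ + k * e) ∧ |mean μ ρ f - mean μ ρ g| ≤ k * e ∧
      energy μ w β ρ f ≤ (1 - h * ρ') ^ k * energy μ w β ρ g + k * e ∧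
      pair μ u g (a + 1) ≤ pair μ u f (a + 1 - k * h) + k * Z + k * e := by
    intro k
    induction k with
    | zero => intro _; exact ⟨g, by grind, hg01, by grind, by simp, by simp, by simp⟩
    | succ k ih =>
      intro hk
      have hk' : k ≤ n := by omega
      obtain ⟨f, f1, f2, f3, f4, f5, f6⟩ := ih hk'
      have hfL := f1.mono le_rfl (hKk k hk')
      obtain ⟨s1, s2, s3, s4⟩ := hone h h0.le h1 f _ f1
      obtain ⟨-, s2', s3', s4'⟩ := hone h h0.le h1 f _ hfL
      have hhs : 0 ≤ h * √h := by positivity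
      have a1 : C * L ^ 2 * (h * √h) ≤ e := by
        exact mul_le_right (by
          have : 0 ≤ C * L := by positivity
          have : 0 ≤ Ce * L * M := by positivity
          linarith) hhs
      have a2 : C * L * (h * √h) ≤ e := by
        exact mul_le_right (by
          have : 0 ≤ C * L ^ 2 := by positivity
          have : 0 ≤ Ce * L * M := by positivity
          linarith) hhs
      have a3 : Ce * L * M * (h * √h) ≤ e := by
        exact mul_le_right (by
          have : 0 ≤ C * L ^ 2 := by positivity
          have : 0 ≤ C * L := by positivity
          linarith) hhs
      have hken : (k : ℝ) * e ≤ ε := by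
        have : (k : ℝ) * e ≤ n * e := mul_le_right (by gcongr) he0
        linarith
      refine ⟨stepP v b h f, ?_, fun p => ⟨?_, ?_⟩, fun p => ?_, ?_, ?_, ?_⟩
      · exact s1.mono le_rfl (le_of_eq (by ring))
      · rw [← stepP_const v b h 0 p]; exact stepP_mono v b h (fun x => (f2 x).1) p
      · rw [← stepP_const v b h 1 p]; exact stepP_mono v b h (fun x => (f2 x).2) p
      · have := s2' _ f3 p
        push_cast; linarith
      · have := abs_sub_le (mean μ ρ (stepP v b h f)) (mean μ ρ f) (mean μ ρ g)
        push_cast; linarith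
      · have b1 := mul_le_left f5 hq0
        have b2 : (1 - h * ρ') * (k * e) ≤ k * e := by
          have : 0 ≤ (k : ℝ) * e := by positivity
          exact mul_le_of_le_one_left this hq1
        have b3 : (1 - h * ρ') * ((1 - h * ρ') ^ k * energy μ w β ρ g)
          = (1 - h * ρ') ^ (k + 1) * energy μ w β ρ g := by ring
        push_cast; linarith
      · have hkh : (k : ℝ) * h + h ≤ 1 := by
          have : ((k : ℝ) + 1) * h ≤ n * h :=
            mul_le_right (by exact_mod_cast hk) h0.le
          linarith
        have hkh0 : 0 ≤ (k : ℝ) * h := by positivity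
        have hst := HF.pair_step H.b_smooth w hκ0 hbD hCe herr ha hbt' hcl hi hM hmod h0.le h1
          hN2 (r := a + 1 - k * h) (by linarith) (by linarith)
          (hfL.mono (by norm_num) le_rfl) (Θ := Θ + ε) (fun p => by
            have := f3 p
            unfold thetaF at this
            have : 0 ≤ β * (f p - 0) ^ 2 := by positivity
            linarith)
        rw [show a + 1 - ((k + 1 : ℕ) : ℝ) * h = a + 1 - k * h - h by grind]
        push_cast
        linarith
  obtain ⟨f, f1, f2, f3, f4, f5, f6⟩ := key n le_rfl
  refine ⟨f, _, f1, f2, fun p => (f3 p).trans (by linarith), f4.trans (by linarith), ?_, ?_⟩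
  · refine f5.trans (add_le_add ?_ (by linarith))
    refine mul_le_right ?_ (H.energy_nonneg g)
    calc (1 - h * ρ') ^ n ≤ exp (-(h * ρ')) ^ n :=
          pow_le_pow_left₀ hq0 (by linarith [add_one_le_exp (-(h * ρ'))]) n
      _ = exp (n * (-(h * ρ'))) := by rw [← exp_nat_mul]
      _ = exp (-ρ') := by
        grind
  · have e1 : (n : ℝ) * Z = (n * h) * (κ0 * √(Θ + ε) * M + L * Cg * ϖ) := by ring
    rw [e1, hnh] at f6
    rw [show a + 1 - 1 = a by ring] at f6
    linarith

variable [μ.IsAddHaarMeasure]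

/-- Polynomial moments of functions with Gaussian decay. -/
lemma integrable_pow_mul_exp_neg {W : E → ℝ} (hW : Continuous W) {a : ℝ} (ha : 0 < a)
    (hWa : ∀ p, a * ‖p‖ ^ 2 ≤ W p) (k : ℕ) :
    Integrable (fun p => (1 + ‖p‖) ^ k * exp (-(W p))) μ := by
  set d := Module.finrank ℝ E
  have h0 := integrable_one_add_norm (E := E) (μ := μ) (r := ((d + 1 : ℕ) : ℝ))
    (by grind)
  set j := k + d + 1 with hj
  set C : ℝ := (j.factorial : ℝ) * exp a * (2 / a) ^ j with hC
  have key : ∀ p : E, (1 + ‖p‖) ^ (2 * j) * exp (-(W p)) ≤ C := by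
    intro p
    have h1 := pow_div_factorial_le_exp (a * (1 + ‖p‖ ^ 2)) (by positivity) j
    have h2 : exp (-(W p)) ≤ exp (-(a * (1 + ‖p‖ ^ 2))) * exp a := by
      rw [← exp_add]; apply exp_le_exp.2; grind
    have h3 : (1 + ‖p‖) ^ (2 * j) ≤ (2 / a) ^ j * (a * (1 + ‖p‖ ^ 2)) ^ j := by
      rw [← mul_pow, pow_mul]
      refine pow_le_pow_left₀ (by positivity) ?_ j
      rw [show 2 / a * (a * (1 + ‖p‖ ^ 2)) = 2 * (1 + ‖p‖ ^ 2) by grind]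
      nlinarith [sq_nonneg (1 - ‖p‖)]
    rw [div_le_iff₀ (by positivity)] at h1
    calc (1 + ‖p‖) ^ (2 * j) * exp (-(W p))
        ≤ ((2 / a) ^ j * (exp (a * (1 + ‖p‖ ^ 2)) * j.factorial)) *
          (exp (-(a * (1 + ‖p‖ ^ 2))) * exp a) := by
          refine mul_le_mul (h3.trans ?_) h2 (by positivity) (by positivity)
          gcongr
      _ = C * (exp (a * (1 + ‖p‖ ^ 2)) * exp (-(a * (1 + ‖p‖ ^ 2)))) := by linarith
      _ = C := by rw [← exp_add]; simp
  refine (h0.const_mul C).mono' (((continuous_const.add continuous_norm).pow k).mul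
    (continuous_exp.comp hW.neg)).aestronglyMeasurable (.of_forall fun p => ?_)
  rw [norm_eq_abs, abs_of_nonneg (by positivity), rpow_neg (by positivity), rpow_natCast]
  have h4 : (1:ℝ) ≤ 1 + ‖p‖ := by simp
  rw [← div_eq_mul_inv, le_div_iff₀ (by positivity)]
  refine le_trans ?_ (key p)
  rw [mul_right_comm, ← pow_add]
  exact mul_le_right (pow_le_pow_right₀ h4 (by omega))

/-- Positive definite quadratic forms, in the guise needed for Gaussian integrals. -/
structure GaussForm (N : E → ℝ) (a : ℝ) : Prop where
  cont : Continuous N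
  pos : 0 < a
  lower : ∀ p, a * ‖p‖ ^ 2 ≤ N p
  smul : ∀ (c : ℝ) p, N (c • p) = c ^ 2 * N p
  rot : ∀ (θ : ℝ) p q, N (cos θ • p + sin θ • q) + N (cos θ • q - sin θ • p) = N p + N q

/-- Rotation of pairs. -/
def pairRot (E : Type) [NormedAddCommGroup E] [NormedSpace ℝ E] (θ : ℝ) : E × E →L[ℝ] E × E :=
  (cos θ • fst ℝ E E + sin θ • snd ℝ E E).prod
    (cos θ • snd ℝ E E - sin θ • fst ℝ E E)

lemma pairRot_apply (θ : ℝ) (z : E × E) : pairRot E θ z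
    = (cos θ • z.1 + sin θ • z.2, cos θ • z.2 - sin θ • z.1) := rfl

lemma pairRot_add (θ h : ℝ) (z : E × E) : pairRot E h (pairRot E θ z) = pairRot E (θ + h) z := by
  simp only [pairRot_apply, cos_add, sin_add]
  refine Prod.ext ?_ ?_
  · module
  · module

lemma pairRot_zero (z : E × E) : pairRot E 0 z = z := by
  simp [pairRot_apply]

namespace GaussForm
variable {N : E → ℝ} {a : ℝ}

lemma integrable (H : GaussForm N a) (k : ℕ) :
    Integrable (fun p => (1 + ‖p‖) ^ k * exp (-(N p))) μ :=
  integrable_pow_mul_exp_neg H.cont H.pos H.lower k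

lemma integrable_exp (H : GaussForm N a) : Integrable (fun p => exp (-(N p))) μ := by
  simpa using H.integrable (μ := μ) 0

/-- The product weight. -/
def wt (N : E → ℝ) (z : E × E) : ℝ := exp (-(N z.1)) * exp (-(N z.2))

lemma wt_cont (H : GaussForm N a) : Continuous (wt N) :=
  (continuous_exp.comp (H.cont.comp continuous_fst).neg).mul
    (continuous_exp.comp (H.cont.comp continuous_snd).neg)

lemma wt_pos (N : E → ℝ) (z : E × E) : 0 < wt N z := mul_pos (exp_pos _) (exp_pos _)

lemma wt_rot (H : GaussForm N a) (θ : ℝ) (z : E × E) : wt N (pairRot E θ z) = wt N z := by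
  unfold wt
  rw [← exp_add, ← exp_add, pairRot_apply]
  congr 1
  linarith [H.rot θ z.1 z.2]

lemma Z_pos (H : GaussForm N a) : 0 < ∫ p, exp (-(N p)) ∂μ :=
  integral_exp_pos H.integrable_exp

lemma integral_rot (H : GaussForm N a) (θ : ℝ) {F : E × E → ℝ} (hF : Continuous F) :
    ∫ z, F (pairRot E θ z) * wt N z ∂(μ.prod μ) = ∫ z, F z * wt N z ∂(μ.prod μ) := by
  have hdet : LinearMap.det (pairRot E θ : E × E →ₗ[ℝ] E × E) ≠ 0 := by
    have h1 : (pairRot E (-θ) : E × E →ₗ[ℝ] E × E) ∘ₗ (pairRot E θ : E × E →ₗ[ℝ] E × E)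
        = LinearMap.id := by
      ext1 <;> ext1 z <;> simp only [LinearMap.comp_apply] <;>
      · show pairRot E (-θ) (pairRot E θ _) = _
        rw [pairRot_add, add_neg_cancel, pairRot_zero]
        rfl
    intro h0
    have h2 := congrArg LinearMap.det h1
    rw [LinearMap.det_comp, h0, mul_zero, LinearMap.det_id] at h2
    linarith
  have hmap := Measure.map_linearMap_addHaar_eq_smul_addHaar (μ.prod μ) hdet
  have hint : ∀ F : E × E → ℝ, Continuous F → ∫ z, F (pairRot E θ z) ∂(μ.prod μ)
      = (ENNReal.ofReal |(LinearMap.det (pairRot E θ : E × E →ₗ[ℝ] E × E))⁻¹|).toReal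
        * ∫ z, F z ∂(μ.prod μ) := by
    intro F hF
    have h := integral_map (μ := μ.prod μ) (φ := pairRot E θ)
      (pairRot E θ).continuous.measurable.aemeasurable (f := F) hF.aestronglyMeasurable
    simp_all
  have hZ : ∫ z, wt N z ∂(μ.prod μ) = (∫ p, exp (-(N p)) ∂μ) * ∫ p, exp (-(N p)) ∂μ :=
    integral_prod_mul (μ := μ) (ν := μ) (fun p => exp (-(N p))) fun p => exp (-(N p))
  have hc := hint _ H.wt_cont
  simp only [H.wt_rot] at hc
  have hZ0 : 0 < ∫ z, wt N z ∂(μ.prod μ) := by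
    rw [hZ]; exact mul_pos H.Z_pos H.Z_pos
  have hc1 : (ENNReal.ofReal |(LinearMap.det (pairRot E θ : E × E →ₗ[ℝ] E × E))⁻¹|).toReal = 1 := by
    nlinarith
  have h5 := hint (fun z => F z * wt N z) (hF.mul H.wt_cont)
  rw [hc1, one_mul] at h5
  simpa only [H.wt_rot] using h5

lemma integrable_wt (H : GaussForm N a) {F : E × E → ℝ} (hF : Continuous F) {C : ℝ}
    (hC : ∀ z, |F z| ≤ C * ((1 + ‖z.1‖) ^ 2 * (1 + ‖z.2‖) ^ 2)) :
    Integrable (fun z => F z * wt N z) (μ.prod μ) := by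
  have h := ((H.integrable (μ := μ) 2).mul_prod (H.integrable (μ := μ) 2)).const_mul C
  refine h.mono' (hF.mul H.wt_cont).aestronglyMeasurable (.of_forall fun z => ?_)
  rw [norm_mul, norm_eq_abs, norm_eq_abs, abs_of_pos (wt_pos N z)]
  refine (mul_le_right (hC z) (wt_pos N z).le).trans (le_of_eq ?_)
  unfold wt; ring

lemma abs_one_sub_cos_le {h : ℝ} (h0 : 0 ≤ h) (h2 : h ≤ 2) : |cos h - 1| ≤ h := by
  rw [abs_le]; constructor
  · have := one_sub_sq_div_two_le_cos (x := h); nlinarith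
  · linarith [cos_le_one h]

lemma pair_diff (H : GaussForm N a) {g : E → ℝ} {K : ℝ} (hg : BD 1 K g) :
    ∫ z : E × E, (g z.2 - g z.1) ^ 2 * wt N z ∂(μ.prod μ)
      ≤ (π / 2) ^ 2 * ∫ z : E × E, ∇ g z.1 z.2 ^ 2 * wt N z ∂(μ.prod μ) := by
  have hK := hg.nonneg
  have hgc := hg.1.continuous
  have hgd : Differentiable ℝ g := hg.1.diff_top
  set hs : ℕ → ℝ := fun n => π / (2 * ((n : ℝ) + 1)) with hhs
  have hs0 : ∀ n, 0 < hs n := fun n => by positivity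
  have hs2 : ∀ n, hs n ≤ 2 := fun n => by
    rw [hhs]; rw [div_le_iff₀ (by grind)]
    linarith [pi_le_four]
  have hsn : ∀ n : ℕ, ((n : ℝ) + 1) * hs n = π / 2 := by grind
  have hslim : Tendsto hs atTop (nhds 0) := by
    have h1 := (tendsto_one_div_add_atTop_nhds_zero_nat (𝕜 := ℝ)).const_mul (π / 2)
    grind
  set d : ℝ → E × E → ℝ := fun h z => g (pairRot E h z).1 - g z.1 with hd
  have hdc : ∀ h, Continuous (d h) := by fun_prop
  have hdb : ∀ h, 0 ≤ h → h ≤ 2 → ∀ z : E × E, |d h z| ≤ K * h * (‖z.1‖ + ‖z.2‖) := by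
    intro h h0 h2 z
    have e : (pairRot E h z).1 = z.1 + ((cos h - 1) • z.1 + sin h • z.2) := by
      show cos h • z.1 + sin h • z.2 = _; module
    have h3 := norm_sub_le_of_fderiv_bound hgd (fun p => BD.norm_fderiv_le (j := 0) hg p) z.1
      ((cos h - 1) • z.1 + sin h • z.2)
    rw [← e, norm_eq_abs] at h3
    refine h3.trans ?_
    rw [mul_assoc]
    refine mul_le_left ((norm_add_le _ _).trans ?_) hK
    rw [norm_smul, norm_smul, norm_eq_abs, norm_eq_abs, mul_add]
    refine add_le_add (mul_le_right (abs_one_sub_cos_le h0 h2))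
      (mul_le_right ?_)
    have := abs_sin_le_abs (x := h)
    grind
  have hdb2 : ∀ h, 0 ≤ h → h ≤ 2 → ∀ z : E × E, |d h z ^ 2|
      ≤ (K * h) ^ 2 * ((1 + ‖z.1‖) ^ 2 * (1 + ‖z.2‖) ^ 2) := by
    intro h h0 h2 z
    rw [abs_pow, ← mul_pow, ← mul_pow]
    refine pow_le_pow_left₀ (abs_nonneg _) ((hdb h h0 h2 z).trans ?_) 2
    refine mul_le_left ?_
    nlinarith [mul_nonneg (norm_nonneg z.1) (norm_nonneg z.2)]
  have hstep : ∀ n : ℕ, ∫ z : E × E, (g z.2 - g z.1) ^ 2 * wt N z ∂(μ.prod μ)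
      ≤ ∫ z : E × E, ((((n : ℝ) + 1) * d (hs n) z) ^ 2) * wt N z ∂(μ.prod μ) := by
    intro n
    set h := hs n
    have hc2 : ∀ θ, Continuous fun z => d h (pairRot E θ z) ^ 2 := by fun_prop
    have irot : ∀ θ, Integrable (fun z => d h (pairRot E θ z) ^ 2 * wt N z) (μ.prod μ) := by
      intro θ
      refine H.integrable_wt (hc2 θ) (C := (K * h) ^ 2 * 4) fun z => ?_
      rw [abs_pow, mul_assoc, ← mul_pow]
      have h1 := hdb h (hs0 n).le (hs2 n) (pairRot E θ z)
      have h2 : ‖(pairRot E θ z).1‖ ≤ ‖z.1‖ + ‖z.2‖ := by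
        rw [pairRot_apply]
        refine (norm_add_le _ _).trans ?_
        rw [norm_smul, norm_smul, norm_eq_abs, norm_eq_abs]
        exact add_le_add (mul_le_of_le_one_left (norm_nonneg _) (abs_cos_le_one _))
          (mul_le_of_le_one_left (norm_nonneg _) (abs_sin_le_one _))
      have h3 : ‖(pairRot E θ z).2‖ ≤ ‖z.1‖ + ‖z.2‖ := by
        rw [pairRot_apply]
        refine (norm_sub_le _ _).trans ?_
        rw [norm_smul, norm_smul, norm_eq_abs, norm_eq_abs, add_comm]
        exact add_le_add (mul_le_of_le_one_left (norm_nonneg _) (abs_sin_le_one _))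
          (mul_le_of_le_one_left (norm_nonneg _) (abs_cos_le_one _))
      have h4 : |d h (pairRot E θ z)| ≤ (K * h) * (2 * ((1 + ‖z.1‖) * (1 + ‖z.2‖))) := by
        refine h1.trans (mul_le_left ?_ (mul_nonneg hK (hs0 n).le))
        nlinarith [mul_nonneg (norm_nonneg z.1) (norm_nonneg z.2)]
      refine (pow_le_pow_left₀ (abs_nonneg _) h4 2).trans (le_of_eq (by ring))
    have htel : ∀ z : E × E, g z.2 - g z.1
        = ∑ j ∈ Finset.range (n + 1), d h (pairRot E (j * h) z) := by
      intro z
      have : ∀ j : ℕ, d h (pairRot E (j * h) z)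
          = (fun j : ℕ => g (pairRot E (j * h) z).1) (j + 1)
            - (fun j : ℕ => g (pairRot E (j * h) z).1) j := by
        intro j
        simp only [hd, pairRot_add]
        grind
      simp only [this]
      rw [Finset.sum_range_sub (fun j : ℕ => g (pairRot E (j * h) z).1)]
      have e1 : ((n + 1 : ℕ) : ℝ) * h = π / 2 := by grind
      simp only [e1]
      rw [Nat.cast_zero, zero_mul, pairRot_zero, pairRot_apply, cos_pi_div_two, sin_pi_div_two]
      simp
    calc ∫ z : E × E, (g z.2 - g z.1) ^ 2 * wt N z ∂(μ.prod μ)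
        ≤ ∫ z : E × E, ∑ j ∈ Finset.range (n + 1), ((n : ℝ) + 1) *
            (d h (pairRot E (j * h) z) ^ 2 * wt N z) ∂(μ.prod μ) := by
          refine integral_mono_of_nonneg (.of_forall fun z =>
            mul_nonneg (sq_nonneg _) (wt_pos N z).le)
            (integrable_finsetSum _ fun j _ => (irot _).const_mul _)
            (.of_forall fun z => ?_)
          show (g z.2 - g z.1) ^ 2 * wt N z ≤ _
          rw [htel z]
          have := sq_sum_le_card_mul_sum_sq (s := Finset.range (n + 1))
            (f := fun j : ℕ => d h (pairRot E (j * h) z))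
          rw [Finset.card_range] at this
          refine (mul_le_right this (wt_pos N z).le).trans (le_of_eq ?_)
          push_cast
          rw [← mul_sum, ← sum_mul]; ring
      _ = ((n : ℝ) + 1) * (((n : ℝ) + 1) * ∫ z, d h z ^ 2 * wt N z ∂(μ.prod μ)) := by
          rw [integral_finsetSum _ fun j _ => (irot _).const_mul _]
          have : ∀ j ∈ Finset.range (n + 1), ∫ z : E × E, ((n : ℝ) + 1) *
              (d h (pairRot E (j * h) z) ^ 2 * wt N z) ∂(μ.prod μ)
              = ((n : ℝ) + 1) * ∫ z, d h z ^ 2 * wt N z ∂(μ.prod μ) := by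
            intro j _
            rw [integral_const_mul, H.integral_rot (μ := μ) _ (F := fun z => d h z ^ 2)
              ((hdc h).pow 2)]
          rw [sum_congr rfl this, sum_const, Finset.card_range, nsmul_eq_mul]
          simp
      _ = _ := by
          rw [← integral_const_mul, ← integral_const_mul]
          ring
  have hlim : Tendsto (fun n : ℕ => ∫ z : E × E,
      ((((n : ℝ) + 1) * d (hs n) z) ^ 2) * wt N z ∂(μ.prod μ)) atTop
      (nhds (∫ z : E × E, (π / 2 * ∇ g z.1 z.2) ^ 2 * wt N z ∂(μ.prod μ))) := by
    refine tendsto_integral_of_dominated_convergence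
      (fun z : E × E => (K * (π / 2)) ^ 2 * (((1 + ‖z.1‖) ^ 2 * exp (-(N z.1))) *
        ((1 + ‖z.2‖) ^ 2 * exp (-(N z.2))))) (fun n => ?_) ?_ (fun n => ?_) ?_
    · exact (((continuous_const.mul (hdc _)).pow 2).mul H.wt_cont).aestronglyMeasurable
    · exact ((H.integrable (μ := μ) 2).mul_prod (H.integrable (μ := μ) 2)).const_mul _
    · refine .of_forall fun z => ?_
      rw [norm_mul, norm_eq_abs, norm_eq_abs, abs_of_pos (wt_pos N z), mul_pow, abs_mul]
      have h1 := hdb2 (hs n) (hs0 n).le (hs2 n) z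
      have h2 : |((n : ℝ) + 1) ^ 2| * |d (hs n) z ^ 2|
          ≤ (K * (π / 2)) ^ 2 * ((1 + ‖z.1‖) ^ 2 * (1 + ‖z.2‖) ^ 2) := by
        rw [abs_of_nonneg (by positivity), ← hsn n]
        refine (mul_le_left h1).trans (le_of_eq (by ring))
      refine (mul_le_right h2 (wt_pos N z).le).trans (le_of_eq ?_)
      unfold wt; ring
    · refine .of_forall fun z => ?_
      refine Tendsto.mul_const _ (Tendsto.pow ?_ 2)
      have hder : HasDerivAt (fun h : ℝ => g (pairRot E h z).1) (∇ g z.1 z.2) 0 := by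
        have c1 : HasDerivAt (fun h : ℝ => (pairRot E h z).1) z.2 0 := by
          have := ((hasDerivAt_cos 0).smul_const z.1).add ((hasDerivAt_sin 0).smul_const z.2)
          exact HasDerivAt.congr_deriv this (by simp)
        have c2 : HasFDerivAt g (∇ g z.1) ((pairRot E 0 z).1) := by
          rw [pairRot_zero]; exact (hgd z.1).hasFDerivAt
        exact c2.comp_hasDerivAt (0 : ℝ) c1
      have hsl := hder.tendsto_slope_zero.comp (tendsto_nhdsWithin_iff.2
        ⟨hslim, .of_forall fun n => (hs0 n).ne'⟩)
      have := hsl.const_mul (π / 2)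
      refine this.congr fun n => ?_
      have hne := (hs0 n).ne'
      simp only [Function.comp, zero_add, smul_eq_mul, pairRot_zero, hd]
      grind
  refine (ge_of_tendsto hlim (.of_forall hstep)).trans (le_of_eq ?_)
  rw [← integral_const_mul]
  ring

end GaussForm

/-- Products of functions with quadratic growth against a continuous integrable weight. -/
lemma integrable_mul_of_bound {ρ f : E → ℝ} {C : ℝ} (hρ : Integrable ρ μ) (hρ0 : ∀ p, 0 ≤ ρ p)
    (hf : Continuous f) (hC : ∀ p, |f p| ≤ C) : Integrable (fun p => f p * ρ p) μ :=
  hρ.bdd_mul hf.aestronglyMeasurable (.of_forall hC)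

lemma continuous_dirQ {w : κ → E} {g : E → ℝ} (hg : C∞ g) :
    Continuous (_root_.dirQ w g) := by
  refine continuous_finsetSum _ fun k _ => ?_
  exact (((contDiff_fderiv_top hg).continuous).clm_apply continuous_const).pow 2

lemma dirQ_le_of_norm {w : κ → E} {g : E → ℝ} {K : ℝ} (hK : ∀ p, ‖∇ g p‖ ≤ K) (p : E) :
    |_root_.dirQ w g p| ≤ ∑ k, (K * ‖w k‖) ^ 2 := by
  rw [abs_of_nonneg (dirQ_nonneg w g p)]
  refine sum_le_sum fun k _ => ?_
  rw [← sq_abs]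
  refine pow_le_pow_left₀ (abs_nonneg _) ?_ 2
  exact ((∇ g p).le_opNorm (w k)).trans (mul_le_right (hK p))

namespace GaussForm
variable {N : E → ℝ} {a : ℝ}

/-- Mass of the Gaussian weight at half the inverse temperature. -/
lemma half_mass (H : GaussForm N a) :
    ∫ q, exp (-(N q / 2)) ∂μ = √2 ^ Module.finrank ℝ E * ∫ q, exp (-(N q)) ∂μ := by
  have hsc : ∀ q, -(N ((√2)⁻¹ • q)) = -(N q / 2) := fun q => by
    rw [H.smul, inv_pow, sq_sqrt (by norm_num)]; ring
  have h := Measure.integral_comp_smul μ (fun q => exp (-(N q))) (√2)⁻¹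
  simp only [hsc] at h
  rw [h, smul_eq_mul, inv_pow, inv_inv, abs_of_pos (by simp)]

lemma const_mul (H : GaussForm N a) {τ : ℝ} (hτ : 0 < τ) :
    GaussForm (fun p => τ * N p) (τ * a) where
  cont := continuous_const.mul H.cont
  pos := mul_pos hτ H.pos
  lower p := by rw [mul_assoc]; exact mul_le_left (H.lower p) hτ.le
  smul c p := by rw [H.smul]; ring
  rot θ p q := by rw [← mul_add, H.rot, mul_add]

/-- Second moments under a Gaussian weight. -/
lemma second_moment (H : GaussForm N a) :
    ∫ q, ‖q‖ ^ 2 * exp (-(N q)) ∂μ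
      ≤ √2 ^ Module.finrank ℝ E / a * ∫ q, exp (-(N q)) ∂μ := by
  have hi2 : Integrable (fun q => exp (-(N q / 2))) μ := by
    have h := integrable_pow_mul_exp_neg (μ := μ) (W := fun q => N q / 2) (H.cont.div_const 2)
      (a := a / 2) (by have := H.pos; grind) (fun p => by linarith [H.lower p]) 0
    grind
  rw [div_mul_eq_mul_div, ← H.half_mass, le_div_iff₀ H.pos, mul_comm, ← integral_const_mul]
  refine integral_mono_of_nonneg (.of_forall fun q => ?_) hi2
    (.of_forall fun q => ?_)
  · have := H.pos; positivity
  · have h1 := H.lower q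
    have h2 : N q ≤ exp (N q / 2) := by
      have h3 := add_one_le_exp (N q / 4)
      have h4 : exp (N q / 2) = exp (N q / 4) * exp (N q / 4) := by rw [← exp_add]; ring_nf
      nlinarith [sq_nonneg (N q / 4 - 1)]
    have h5 : exp (-(N q)) * exp (N q / 2) = exp (-(N q / 2)) := by
      rw [← exp_add]; ring_nf
    calc a * (‖q‖ ^ 2 * exp (-(N q))) = exp (-(N q)) * (a * ‖q‖ ^ 2) := by ring
      _ ≤ exp (-(N q)) * exp (N q / 2) :=
        mul_le_left (h1.trans h2)
      _ = _ := h5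

/-- The Gaussian Poincaré inequality. -/
theorem poincare (H : GaussForm N a) {w : κ → E} {CQ : ℝ} (hCQ : 0 ≤ CQ)
    (hQ : ∀ (ξ : E →L[ℝ] ℝ) q, ξ q ^ 2 ≤ CQ * ‖q‖ ^ 2 * ∑ k, ξ (w k) ^ 2)
    {g : E → ℝ} {K : ℝ} (hg : BD 1 K g) :
    ∃ c, ∫ p, (g p - c) ^ 2 * exp (-(N p)) ∂μ
      ≤ (π ^ 2 / 8 * CQ * (√2 ^ Module.finrank ℝ E / a))
        * ∫ p, _root_.dirQ w g p * exp (-(N p)) ∂μ := by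
  have hgc := hg.1.continuous
  set Z := ∫ p, exp (-(N p)) ∂μ with hZ
  have hZ0 : 0 < Z := H.Z_pos
  have hie : Integrable (fun p => exp (-(N p))) μ := H.integrable_exp
  have hige : Integrable (fun p => g p * exp (-(N p))) μ :=
    integrable_mul_of_bound hie (fun p => (exp_pos _).le) hgc fun p => hg.norm_le p
  set c := (∫ p, g p * exp (-(N p)) ∂μ) / Z with hc
  have hi1 : Integrable (fun p => (g p - c) * exp (-(N p))) μ := by
    refine (hige.sub (hie.const_mul c)).congr (.of_forall fun p => ?_)
    show g p * exp (-(N p)) - c * exp (-(N p)) = _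
    ring
  have hc0 : ∫ p, (g p - c) * exp (-(N p)) ∂μ = 0 := by
    simp only [sub_mul]
    rw [integral_sub hige (hie.const_mul c), integral_const_mul, hc, ← hZ]
    grind
  have hi2 : Integrable (fun p => (g p - c) ^ 2 * exp (-(N p))) μ := by
    refine integrable_mul_of_bound (C := (K + |c|) ^ 2) hie (fun p => (exp_pos _).le)
      ((hgc.sub continuous_const).pow 2) fun p => ?_
    rw [abs_pow]
    refine pow_le_pow_left₀ (abs_nonneg _) ((abs_sub _ _).trans ?_) 2
    have := hg.norm_le p
    simp_all
  have hL : ∫ z : E × E, (g z.2 - g z.1) ^ 2 * wt N z ∂(μ.prod μ)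
      = 2 * Z * ∫ p, (g p - c) ^ 2 * exp (-(N p)) ∂μ := by
    have e : ∀ z : E × E, (g z.2 - g z.1) ^ 2 * wt N z
        = exp (-(N z.1)) * ((g z.2 - c) ^ 2 * exp (-(N z.2)))
          + ((g z.1 - c) ^ 2 * exp (-(N z.1))) * exp (-(N z.2))
          - 2 * (((g z.1 - c) * exp (-(N z.1))) * ((g z.2 - c) * exp (-(N z.2)))) := fun z => by
      unfold wt; ring
    simp only [e]
    have j1 := hie.mul_prod hi2
    have j2 := hi2.mul_prod hie
    have j3 := (hi1.mul_prod hi1).const_mul 2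
    have j12 : Integrable (fun z : E × E => exp (-(N z.1)) * ((g z.2 - c) ^ 2 * exp (-(N z.2)))
          + ((g z.1 - c) ^ 2 * exp (-(N z.1))) * exp (-(N z.2))) (μ.prod μ) := j1.add j2
    rw [integral_sub j12 j3, integral_add j1 j2, integral_const_mul,
      integral_prod_mul (μ := μ) (ν := μ) (fun p => exp (-(N p)))
        (fun p => (g p - c) ^ 2 * exp (-(N p))),
      integral_prod_mul (μ := μ) (ν := μ) (fun p => (g p - c) ^ 2 * exp (-(N p)))
        (fun p => exp (-(N p))),
      integral_prod_mul (μ := μ) (ν := μ) (fun p => (g p - c) * exp (-(N p)))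
        (fun p => (g p - c) * exp (-(N p))), hc0]
    ring
  have hdQ : Integrable (fun p => _root_.dirQ w g p * exp (-(N p))) μ :=
    integrable_mul_of_bound hie (fun p => (exp_pos _).le) (continuous_dirQ hg.1)
      (dirQ_le_of_norm fun p => hg.norm_fderiv_le p)
  have hq2 : Integrable (fun p => ‖p‖ ^ 2 * exp (-(N p))) μ := by
    refine (H.integrable (μ := μ) 2).mono' ((continuous_norm.pow 2).mul
      (continuous_exp.comp H.cont.neg)).aestronglyMeasurable (.of_forall fun p => ?_)
    rw [norm_eq_abs, abs_of_nonneg (by positivity)]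
    refine mul_le_right ?_
    exact pow_le_pow_left₀ (norm_nonneg _) (by linarith) 2
  have hR : ∫ z : E × E, ∇ g z.1 z.2 ^ 2 * wt N z ∂(μ.prod μ)
      ≤ CQ * ((∫ p, _root_.dirQ w g p * exp (-(N p)) ∂μ) * ∫ p, ‖p‖ ^ 2 * exp (-(N p)) ∂μ) := by
    rw [← integral_prod_mul (μ := μ) (ν := μ), ← integral_const_mul]
    refine integral_mono_of_nonneg (.of_forall fun z => ?_)
      ((hdQ.mul_prod hq2).const_mul CQ) (.of_forall fun z => ?_)
    · exact mul_nonneg (sq_nonneg _) (wt_pos N z).le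
    · refine (mul_le_right (hQ (∇ g z.1) z.2) (wt_pos N z).le).trans
        (le_of_eq ?_)
      unfold wt _root_.dirQ; ring
  have hD0 : 0 ≤ ∫ p, _root_.dirQ w g p * exp (-(N p)) ∂μ :=
    integral_nonneg fun p => mul_nonneg (dirQ_nonneg w g p) (exp_pos _).le
  refine ⟨c, ?_⟩
  have h1 := H.pair_diff (μ := μ) hg
  rw [hL] at h1
  have h2 := mul_le_left (hR.trans (mul_le_left
    (mul_le_left (H.second_moment (μ := μ)) hD0) hCQ))
    (show (0:ℝ) ≤ (π / 2) ^ 2 by positivity)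
  have h3 := h1.trans h2
  refine le_of_mul_le_mul_left (h3.trans (le_of_eq ?_)) (mul_pos two_pos hZ0)
  ring

/-- Bounded perturbations of a Gaussian weight satisfy a Poincaré inequality. -/
theorem poincare_perturb (H : GaussForm N a) {w : κ → E} {CQ : ℝ} (hCQ : 0 ≤ CQ)
    (hQ : ∀ (ξ : E →L[ℝ] ℝ) q, ξ q ^ 2 ≤ CQ * ‖q‖ ^ 2 * ∑ k, ξ (w k) ^ 2)
    {W : E → ℝ} {δ : ℝ} (hW : Continuous W) (h1 : ∀ p, N p ≤ W p) (h2 : ∀ p, W p ≤ N p + δ)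
    {ρ : E → ℝ} (hρ : ∀ p, ρ p = exp (-(W p)) / ∫ q, exp (-(W q)) ∂μ)
    {g : E → ℝ} {K : ℝ} (hg : BD 1 K g) :
    ∫ p, (g p - ∫ q, g q * ρ q ∂μ) ^ 2 * ρ p ∂μ
      ≤ (π ^ 2 / 8 * CQ * (√2 ^ Module.finrank ℝ E / a) * exp δ)
        * ∫ p, _root_.dirQ w g p * ρ p ∂μ := by
  obtain ⟨c, hc⟩ := H.poincare (μ := μ) hCQ hQ hg
  have hiN : Integrable (fun p => exp (-(N p))) μ := H.integrable_exp
  have hiW : Integrable (fun p => exp (-(W p))) μ := by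
    have h := integrable_pow_mul_exp_neg (μ := μ) hW H.pos (fun p => (H.lower p).trans (h1 p)) 0
    grind
  set Z := ∫ q, exp (-(W q)) ∂μ with hZ
  have hZ0 : 0 < Z := integral_exp_pos hiW
  have hρ' : ρ = fun p => exp (-(W p)) / Z := funext hρ
  have hiρ : Integrable ρ μ := by rw [hρ']; fun_prop
  have hρ0 : ∀ p, 0 ≤ ρ p := fun p => by rw [hρ]; positivity
  have hmass : ∫ p, ρ p ∂μ = 1 := by
    rw [hρ', integral_div, ← hZ, div_self hZ0.ne']
  have hgc := hg.1.continuous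
  set m := ∫ q, g q * ρ q ∂μ with hm
  have hb2 : ∀ c p, |(g p - c) ^ 2| ≤ (K + |c|) ^ 2 := fun c p => by
    rw [abs_pow]
    refine pow_le_pow_left₀ (abs_nonneg _) ((abs_sub _ _).trans ?_) 2
    have := hg.norm_le p
    rw [norm_eq_abs] at this
    linarith
  have hic : ∀ c, Integrable (fun p => (g p - c) ^ 2 * ρ p) μ := fun c =>
    integrable_mul_of_bound hiρ hρ0 ((hgc.sub continuous_const).pow 2) (hb2 c)
  have hig : Integrable (fun p => g p * ρ p) μ :=
    integrable_mul_of_bound hiρ hρ0 hgc fun p => hg.norm_le p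
  have hvar : ∫ p, (g p - m) ^ 2 * ρ p ∂μ ≤ ∫ p, (g p - c) ^ 2 * ρ p ∂μ := by
    have e : ∀ p, (g p - c) ^ 2 * ρ p = (g p - m) ^ 2 * ρ p + (2 * (m - c) * (g p * ρ p)
        - (m ^ 2 - c ^ 2) * ρ p) := by grind
    have i1 : Integrable (fun p => 2 * (m - c) * (g p * ρ p) - (m ^ 2 - c ^ 2) * ρ p) μ :=
      by fun_prop
    simp only [e]
    rw [integral_add (hic m) i1, integral_sub (hig.const_mul _) (hiρ.const_mul _),
      integral_const_mul, integral_const_mul, hmass, ← hm]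
    nlinarith [sq_nonneg (m - c)]
  refine hvar.trans ?_
  have e1 : ∀ f : E → ℝ, ∫ p, f p * ρ p ∂μ = (∫ p, f p * exp (-(W p)) ∂μ) / Z := fun f => by
    rw [← integral_div]; congr 1; grind
  rw [e1, e1, ← mul_div_assoc]
  refine div_le_div_of_nonneg_right ?_ hZ0.le
  have s1 : ∫ p, (g p - c) ^ 2 * exp (-(W p)) ∂μ ≤ ∫ p, (g p - c) ^ 2 * exp (-(N p)) ∂μ := by
    refine integral_mono_of_nonneg (.of_forall fun p => ?_)
      (integrable_mul_of_bound hiN (fun p => (exp_pos _).le) ((hgc.sub continuous_const).pow 2)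
        (hb2 c)) (.of_forall fun p => ?_)
    · positivity
    · exact mul_le_left (exp_le_exp.2 (neg_le_neg (h1 p)))
  have s2 : ∫ p, _root_.dirQ w g p * exp (-(N p)) ∂μ
      ≤ exp δ * ∫ p, _root_.dirQ w g p * exp (-(W p)) ∂μ := by
    rw [← integral_const_mul]
    refine integral_mono_of_nonneg (.of_forall fun p => ?_)
      ((integrable_mul_of_bound hiW (fun p => (exp_pos _).le) (continuous_dirQ hg.1)
        (dirQ_le_of_norm fun p => hg.norm_fderiv_le p)).const_mul _)
      (.of_forall fun p => ?_)
    · exact mul_nonneg (dirQ_nonneg w g p) (exp_pos _).le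
    · show _ ≤ exp δ * (_root_.dirQ w g p * exp (-(W p)))
      rw [mul_left_comm, ← exp_add]
      exact mul_le_left (exp_le_exp.2 (by grind)) (dirQ_nonneg w g p)
  have hCP : 0 ≤ π ^ 2 / 8 * CQ * (√2 ^ Module.finrank ℝ E / a) := by
    have := H.pos; positivity
  calc _ ≤ _ := s1.trans hc
    _ ≤ _ := mul_le_left s2 hCP
    _ = _ := by ring

end GaussForm
section GibbsFrozen
open Matrix

/-- The hypocoercive directions span. -/
lemma exists_wDir_span (lamInv : Matrix (Fin n) (Fin m) ℝ) {S : ℝ} (hS : 0 ≤ S) :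
    ∃ C, 0 ≤ C ∧ ∀ (ξ : St n m →L[ℝ] ℝ) (q : St n m),
      |ξ q| ≤ C * ‖q‖ * √(∑ k, ξ (wDir lamInv S k) ^ 2) := by
  set L := ∑ i, ∑ j, |lamInv i j| with hL
  refine ⟨n * (2 + S * L) + n * (1 + S * L) + m, by positivity, fun ξ q => ?_⟩
  set r := √(∑ k, ξ (wDir lamInv S k) ^ 2) with hr
  have hr0 : 0 ≤ r := by positivity
  have hw : ∀ k, |ξ (wDir lamInv S k)| ≤ r := fun k =>
    abs_le_sqrt (single_le_sum (f := fun k => (ξ (wDir lamInv S k)) ^ 2)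
      (fun i _ => sq_nonneg _) (mem_univ k))
  have hc : ∀ j, |ξ (0, 0, Pi.single j 1)| ≤ r := fun j => by
    simpa [wDir] using hw (Sum.inr (Sum.inr j))
  have hb : ∀ i, |ξ (0, Pi.single i 1, 0)| ≤ (1 + S * L) * r := fun i => by
    have h1 := hw (Sum.inr (Sum.inl i))
    have e : ξ (0, Pi.single i 1, 0) = ξ (wDir lamInv S (Sum.inr (Sum.inl i)))
        + S * ∑ j, ξ (0, 0, Pi.single j 1) * lamInv i j := by
      have h2 := clm_apply_eq ξ (wDir lamInv S (Sum.inr (Sum.inl i)))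
      simp [wDir, dotProduct] at h2 ⊢
      rw [h2, mul_sum]
      simp [Pi.single_apply, mul_left_comm]
    have h3 : |∑ j, ξ (0, 0, Pi.single j 1) * lamInv i j| ≤ r * L := by
      calc _ ≤ ∑ j, |ξ (0, 0, Pi.single j 1) * lamInv i j| := abs_sum_le_sum_abs _ _
        _ ≤ ∑ j, r * |lamInv i j| := sum_le_sum fun j _ => by
            rw [abs_mul]; exact mul_le_right (hc j)
        _ = r * ∑ j, |lamInv i j| := by rw [mul_sum]
        _ ≤ r * L := mul_le_left (single_le_sum
            (f := fun i : Fin n => ∑ j : Fin m, |lamInv i j|)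
            (fun i _ => sum_nonneg fun j _ => abs_nonneg _) (mem_univ i)) hr0
    rw [e]
    refine (abs_add_le _ _).trans ?_
    rw [abs_mul, abs_of_nonneg hS]
    nlinarith
  have ha : ∀ i, |ξ (Pi.single i 1, 0, 0)| ≤ (2 + S * L) * r := fun i => by
    have h1 := hw (Sum.inl i)
    have e : ξ (Pi.single i 1, 0, 0) = ξ (wDir lamInv S (Sum.inl i)) + ξ (0, Pi.single i 1, 0) := by
      rw [← map_add]; simp [wDir]
    rw [e]
    refine (abs_add_le _ _).trans ?_
    linarith [hb i]
  have hdot : ∀ {k : ℕ} (c v : Fin k → ℝ) (M : ℝ), 0 ≤ M → (∀ i, |c i| ≤ M) → ‖v‖ ≤ ‖q‖ →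
      |c ⬝ᵥ v| ≤ k * (M * ‖q‖) := fun {k} c v M hM hcM hv => by
    calc _ ≤ ∑ i, |c i * v i| := abs_sum_le_sum_abs _ _
      _ ≤ ∑ _i : Fin k, M * ‖q‖ := sum_le_sum fun i _ => by
          rw [abs_mul]
          exact mul_le_mul (hcM i) ((norm_le_pi_norm v i).trans hv) (abs_nonneg _) hM
      _ = _ := by simp
  have n1 : ‖q.1‖ ≤ ‖q‖ := norm_fst_le q
  have n2 : ‖q.2.1‖ ≤ ‖q‖ := (norm_fst_le q.2).trans (norm_snd_le q)
  have n3 : ‖q.2.2‖ ≤ ‖q‖ := (norm_snd_le q.2).trans (norm_snd_le q)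
  rw [clm_apply_eq ξ q]
  have d1 := hdot _ q.1 _ (by positivity) ha n1
  have d2 := hdot _ q.2.1 _ (by positivity) hb n2
  have d3 := hdot _ q.2.2 _ hr0 hc n3
  refine (abs_add_three _ _ _).trans ?_
  linarith

/-- The Gaussian comparison form. -/
def quadN (abar : Fin n → ℝ) (p : St n m) : ℝ :=
  sqnorm (fun i => abar i * p.1 i) + sqnorm p.2.1 / 2 + sqnorm p.2.2 / 2

lemma sqnorm_rot {k : ℕ} (θ : ℝ) (v w : Fin k → ℝ) :
    sqnorm (cos θ • v + sin θ • w) + sqnorm (cos θ • w - sin θ • v) = sqnorm v + sqnorm w := by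
  unfold sqnorm
  rw [← sum_add_distrib, ← sum_add_distrib]
  refine sum_congr rfl fun i _ => ?_
  simp only [Pi.add_apply, Pi.sub_apply, Pi.smul_apply, smul_eq_mul]
  linear_combination (v i ^ 2 + w i ^ 2) * sin_sq_add_cos_sq θ

lemma continuous_quadN (abar : Fin n → ℝ) : Continuous (quadN abar : St n m → ℝ) := by
  unfold quadN sqnorm
  fun_prop

lemma exists_quadN_lower {abar : Fin n → ℝ} (habar : ∀ i, 0 < abar i) :
    ∃ a, 0 < a ∧ ∀ p : St n m, a * ‖p‖ ^ 2 ≤ quadN abar p := by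
  obtain ⟨a0, a1, h0, h1, h⟩ := hadamard_bounds habar
  refine ⟨min a0 (1 / 2), by positivity, fun p => ?_⟩
  have hs := norm_sq_le_sqSt p
  have l1 : min a0 (1 / 2) * sqnorm p.1 ≤ a0 * sqnorm p.1 :=
    mul_le_right (min_le_left _ _) (sqnorm_nonneg _)
  have l2 : min a0 (1 / 2) * sqnorm p.2.1 ≤ 1 / 2 * sqnorm p.2.1 :=
    mul_le_right (min_le_right _ _) (sqnorm_nonneg _)
  have l3 : min a0 (1 / 2) * sqnorm p.2.2 ≤ 1 / 2 * sqnorm p.2.2 :=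
    mul_le_right (min_le_right _ _) (sqnorm_nonneg _)
  have l4 := mul_le_left hs (show 0 ≤ min a0 (1 / 2) by positivity)
  have l5 := (h p.1).1
  unfold sqSt at l4
  unfold quadN
  linarith

lemma quadN_gaussForm {abar : Fin n → ℝ} {a : ℝ} (ha : 0 < a)
    (hlow : ∀ p : St n m, a * ‖p‖ ^ 2 ≤ quadN abar p) :
    GaussForm (quadN abar : St n m → ℝ) a where
  cont := continuous_quadN abar
  pos := ha
  lower := hlow
  smul c p := by
    have h : ∀ {k : ℕ} (v : Fin k → ℝ), sqnorm (c • v) = c ^ 2 * sqnorm v := fun v => by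
      rw [sqnorm_smul]
    have e : (fun i => abar i * (c • p).1 i) = c • fun i => abar i * p.1 i := by
      funext i; simp; ring
    unfold quadN
    rw [e, h]
    simp only [Prod.smul_snd, Prod.smul_fst, h]
    ring
  rot θ p q := by
    have e1 : (fun i => abar i * (cos θ • p + sin θ • q).1 i)
        = cos θ • (fun i => abar i * p.1 i) + sin θ • fun i => abar i * q.1 i := by
      funext i; simp; ring
    have e2 : (fun i => abar i * (cos θ • q - sin θ • p).1 i)
        = cos θ • (fun i => abar i * q.1 i) - sin θ • fun i => abar i * p.1 i := by
      funext i; simp; ring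
    have r1 := sqnorm_rot θ (fun i => abar i * p.1 i) fun i => abar i * q.1 i
    have r2 := sqnorm_rot θ p.2.1 q.2.1
    have r3 := sqnorm_rot θ p.2.2 q.2.2
    unfold quadN
    rw [e1, e2]
    simp only [Prod.snd_add, Prod.fst_add, Prod.snd_sub, Prod.fst_sub, Prod.smul_snd, Prod.smul_fst]
    linarith

lemma BD_fderiv_bDrift {G : (Fin n → ℝ) → Fin n → ℝ} (hG : C∞ G) {j : ℕ} {C : ℝ}
    (hC : BD j C (∇ G)) (A : Matrix (Fin m) (Fin m) ℝ) (lam : Matrix (Fin m) (Fin n) ℝ)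
    (τ : ℝ) : ∃ C', BD j C' (∇ (bDrift G A lam τ)) := by
  have hfst : ‖fst ℝ (Fin n → ℝ) ((Fin n → ℝ) × (Fin m → ℝ))‖ ≤ 1 :=
    ContinuousLinearMap.norm_fst_le ..
  have h1 := hC.comp_contraction (fst ℝ (Fin n → ℝ) ((Fin n → ℝ) × (Fin m → ℝ)))
    hfst
  have h2 := h1.clm_left ((compL ℝ (St n m) (Fin n → ℝ)
    (Fin n → ℝ)).flip (fst ℝ (Fin n → ℝ) ((Fin n → ℝ) × (Fin m → ℝ))))
  have h3 := h2.clm_left (compL ℝ (St n m) (Fin n → ℝ) (St n m)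
    (inclY : (Fin n → ℝ) →L[ℝ] St n m))
  have h4 := (BD.const (E := St n m) (j := j) (driftLin A lam τ)).add (h3.smul (-1))
  have e : ∇ (bDrift G A lam τ) = fun p : St n m => driftLin A lam τ
      + (-1 : ℝ) • inclY.comp ((∇ G p.1).comp (fst ℝ _ _)) :=
    funext fun p => (bDrift_fderiv (m := m) hG.diff_top A lam τ p).trans
      ((sub_eq_add_neg (driftLin A lam τ) _).trans
        (congrArg (driftLin A lam τ + ·) (neg_one_smul ℝ _).symm))
  rw [e]
  exact ⟨_, h4⟩

/-- The frozen dynamics with Gibbs invariant density. -/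
theorem exists_frozen {abar : Fin n → ℝ} (habar : ∀ i, 0 < abar i)
    (A : Matrix (Fin m) (Fin m) ℝ) (lam : Matrix (Fin m) (Fin n) ℝ)
    (lamInv : Matrix (Fin n) (Fin m) ℝ) (hl : lamInv * lam = 1) {D Ac : ℝ} (hD : 0 ≤ D)
    (hAc : 0 < Ac) (hApd : ∀ v : Fin m → ℝ, Ac * sqnorm v ≤ ∑ j, v j * A.mulVec v j)
    {B : Matrix (Fin m) (Fin m) ℝ} (hB : Bᵀ * B = (1 / 2 : ℝ) • (A + Aᵀ)) :
    ∃ S B0 Cp Cw : ℝ, 0 ≤ S ∧ 0 ≤ B0 ∧ 0 ≤ Cp ∧ 0 ≤ Cw ∧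
      (∀ (ξ : St n m →L[ℝ] ℝ) (q : St n m),
        |ξ q| ≤ Cw * ‖q‖ * √(∑ k, ξ (wDir lamInv S k) ^ 2)) ∧
      ∀ (V : (Fin n → ℝ) → ℝ) (g osc : ℝ), C∞ V →
      (∀ x, ‖∇ (gradp V) x‖ ≤ D) → (∀ j, ∃ C, BD j C (∇ (gradp V))) →
      (∀ x, ‖gradp V x‖ ≤ g * (1 + ‖x‖)) → (∀ x, sqnorm (fun i => abar i * x i) ≤ V x) →
      (∀ x, V x ≤ sqnorm (fun i => abar i * x i) + osc) → ∀ τ β CP : ℝ, 1 ≤ τ →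
      B0 * (1 + τ ^ 2) ≤ β → Cp * exp (τ * osc) ≤ CP →
      Frozen volume (vDir B) (bDrift (gradp V) A lam τ) (wDir lamInv S) β 1 CP
        (fun p => gibbs V τ p / ∫ q : St n m, gibbs V τ q) := by
  obtain ⟨S, B0, hS, hB0, hstr⟩ := structural A lam lamInv hl hD hAc (vDir B)
    (fun ξ => sum_vDir_sq hB hApd ξ)
  obtain ⟨Cw, hCw, hspan⟩ := exists_wDir_span (m := m) lamInv hS
  obtain ⟨a, ha, hlow⟩ := exists_quadN_lower (m := m) habar
  refine ⟨S, B0, π ^ 2 / 8 * Cw ^ 2 * (√2 ^ Module.finrank ℝ (St n m) / a), Cw, hS, hB0,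
    by positivity, hCw, hspan, ?_⟩
  intro V g osc hV hVD hVB hVg hVl hVu τ β CP hτ hβ hCP
  have hτ0 : 0 < τ := by linarith
  have hG := gradp_contDiff hV
  have hNW : ∀ p : St n m, quadN abar p ≤ Wfun V p := fun p => by
    unfold quadN Wfun; linarith [hVl p.1]
  have hWN : ∀ p : St n m, Wfun V p ≤ quadN abar p + osc := fun p => by
    unfold quadN Wfun; linarith [hVu p.1]
  have hgc : Continuous (gibbs V τ : St n m → ℝ) := (contDiff_gibbs hV τ).continuous
  have hWc : Continuous (fun p : St n m => τ * Wfun V p) :=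
    continuous_const.mul (contDiff_Wfun hV).continuous
  have hlow' : ∀ p : St n m, τ * a * ‖p‖ ^ 2 ≤ τ * Wfun V p := fun p => by
    rw [mul_assoc]; exact mul_le_left ((hlow p).trans (hNW p)) hτ0.le
  have hint : ∀ k, Integrable (fun p : St n m => (1 + ‖p‖) ^ k * gibbs V τ p) := fun k =>
    integrable_pow_mul_exp_neg hWc (by positivity) hlow' k
  have hi0 : Integrable (gibbs V τ : St n m → ℝ) := by simpa using hint 0
  set Z := ∫ q : St n m, gibbs V τ q with hZ
  have hZ0 : 0 < Z := integral_exp_pos hi0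
  have hCP0 : 0 ≤ CP := le_trans (by positivity) hCP
  refine ⟨bDrift_contDiff hG A lam τ, fun j => ?_, ⟨_, norm_bDrift_le A lam τ hVg⟩, ?_, one_pos,
    le_rfl, hCP0, fun p ξ => ?_, hgc.div_const Z, fun p => ?_, ?_, ?_, fun K f hf => ?_,
    fun K f hf => ?_⟩
  · obtain ⟨C, hC⟩ := hVB j
    exact BD_fderiv_bDrift hG hC A lam τ
  · exact le_trans (by positivity) hβ
  · have h1 := hstr (gradp V) hG.diff_top hVD τ p ξ
    have h2 : 0 ≤ ∑ l, ξ (vDir B l) ^ 2 := by positivity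
    have h3 := mul_le_right hβ h2
    linarith
  · exact div_nonneg (gibbs_pos V τ p).le hZ0.le
  · rw [integral_div, ← hZ, div_self hZ0.ne']
  · simpa only [mul_div_assoc] using (hint 2).div_const Z
  · have h := integral_genB_gibbs hV hB lam τ hVg (by simpa using hint 1) hf
    simp only [← mul_div_assoc]
    rw [integral_div, h, zero_div]
  · have hQ : ∀ (ξ : St n m →L[ℝ] ℝ) (q : St n m),
        (ξ q) ^ 2 ≤ Cw ^ 2 * ‖q‖ ^ 2 * ∑ k, ξ (wDir lamInv S k) ^ 2 := fun ξ q => by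
      have h := pow_le_pow_left₀ (abs_nonneg _) (hspan ξ q) 2
      rw [sq_abs, mul_pow, mul_pow, sq_sqrt (sum_nonneg fun _ _ => sq_nonneg _)] at h
      exact h
    have h := ((quadN_gaussForm ha hlow).const_mul hτ0).poincare_perturb (μ := volume) (sq_nonneg Cw) hQ hWc
      (δ := τ * osc) (fun p => mul_le_left (hNW p) hτ0.le)
      (fun p => by rw [← mul_add]; exact mul_le_left (hWN p) hτ0.le)
      (ρ := fun p => gibbs V τ p / Z) (fun p => rfl) hf
    refine h.trans (mul_le_right (le_trans ?_ hCP) ?_)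
    · refine mul_le_right (mul_le_left ?_)
      refine div_le_div_of_nonneg_left (by positivity) ha ?_
      nlinarith
    · exact integral_nonneg fun p => mul_nonneg (dirQ_nonneg _ _ _)
        (div_nonneg (gibbs_pos V τ p).le hZ0.le)

end GibbsFrozen

section Mollify
open scoped Convolution
variable {G : Type} [NormedAddCommGroup G] [NormedSpace ℝ G] [FiniteDimensional ℝ G]
  [MeasurableSpace G] [BorelSpace G] {μ : Measure G} [μ.IsAddHaarMeasure]

/-- Convolving a test function with a bounded continuous function bounds all derivatives. -/
lemma BD_convolution (j : ℕ) : ∀ {E E' F : Type} [NormedAddCommGroup E] [NormedSpace ℝ E]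
    [NormedAddCommGroup E'] [NormedSpace ℝ E'] [NormedAddCommGroup F] [NormedSpace ℝ F]
    (L : E →L[ℝ] E' →L[ℝ] F) {f : G → E} {g : G → E'} {M : ℝ},
    HasCompactSupport f → C∞ f → Continuous g → (∀ x, ‖g x‖ ≤ M) →
    ∃ C, BD j C (f ⋆[L, μ] g) := by
  have h0 : ∀ {E E' F : Type} [NormedAddCommGroup E] [NormedSpace ℝ E]
      [NormedAddCommGroup E'] [NormedSpace ℝ E'] [NormedAddCommGroup F] [NormedSpace ℝ F]
      (L : E →L[ℝ] E' →L[ℝ] F) {f : G → E} {g : G → E'} {M : ℝ},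
      HasCompactSupport f → C∞ f → Continuous g → (∀ x, ‖g x‖ ≤ M) →
      ∃ C, ∀ x, ‖(f ⋆[L, μ] g) x‖ ≤ C := by
    intro E E' F _ _ _ _ _ _ L f g M hcf hf hg hM
    refine ⟨∫ t, ‖L‖ * ‖f t‖ * M ∂μ, fun x => ?_⟩
    have hi : Integrable (fun t => ‖L‖ * ‖f t‖ * M) μ :=
      (((hf.continuous.integrable_of_hasCompactSupport hcf).norm.const_mul ‖L‖).mul_const M)
    refine norm_integral_le_of_norm_le hi (.of_forall fun t => ?_)
    refine ((L (f t)).le_opNorm _).trans ?_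
    exact mul_le_mul (L.le_opNorm _) (hM _) (norm_nonneg _) (by positivity)
  have hsm : ∀ {E E' F : Type} [NormedAddCommGroup E] [NormedSpace ℝ E]
      [NormedAddCommGroup E'] [NormedSpace ℝ E'] [NormedAddCommGroup F] [NormedSpace ℝ F]
      (L : E →L[ℝ] E' →L[ℝ] F) {f : G → E} {g : G → E'},
      HasCompactSupport f → C∞ f → Continuous g →
      C∞ (f ⋆[L, μ] g) := by
    intro E E' F _ _ _ _ _ _ L f g hcf hf hg
    exact hcf.contDiff_convolution_left L hf hg.locallyIntegrable
  induction j with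
  | zero =>
    intro E E' F _ _ _ _ _ _ L f g M hcf hf hg hM
    obtain ⟨C, hC⟩ := h0 L hcf hf hg hM
    exact ⟨C, BD.zero (hsm L hcf hf hg) hC⟩
  | succ j ih =>
    intro E E' F _ _ _ _ _ _ L f g M hcf hf hg hM
    obtain ⟨C, hC⟩ := h0 L hcf hf hg hM
    obtain ⟨C', hC'⟩ := ih (L.precompL G) (hcf.fderiv (𝕜 := ℝ)) (contDiff_fderiv_top hf) hg hM
    have e : ∇ (f ⋆[L, μ] g) = (∇ f ⋆[L.precompL G, μ] g) := funext fun x =>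
      (hcf.hasFDerivAt_convolution_left L (hf.of_le (by simp))
        hg.locallyIntegrable x).fderiv
    refine ⟨max C C', BD.succ (hsm L hcf hf hg) (fun p => (hC p).trans (le_max_left _ _)) ?_⟩
    rw [e]
    exact hC'.mono le_rfl (le_max_right _ _)

/-- Mollification against a fixed kernel. -/
def moll {F : Type} [NormedAddCommGroup F] [NormedSpace ℝ F] (μ : Measure G) (φ : G → ℝ)
    (g : G → F) (x : G) : F := ∫ y, φ y • g (x - y) ∂μ

lemma moll_integrable {F : Type} [NormedAddCommGroup F] [NormedSpace ℝ F] {φ : G → ℝ}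
    (hφ : Continuous φ) (hc : HasCompactSupport φ) {g : G → F} (hg : Continuous g) (x : G) :
    Integrable (fun y => φ y • g (x - y)) μ :=
  (hφ.smul (hg.comp (continuous_const.sub continuous_id))).integrable_of_hasCompactSupport
    hc.smul_right

lemma moll_hasFDerivAt {F : Type} [NormedAddCommGroup F] [NormedSpace ℝ F] {φ : G → ℝ}
    (hφ : Continuous φ) (hc : HasCompactSupport φ) {g : G → F} (hg : Differentiable ℝ g)
    (hg' : Continuous (∇ g)) (x : G) :
    HasFDerivAt (moll μ φ g) (moll μ φ (∇ g) x) x := by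
  obtain ⟨C, hC⟩ := ((isCompact_closedBall x 1).prod hc).exists_bound_of_continuousOn
    (f := fun z : G × G => ∇ g (z.1 - z.2))
    (hg'.comp (continuous_fst.sub continuous_snd)).continuousOn
  have hφi : Integrable φ μ := hφ.integrable_of_hasCompactSupport hc
  refine hasFDerivAt_integral_of_dominated_of_fderiv_le (s := Metric.closedBall x 1)
    (bound := fun y => ‖φ y‖ * C) (F := fun x y => φ y • g (x - y))
    (F' := fun x y => φ y • ∇ g (x - y))
    (Metric.closedBall_mem_nhds x one_pos) ?_ ?_ ?_ ?_ (hφi.norm.mul_const C) ?_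
  · exact .of_forall fun z => (moll_integrable hφ hc hg.continuous z).aestronglyMeasurable
  · exact moll_integrable hφ hc hg.continuous x
  · fun_prop
  · refine .of_forall fun y z hz => ?_
    rw [norm_smul]
    by_cases hy : y ∈ tsupport φ
    · exact mul_le_left (hC (z, y) ⟨hz, hy⟩)
    · rw [image_eq_zero_of_notMem_tsupport hy]; simp
  · refine .of_forall fun y z _ => ?_
    have h1 := ((hg (z - y)).hasFDerivAt.comp z ((hasFDerivAt_id z).sub_const y)).const_smul (φ y)
    exact HasFDerivAt.congr_fderiv (f := fun z => φ y • g (z - y)) h1 (by simp)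

lemma moll_norm_le {F : Type} [NormedAddCommGroup F] [NormedSpace ℝ F] {φ : G → ℝ}
    (hφ0 : ∀ y, 0 ≤ φ y) (hφi : Integrable φ μ) (hφ1 : ∫ y, φ y ∂μ = 1)
    {g : G → F} {r D : ℝ} (hr : ∀ y, φ y ≠ 0 → ‖y‖ < r) (x : G)
    (hD : ∀ y, ‖y‖ < r → ‖g (x - y)‖ ≤ D) : ‖moll μ φ g x‖ ≤ D := by
  have h := norm_integral_le_of_norm_le (f := fun y => φ y • g (x - y)) (hφi.mul_const D)
    (.of_forall fun y => ?_)
  · rwa [integral_mul_const, hφ1, one_mul] at h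
  · rw [norm_smul, norm_eq_abs, abs_of_nonneg (hφ0 y)]
    by_cases hy : φ y = 0
    · simp [hy]
    · exact mul_le_left (hD y (hr y hy)) (hφ0 y)

/-- Smooth approximation of functions with bounded Hessian. -/
theorem exists_mollification {u : G → ℝ} (hu : C∞ u) {D : ℝ}
    (hD : ∀ x, ‖∇ (∇ u) x‖ ≤ D) {ε : ℝ} (hε : 0 < ε) :
    ∃ V : G → ℝ, C∞ V ∧ (∀ x, |V x - u x| ≤ ε) ∧
      (∀ x, ‖∇ V x - ∇ u x‖ ≤ ε) ∧ (∀ x, ‖∇ (∇ V) x‖ ≤ D) ∧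
      ∀ j, ∃ C, BD j C (∇ (∇ V)) := by
  set μ : Measure G := Measure.addHaar with hμ
  have hD0 : 0 ≤ D := (norm_nonneg _).trans (hD 0)
  set r : ℝ := min 1 (ε / (D + 1)) with hr
  have hr0 : 0 < r := by positivity
  have hr1 : r ≤ 1 := by grind
  have hDr : D * r ≤ ε := by
    have : r * (D + 1) ≤ ε := by
      rw [← le_div_iff₀ (by grind)]; grind
    nlinarith
  let B : ContDiffBump (0 : G) := ⟨r / 2, r, by grind, by linarith⟩
  set φ : G → ℝ := B.normed μ with hφd
  have hφs : C∞ φ := B.contDiff_normed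
  have hφ : Continuous φ := by fun_prop
  have hc : HasCompactSupport φ := B.hasCompactSupport_normed
  have hφ0 : ∀ y, 0 ≤ φ y := B.nonneg_normed
  have hφi : Integrable φ μ := B.integrable_normed
  have hφ1 : ∫ y, φ y ∂μ = 1 := B.integral_normed
  have hφr : ∀ y, φ y ≠ 0 → ‖y‖ < r := fun y hy => by
    have h : y ∈ Function.support (B.normed μ) := hy
    rw [B.support_normed_eq] at h
    simpa using h
  have hφn : ∀ y, φ (-y) = φ y := B.normed_neg
  have hu1 := contDiff_fderiv_top hu
  have hu2 := contDiff_fderiv_top hu1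
  have hd1 : ∇ (moll μ φ u) = moll μ φ (∇ u) := funext fun x =>
    (moll_hasFDerivAt hφ hc hu.diff_top hu1.continuous x).fderiv
  have hd2 : ∇ (moll μ φ (∇ u)) = moll μ φ (∇ (∇ u)) := funext fun x =>
    (moll_hasFDerivAt hφ hc hu1.diff_top hu2.continuous x).fderiv
  have hsubst : ∀ {F : Type} [NormedAddCommGroup F] [NormedSpace ℝ F] [CompleteSpace F] (g : G → F)
      (hg : Continuous g) (x : G),
      moll μ φ g x - g x = moll μ φ (fun z => g z - g x) x := fun g hg x => by
    unfold moll
    simp only [smul_sub]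
    rw [integral_sub (moll_integrable hφ hc hg x) (hφi.smul_const _), integral_smul_const, hφ1,
      one_smul]
  refine ⟨moll μ φ u, ?_, fun x => ?_, fun x => ?_, fun x => ?_, fun j => ?_⟩
  · exact hc.contDiff_convolution_left (ContinuousLinearMap.lsmul ℝ ℝ) hφs
      hu.continuous.locallyIntegrable
  · have hlin : ∫ y, φ y • ∇ u x y ∂μ = 0 := by
      have h := integral_neg_eq_self (fun y => φ y • ∇ u x y) μ
      simp only [hφn, map_neg, smul_neg, integral_neg] at h
      linarith
    have e : moll μ φ u x - u x = moll μ φ (fun z => u z - u x - ∇ u x (z - x)) x := by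
      rw [hsubst u hu.continuous x]
      unfold moll
      have i1 : Integrable (fun y => φ y • (u (x - y) - u x)) μ :=
        moll_integrable hφ hc (g := fun z => u z - u x) (hu.continuous.sub continuous_const) x
      have i2 : Integrable (fun y => φ y • ∇ u x y) μ :=
        (hφ.smul (∇ u x).continuous).integrable_of_hasCompactSupport hc.smul_right
      have h3 : ∀ y, φ y • (u (x - y) - u x - ∇ u x (x - y - x))
          = φ y • (u (x - y) - u x) + φ y • ∇ u x y := fun y => by
        rw [show x - y - x = -y by abel, map_neg, ← smul_add, sub_neg_eq_add]
      simp only [h3]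
      rw [integral_add i1 i2, hlin, add_zero]
    rw [e, ← norm_eq_abs]
    refine moll_norm_le hφ0 hφi hφ1 hφr x fun y hy => ?_
    have h := taylor_one hu.diff_top hu1.diff_top hD x (-y)
    rw [← sub_eq_add_neg, norm_neg] at h
    rw [show x - y - x = -y by abel]
    refine h.trans (le_trans (mul_le_left ?_ hD0) hDr)
    nlinarith [norm_nonneg y]
  · rw [hd1, hsubst _ hu1.continuous x]
    refine moll_norm_le hφ0 hφi hφ1 hφr x fun y hy => ?_
    have h := norm_sub_le_of_fderiv_bound hu1.diff_top hD x (-y)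
    rw [← sub_eq_add_neg, norm_neg] at h
    exact h.trans (le_trans (mul_le_left hy.le hD0) hDr)
  · rw [hd1, hd2]
    exact moll_norm_le hφ0 hφi hφ1 hφr x fun y _ => hD _
  · rw [hd1, hd2]
    exact BD_convolution j (ContinuousLinearMap.lsmul ℝ ℝ) hc hφs hu2.continuous hD

end Mollify

/-- Evaluation of covectors on the standard basis. -/
def coordL (n : ℕ) : ((Fin n → ℝ) →L[ℝ] ℝ) →L[ℝ] (Fin n → ℝ) :=
  ContinuousLinearMap.pi fun i => ContinuousLinearMap.apply ℝ ℝ (Pi.single i 1)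

lemma norm_coordL_apply_le (ξ : (Fin n → ℝ) →L[ℝ] ℝ) : ‖coordL n ξ‖ ≤ ‖ξ‖ := by
  refine (pi_norm_le_iff_of_nonneg (norm_nonneg _)).2 fun i => ?_
  refine (ξ.le_opNorm (Pi.single i 1)).trans (le_of_eq ?_)
  rw [Pi.norm_single, norm_one, mul_one]

lemma gradp_eq_coordL (U : (Fin n → ℝ) → ℝ) (x : Fin n → ℝ) :
    gradp U x = coordL n (∇ U x) := rfl

/-- Smooth potentials with all higher derivatives bounded, close to a given potential. -/
theorem exists_regularised {U : (Fin n → ℝ) → ℝ} (hU : C∞ U) {D2 : ℝ}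
    (hD2 : ∀ x, ‖∇ (fun y => ∇ U y) x‖ ≤ D2) {abar : Fin n → ℝ} {Um UM : ℝ}
    (hUlow : ∀ x, sqnorm (fun i => abar i * x i) + Um ≤ U x)
    (hUup : ∀ x, U x ≤ sqnorm (fun i => abar i * x i) + UM) {ε : ℝ} (hε : 0 < ε) :
    ∃ V : (Fin n → ℝ) → ℝ, C∞ V ∧ (∀ x, ‖gradp V x - gradp U x‖ ≤ ε) ∧
      (∀ x, |V x + Um - U x| ≤ 2 * ε) ∧ (∀ x, ‖∇ (gradp V) x‖ ≤ D2) ∧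
      (∀ j, ∃ C, BD j C (∇ (gradp V))) ∧
      (∀ x, sqnorm (fun i => abar i * x i) ≤ V x) ∧
      (∀ x, V x ≤ sqnorm (fun i => abar i * x i) + (UM - Um + 2 * ε)) := by
  obtain ⟨V, hV, h0, h1, h2, h3⟩ := exists_mollification hU hD2 hε
  have e : (fun x => V x - Um + ε) = fun x => V x + (ε - Um) := funext fun x => by ring
  have hfd : ∀ x, ∇ (fun x => V x - Um + ε) x = ∇ V x := by simp_all
  have hg : gradp (fun x => V x - Um + ε) = fun x => coordL n (∇ V x) := funext fun x => by
    rw [gradp_eq_coordL, hfd]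
  have hV1 := contDiff_fderiv_top hV
  have hg' : ∇ (gradp fun x => V x - Um + ε)
      = fun x => (coordL n).comp (∇ (∇ V) x) := by
    rw [hg]
    exact funext fun x => ((coordL n).hasFDerivAt.comp x (hV1.diff_top x).hasFDerivAt).fderiv
  refine ⟨fun x => V x - Um + ε, (hV.sub contDiff_const).add contDiff_const, fun x => ?_,
    fun x => ?_, fun x => ?_, fun j => ?_, fun x => ?_, fun x => ?_⟩
  · rw [hg, gradp_eq_coordL]
    exact (norm_coordL_apply_le _).trans (h1 x)
  · have := abs_le.1 (h0 x)
    rw [abs_le]; constructor <;> linarith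
  · rw [hg']
    refine opNorm_le_bound _ ((norm_nonneg _).trans (h2 x)) fun y => ?_
    refine (norm_coordL_apply_le _).trans ?_
    exact ((∇ (∇ V) x).le_opNorm y).trans
      (mul_le_right (h2 x))
  · obtain ⟨C, hC⟩ := h3 j
    rw [hg']
    exact ⟨_, hC.clm_left (compL ℝ (Fin n → ℝ) ((Fin n → ℝ) →L[ℝ] ℝ)
      (Fin n → ℝ) (coordL n))⟩
  · linarith [hUlow x, (abs_le.1 (h0 x)).1]
  · linarith [hUup x, (abs_le.1 (h0 x)).2]

/-- Normalised Gibbs density of `W` at inverse temperature `τ`. -/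
def temper (μ : Measure E) (W : E → ℝ) (τ : ℝ) (p : E) : ℝ :=
  exp (-(τ * W p)) / ∫ q, exp (-(τ * W q)) ∂μ

/-- A continuous potential within a constant of a Gaussian form. -/
structure NearGauss (N W : E → ℝ) (a osc : ℝ) : Prop where
  form : GaussForm N a
  cont : Continuous W
  lower : ∀ p, N p ≤ W p
  upper : ∀ p, W p ≤ N p + osc

namespace NearGauss
variable {N W : E → ℝ} {a osc : ℝ}

lemma nonneg (H : NearGauss N W a osc) (p : E) : 0 ≤ W p :=
  le_trans (by have := H.form.pos; positivity) ((H.form.lower p).trans (H.lower p))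

lemma integrable_exp (H : NearGauss N W a osc) {τ : ℝ} (hτ : 0 < τ) :
    Integrable (fun p => exp (-(τ * W p))) μ := by
  have h := integrable_pow_mul_exp_neg (μ := μ) (continuous_const.mul H.cont)
    (mul_pos hτ H.form.pos) (W := fun p => τ * W p) (fun p => by
      rw [mul_assoc]
      exact mul_le_left ((H.form.lower p).trans (H.lower p)) hτ.le) 0
  grind

lemma Z_pos (H : NearGauss N W a osc) {τ : ℝ} (hτ : 0 < τ) :
    0 < ∫ q, exp (-(τ * W q)) ∂μ := integral_exp_pos (H.integrable_exp hτ)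

lemma integrable_mul (H : NearGauss N W a osc) {τ : ℝ} (hτ : 0 < τ) {F : E → ℝ}
    (hF : Continuous F) {B : ℝ} (h0 : ∀ p, 0 ≤ F p) (hB : ∀ p, F p ≤ B) :
    Integrable (fun p => F p * temper μ W τ p) μ :=
  integrable_mul_of_bound ((H.integrable_exp hτ).div_const _)
    (fun p => div_nonneg (exp_pos _).le (H.Z_pos (μ := μ) hτ).le) hF
    fun p => by rw [abs_of_nonneg (h0 p)]; exact hB p

/-- Comparison of Gibbs averages when the temperature is raised. -/
lemma temper_compare (H : NearGauss N W a osc) {τ τ' : ℝ} (hτ' : 0 < τ') (hτ : τ' ≤ τ) (M : ℝ)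
    {F : E → ℝ} (hF : Continuous F) {B : ℝ} (h0 : ∀ p, 0 ≤ F p) (hB : ∀ p, F p ≤ B) :
    ∫ p, F p * temper μ W τ' p ∂μ ≤ exp ((τ - τ') * M) * ∫ p, F p * temper μ W τ p ∂μ
      + B * (√2 ^ Module.finrank ℝ E * exp (τ' * (osc - M / 2))) := by
  have hτ0 : 0 < τ := by linarith
  have hB0 : 0 ≤ B := (h0 0).trans (hB 0)
  set Z := ∫ q, exp (-(τ * W q)) ∂μ with hZ
  set Z' := ∫ q, exp (-(τ' * W q)) ∂μ with hZ'
  have hZ0 : 0 < Z := H.Z_pos hτ0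
  have hZ0' : 0 < Z' := H.Z_pos hτ'
  have hZZ : Z ≤ Z' := integral_mono (H.integrable_exp hτ0) (H.integrable_exp hτ') fun p =>
    exp_le_exp.2 (neg_le_neg (mul_le_right hτ (H.nonneg p)))
  have HG := H.form.const_mul hτ'
  have ih : Integrable (fun q => exp (-(τ' * N q / 2))) μ := by
    have h := (H.form.const_mul (half_pos hτ')).integrable_exp (μ := μ)
    grind
  have hhalf : ∫ q, exp (-(τ' * N q / 2)) ∂μ
      ≤ √2 ^ Module.finrank ℝ E * (exp (τ' * osc) * Z') := by
    rw [HG.half_mass (μ := μ)]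
    refine mul_le_left ?_ (by simp)
    rw [hZ', ← integral_const_mul]
    refine integral_mono HG.integrable_exp ((H.integrable_exp hτ').const_mul _) fun q => ?_
    rw [← exp_add, exp_le_exp]
    have := mul_le_left (H.upper q) hτ'.le
    linarith
  have i2 := (H.integrable_mul (μ := μ) hτ0 hF h0 hB).const_mul (exp ((τ - τ') * M))
  have i3 := ih.const_mul (B * exp (-(τ' * M / 2)) / Z')
  have hmono := integral_mono (H.integrable_mul (μ := μ) hτ' hF h0 hB) (i2.add i3) fun p => ?_
  · refine hmono.trans ?_
    rw [integral_add' i2 i3, integral_const_mul, integral_const_mul]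
    refine add_le_add le_rfl ?_
    refine (mul_le_left hhalf).trans (le_of_eq ?_)
    have e : τ' * (osc - M / 2) = -(τ' * M / 2) + τ' * osc := by ring
    rw [e, exp_add]
    field_simp
  · show F p * (exp (-(τ' * W p)) / Z') ≤ exp ((τ - τ') * M) * (F p * (exp (-(τ * W p)) / Z))
      + B * exp (-(τ' * M / 2)) / Z' * exp (-(τ' * N p / 2))
    rcases le_or_gt (W p) M with hM | hM
    · refine le_add_of_le_of_nonneg ?_ (by positivity)
      have h1 : exp (-(τ' * W p)) ≤ exp ((τ - τ') * M) * exp (-(τ * W p)) := by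
        rw [← exp_add, exp_le_exp]
        nlinarith
      have h2 : exp (-(τ' * W p)) / Z' ≤ exp ((τ - τ') * M) * exp (-(τ * W p)) / Z :=
        by gcongr
      calc _ ≤ F p * (exp ((τ - τ') * M) * exp (-(τ * W p)) / Z) :=
            mul_le_left h2 (h0 p)
        _ = _ := by ring
    · refine le_add_of_nonneg_of_le (mul_nonneg (exp_pos _).le (mul_nonneg (h0 p)
        (by positivity))) ?_
      have h1 : exp (-(τ' * W p)) ≤ exp (-(τ' * M / 2)) * exp (-(τ' * N p / 2)) := by
        rw [← exp_add, exp_le_exp]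
        have := mul_le_left hM.le hτ'.le
        have := mul_le_left (H.lower p) hτ'.le
        linarith
      calc _ ≤ B * (exp (-(τ' * M / 2)) * exp (-(τ' * N p / 2)) / Z') :=
            mul_le_mul (hB p) (div_le_div_of_nonneg_right h1 hZ0'.le) (by positivity) hB0
        _ = _ := by ring

/-- Laplace-type bound for the mass away from a low-potential ball. -/
lemma temper_laplace (H : NearGauss N W a osc) {τ : ℝ} (hτ : 1 ≤ τ) {F : E → ℝ}
    (hF : Continuous F) (h0 : ∀ p, 0 ≤ F p) (h1 : ∀ p, F p ≤ 1) {w0 w1 r : ℝ} {q0 : E}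
    (hr : 0 < r) (hw0 : ∀ p, F p ≠ 0 → w0 ≤ W p) (hw1 : ∀ p ∈ Metric.ball q0 r, W p ≤ w1) :
    ∫ p, F p * temper μ W τ p ∂μ
      ≤ exp (τ * w1 - (τ - 1) * w0) * ((∫ q, exp (-(N q)) ∂μ) / μ.real (Metric.ball q0 r)) := by
  have hτ0 : 0 < τ := by linarith
  have hb0 : 0 < μ.real (Metric.ball q0 r) :=
    ENNReal.toReal_pos (Metric.measure_ball_pos μ q0 hr).ne' measure_ball_lt_top.ne
  have hZ : exp (-(τ * w1)) * μ.real (Metric.ball q0 r) ≤ ∫ q, exp (-(τ * W q)) ∂μ := by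
    have h := setIntegral_mono_on (μ := μ) (s := Metric.ball q0 r) (integrableOn_const
      measure_ball_lt_top.ne) (H.integrable_exp hτ0).integrableOn measurableSet_ball
      (f := fun _ => exp (-(τ * w1))) fun p hp => exp_le_exp.2 (neg_le_neg
        (mul_le_left (hw1 p hp) hτ0.le))
    rw [setIntegral_const, smul_eq_mul, mul_comm] at h
    exact h.trans (setIntegral_le_integral (H.integrable_exp hτ0)
      (.of_forall fun _ => (exp_pos _).le))
  have hi := H.form.integrable_exp (μ := μ)
  have hmono := integral_mono (H.integrable_mul (μ := μ) hτ0 hF h0 h1) (hi.const_mul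
    (exp (-((τ - 1) * w0)) / (exp (-(τ * w1)) * μ.real (Metric.ball q0 r)))) fun p => ?_
  · refine hmono.trans (le_of_eq ?_)
    rw [integral_const_mul, exp_sub, exp_neg, exp_neg]
    grind
  · by_cases hp : F p = 0
    · rw [hp, zero_mul]; positivity
    · have e : exp (-(τ * W p)) ≤ exp (-((τ - 1) * w0)) * exp (-(N p)) := by
        rw [← exp_add, exp_le_exp]
        have := mul_le_left (hw0 p hp) (sub_nonneg.2 hτ)
        have := H.lower p
        linarith
      calc F p * (exp (-(τ * W p)) / _) ≤ 1 * (exp (-((τ - 1) * w0)) * exp (-(N p))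
            / (exp (-(τ * w1)) * μ.real (Metric.ball q0 r))) :=
            mul_le_mul (h1 p) (div_le_div₀ (by positivity) e (by positivity) hZ)
              (div_nonneg (exp_pos _).le (H.Z_pos (μ := μ) hτ0).le) zero_le_one
        _ = _ := by ring

lemma le_temper (H : NearGauss N W a osc) {τ : ℝ} (hτ : 1 ≤ τ) {w1 : ℝ} {p : E} (hp : W p ≤ w1) :
    exp (-(τ * w1)) / ∫ q, exp (-(N q)) ∂μ ≤ temper μ W τ p := by
  have hτ0 : 0 < τ := by linarith
  refine div_le_div₀ (exp_pos _).le (exp_le_exp.2 (neg_le_neg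
    (mul_le_left hp hτ0.le))) (H.Z_pos hτ0) ?_
  refine integral_mono (H.integrable_exp hτ0) H.form.integrable_exp fun q =>
    exp_le_exp.2 (neg_le_neg ?_)
  have := mul_le_right hτ (H.nonneg q)
  have := H.lower q
  linarith

end NearGauss

lemma BD.exists_thetaF {K : ℝ} {g : E → ℝ} (hg : BD 4 K g) (w : κ → E) {β : ℝ} (hβ : 0 ≤ β)
    (c : ℝ) : ∃ C, BD 3 C (_root_.thetaF w β g c) := by
  have h := (hg.mono le_rfl (le_max_left K |c|)).thetaF_sub w hβ le_rfl zero_le_one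
    (le_max_right K |c|)
  simp only [zero_mul, sub_zero] at h
  grind

namespace Frozen

/-- The modified energy at the mean minimises over the centring constant. -/
lemma energy_le (H : Frozen μ v b w β η CP ρ) {g : E → ℝ} {K : ℝ} (hg : BD 4 K g) (c : ℝ) :
    energy μ w β ρ g ≤ ∫ p, thetaF w β g c p * ρ p ∂μ := by
  have hg1 : BD 1 K g := hg.mono (by norm_num) le_rfl
  unfold energy
  rw [H.integral_thetaF hg1, H.integral_thetaF hg1, H.integral_sq_sub hg.1.continuous hg.norm_le c]
  have := mul_nonneg H.β_nonneg (sq_nonneg (mean μ ρ g - c))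
  linarith

/-- Pointwise upper bound on a ball from a small modified energy. -/
lemma le_of_energy (H : Frozen μ v b w β η CP ρ) {g : E → ℝ} {K : ℝ} (hg : BD 4 K g) {Θ Cw : ℝ}
    (hΘ : ∀ p, thetaF w β g 0 p ≤ Θ) (hCw : 0 ≤ Cw)
    (hspan : ∀ (ξ : E →L[ℝ] ℝ) q, |ξ q| ≤ Cw * ‖q‖ * √(∑ k, ξ (w k) ^ 2))
    {p : E} {r e ρ0 : ℝ} (he : 0 ≤ e) (hr : Cw * √Θ * r ≤ e)
    (hρ0 : ∀ q ∈ Metric.ball p r, ρ0 ≤ ρ q)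
    (hen : energy μ w β ρ g < β * e ^ 2 * ρ0 * μ.real (Metric.ball p r)) :
    g p ≤ mean μ ρ g + 2 * e := by
  by_contra! hp
  refine hen.not_ge ?_
  obtain ⟨C, hC⟩ := hg.exists_thetaF w H.β_nonneg (mean μ ρ g)
  have hi := H.integrable_mul hC.1.continuous hC.norm_le
  have hlip : ∀ q, ‖∇ g q‖ ≤ Cw * √Θ := fun q => by
    refine opNorm_le_bound _ (by positivity) fun x => ?_
    refine (hspan _ x).trans ?_
    rw [mul_right_comm]
    refine mul_le_right (mul_le_left (sqrt_le_sqrt ?_) hCw)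
    refine le_trans ?_ (hΘ q)
    exact le_add_of_nonneg_right (mul_nonneg H.β_nonneg (sq_nonneg _))
  have hlow : ∀ q ∈ Metric.ball p r, β * e ^ 2 * ρ0 ≤ thetaF w β g (mean μ ρ g) q * ρ q := by
    intro q hq
    have h1 := norm_sub_le_of_fderiv_bound hg.1.diff_top hlip p (q - p)
    rw [add_sub_cancel, norm_eq_abs] at h1
    have h2 : ‖q - p‖ ≤ r := (mem_ball_iff_norm.1 hq).le
    have h3 := (abs_le.1 (h1.trans ((mul_le_left h2).trans hr))).1
    have h4 : e ^ 2 ≤ (g q - mean μ ρ g) ^ 2 := by nlinarith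
    have h5 : β * e ^ 2 ≤ thetaF w β g (mean μ ρ g) q :=
      (mul_le_left h4 H.β_nonneg).trans (le_add_of_nonneg_left (dirQ_nonneg w g q))
    exact (mul_le_left (hρ0 q hq) (mul_nonneg H.β_nonneg (sq_nonneg e))).trans
      (mul_le_right h5 (H.nonneg q))
  have h := setIntegral_mono_on (μ := μ) (s := Metric.ball p r) (integrableOn_const
    measure_ball_lt_top.ne) hi.integrableOn measurableSet_ball hlow
  rw [setIntegral_const, smul_eq_mul, mul_comm] at h
  exact h.trans (setIntegral_le_integral hi (.of_forall fun q =>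
    mul_nonneg (thetaF_nonneg w H.β_nonneg g _ q) (H.nonneg q)))

end Frozen

open FPFlow Frozen in
/-- Propagation of a test function over a window of `N` units of time, freezing the temperature on
each unit. -/
theorem window_iterate {b : ℕ → E → E} {ρ : ℕ → E → ℝ} (HF : FPFlow μ v b0 b1 κc τ u)
    {N : ℕ} {t : ℝ} (ht : N ≤ t)
    (H : ∀ k ≤ N, Frozen μ v (b k) w β 1 CP (ρ k)) {Cb κ0 M d θ : ℝ} (hκ0 : 0 ≤ κ0)
    (hd : 0 ≤ d) (hd1 : d ≤ 1) (hdr : d ≤ 1 / (1 + β * CP)) (hθ : 0 ≤ θ)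
    (hbt : ∀ s ∈ Icc (t - N) t, ∀ p, ‖affDrift b0 b1 (τ s) p‖ ≤ Cb * (1 + ‖p‖))
    (hcl : ∀ k < N, ∀ s ∈ Icc (t - k - 1) (t - k), ∀ p (ξ : E →L[ℝ] ℝ),
      |ξ (affDrift b0 b1 (τ s) p - b k p)| ≤ κ0 * (1 + ‖p‖) * √(∑ l, ξ (w l) ^ 2))
    (hi : ∀ s ∈ Icc (t - N) t, Integrable (fun p => (1 + ‖p‖) ^ 2 * u s p) μ)
    (hM : ∀ s ∈ Icc (t - N) t, ∫ p, (1 + ‖p‖) ^ 2 * u s p ∂μ ≤ M)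
    (hcmp : ∀ k < N, ∀ (F : E → ℝ) (B : ℝ), Continuous F → (∀ p, 0 ≤ F p) → (∀ p, F p ≤ B) →
      ∫ p, F p * ρ (k + 1) p ∂μ ≤ exp d * ∫ p, F p * ρ k p ∂μ + B * θ)
    {φ : E → ℝ} {K Θ ε : ℝ} (hφ : BD 4 K φ) (hφ01 : ∀ p, 0 ≤ φ p ∧ φ p ≤ 1)
    (hΘ : ∀ p, thetaF w β φ 0 p ≤ Θ) (hε : 0 < ε) (hNε : N * ε ≤ 1) :
    ∃ g K', BD 4 K' g ∧ (∀ p, 0 ≤ g p ∧ g p ≤ 1) ∧ (∀ p, thetaF w β g 0 p ≤ Θ + 1) ∧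
      mean μ (ρ N) g ≤ exp (N * d) * (mean μ (ρ 0) φ + N * (ε + θ)) ∧
      energy μ w β (ρ N) g ≤ exp (-(N * (1 / (1 + β * CP) - d))) * (Θ + 1 + β)
        + N * (3 * ε + (Θ + 1 + β) * θ) ∧
      pair μ u φ t ≤ pair μ u g (t - N) + N * (κ0 * √(Θ + 1) * M + ε) := by
  set r := 1 / (1 + β * CP)
  have hβ : 0 ≤ β := (H 0 N.zero_le).β_nonneg
  have hM0 : 0 ≤ M := le_trans (integral_nonneg fun p => mul_nonneg (by positivity)
    (HF.pos t p).le) (hM t ⟨by linarith, le_rfl⟩)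
  have hΘ0 : 0 ≤ Θ := (thetaF_nonneg w hβ φ 0 0).trans (hΘ 0)
  set Θ' := Θ + 1 + β with hΘ'
  have hcent : ∀ g : E → ℝ, (∀ p, 0 ≤ g p ∧ g p ≤ 1) → (∀ p, thetaF w β g 0 p ≤ Θ + 1) →
      ∀ c, 0 ≤ c → c ≤ 1 → ∀ p, thetaF w β g c p ≤ Θ' := by
    intro g hg hgΘ c hc0 hc1 p
    have h1 := hgΘ p
    have h2 : (g p - c) ^ 2 ≤ 1 := by
      rw [sq_le_one_iff_abs_le_one, abs_le]
      grind
    have h3 := mul_le_left h2 hβ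
    have h4 := mul_nonneg hβ (sq_nonneg (g p - 0))
    unfold thetaF at h1 ⊢
    linarith
  have hmean : ∀ k ≤ N, ∀ g : E → ℝ, (∀ p, 0 ≤ g p ∧ g p ≤ 1) →
      0 ≤ mean μ (ρ k) g ∧ mean μ (ρ k) g ≤ 1 := fun k hk g hg =>
    ⟨integral_nonneg fun p => mul_nonneg (hg p).1 ((H k hk).nonneg p),
      (abs_le.1 ((H k hk).abs_mean_le (f := g) (K := 1) fun p => by
        grind)).2⟩
  have key : ∀ j : ℕ, j ≤ N → ∃ g K', BD 4 K' g ∧ (∀ p, 0 ≤ g p ∧ g p ≤ 1) ∧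
      (∀ p, thetaF w β g 0 p ≤ Θ + j * ε) ∧
      mean μ (ρ j) g ≤ exp (j * d) * (mean μ (ρ 0) φ + j * (ε + θ)) ∧
      energy μ w β (ρ j) g ≤ exp (-(j * (r - d))) * Θ' + j * (3 * ε + Θ' * θ) ∧
      pair μ u φ t ≤ pair μ u g (t - j) + j * (κ0 * √(Θ + 1) * M + ε) := by
    intro j
    induction j with
    | zero =>
      intro _
      have h0 := H 0 N.zero_le
      have hc := hmean 0 N.zero_le φ hφ01
      refine ⟨φ, K, hφ, hφ01, by grind, by simp, ?_, by simp⟩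
      obtain ⟨C, hC⟩ := hφ.exists_thetaF w hβ (mean μ (ρ 0) φ)
      have h := integral_mono (h0.integrable_mul hC.1.continuous hC.norm_le)
        (h0.integrable_ρ.const_mul Θ') fun p => mul_le_right
          (hcent φ hφ01 (fun p => (hΘ p).trans (by linarith)) _ hc.1 hc.2 p) (h0.nonneg p)
      rw [integral_const_mul, h0.mass] at h
      simpa [energy] using h
    | succ j ih =>
      intro hj
      obtain ⟨g, Kg, hg, hg01, hgΘ, hgm, hge, hgp⟩ := ih (by omega)
      have hjN : (j : ℝ) + 1 ≤ N := by exact_mod_cast hj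
      have hsub : Icc (t - j - 1) (t - j - 1 + 1) ⊆ Icc (t - N) t := fun s hs =>
        ⟨by grind, by grind⟩
      have hk := H j (by omega)
      obtain ⟨g', K', hg', hg'01, hg'Θ, hg'm, hg'e, hg'p⟩ := hk.unit_step HF
        (a := t - j - 1) (by linarith) hκ0 (fun s hs => hbt s (hsub hs))
        (fun s hs => hcl j (by omega) s ⟨hs.1, by grind⟩)
        (fun s hs => hi s (hsub hs)) (fun s hs => hM s (hsub hs)) hg hg01 hgΘ hε
      have hjε : ((j : ℝ) + 1) * ε ≤ 1 := (mul_le_right hjN hε.le).trans hNε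
      have hΘ1 : Θ + j * ε + ε ≤ Θ + 1 := by linarith
      have hc := hmean j (by omega) g' hg'01
      refine ⟨g', K', hg', hg'01, fun p => (hg'Θ p).trans (le_of_eq (by grind)),
        ?_, ?_, ?_⟩
      · have h1 := hcmp j (by omega) g' 1 hg'.1.continuous (fun p => (hg'01 p).1)
          fun p => (hg'01 p).2
        have h2 : mean μ (ρ (j + 1)) g' ≤ exp d * mean μ (ρ j) g' + 1 * θ := h1
        have h3 := (abs_le.1 hg'm).2
        have h4 : exp d * mean μ (ρ j) g'
            ≤ exp d * (exp (j * d) * (mean μ (ρ 0) φ + j * (ε + θ)) + ε) :=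
          mul_le_left (by linarith)
        have h5 : (1:ℝ) ≤ exp d := one_le_exp hd
        have h6 : exp d ≤ exp (((j : ℝ) + 1) * d) := exp_le_exp.2 (by
          have := mul_nonneg (j.cast_nonneg (α := ℝ)) hd; linarith)
        have h7 : exp (((j : ℝ) + 1) * d) = exp d * exp (j * d) := by rw [← exp_add]; ring_nf
        have h8 := mul_le_right h6 hε.le
        have h9 := mul_le_right (h5.trans h6) hθ
        push_cast
        calc _ ≤ exp d * exp (j * d) * (mean μ (ρ 0) φ + j * (ε + θ)) + exp d * ε + 1 * θ := by
              linarith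
          _ ≤ exp (((j : ℝ) + 1) * d) * (mean μ (ρ 0) φ + j * (ε + θ))
              + exp (((j : ℝ) + 1) * d) * ε + exp (((j : ℝ) + 1) * d) * θ := by
              rw [← h7]; linarith
          _ = _ := by ring
      · obtain ⟨C, hC⟩ := hg'.exists_thetaF w hβ (mean μ (ρ j) g')
        have h1 := hcmp j (by omega) _ Θ' hC.1.continuous (fun p => thetaF_nonneg w hβ _ _ p)
          (hcent g' hg'01 (fun p => (hg'Θ p).trans hΘ1) _ hc.1 hc.2)
        have h2 := ((H (j + 1) hj).energy_le hg' _).trans h1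
        change _ ≤ exp d * energy μ w β (ρ j) g' + _ at h2
        have h3 := mul_le_left (hg'e.trans (add_le_add
          (mul_le_left hge (exp_pos _).le) le_rfl)) (exp_pos d).le
        have h4 : exp d * exp (-r) ≤ 1 := by
          rw [← exp_add]; exact exp_le_one_iff.2 (by linarith)
        have h5 : exp d ≤ 3 := (exp_le_exp.2 hd1).trans exp_one_lt_d9.le |>.trans (by norm_num)
        have h6 := mul_le_right h4
          (show 0 ≤ (j:ℝ) * (3 * ε + Θ' * θ) by positivity)
        have h7 : exp (-((((j : ℝ) + 1)) * (r - d))) = exp d * exp (-r) * exp (-(j * (r - d))) := by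
          rw [← exp_add, ← exp_add]; ring_nf
        have h8 := mul_le_right h5 hε.le
        push_cast
        rw [h7]
        linarith
      · have h1 : κ0 * √(Θ + j * ε + ε) * M ≤ κ0 * √(Θ + 1) * M :=
          mul_le_right (mul_le_left (sqrt_le_sqrt hΘ1) hκ0) hM0
        grind
  obtain ⟨g, K', h1, h2, h3, h4, h5, h6⟩ := key N le_rfl
  exact ⟨g, K', h1, h2, fun p => (h3 p).trans (by linarith), h4, h5, h6⟩

open FPFlow Frozen in
/-- Quantitative bound for the flow at time `t` by the Gibbs average at the temperature of time
`t`, over a window of `N` units of time. -/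
theorem FPFlow.window_estimate (HF : FPFlow μ v b0 b1 κc τ u) {Q W : E → ℝ} {a osc : ℝ}
    (HW : NearGauss Q W a osc) {N : ℕ} {t : ℝ} (ht : N ≤ t)
    (hmono : MonotoneOn τ (Icc (t - N) t)) (hτ1 : 1 ≤ τ (t - N)) {Δ Lb ε1 Cw : ℝ}
    (hΔ : ∀ s ∈ Icc (t - N) t, ∀ s' ∈ Icc (t - N) t, |s - s'| ≤ 1 → |τ s - τ s'| ≤ Δ)
    (hΔ0 : 0 ≤ Δ) (hLb : 0 ≤ Lb) (hε1 : 0 ≤ ε1) (hCw : 0 ≤ Cw)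
    {bd : ℝ → E → E} (Hf : ∀ τ0, 1 ≤ τ0 → τ0 ≤ τ t →
      Frozen μ v (bd τ0) w β 1 CP (temper μ W τ0)) {Cb : ℝ}
    (hbt : ∀ s ∈ Icc (t - N) t, ∀ p, ‖affDrift b0 b1 (τ s) p‖ ≤ Cb * (1 + ‖p‖))
    (hcl : ∀ s τ0 p (ξ : E →L[ℝ] ℝ), |ξ (affDrift b0 b1 (τ s) p - bd τ0 p)|
      ≤ Cw * (|τ s - τ0| * Lb + ε1) * (1 + ‖p‖) * √(∑ l, ξ (w l) ^ 2))
    (hspan : ∀ (ξ : E →L[ℝ] ℝ) q, |ξ q| ≤ Cw * ‖q‖ * √(∑ k, ξ (w k) ^ 2))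
    (hi : ∀ s ∈ Icc (t - N) t, Integrable (fun p => (1 + ‖p‖) ^ 2 * u s p) μ) {M2 : ℝ}
    (hM2 : ∀ s ∈ Icc (t - N) t, ∫ p, (1 + ‖p‖) ^ 2 * u s p ∂μ ≤ M2)
    {M : ℝ} (hd1 : Δ * M ≤ 1) (hdr : Δ * M ≤ 1 / (1 + β * CP)) (hM : osc ≤ M / 2)
    {φ : E → ℝ} {K Θ ε : ℝ} (hφ : BD 4 K φ) (hφ01 : ∀ p, 0 ≤ φ p ∧ φ p ≤ 1)
    (hΘ : ∀ p, thetaF w β φ 0 p ≤ Θ) (hε : 0 < ε) (hNε : N * ε ≤ 1)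
    {e r R w1 θ : ℝ} (he : 0 ≤ e) (hr : 0 ≤ r) (hre : Cw * √(Θ + 1) * r ≤ e) (hR : 0 < R)
    (hw1 : ∀ q, ‖q‖ ≤ R + r → W q ≤ w1)
    (hθ : θ = √2 ^ Module.finrank ℝ E * exp (osc - M / 2))
    (hen : exp (-(N * (1 / (1 + β * CP) - Δ * M))) * (Θ + 1 + β) + N * (3 * ε + (Θ + 1 + β) * θ)
      < β * e ^ 2 * (exp (-(τ t * w1)) / ∫ q, exp (-(Q q)) ∂μ) * μ.real (Metric.ball 0 r)) :
    pair μ u φ t ≤ exp (N * (Δ * M)) * ((∫ p, φ p * temper μ W (τ t) p ∂μ) + N * (ε + θ))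
      + 2 * e + M2 / R ^ 2 + N * (Cw * (Δ * Lb + ε1) * √(Θ + 1) * M2 + ε) := by
  have hosc : 0 ≤ osc := by linarith [HW.lower 0, HW.upper 0]
  have hM0 : 0 ≤ M := by linarith
  have htk : ∀ k ≤ N, t - k ∈ Icc (t - N) t := fun k hk =>
    ⟨by gcongr, by linarith⟩
  have htt : t ∈ Icc (t - N) t := by simp
  have hsN := htk N le_rfl
  have h1τ : ∀ s ∈ Icc (t - N) t, 1 ≤ τ s := fun s hs => hτ1.trans (hmono hsN hs hs.1)
  have hτt : ∀ s ∈ Icc (t - N) t, τ s ≤ τ t := fun s hs => hmono hs htt hs.2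
  have hcl' : ∀ k < N, ∀ s ∈ Icc (t - k - 1) (t - k), ∀ p (ξ : E →L[ℝ] ℝ),
      |ξ (affDrift b0 b1 (τ s) p - bd (τ (t - k)) p)|
        ≤ Cw * (Δ * Lb + ε1) * (1 + ‖p‖) * √(∑ l, ξ (w l) ^ 2) := fun k hk s hs p ξ => by
    have hk1 := htk (k + 1) hk
    push_cast at hk1
    have hs' : s ∈ Icc (t - N) t := ⟨by grind,
      by grind⟩
    have h1 := hΔ s hs' _ (htk k hk.le) (by rw [abs_le]; grind)
    refine (hcl s (τ (t - k)) p ξ).trans ?_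
    gcongr
  have hcmp : ∀ k < N, ∀ (F : E → ℝ) (B : ℝ), Continuous F → (∀ p, 0 ≤ F p) →
      (∀ p, F p ≤ B) → ∫ p, F p * temper μ W (τ (t - (k + 1 : ℕ))) p ∂μ
        ≤ exp (Δ * M) * ∫ p, F p * temper μ W (τ (t - k)) p ∂μ + B * θ := by
    intro k hk F B hF h0 hB
    have hk1 := htk (k + 1) hk
    have h1 := hΔ _ (htk k hk.le) _ hk1 (by simp)
    have hle := hmono hk1 (htk k hk.le) (by grind)
    have h1' := h1τ _ hk1
    refine (HW.temper_compare (by linarith) hle M hF h0 hB).trans (add_le_add ?_ ?_)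
    · refine mul_le_right (exp_le_exp.2 (mul_le_right
        ((le_abs_self _).trans h1) hM0)) (integral_nonneg fun p => mul_nonneg (h0 p)
        ((Hf _ (h1τ _ (htk k hk.le)) (hτt _ (htk k hk.le))).nonneg p))
    · rw [hθ]
      refine mul_le_left (mul_le_left (exp_le_exp.2 ?_)
        (by simp)) ((h0 0).trans (hB 0))
      have := mul_le_right h1' (sub_nonneg.2 hM)
      linarith
  obtain ⟨g, K', hg, hg01, hgΘ, hgm, hge, hgp⟩ := window_iterate HF ht
    (b := fun k => bd (τ (t - k))) (ρ := fun k => temper μ W (τ (t - k))) (w := w)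
    (fun k hk => Hf _ (h1τ _ (htk k hk)) (hτt _ (htk k hk)))
    (κ0 := Cw * (Δ * Lb + ε1)) (d := Δ * M) (θ := θ) (by positivity) (by positivity) hd1 hdr
    (by rw [hθ]; positivity) hbt hcl' hi hM2 hcmp
    hφ hφ01 hΘ hε hNε
  simp only [Nat.cast_zero, sub_zero] at hgm
  have HN := Hf _ hτ1 (hτt _ hsN)
  set c := mean μ (temper μ W (τ (t - N))) g
  have hc0 : 0 ≤ c := integral_nonneg fun p => mul_nonneg (hg01 p).1 (HN.nonneg p)
  have hball : ∀ p, ‖p‖ < R → g p ≤ c + 2 * e := fun p hp => by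
    refine HN.le_of_energy hg hgΘ hCw hspan he hre (ρ0 := exp (-(τ t * w1))
      / ∫ q, exp (-(Q q)) ∂μ) (fun q hq => ?_) (hge.trans_lt ?_)
    · have hq1 : W q ≤ w1 := hw1 q (by
        have h1 := mem_ball_iff_norm.1 hq
        have h2 := norm_add_le p (q - p)
        rw [add_sub_cancel] at h2
        linarith)
      refine le_trans (div_le_div_of_nonneg_right (exp_le_exp.2 (neg_le_neg
        (mul_le_right (hτt _ hsN) ((HW.nonneg q).trans hq1))))
        (integral_nonneg fun _ => (exp_pos _).le)) (HW.le_temper hτ1 hq1)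
    · rwa [Measure.real, Measure.addHaar_ball_center]
  have hpt : ∀ p, g p * u (t - N) p
      ≤ (c + 2 * e) * u (t - N) p + 1 / R ^ 2 * ((1 + ‖p‖) ^ 2 * u (t - N) p) := fun p => by
    have hu := (HF.pos (t - N) p).le
    rw [← mul_assoc, ← add_mul]
    refine mul_le_right ?_ hu
    rcases lt_or_ge ‖p‖ R with hp | hp
    · exact (hball p hp).trans (le_add_of_nonneg_right (by positivity))
    · refine (hg01 p).2.trans (le_add_of_nonneg_of_le (by linarith) ?_)
      rw [div_mul_eq_mul_div, one_mul, one_le_div (by positivity)]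
      exact pow_le_pow_left₀ hR.le (by linarith) 2
  have hiu := HF.integrable (t - N)
  have i2 := (hiu.const_mul (c + 2 * e)).add ((hi _ hsN).const_mul (1 / R ^ 2))
  have h := integral_mono (integrable_bdd_mul hg.1.continuous hg.norm_le hiu) i2 hpt
  rw [integral_add' (hiu.const_mul _) ((hi _ hsN).const_mul _), integral_const_mul,
    integral_const_mul, HF.mass] at h
  have h3 := mul_le_left (hM2 _ hsN) (show 0 ≤ 1 / R ^ 2 by positivity)
  rw [one_div_mul_eq_div, one_div_mul_eq_div] at h3
  rw [one_div_mul_eq_div] at h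
  change pair μ u g (t - N) ≤ _ at h
  change c ≤ exp (N * (Δ * M)) * ((∫ p, φ p * temper μ W (τ t) p ∂μ) + N * (ε + θ)) at hgm
  linarith

/-- A smooth indicator of a superlevel set of a confining potential. -/
lemma exists_superlevel_indicator {U : (Fin n → ℝ) → ℝ} (hU : C∞ U)
    {abar : Fin n → ℝ} (habar : ∀ i, 0 < abar i) {Um : ℝ}
    (hUlow : ∀ x, sqnorm (fun i => abar i * x i) + Um ≤ U x) {l1 l2 : ℝ} (hl : l1 < l2) :
    ∃ (φ : St n m → ℝ) (K : ℝ), BD 4 K φ ∧ (∀ p, 0 ≤ φ p ∧ φ p ≤ 1) ∧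
      (∀ p, l2 ≤ U p.1 → φ p = 1) ∧ ∀ p, φ p ≠ 0 → l1 ≤ U p.1 := by
  have hl' : 0 < l2 - l1 := by grind
  set ψ : (Fin n → ℝ) → ℝ := fun x => 1 - smoothTransition ((U x - l1) / (l2 - l1)) with hψ
  have hψs : C∞ ψ :=
    by fun_prop
  have h1 : ∀ x, l2 ≤ U x → smoothTransition ((U x - l1) / (l2 - l1)) = 1 := fun x hx =>
    smoothTransition.one_of_one_le ((one_le_div hl').2 (by linarith))
  obtain ⟨a0, a1, ha0, ha1, ha⟩ := hadamard_bounds habar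
  have hc : HasCompactSupport ψ := HasCompactSupport.intro
    (isCompact_closedBall (0 : Fin n → ℝ) (√((l2 - Um) / a0))) fun x hx => by
    show 1 - _ = _
    rw [h1 x, sub_self]
    by_contra! hlt
    refine hx (mem_closedBall_zero_iff.2 (le_sqrt_of_sq_le ((le_div_iff₀ ha0).2 ?_)))
    have := mul_le_left (norm_sq_le_sqnorm x) ha0.le
    linarith [(ha x).1, hUlow x]
  obtain ⟨K, hK⟩ := exists_BD_of_compact hψs hc 4
  have hφ := (BD.const (E := St n m) (j := 4) (1:ℝ)).add ((hK.comp_contraction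
    (fst ℝ (Fin n → ℝ) ((Fin n → ℝ) × (Fin m → ℝ)))
    (ContinuousLinearMap.norm_fst_le ..)).smul (-1))
  have e : (fun p : St n m => 1 + (-1 : ℝ) • ψ (fst ℝ (Fin n → ℝ)
      ((Fin n → ℝ) × (Fin m → ℝ)) p)) = fun p => smoothTransition ((U p.1 - l1) / (l2 - l1)) := by
    simp [hψ]
  rw [e] at hφ
  refine ⟨_, _, hφ, fun p => ⟨smoothTransition.nonneg _, smoothTransition.le_one _⟩,
    fun p => h1 p.1, fun p hp => ?_⟩
  by_contra! hlt
  exact hp (smoothTransition.zero_of_nonpos (div_nonpos_of_nonpos_of_nonneg (by linarith) hl'.le))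

lemma eventually_mul_pow_le_exp (c : ℝ) (k : ℕ) : ∀ᶠ x : ℝ in atTop, c * x ^ k ≤ exp x := by
  filter_upwards [(isLittleO_pow_exp_atTop (n := k)).def
    (show 0 < (|c| + 1)⁻¹ by positivity), eventually_ge_atTop 0] with x hx hx0
  rw [norm_of_nonneg (by positivity), norm_of_nonneg (exp_pos x).le, inv_mul_eq_div,
    le_div_iff₀ (by grind)] at hx
  have := mul_le_right (le_abs_self c) (pow_nonneg hx0 k)
  have := pow_nonneg hx0 k
  linarith

/-- The choice of window length, truncation and tolerances for annealing at the rate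
`exp (τ t * osc) ≲ y`, where `t = y * x ^ 40`. -/
theorem FPFlow.window_rate (HF : FPFlow μ v b0 b1 κc τ u) {Q : E → ℝ}
    (hQ : 0 < ∫ q, exp (-(Q q)) ∂μ) {a Lb Cw B0 Cp osc0 C1 : ℝ} (hLb : 0 ≤ Lb) (hCw : 0 ≤ Cw)
    (hspan : ∀ (ξ : E →L[ℝ] ℝ) q, |ξ q| ≤ Cw * ‖q‖ * √(∑ k, ξ (w k) ^ 2))
    {φ : E → ℝ} {K : ℝ} (hφ : BD 4 K φ) (hφ01 : ∀ p, 0 ≤ φ p ∧ φ p ≤ 1) {e : ℝ} (he : 0 < e)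
    (he1 : e ≤ 1) :
    ∀ᶠ x in atTop, ∀ (y t ε1 osc : ℝ) (W : E → ℝ) (bd : ℝ → E → E), 1 ≤ y → t = y * x ^ 40 →
      t ≤ exp x → NearGauss Q W a osc → osc ≤ osc0 → 0 ≤ ε1 → ε1 ≤ 1 / t →
      (∀ τ0 β CP, 1 ≤ τ0 → B0 * (1 + τ0 ^ 2) ≤ β → Cp * exp (τ0 * osc) ≤ CP →
        Frozen μ v (bd τ0) w β 1 CP (temper μ W τ0)) →
      0 ≤ B0 → 0 ≤ Cp → τ t ≤ x → exp (τ t * osc) ≤ 3 * y → MonotoneOn τ (Icc (t / 2) t) →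
      1 ≤ τ (t / 2) →
      (∀ s ∈ Icc (t / 2) t, ∀ s' ∈ Icc (t / 2) t, |s - s'| ≤ 1 →
        |τ s - τ s'| ≤ x ^ 3 / t) →
      (∃ Cb, ∀ s ∈ Icc (t / 2) t, ∀ p, ‖affDrift b0 b1 (τ s) p‖ ≤ Cb * (1 + ‖p‖)) →
      (∀ s τ0 p (ξ : E →L[ℝ] ℝ), |ξ (affDrift b0 b1 (τ s) p - bd τ0 p)|
        ≤ Cw * (|τ s - τ0| * Lb + ε1) * (1 + ‖p‖) * √(∑ l, ξ (w l) ^ 2)) →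
      (∀ s ∈ Icc (t / 2) t, Integrable (fun p => (1 + ‖p‖) ^ 2 * u s p) μ ∧
        ∫ p, (1 + ‖p‖) ^ 2 * u s p ∂μ ≤ x ^ 2) →
      (∀ q, W q ≤ C1 * (1 + ‖q‖) ^ 2) →
      pair μ u φ t ≤ 3 * (∫ p, φ p * temper μ W (τ t) p ∂μ) + 5 * e := by
  set D := Module.finrank ℝ E
  set Z := ∫ q, exp (-(Q q)) ∂μ
  set v1 := μ.real (Metric.ball (0 : E) 1) with hv1
  have hv1p : 0 < v1 :=
    ENNReal.toReal_pos (Metric.measure_ball_pos μ 0 one_pos).ne' measure_ball_lt_top.ne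
  set H := K ^ 2 * ∑ k, ‖w k‖ ^ 2
  filter_upwards [eventually_ge_atTop 4, eventually_ge_atTop (2 * B0), eventually_ge_atTop (3 * Cp),
    eventually_ge_atTop Cw, eventually_ge_atTop (Lb + 1), eventually_ge_atTop (9 * C1),
    eventually_ge_atTop H, eventually_ge_atTop (√2 ^ D * exp osc0), eventually_ge_atTop (2 * osc0),
    eventually_ge_atTop (6 / e), eventually_mul_pow_le_exp 8 5,
    eventually_mul_pow_le_exp (2 * Z / (e ^ 2 * e ^ D * v1)) (4 * D)]
    with x hx4 hxB hxP hxC hxL hx1 hxH hxD hxo hxe hE5 hED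
  intro y t ε1 osc W bd hy ht htx HW hosc hε0 hε1 Hf hB0 hCp hτx hτy hmono hτ1 hΔ ⟨Cb, hCb⟩ hcl hmom
    hW1
  have hx0 : 0 < x := by linarith
  have hx1' : 1 ≤ x := by linarith
  have hpw : ∀ {j k : ℕ}, j ≤ k → x ^ j ≤ x ^ k := fun h => pow_le_pow_right₀ hx1' h
  have hpw4 : ∀ {j k : ℕ}, j < k → 4 * x ^ j ≤ x ^ k := fun {j k} h => by
    refine le_trans ?_ (hpw h)
    rw [pow_succ, mul_comm]
    gcongr
  have hy0 : 0 < y := by linarith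
  have ht0 : 0 < t := by rw [ht]; positivity
  have hyx : ∀ j : ℕ, x ^ j ≤ y * x ^ j := fun j =>
    le_mul_of_one_le_left (by positivity) hy
  obtain ⟨N, hN1, hN2⟩ : ∃ N : ℕ, y * x ^ 14 ≤ N ∧ (N : ℝ) ≤ 2 * (y * x ^ 14) := by
    refine ⟨⌈y * x ^ 14⌉₊, Nat.le_ceil _, ?_⟩
    have h1 := (Nat.ceil_lt_add_one (show 0 ≤ y * x ^ 14 by positivity)).le
    have h2 := (one_le_pow₀ hx1' (n := 14)).trans (hyx 14)
    linarith
  have hN0 : (0:ℝ) ≤ N := by simp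
  have hNt : (N : ℝ) ≤ t / 2 := by
    have h1 := mul_le_left (hpw4 (show 14 < 40 by norm_num)) hy0.le
    linarith
  have hNx : (N : ℝ) ≤ exp x := by linarith
  have hsub : Icc (t - N) t ⊆ Icc (t / 2) t := Set.Icc_subset_Icc_left (by linarith)
  have hhalf : t / 2 ∈ Icc (t / 2) t := ⟨le_rfl, by linarith⟩
  have hMon : MonotoneOn τ (Icc (t - N) t) := hmono.mono hsub
  have hτN : t - N ∈ Icc (t / 2) t := ⟨by linarith, by linarith⟩
  have hτN1 : 1 ≤ τ (t - N) := hτ1.trans (hmono hhalf hτN hτN.1)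
  have hosc0 : 0 ≤ osc := by linarith [HW.lower 0, HW.upper 0]
  have hrate : 1 + x ^ 3 * (x * y) ≤ y * x ^ 5 := by
    have h1 := hpw4 (show 4 < 5 by norm_num)
    have h2 := mul_le_left h1 hy0.le
    have h3 := (one_le_pow₀ hx1' (n := 4)).trans (hyx 4)
    linarith
  have hΔM : x ^ 3 / t * x ^ 9 = 1 / (y * x ^ 28) := by
    rw [ht]; field_simp
  have hM1 : (1:ℝ) ≤ y * x ^ 28 := (one_le_pow₀ hx1').trans (hyx 28)
  have hNΔ : N * (x ^ 3 / t * x ^ 9) ≤ 1 := by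
    rw [hΔM, mul_one_div, div_le_one (by grind)]
    have := mul_le_left (hpw4 (show 14 < 28 by norm_num)) hy0.le
    linarith
  set θ := √2 ^ D * exp (osc - x ^ 9 / 2) with hθ
  have h9 : 4 * x ^ 8 ≤ x ^ 9 := hpw4 (show 8 < 9 by norm_num)
  have h8 : 4 * x ^ 7 ≤ x ^ 8 := hpw4 (show 7 < 8 by norm_num)
  have h7 : 4 * x ^ 6 ≤ x ^ 7 := hpw4 (show 6 < 7 by norm_num)
  have hx6 : x ≤ x ^ 6 := by simpa using hpw (show 1 ≤ 6 by norm_num)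
  have hθ8 : θ ≤ exp (-x ^ 8) := by
    have h1 : θ = (√2 ^ D * exp osc) * exp (-(x ^ 9 / 2)) := by
      rw [hθ, mul_assoc, ← exp_add, sub_eq_add_neg]
    have h2 : √2 ^ D * exp osc ≤ exp x := (mul_le_left (exp_le_exp.2 hosc)
      (by simp)).trans (hxD.trans (by linarith [add_one_le_exp x]))
    rw [h1]
    refine (mul_le_right h2).trans ?_
    rw [← exp_add, exp_le_exp]
    linarith
  have hNε : N * exp (-x ^ 8) ≤ exp (-x) := by
    refine (mul_le_right hNx).trans ?_
    rw [← exp_add, exp_le_exp]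
    linarith
  have hex : exp (-x) ≤ e / 6 := by
    rw [exp_neg, inv_le_comm₀ (exp_pos x) (by grind), inv_div]
    linarith [add_one_le_exp x]
  have hsq : √(x ^ 4 + 1) ≤ x ^ 3 := by
    rw [sqrt_le_left (by positivity), ← pow_mul]
    have := hpw4 (show 5 < 6 by norm_num)
    have := hpw (show 4 ≤ 5 by norm_num)
    norm_num
    linarith
  have hr1 : e / x ^ 4 ≤ 1 := (div_le_one (by positivity)).2 (he1.trans (one_le_pow₀ hx1'))
  have hx3B : ∀ τ0, 1 ≤ τ0 → τ0 ≤ τ t → B0 * (1 + τ0 ^ 2) ≤ x ^ 3 := fun τ0 h1 h2 => by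
    have h3 : τ0 ^ 2 ≤ x ^ 2 := pow_le_pow_left₀ (by linarith) (h2.trans hτx) 2
    have h4 : 1 ≤ x ^ 2 := one_le_pow₀ hx1'
    have h5 := mul_le_left (show 1 + τ0 ^ 2 ≤ 2 * x ^ 2 by linarith) hB0
    have h6 := mul_le_right hxB (sq_nonneg x)
    linarith
  have hxP' : ∀ τ0, τ0 ≤ τ t → Cp * exp (τ0 * osc) ≤ x * y := fun τ0 h2 => by
    have h3 : exp (τ0 * osc) ≤ 3 * y :=
      (exp_le_exp.2 (mul_le_right h2 hosc0)).trans hτy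
    have h4 := mul_le_left h3 hCp
    have h5 := mul_le_right hxP hy0.le
    linarith
  have hΘ : ∀ p, thetaF w (x ^ 3) φ 0 p ≤ x ^ 4 := fun p => by
    have h1 : dirQ w φ p ≤ H := by
      rw [dirQ, show H = ∑ k, K ^ 2 * ‖w k‖ ^ 2 from mul_sum ..]
      refine sum_le_sum fun k _ => ?_
      rw [← mul_pow, ← sq_abs]
      have h0 := ((∇ φ p).le_opNorm (w k)).trans
        (mul_le_right (hφ.norm_fderiv_le p (j := 3)))
      exact pow_le_pow_left₀ (abs_nonneg _) h0 2
    have h2 : (φ p - 0) ^ 2 ≤ 1 := by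
      rw [sub_zero]
      exact pow_le_one₀ (hφ01 p).1 (hφ01 p).2
    have h3 := mul_le_left h2 (show 0 ≤ x ^ 3 by positivity)
    have h4 := hpw4 (show 3 < 4 by norm_num)
    have h5 : x ≤ x ^ 3 := by simpa using hpw (show 1 ≤ 3 by norm_num)
    rw [thetaF]
    linarith
  have hCwx : Cw * √(x ^ 4 + 1) ≤ x ^ 4 := by
    calc _ ≤ x * x ^ 3 := by gcongr
      _ = x ^ 4 := by ring
  have hball : μ.real (Metric.ball (0 : E) (e / x ^ 4)) = (e / x ^ 4) ^ D * v1 := by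
    rw [measureReal_def, Measure.addHaar_ball_of_pos μ _ (by positivity), ENNReal.toReal_mul,
      ENNReal.toReal_ofReal (by positivity), hv1, measureReal_def]
  have hw1 : ∀ q : E, ‖q‖ ≤ x ^ 2 + e / x ^ 4 → W q ≤ x ^ 5 := fun q hq => by
    have hC1 : 0 ≤ C1 := by
      have := (HW.nonneg 0).trans (hW1 0)
      simpa using this
    have h4 : 1 ≤ x ^ 2 := one_le_pow₀ hx1'
    have h1 : (1 + ‖q‖) ^ 2 ≤ (3 * x ^ 2) ^ 2 :=
      pow_le_pow_left₀ (by positivity) (by linarith) 2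
    have h2 := mul_le_left h1 hC1
    have h3 := mul_le_right hx1 (show 0 ≤ x ^ 4 by positivity)
    calc W q ≤ C1 * (3 * x ^ 2) ^ 2 := (hW1 q).trans h2
      _ = 9 * C1 * x ^ 4 := by ring
      _ ≤ x * x ^ 4 := h3
      _ = x ^ 5 := by ring
  have hlow : exp (-x ^ 7) < x ^ 3 * e ^ 2 * (exp (-(τ t * x ^ 5)) / Z)
      * μ.real (Metric.ball (0 : E) (e / x ^ 4)) := by
    rw [hball]
    have h1 : exp (-x ^ 6) ≤ exp (-(τ t * x ^ 5)) := exp_le_exp.2 (by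
      linarith [mul_le_right hτx (show 0 ≤ x ^ 5 by positivity)])
    have h2 : 2 * exp (-x) ≤ e ^ 2 * ((e / x ^ 4) ^ D * v1) / Z := by
      rw [div_pow, ← pow_mul]
      rw [div_mul_eq_mul_div, div_le_iff₀ (by positivity)] at hED
      rw [exp_neg, ← div_eq_mul_inv, div_le_div_iff₀ (exp_pos x) hQ, div_mul_eq_mul_div,
        mul_div_assoc', div_mul_eq_mul_div, le_div_iff₀ (by positivity)]
      linarith
    calc exp (-x ^ 7) ≤ exp (-x ^ 6) * exp (-x) := by
          rw [← exp_add, exp_le_exp]; linarith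
      _ < exp (-x ^ 6) * (2 * exp (-x)) := by
          have := exp_pos (-x)
          gcongr; linarith
      _ ≤ exp (-(τ t * x ^ 5)) * (e ^ 2 * ((e / x ^ 4) ^ D * v1) / Z) := by gcongr
      _ ≤ x ^ 3 * (exp (-(τ t * x ^ 5)) * (e ^ 2 * ((e / x ^ 4) ^ D * v1) / Z)) :=
          le_mul_of_one_le_left (by positivity) (one_le_pow₀ hx1')
      _ = _ := by ring
  have hdecay : x ^ 8 ≤ N * (1 / (1 + x ^ 3 * (x * y)) - x ^ 3 / t * x ^ 9) := by
    have h1 : 1 / (y * x ^ 5) ≤ 1 / (1 + x ^ 3 * (x * y)) :=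
      by gcongr
    have h2 : x ^ 9 ≤ N * (1 / (y * x ^ 5)) := by
      rw [mul_one_div, le_div_iff₀ (by positivity)]
      linarith
    have h3 := mul_le_left h1 hN0
    linarith
  have hen : exp (-(N * (1 / (1 + x ^ 3 * (x * y)) - x ^ 3 / t * x ^ 9))) * (x ^ 4 + 1 + x ^ 3)
      + N * (3 * exp (-x ^ 8) + (x ^ 4 + 1 + x ^ 3) * θ) ≤ exp (-x ^ 7) := by
    have h1 : x ^ 4 + 1 + x ^ 3 ≤ x ^ 5 := by
      have := hpw4 (show 4 < 5 by norm_num)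
      have := hpw (show 3 ≤ 4 by norm_num)
      have := one_le_pow₀ hx1' (n := 4)
      linarith
    have h5 := one_le_pow₀ hx1' (n := 5)
    have h6 := one_le_exp hx0.le
    calc _ ≤ exp (-x ^ 8) * x ^ 5 + exp x * (3 * exp (-x ^ 8) + x ^ 5 * exp (-x ^ 8)) := by gcongr
      _ = (x ^ 5 + exp x * (3 + x ^ 5)) * exp (-x ^ 8) := by ring
      _ ≤ exp x * (8 * x ^ 5) * exp (-x ^ 8) := by
          have h8 := mul_le_left (show 3 + 2 * x ^ 5 ≤ 8 * x ^ 5 by linarith)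
            (exp_pos x).le
          gcongr
          linarith
      _ ≤ exp x * exp x * exp (-x ^ 8) := by gcongr
      _ ≤ exp (-x ^ 7) := by
          rw [← exp_add, ← exp_add, exp_le_exp]
          linarith
  have key := HF.window_estimate (w := w) HW (by linarith) hMon hτN1
    (fun s hs s' hs' h => hΔ s (hsub hs) s' (hsub hs') h) (by positivity) hLb hε0 hCw
    (β := x ^ 3) (CP := x * y) (fun τ0 h1 h2 => Hf τ0 _ _ h1 (hx3B τ0 h1 h2) (hxP' τ0 h2))
    (fun s hs => hCb s (hsub hs)) hcl hspan (fun s hs => (hmom s (hsub hs)).1)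
    (fun s hs => (hmom s (hsub hs)).2) (M := x ^ 9)
    (by rw [hΔM]; exact (div_le_one (by positivity)).2 hM1)
    (by
      rw [hΔM]
      exact one_div_le_one_div_of_le (by positivity) (hrate.trans
        (mul_le_left (hpw (by norm_num)) hy0.le)))
    (by linarith [show x ≤ x ^ 9 by linarith])
    hφ hφ01 hΘ (exp_pos (-x ^ 8)) (by linarith) he.le (r := e / x ^ 4) (by positivity)
    (by
      refine (mul_le_right hCwx).trans (le_of_eq ?_)
      field_simp)
    (R := x ^ 2) (by positivity) hw1 hθ (hen.trans_lt hlow)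
  refine key.trans ?_
  set I := ∫ p, φ p * temper μ W (τ t) p ∂μ with hI
  have hI0 : 0 ≤ I := integral_nonneg fun p => mul_nonneg (hφ01 p).1
    (div_nonneg (exp_pos _).le (integral_nonneg fun _ => (exp_pos _).le))
  have hNθ : N * (exp (-x ^ 8) + θ) ≤ e / 3 := by
    have := mul_le_left hθ8 hN0
    linarith
  have hexp3 : exp (N * (x ^ 3 / t * x ^ 9)) ≤ 3 :=
    (exp_le_exp.2 hNΔ).trans exp_one_lt_three.le
  have h1 : exp (N * (x ^ 3 / t * x ^ 9)) * (I + N * (exp (-x ^ 8) + θ)) ≤ 3 * (I + e / 3) := by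
    gcongr
  have hxinv : 1 / x ≤ e / 6 := by
    rw [div_le_iff₀ hx0, div_mul_eq_mul_div, le_div_iff₀ (by norm_num)]
    rw [div_le_iff₀ he] at hxe
    linarith
  have h2 : x ^ 2 / (x ^ 2) ^ 2 ≤ e / 6 := by
    refine le_trans ?_ hxinv
    rw [div_le_div_iff₀ (by positivity) hx0]
    have := hpw (show 3 ≤ 4 by norm_num)
    linarith [show (x ^ 2) ^ 2 = x ^ 4 by ring]
  have h3 : x ^ 3 / t * Lb + ε1 ≤ x ^ 4 / t := by
    have h5 : 1 / t ≤ x ^ 3 / t := by gcongr; exact one_le_pow₀ hx1'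
    calc _ ≤ x ^ 3 / t * Lb + x ^ 3 / t := by linarith
      _ = x ^ 3 * (Lb + 1) / t := by ring
      _ ≤ x ^ 3 * x / t := by gcongr
      _ = _ := by ring
  have h4 : N * (Cw * (x ^ 3 / t * Lb + ε1) * √(x ^ 4 + 1) * x ^ 2) ≤ e / 6 := by
    refine le_trans ?_ hxinv
    calc _ = N * ((Cw * √(x ^ 4 + 1)) * (x ^ 3 / t * Lb + ε1) * x ^ 2) := by ring
      _ ≤ (2 * (y * x ^ 14)) * (x ^ 4 * (x ^ 4 / t) * x ^ 2) := by gcongr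
      _ = 2 / x ^ 16 := by rw [ht]; field_simp
      _ ≤ 1 / x := by
          rw [div_le_div_iff₀ (by positivity) hx0]
          have := hpw4 (show 1 < 2 by norm_num)
          have := hpw (show 2 ≤ 16 by norm_num)
          linarith [pow_one x]
  linarith

section Cooling
variable {T : ℝ → ℝ}

lemma eventually_antitoneOn_cooling (hTdiff : ContDiff ℝ 1 T)
    {Ttil : ℝ} (hTder : ∀ᶠ t in atTop, -(Ttil / t) ≤ deriv T t ∧ deriv T t ≤ 0) :
    ∃ t0, AntitoneOn T (Ici t0) := by
  obtain ⟨t0, h⟩ := eventually_atTop.1 hTder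
  refine ⟨t0, antitoneOn_of_deriv_nonpos (convex_Ici t0) hTdiff.continuous.continuousOn
    (hTdiff.differentiable one_ne_zero).differentiableOn fun t ht => (h t ?_).2⟩
  rw [interior_Ici] at ht
  grind

/-- A logarithmic cooling schedule in terms of the power `t ^ a` of the time. -/
lemma eventually_cooling (hTpos : ∀ t, 0 < T t) (hTdiff : ContDiff ℝ 1 T)
    (hTlim : Tendsto T atTop (nhds 0)) {E : ℝ} (hE : 0 < E)
    (hTlb : ∀ᶠ t in atTop, E / log t ≤ T t) {Ttil : ℝ}
    (hTder : ∀ᶠ t in atTop, -(Ttil / t) ≤ deriv T t ∧ deriv T t ≤ 0) {a : ℝ} (ha : 0 < a)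
    {c : ℝ} (hc : 0 ≤ c) :
    ∀ᶠ t in atTop, (T t)⁻¹ ≤ t ^ a ∧ exp ((T t)⁻¹ * c) ≤ t ^ (c / E) ∧ t ≤ exp (t ^ a) ∧
      MonotoneOn (fun s => (T s)⁻¹) (Icc (t / 2) t) ∧ 1 ≤ (T (t / 2))⁻¹ ∧
      ∀ s ∈ Icc (t / 2) t, ∀ s' ∈ Icc (t / 2) t, |s - s'| ≤ 1 →
        |(T s)⁻¹ - (T s')⁻¹| ≤ (t ^ a) ^ 3 / t := by
  obtain ⟨t0, hanti⟩ := eventually_antitoneOn_cooling hTdiff hTder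
  have hhalf : Tendsto (fun t : ℝ => t / 2) atTop atTop := tendsto_id.atTop_div_const two_pos
  obtain ⟨t1, hder⟩ := eventually_atTop.1 hTder
  have hlog := (isLittleO_log_rpow_atTop ha).def (show 0 < min E 1 by grind)
  filter_upwards [hTlb, hlog, eventually_gt_atTop 1, hhalf.eventually_ge_atTop t0,
    hhalf.eventually_ge_atTop t1, hhalf.eventually (hTlim.eventually_le_const one_pos),
    (tendsto_rpow_atTop ha).eventually_ge_atTop (2 * Ttil)] with t hlb hlog ht ht0 ht1 hT1 hTt
  have htp : 0 < t := by linarith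
  have hL : 0 < log t := log_pos ht
  have hx : 0 < t ^ a := by positivity
  rw [norm_of_nonneg hL.le, norm_of_nonneg hx.le] at hlog
  have hinv : (T t)⁻¹ ≤ log t / E := by
    rw [← inv_div]; gcongr
  have hle : (T t)⁻¹ ≤ t ^ a := hinv.trans <| by
    rw [div_le_iff₀ hE, mul_comm]
    exact hlog.trans (mul_le_right (min_le_left _ _) hx.le)
  have hmono : MonotoneOn (fun s => (T s)⁻¹) (Icc (t / 2) t) := fun s hs s' hs' h =>
    inv_anti₀ (hTpos _) (hanti (mem_Ici.2 (ht0.trans hs.1)) (mem_Ici.2 (ht0.trans hs'.1)) h)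
  refine ⟨hle, ?_, ?_, hmono, (one_le_inv₀ (hTpos _)).2 hT1, fun s hs s' hs' hss => ?_⟩
  · rw [rpow_def_of_pos htp, exp_le_exp]
    calc _ ≤ log t / E * c := mul_le_right hinv hc
      _ = _ := by ring
  · rw [← log_le_iff_le_exp htp]
    exact hlog.trans (mul_le_of_le_one_left hx.le (min_le_right _ _))
  · have hmv : |T s - T s'| ≤ Ttil / (t / 2) * |s - s'| := by
      have := (convex_Icc (t / 2) t).norm_image_sub_le_of_norm_deriv_le (f := T)
        (C := Ttil / (t / 2)) (fun r _ => (hTdiff.differentiable one_ne_zero) r)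
        (fun r hr => ?_) hs' hs
      · simpa using this
      · obtain ⟨h1, h2⟩ := hder r (ht1.trans hr.1)
        rw [norm_eq_abs, abs_of_nonpos h2]
        have h3 : Ttil / r ≤ Ttil / (t / 2) ∨ Ttil < 0 := by
          by_cases hT0 : 0 ≤ Ttil
          · exact .inl (div_le_div_of_nonneg_left hT0 (by linarith) hr.1)
          grind
        rcases h3 with h3 | h3
        · linarith
        · have : Ttil / r < 0 := div_neg_of_neg_of_pos h3 (by grind)
          linarith
    have htt : t ∈ Icc (t / 2) t := by grind
    have hb : ∀ r ∈ Icc (t / 2) t, (T r)⁻¹ ≤ t ^ a := fun r hr => (hmono hr htt hr.2).trans hle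
    have hi : ∀ r, 0 < (T r)⁻¹ := fun r => inv_pos.2 (hTpos r)
    have hT0 : 0 ≤ Ttil := by
      obtain ⟨h1, h2⟩ := hder t (by linarith)
      have : 0 ≤ Ttil / t := by linarith
      by_contra hcon
      exact absurd this (not_le.2 (div_neg_of_neg_of_pos (not_le.1 hcon) htp))
    have heq : (T s)⁻¹ - (T s')⁻¹ = -((T s)⁻¹ * (T s')⁻¹ * (T s - T s')) := by
      grind
    rw [heq, abs_neg, abs_mul, abs_of_pos (mul_pos (hi s) (hi s'))]
    calc _ ≤ t ^ a * t ^ a * (Ttil / (t / 2) * 1) := by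
          have := (hi s').le
          have := hb s hs
          have := hb s' hs'
          gcongr
          exact hmv.trans (mul_le_left hss (by grind))
      _ = t ^ a * t ^ a * (2 * Ttil) / t := by ring
      _ ≤ t ^ a * t ^ a * (t ^ a) / t := by gcongr
      _ = _ := by ring

end Cooling

lemma exists_gradp_growth {U : (Fin n → ℝ) → ℝ} {r2 Ug : ℝ} (hr2 : 0 < r2) (hUg : 0 < Ug)
    (hgrad2 : ∀ x, sqnorm (gradp U x) ≤ r2 * sqnorm x + Ug) :
    ∃ g, ∀ x, ‖gradp U x‖ ≤ g * (1 + ‖x‖) := by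
  refine ⟨√(r2 * n + Ug), fun x => ?_⟩
  refine le_of_sq_le_sq ?_ (by positivity)
  rw [mul_pow, sq_sqrt (by positivity)]
  have h1 := (norm_sq_le_sqnorm (gradp U x)).trans (hgrad2 x)
  have h2 := mul_le_left (sqnorm_le_norm_sq x) hr2.le
  have h3 : 0 ≤ (r2 * n) * (1 + 2 * ‖x‖) := by positivity
  have h4 : 0 ≤ Ug * (2 * ‖x‖ + ‖x‖ ^ 2) := by positivity
  linarith

lemma exists_quadN_upper {abar : Fin n → ℝ} (habar : ∀ i, 0 < abar i) :
    ∃ C, 0 ≤ C ∧ ∀ p : St n m, quadN abar p ≤ C * ‖p‖ ^ 2 := by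
  obtain ⟨a0, a1, h0, h1, h⟩ := hadamard_bounds habar
  refine ⟨a1 * n + n + m, by positivity, fun p => ?_⟩
  have hx := (sqnorm_le_norm_sq p.1).trans (mul_le_left
    (pow_le_pow_left₀ (norm_nonneg _) (norm_fst_le p) 2) n.cast_nonneg)
  have hy := (sqnorm_le_norm_sq p.2.1).trans (mul_le_left
    (pow_le_pow_left₀ (norm_nonneg _) ((norm_fst_le p.2).trans (norm_snd_le p)) 2) n.cast_nonneg)
  have hz := (sqnorm_le_norm_sq p.2.2).trans (mul_le_left
    (pow_le_pow_left₀ (norm_nonneg _) ((norm_snd_le p.2).trans (norm_snd_le p)) 2) m.cast_nonneg)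
  have h2 := mul_le_left hx h1.le
  have h3 : 0 ≤ n * ‖p‖ ^ 2 := by positivity
  have h4 : 0 ≤ m * ‖p‖ ^ 2 := by positivity
  rw [quadN]
  grind

lemma nearGauss_Wfun {abar : Fin n → ℝ} {a : ℝ} (ha : 0 < a)
    (hlow : ∀ p : St n m, a * ‖p‖ ^ 2 ≤ quadN abar p) {V : (Fin n → ℝ) → ℝ} {osc : ℝ}
    (hV : C∞ V) (hVl : ∀ x, sqnorm (fun i => abar i * x i) ≤ V x)
    (hVu : ∀ x, V x ≤ sqnorm (fun i => abar i * x i) + osc) :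
    NearGauss (quadN abar : St n m → ℝ) (Wfun V) a osc where
  form := quadN_gaussForm ha hlow
  cont := (contDiff_Wfun hV).continuous
  lower p := by unfold quadN Wfun; grind
  upper p := by unfold quadN Wfun; grind

/-- At low temperature the Gibbs measures of potentials close to `U` do not charge the
superlevel sets of `U`. -/
lemma eventually_gibbs_superlevel_le {U : (Fin n → ℝ) → ℝ} (hU : Continuous U)
    {abar : Fin n → ℝ} {a : ℝ} {Um : ℝ} (x₀ : Fin n → ℝ) {δ : ℝ} (hδ : 0 < δ) {φ : St n m → ℝ}
    (hφ : Continuous φ) (hφ01 : ∀ p, 0 ≤ φ p ∧ φ p ≤ 1)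
    (hφU : ∀ p, φ p ≠ 0 → U x₀ + δ / 2 ≤ U p.1) {e : ℝ} (he : 0 < e) :
    ∀ᶠ τ in atTop, ∀ (V : (Fin n → ℝ) → ℝ) (osc ε : ℝ), 0 ≤ ε → ε ≤ δ / 32 →
      NearGauss (quadN abar : St n m → ℝ) (Wfun V) a osc → (∀ x, |V x + Um - U x| ≤ 2 * ε) →
      ∫ p, φ p * temper volume (Wfun V) τ p ≤ e := by
  have hcont : Continuous (Wfun U : St n m → ℝ) := by
    unfold Wfun sqnorm
    fun_prop
  obtain ⟨r, hr, hball⟩ := Metric.continuousAt_iff.1 (hcont.continuousAt (x := (x₀, 0, 0)))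
    (δ / 4) (by grind)
  have hW0 : Wfun U ((x₀, 0, 0) : St n m) = U x₀ := by simp [Wfun, sqnorm]
  set Kc := (∫ q : St n m, exp (-(quadN abar q)))
    / (volume : Measure (St n m)).real (Metric.ball (x₀, 0, 0) r)
  have hlim : Tendsto (fun τ : ℝ => exp (-(τ * (δ / 8)) + (U x₀ - Um + δ / 2)) * Kc) atTop
      (nhds 0) := by
    have h1 : Tendsto (fun τ : ℝ => -(τ * (δ / 8)) + (U x₀ - Um + δ / 2)) atTop atBot :=
      tendsto_atBot_add_const_right _ _ (tendsto_neg_atTop_atBot.comp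
        (tendsto_id.atTop_mul_const (by positivity)))
    simpa using (tendsto_exp_atBot.comp h1).mul_const Kc
  filter_upwards [hlim.eventually_le_const he, eventually_ge_atTop 1] with τ hτe hτ V osc ε hε hεδ
    HW hVU
  refine (HW.temper_laplace hτ hφ (fun p => (hφ01 p).1) (fun p => (hφ01 p).2)
    (w0 := U x₀ - Um + δ / 2 - 2 * ε) (w1 := U x₀ - Um + δ / 4 + 2 * ε) (q0 := (x₀, 0, 0)) hr
    (fun p hp => ?_) fun p hp => ?_).trans (le_trans ?_ hτe)
  · have h1 := hφU p hp
    have h2 := abs_le.1 (hVU p.1)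
    have h3 := sqnorm_nonneg p.2.1
    have h4 := sqnorm_nonneg p.2.2
    unfold Wfun
    linarith
  · have h1 := hball hp
    rw [hW0, dist_eq] at h1
    have h3 := (abs_lt.1 h1).2
    have h2 := abs_le.1 (hVU p.1)
    unfold Wfun at h3 ⊢
    linarith
  · refine mul_le_right (exp_le_exp.2 ?_) (div_nonneg
      (integral_nonneg fun _ => (exp_pos _).le) measureReal_nonneg)
    nlinarith

end Flow

end Development

/-- convergence in probability to the set of global minimisers. -/
theorem stmt13 (n m : ℕ) (hn : 0 < n) (hm : 0 < m) (hnm : n ≤ m)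
    (U : (Fin n → ℝ) → ℝ) (hU : ContDiff ℝ (⊤ : ℕ∞) U)
    (D2 : ℝ) (hD2 : ∀ x, ‖fderiv ℝ (fun y => fderiv ℝ U y) x‖ ≤ D2)
    (abar : Fin n → ℝ) (habar : ∀ i, 0 < abar i)
    (r1 r2 Ug : ℝ) (hr1 : 0 < r1) (hr2 : 0 < r2) (hUg : 0 < Ug) (Um UM : ℝ)
    (hUlow : ∀ x, sqnorm (fun i => abar i * x i) + Um ≤ U x)
    (hUup : ∀ x, U x ≤ sqnorm (fun i => abar i * x i) + UM)
    (hgrad1 : ∀ x, r1 * sqnorm x - Ug ≤ ∑ i, gradp U x i * x i)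
    (hgrad2 : ∀ x, sqnorm (gradp U x) ≤ r2 * sqnorm x + Ug)
    (A : Matrix (Fin m) (Fin m) ℝ) (Ac : ℝ) (hAc : 0 < Ac)
    (hApd : ∀ v : Fin m → ℝ, Ac * sqnorm v ≤ ∑ j, v j * A.mulVec v j)
    (lam : Matrix (Fin m) (Fin n) ℝ) (lamInv : Matrix (Fin n) (Fin m) ℝ)
    (hlamInv : lamInv * lam = 1)
    (T : ℝ → ℝ) (hTpos : ∀ t, 0 < T t) (hTdiff : ContDiff ℝ 1 T)
    (hTlim : Tendsto T atTop (nhds 0))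
    (E : ℝ) (hE : UM - Um < E)
    (hTlb : ∀ᶠ t in atTop, E / Real.log t ≤ T t)
    (Ttil : ℝ) (hTtil : 0 < Ttil)
    (hTder : ∀ᶠ t in atTop, -(Ttil / t) ≤ deriv T t ∧ deriv T t ≤ 0)
    (δ₀ : ℝ) (hδ₀ : 0 < δ₀) (hTconst : ∀ t ∈ Set.Icc (0:ℝ) δ₀, T t = T 0)
    (mFam : ℝ → St n m → ℝ)
    (hMsmooth : ∀ t, ContDiff ℝ (⊤ : ℕ∞) (mFam t))
    (hMpos : ∀ t p, 0 < mFam t p)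
    (hMprob : ∀ t, ∫ p : St n m, mFam t p = 1)
    (hFP : ∀ t : ℝ, 0 ≤ t → ∀ p : St n m,
      HasDerivAt (fun s => mFam s p) (genLadj U A lam (T t) (mFam t) p) t)
    (hM0grad : Integrable (fun p : St n m => gradSq (mFam 0) p / mFam 0 p))
    (pbar : ℕ) (hpbar : 2 ≤ pbar)
    (hM0mom : ∀ k : ℕ, 2 ≤ k → k ≤ pbar → Integrable (fun q : St n m =>
      (Real.sqrt (sqnorm q.1) ^ k + Real.sqrt (sqnorm q.2.1) ^ k +
        Real.sqrt (sqnorm q.2.2) ^ k) * mFam 0 q))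
    (x₀ : Fin n → ℝ) (hx₀ : ∀ x, U x₀ ≤ U x) :
    ∀ δ : ℝ, 0 < δ →
      Tendsto (fun t : ℝ => ∫ p in {p : St n m | U x₀ + δ < U p.1}, mFam t p)
        atTop (nhds 0) := by
  intro δ hδ
  obtain ⟨B, hB⟩ := exists_sqrt_symm A hAc hApd
  have hTc := hTdiff.continuous
  have hc : 0 ≤ UM - Um := by linarith [hUlow 0, hUup 0]
  have hE0 : 0 < E := hc.trans_lt hE
  have HF := fpFlow_of hU hB lam hTpos hTc hMsmooth hMpos hMprob hFP
  obtain ⟨C, hC, hmom⟩ := moment_bound hU habar hr1 hr2 hUg hUlow hUup hgrad1 hgrad2 hB hAc hApd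
    lam lamInv hlamInv hTpos hTc hTlim (eventually_antitoneOn_cooling hTdiff hTder) hMsmooth hMpos
    hMprob hFP (hM0mom 2 le_rfl hpbar)
  set_option maxSynthPendingDepth 3 in
  have hD : 0 ≤ D2 := (norm_nonneg _).trans (hD2 0)
  obtain ⟨S, B0, Cp, Cw, hS, hB0, hCp, hCw, hspan, hfrozen⟩ :=
    exists_frozen habar A lam lamInv hlamInv hD hAc hApd hB
  obtain ⟨φ, K, hφ, hφ01, hφ1, hφU⟩ := exists_superlevel_indicator (m := m) hU habar hUlow
    (show U x₀ + δ / 2 < U x₀ + δ by linarith)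
  obtain ⟨a, ha, hlow⟩ := exists_quadN_lower (m := m) habar
  obtain ⟨C1, hC1, hquad⟩ := exists_quadN_upper (m := m) habar
  obtain ⟨g, hg⟩ := exists_gradp_growth hr2 hUg hgrad2
  haveI : Nonempty (Fin m) := ⟨⟨0, hm⟩⟩
  have hQ : 0 < ∫ q : St n m, exp (-(quadN abar q)) := by
    have h := (NearGauss.mk (quadN_gaussForm ha hlow) (quadN_gaussForm ha hlow).cont
      (fun _ => le_rfl) (fun _ => by simp) : NearGauss (quadN abar : St n m → ℝ) (quadN abar) a
      0).Z_pos (μ := volume) one_pos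
    simpa using h
  set c0 := (UM - Um) / E
  have hc0 : 0 ≤ c0 := div_nonneg hc hE0.le
  have hc01 : c0 < 1 := (div_lt_one hE0).2 hE
  set α := (1 - c0) / 40 with hα
  have hα0 : 0 < α := by rw [hα]; linarith
  set Ldiff := driftLin A lam 1 - driftLin A lam 0
  have hint : ∀ t, Integrable (mFam t) := fun t => by
    by_contra hcon
    have := hMprob t
    rw [integral_undef hcon] at this
    exact zero_ne_one this
  have hτlim : Tendsto (fun t => (T t)⁻¹) atTop atTop :=
    (tendsto_nhdsWithin_iff.2 ⟨hTlim, Eventually.of_forall hTpos⟩).inv_tendsto_nhdsGT_zero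
  have main : ∀ e, 0 < e → e ≤ 1 → ∀ᶠ t in atTop,
      ∫ p in {p : St n m | U x₀ + δ < U p.1}, mFam t p ≤ 8 * e := by
    intro e he he1
    have hrate := HF.window_rate hQ (a := a) (Lb := ‖Ldiff‖) (B0 := B0) (Cp := Cp)
      (osc0 := UM - Um + 2) (C1 := C1 + (UM - Um + 2)) (norm_nonneg _) hCw hspan hφ hφ01 he he1
    filter_upwards [eventually_ge_atTop 1, eventually_ge_atTop (32 / δ),
      (tendsto_rpow_atTop hα0).eventually hrate,
      (tendsto_rpow_atTop hα0).eventually_ge_atTop (2 * C),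
      (tendsto_rpow_atTop hα0).eventually_ge_atTop 2,
      eventually_cooling hTpos hTdiff hTlim hE0 hTlb hTder hα0 hc, hmom,
      hτlim.eventually (eventually_gibbs_superlevel_le hU.continuous (a := a) (Um := Um) x₀ hδ
        hφ.1.continuous hφ01 hφU he)] with t ht1 htδ hrt hxC hx2 ⟨hcx, hce, hcexp, hcm, hc1, hcd⟩
        hmt hgibbs
    have ht0 : 0 < t := by linarith
    have hpos : ∀ s ∈ Set.Icc (t / 2) t, max s 0 = s := fun s hs =>
      max_eq_left (by linarith [hs.1])
    have htm : max t 0 = t := max_eq_left ht0.le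
    have htm2 : max (t / 2) 0 = t / 2 := max_eq_left (by linarith)
    set x := t ^ α
    have hx0 : 0 < x := by linarith
    have hty : t = t ^ c0 * x ^ 40 := by
      rw [← rpow_natCast, ← rpow_mul ht0.le, ← rpow_add ht0, hα]
      conv_lhs => rw [← rpow_one t]
      congr 1
      push_cast
      ring
    have hy1 : 1 ≤ t ^ c0 := one_le_rpow ht1 hc0
    have htinv : 0 < 1 / t := by positivity
    have htinv1 : 1 / t ≤ 1 := (div_le_one ht0).2 ht1
    obtain ⟨V, hV, hVg, hVU, hVD, hVB, hVl, hVu⟩ := exists_regularised hU hD2 hUlow hUup htinv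
    have hW := nearGauss_Wfun ha hlow hV hVl hVu
    have hgV : ∀ x, ‖gradp V x‖ ≤ (g + 1) * (1 + ‖x‖) := fun x => by
      have h1 := norm_add_le (gradp V x - gradp U x) (gradp U x)
      rw [sub_add_cancel] at h1
      linarith [hVg x, hg x, norm_nonneg x]
    have h2xt : (T t)⁻¹ * (2 * (1 / t)) ≤ 1 := by
      have h1 : x ^ 2 ≤ t := by
        rw [hty]
        exact (pow_le_pow_right₀ (by linarith) (by norm_num)).trans
          (le_mul_of_one_le_left (by positivity) hy1)
      calc _ ≤ x * (2 * (1 / t)) := by gcongr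
        _ = 2 * x / t := by ring
        _ ≤ 1 := by
          rw [div_le_one ht0]
          have := mul_le_right hx2 hx0.le
          linarith [sq x]
    have hest := hrt (t ^ c0) t (1 / t) (UM - Um + 2 * (1 / t)) (Wfun V)
      (fun τ0 => bDrift (gradp V) A lam τ0) hy1 hty hcexp hW (by linarith) htinv.le le_rfl
      (fun τ0 β CP h1 h2 h3 => hfrozen V (g + 1) _ hV hVD hVB hgV hVl hVu τ0 β CP h1 h2 h3)
      hB0 hCp (by simpa only [htm] using hcx)
      (by
        simp only [htm, mul_add, exp_add]
        have h1 := (exp_le_exp.2 h2xt).trans exp_one_lt_three.le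
        calc _ ≤ t ^ c0 * 3 := by gcongr
          _ = _ := mul_comm _ _)
      (fun s hs s' hs' h => by
        simp only [hpos s hs, hpos s' hs']
        exact hcm hs hs' h)
      (by simpa only [htm2] using hc1)
      (fun s hs s' hs' h => by
        simp only [hpos s hs, hpos s' hs']
        exact hcd s hs s' hs' h)
      ⟨(‖driftLin A lam 0‖ + ‖Ldiff‖) * (1 + (T t)⁻¹) + g, fun s hs p => by
        rw [← bDrift_eq_affDrift]
        refine (norm_bDrift_le A lam _ hg p).trans ?_
        simp only [hpos s hs, abs_of_pos (inv_pos.2 (hTpos s))]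
        have := hcm hs ⟨by linarith, le_rfl⟩ hs.2
        gcongr⟩
      (fun s τ0 p ξ => by
        rw [← bDrift_eq_affDrift]
        set τs := (T (max s 0))⁻¹
        have hdiff : bDrift (gradp U) A lam τs p - bDrift (gradp V) A lam τ0 p
            = (τs - τ0) • Ldiff p + (0, gradp V p.1 - gradp U p.1, 0) := by
          rw [bDrift_eq_affDrift, bDrift_eq_affDrift (gradp V)]
          simp only [affDrift, bDrift, Ldiff, _root_.sub_apply, sub_smul]
          have : (0, gradp V p.1 - gradp U p.1, 0)
              = ((0, gradp V p.1, 0) - (0, gradp U p.1, 0) : St n m) := by simp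
          rw [this]
          abel
        have hn : ‖bDrift (gradp U) A lam τs p - bDrift (gradp V) A lam τ0 p‖
            ≤ (|τs - τ0| * ‖Ldiff‖ + 1 / t) * (1 + ‖p‖) := by
          rw [hdiff]
          refine (norm_add_le _ _).trans ?_
          have h1 : ‖((0, gradp V p.1 - gradp U p.1, 0) : St n m)‖ ≤ 1 / t := by
            rw [Prod.norm_def, Prod.norm_def]
            simpa [ht0.le] using hVg p.1
          have h2 : ‖(τs - τ0) • Ldiff p‖ ≤ |τs - τ0| * (‖Ldiff‖ * ‖p‖) := by
            rw [norm_smul, norm_eq_abs]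
            exact mul_le_left (Ldiff.le_opNorm p) (abs_nonneg _)
          have h3 : 0 ≤ |τs - τ0| * ‖Ldiff‖ := by positivity
          have h4 : 0 ≤ 1 / t * ‖p‖ := by positivity
          linarith
        refine (hspan ξ _).trans ?_
        calc _ ≤ Cw * ((|τs - τ0| * ‖Ldiff‖ + 1 / t) * (1 + ‖p‖))
              * √(∑ l, (ξ (wDir lamInv S l)) ^ 2) := by gcongr
          _ = _ := by ring)
      (fun s hs => by
        simp only [hpos s hs]
        obtain ⟨h1, h2⟩ := hmt s ⟨by linarith [hs.1], hs.2⟩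
        refine ⟨h1, h2.trans ?_⟩
        have h3 := mul_le_right hxC hx0.le
        calc C * (1 + (T t)⁻¹) ≤ C * (x + x) := by gcongr; linarith
          _ = 2 * C * x := by ring
          _ ≤ x ^ 2 := by linarith [sq x])
      (fun q => by
        have h1 : 0 ≤ C1 * (1 + 2 * ‖q‖) := by positivity
        have h2 : 0 ≤ (UM - Um + 2) * (2 * ‖q‖ + ‖q‖ ^ 2) := by positivity
        linarith [hW.upper q, hquad q])
    simp only [htm] at hest
    have hg1 := hgibbs V _ (1 / t) htinv.le
      (by rw [div_le_iff₀ hδ] at htδ; rw [div_le_div_iff₀ ht0 (by norm_num)]; linarith) hW hVU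
    have hset : MeasurableSet {p : St n m | U x₀ + δ < U p.1} :=
      measurableSet_lt measurable_const (hU.continuous.measurable.comp measurable_fst)
    have hle : ∫ p in {p : St n m | U x₀ + δ < U p.1}, mFam t p ≤ ∫ p, φ p * mFam t p := by
      rw [← integral_indicator hset]
      refine integral_mono ((hint t).indicator hset) (FPFlow.integrable_bdd_mul hφ.1.continuous
        (K := 1) (fun p => abs_le.2 ⟨by linarith [(hφ01 p).1], (hφ01 p).2⟩) (hint t)) fun p => ?_
      by_cases hp : U x₀ + δ < U p.1
      · rw [Set.indicator_of_mem (by exact hp)]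
        simp [hφ1 p hp.le]
      · rw [Set.indicator_of_notMem (by exact hp)]
        exact mul_nonneg (hφ01 p).1 (hMpos t p).le
    have hpair : FPFlow.pair volume (fun t => mFam (max t 0)) φ t = ∫ p, φ p * mFam t p := by
      simp only [FPFlow.pair, htm]
    rw [hpair] at hest
    linarith
  rw [Metric.tendsto_atTop']
  intro ε hε
  have hmin : 0 < min (ε / 16) 1 := by positivity
  obtain ⟨t0, h0⟩ := eventually_atTop.1 (main _ hmin (min_le_right _ _))
  refine ⟨t0, fun t ht => ?_⟩
  rw [dist_zero_right, norm_of_nonneg (integral_nonneg fun p => (hMpos t p).le)]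
  linarith [h0 t ht.le, min_le_left (ε / 16) 1]
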